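/- There exists a constant c_0 > 0 such that for every constant c ≥ c_0 the following holds for all sufficiently large odd integers N: with D = \sqrt{N} L^{-c}, r_2(m) = \sum_{d | m, D < d < N/D} χ(d) and r_3(m) = \sum_{d | m, d \ge N/D} χ(d), one has \sum_{p_1+p_2+p_3=N} r_2(p_1-1) r_3(p_2-1) (\log p_1)(\log p_2)(\log p_3) \ll N^2 L^{-1}, the sum being over ordered triples of primes and the implied constant depending only on c. -/

import Mathlib

open Finset

noncomputable section

/-- The non-principal Dirichlet character modulo 4. -/
def chi4 (n : ℕ) : ℝ := if n % 4 = 1 then 1 else if n % 4 = 3 then -1 else 0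

/-- θ₀ = 1/2 - (1/4) e log 2. -/
def theta0 : ℝ := 1 / 2 - (1 / 4) * Real.exp 1 * Real.log 2

/-- Weighted sum over ordered triples of primes with p₁ + p₂ + p₃ = N. -/
def tripleSum (N : ℕ) (w1 w2 : ℕ → ℝ) : ℝ :=
  ∑ p1 ∈ Finset.range (N + 1), ∑ p2 ∈ Finset.range (N + 1), ∑ p3 ∈ Finset.range (N + 1),
    if p1.Prime ∧ p2.Prime ∧ p3.Prime ∧ p1 + p2 + p3 = N then
      w1 p1 * w2 p2 * Real.log p1 * Real.log p2 * Real.log p3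
    else 0

/-- r₁(m) = ∑_{d ∣ m, d ≤ D} χ(d). -/
def r1 (D : ℝ) (m : ℕ) : ℝ := ∑ d ∈ m.divisors, if (d : ℝ) ≤ D then chi4 d else 0

/-- r₂(m) = ∑_{d ∣ m, D < d < N/D} χ(d). -/
def r2 (D NR : ℝ) (m : ℕ) : ℝ :=
  ∑ d ∈ m.divisors, if D < (d : ℝ) ∧ (d : ℝ) < NR / D then chi4 d else 0

/-- r₃(m) = ∑_{d ∣ m, d ≥ N/D} χ(d). -/
def r3 (D NR : ℝ) (m : ℕ) : ℝ :=
  ∑ d ∈ m.divisors, if NR / D ≤ (d : ℝ) then chi4 d else 0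

namespace TernaryPrimes

section partialSummation

open Complex MeasureTheory Set Filter Topology Asymptotics

/-- Partial sum of `f` over `Y < k ≤ t`. -/
def tailSum (f : ℕ → ℂ) (Y : ℕ) (t : ℝ) : ℂ :=
  ∑ k ∈ Finset.Icc 1 ⌊t⌋₊, if Y < k then f k else 0

/-- The integral representing the tail `∑_{n > Y} f n n^{-s}` of a Dirichlet series. -/
def tailIntegral (f : ℕ → ℂ) (Y : ℕ) (s : ℂ) : ℂ :=
  s * ∫ t in Ioi (1 : ℝ), tailSum f Y t * (t : ℂ) ^ (-(s + 1))

lemma tailSum_eq_zero (f : ℕ → ℂ) {Y : ℕ} {t : ℝ} (ht : t < Y + 1) : tailSum f Y t = 0 := by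
  apply Finset.sum_eq_zero
  intro k hk
  rw [if_neg]
  have h1 := (Finset.mem_Icc.mp hk).2
  have h2 : ⌊t⌋₊ < Y + 1 := by
    rcases lt_or_ge t 0 with h | h
    · rw [Nat.floor_of_nonpos h.le]; omega
    · rw [Nat.floor_lt h]; exact_mod_cast ht
  omega

lemma measurable_tailSum (f : ℕ → ℂ) (Y : ℕ) : Measurable (tailSum f Y) := by
  have : tailSum f Y = (fun n : ℕ => ∑ k ∈ Finset.Icc 1 n, if Y < k then f k else 0) ∘
      (fun t : ℝ => ⌊t⌋₊) := rfl
  rw [this]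
  exact (measurable_from_top).comp Nat.measurable_floor

lemma norm_tailIntegral_le {f : ℕ → ℂ} {Y : ℕ} (hY : 1 ≤ Y) {K : ℝ}
    (hK : ∀ t, ‖tailSum f Y t‖ ≤ K) {s : ℂ} (hs : 0 < s.re) :
    ‖tailIntegral f Y s‖ ≤ ‖s‖ * (K * ((Y : ℝ) ^ (-s.re) / s.re)) := by
  have hK0 : 0 ≤ K := (norm_nonneg _).trans (hK 0)
  have hY0 : (0 : ℝ) < Y := by exact_mod_cast hY
  rw [tailIntegral, norm_mul]
  gcongr
  have h1 : ∫ t in Ioi (1 : ℝ), tailSum f Y t * (t : ℂ) ^ (-(s + 1)) =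
      ∫ t in Ioi (Y : ℝ), tailSum f Y t * (t : ℂ) ^ (-(s + 1)) := by
    apply setIntegral_eq_of_subset_of_forall_sdiff_eq_zero measurableSet_Ioi
    · exact Ioi_subset_Ioi (by exact_mod_cast hY)
    · intro t ht
      rw [tailSum_eq_zero, zero_mul]
      have := ht.2
      simp only [Set.mem_Ioi, not_lt] at this
      linarith
  rw [h1]
  have h2 : ∫ t in Ioi (Y : ℝ), K * t ^ (-s.re - 1) = K * ((Y : ℝ) ^ (-s.re) / s.re) := by
    rw [integral_const_mul, integral_Ioi_rpow_of_lt (by linarith) hY0]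
    congr 1
    rw [sub_add_cancel, neg_div_neg_eq]
  rw [← h2]
  apply norm_integral_le_of_norm_le
  · apply Integrable.const_mul
    exact integrableOn_Ioi_rpow_of_lt (by linarith) hY0
  · filter_upwards [ae_restrict_mem measurableSet_Ioi] with t ht
    have ht0 : 0 < t := hY0.trans ht
    rw [norm_mul, norm_cpow_eq_rpow_re_of_pos ht0]
    have : (-(s + 1)).re = -s.re - 1 := by simp; ring
    rw [this]
    gcongr
    exact hK t

lemma LSeries_eq_sum_add_tailIntegral {f : ℕ → ℂ} {M : ℝ} (hf : ∀ n, ‖f n‖ ≤ M) (Y : ℕ) {s : ℂ}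
    (hs : 1 < s.re) :
    LSeries f s = ∑ n ∈ Finset.Icc 1 Y, f n * (n : ℂ) ^ (-s) + tailIntegral f Y s := by
  set g : ℕ → ℂ := fun k => if Y < k then f k else 0 with hg
  set h : ℕ → ℂ := fun k => if Y < k then 0 else f k with hh
  have hfg : f = h + g := by
    ext k; simp only [hg, hh, Pi.add_apply]; split_ifs <;> simp
  have hgM : ∀ n, ‖g n‖ ≤ M := by
    intro n
    simp only [hg]
    split_ifs
    · exact hf n
    · simpa using (norm_nonneg _).trans (hf n)
  have hhM : ∀ n, ‖h n‖ ≤ M := by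
    intro n
    simp only [hh]
    split_ifs
    · simpa using (norm_nonneg _).trans (hf n)
    · exact hf n
  have hgs : LSeriesSummable g s := LSeriesSummable_of_bounded_of_one_lt_re (fun n _ => hgM n) hs
  have hhs : LSeriesSummable h s := LSeriesSummable_of_bounded_of_one_lt_re (fun n _ => hhM n) hs
  rw [hfg, LSeries_add hhs hgs]
  congr 1
  · rw [LSeries, tsum_eq_sum (s := Finset.Icc 1 Y)]
    · apply Finset.sum_congr rfl
      intro n hn
      have hn1 := Finset.mem_Icc.mp hn
      rw [LSeries.term_of_ne_zero (by omega), cpow_neg, div_eq_mul_inv]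
      simp [hh, hg, hn1.2.not_gt]
    · intro n hn
      rw [LSeries.term_def]
      split_ifs with h0
      · rfl
      · have : Y < n := by
          by_contra hcon
          exact hn (Finset.mem_Icc.mpr ⟨by omega, by omega⟩)
        simp [hh, this]
  · rw [LSeries_eq_mul_integral g zero_le_one hs hgs, tailIntegral]
    · rw [← hfg]
      rfl
    · refine IsBigO.of_bound M (Filter.Eventually.of_forall fun n => ?_)
      calc ‖∑ k ∈ Finset.Icc 1 n, g k‖ ≤ ∑ k ∈ Finset.Icc 1 n, M :=
            norm_sum_le_of_le _ fun k _ => hgM k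
        _ = M * ‖(n : ℝ) ^ (1 : ℝ)‖ := by simp [mul_comm]

lemma differentiableAt_tailIntegral {f : ℕ → ℂ} {Y : ℕ} (hY : 1 ≤ Y) {K : ℝ}
    (hK : ∀ t, ‖tailSum f Y t‖ ≤ K) {s : ℂ} (hs : 0 < s.re) :
    DifferentiableAt ℂ (tailIntegral f Y) s := by
  have hY1 : (1 : ℝ) ≤ Y := by exact_mod_cast hY
  have key : tailIntegral f Y = fun s => s * mellin (tailSum f Y) (-s) := by
    ext s
    rw [tailIntegral, mellin]
    congr 1
    rw [← integral_indicator measurableSet_Ioi, ← integral_indicator measurableSet_Ioi]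
    congr 1
    ext t
    simp only [Set.indicator, Set.mem_Ioi, smul_eq_mul]
    by_cases h1 : 1 < t
    · rw [if_pos h1, if_pos (zero_lt_one.trans h1), mul_comm]
      congr 2; ring
    · rw [if_neg h1, tailSum_eq_zero f (by linarith), mul_zero, ite_self]
  rw [key]
  apply DifferentiableAt.mul differentiableAt_id
  have : DifferentiableAt ℂ (mellin (tailSum f Y)) (-s) := by
    apply mellin_differentiableAt_of_isBigO_rpow (a := 0) (b := -s.re - 1)
    · apply LocallyIntegrable.locallyIntegrableOn
      refine LocallyIntegrable.mono (f := fun _ => K) (locallyIntegrable_const K)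
        (measurable_tailSum f Y).aestronglyMeasurable ?_
      filter_upwards with t
      exact (hK t).trans (le_abs_self K)
    · refine IsBigO.of_bound K (Filter.Eventually.of_forall fun t => ?_)
      simpa using hK t
    · simpa using hs
    · refine IsBigO.of_bound 1 ?_
      have : ∀ᶠ t : ℝ in 𝓝[>] 0, t < 1 :=
        (eventually_lt_nhds zero_lt_one).filter_mono nhdsWithin_le_nhds
      filter_upwards [this] with t ht
      rw [tailSum_eq_zero f (by linarith)]
      simp
    · simp
  exact this.comp (f := fun s => -s) s differentiableAt_id.neg

end partialSummation

section growth

open Complex MeasureTheory Set Filter Topology Asymptotics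

lemma sum_Ico_period {f : ℕ → ℂ} {q : ℕ} (hf : Function.Periodic f q) (a : ℕ) :
    ∑ k ∈ Finset.Ico a (a + q), f k = ∑ k ∈ Finset.range q, f k := by
  induction a with
  | zero => rw [zero_add, Finset.range_eq_Ico]
  | succ a ih =>
    rw [← ih]
    rcases Nat.eq_zero_or_pos q with h | h
    · simp [h]
    · have h1 := Finset.sum_Ico_succ_top (show a + 1 ≤ a + q by omega) f
      have h2 := Finset.sum_eq_sum_Ico_succ_bot (show a < a + q by omega) f
      rw [show a + 1 + q = a + q + 1 by ring, h1, h2, hf a]; ring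

lemma norm_sum_Ico_le_of_periodic {f : ℕ → ℂ} {q : ℕ} (hq : 0 < q) (hf : Function.Periodic f q)
    (h0 : ∑ k ∈ Finset.range q, f k = 0) (h1 : ∀ n, ‖f n‖ ≤ 1) (a b : ℕ) :
    ‖∑ k ∈ Finset.Ico a b, f k‖ ≤ q := by
  induction b using Nat.strong_induction_on with
  | _ b ih =>
    by_cases h : a + q ≤ b
    · have h2 := Finset.sum_Ico_consecutive f (show a ≤ b - q by omega) (show b - q ≤ b by omega)
      have h3 := sum_Ico_period hf (b - q)
      rw [show b - q + q = b by omega, h0] at h3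
      rw [← h2, h3, add_zero]
      exact ih (b - q) (by omega)
    · calc ‖∑ k ∈ Finset.Ico a b, f k‖ ≤ ∑ k ∈ Finset.Ico a b, (1 : ℝ) :=
            norm_sum_le_of_le _ fun k _ => h1 k
        _ = ((b - a : ℕ) : ℝ) := by simp
        _ ≤ q := by exact_mod_cast (by omega)

lemma norm_tailSum_le_of_periodic {f : ℕ → ℂ} {q : ℕ} (hq : 0 < q) (hf : Function.Periodic f q)
    (h0 : ∑ k ∈ Finset.range q, f k = 0) (h1 : ∀ n, ‖f n‖ ≤ 1) (Y : ℕ) (t : ℝ) :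
    ‖tailSum f Y t‖ ≤ q := by
  have : tailSum f Y t = ∑ k ∈ Finset.Ico (Y + 1) (⌊t⌋₊ + 1), f k := by
    rw [tailSum, ← Finset.sum_filter]
    congr 1
    ext k
    simp only [Finset.mem_filter, Finset.mem_Icc, Finset.mem_Ico]
    omega
  rw [this]
  exact norm_sum_Ico_le_of_periodic hq hf h0 h1 _ _

section character
variable {q : ℕ} [NeZero q] {χ : DirichletCharacter ℂ q}

omit [NeZero q] in
lemma periodic_char (χ : DirichletCharacter ℂ q) : Function.Periodic (fun n : ℕ => χ n) q := by
  intro n; simp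

lemma sum_range_zmod {q : ℕ} [NeZero q] (f : ZMod q → ℂ) :
    ∑ k ∈ Finset.range q, f (k : ZMod q) = ∑ a : ZMod q, f a := by
  refine Finset.sum_bij' (fun k _ => (k : ZMod q)) (fun a _ => a.val) ?_ ?_ ?_ ?_ ?_
  · simp
  · intro a _; simpa using ZMod.val_lt a
  · intro k hk; exact ZMod.val_cast_of_lt (by simpa using hk)
  · intro a _; simp
  · simp

lemma norm_tailSum_char_le (hχ : χ ≠ 1) (Y : ℕ) (t : ℝ) :
    ‖tailSum (fun n => χ n) Y t‖ ≤ q := by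
  apply norm_tailSum_le_of_periodic (NeZero.pos q) (periodic_char χ)
  · rw [sum_range_zmod (fun a => χ a)]
    exact MulChar.sum_eq_zero_of_ne_one hχ
  · intro n; exact χ.norm_le_one _

lemma LFunction_eq_sum_add_tailIntegral (hχ : χ ≠ 1) {Y : ℕ} (hY : 1 ≤ Y) {s : ℂ}
    (hs : 0 < s.re) :
    χ.LFunction s = ∑ n ∈ Finset.Icc 1 Y, χ n * (n : ℂ) ^ (-s) +
      tailIntegral (fun n => χ n) Y s := by
  have hopen : IsOpen {s : ℂ | 0 < s.re} := isOpen_lt continuous_const continuous_re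
  have h1 : AnalyticOnNhd ℂ χ.LFunction {s : ℂ | 0 < s.re} :=
    (DirichletCharacter.differentiable_LFunction hχ).differentiableOn.analyticOnNhd hopen
  have h2 : AnalyticOnNhd ℂ (fun s => ∑ n ∈ Finset.Icc 1 Y, χ n * (n : ℂ) ^ (-s) +
      tailIntegral (fun n => χ n) Y s) {s : ℂ | 0 < s.re} := by
    apply DifferentiableOn.analyticOnNhd _ hopen
    intro s hs
    apply DifferentiableAt.differentiableWithinAt
    apply DifferentiableAt.add
    · apply DifferentiableAt.fun_sum
      intro n hn
      have : (n : ℂ) ≠ 0 := by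
        have := (Finset.mem_Icc.mp hn).1
        exact_mod_cast (by omega : n ≠ 0)
      apply DifferentiableAt.mul (differentiableAt_const _)
      exact (differentiableAt_id.neg).const_cpow (Or.inl this)
    · exact differentiableAt_tailIntegral hY (norm_tailSum_char_le hχ Y) hs
  have hconv : IsPreconnected {s : ℂ | 0 < s.re} :=
    (convex_halfSpace_re_gt 0).isPreconnected
  refine h1.eqOn_of_preconnected_of_eventuallyEq h2 hconv (z₀ := 2) (by simp) ?_ hs
  have : {s : ℂ | 1 < s.re} ∈ 𝓝 (2 : ℂ) :=
    (isOpen_lt continuous_const continuous_re).mem_nhds (by simp)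
  filter_upwards [this] with s hs
  rw [DirichletCharacter.LFunction_eq_LSeries χ hs]
  exact LSeries_eq_sum_add_tailIntegral (fun n => χ.norm_le_one n) Y hs

lemma norm_LFunction_le (hχ : χ ≠ 1) {Y : ℕ} (hY : 1 ≤ Y) {s : ℂ} (hs : 0 < s.re) :
    ‖χ.LFunction s‖ ≤ ∑ n ∈ Finset.Icc 1 Y, (n : ℝ) ^ (-s.re) +
      ‖s‖ * (q * ((Y : ℝ) ^ (-s.re) / s.re)) := by
  rw [LFunction_eq_sum_add_tailIntegral hχ hY hs]
  refine (norm_add_le _ _).trans (add_le_add ?_ ?_)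
  · refine norm_sum_le_of_le _ fun n hn => ?_
    have hn : 0 < n := (Finset.mem_Icc.mp hn).1
    rw [norm_mul, norm_natCast_cpow_of_pos hn]
    simpa using mul_le_mul_of_nonneg_right (χ.norm_le_one n) (by positivity : (0:ℝ) ≤ n ^ (-s.re))
  · exact norm_tailIntegral_le hY (norm_tailSum_char_le hχ Y) hs

lemma norm_LFunction_le_linear (hχ : χ ≠ 1) {s : ℂ} (hs : 0 < s.re) :
    ‖χ.LFunction s‖ ≤ 1 + ‖s‖ * q / s.re := by
  have := norm_LFunction_le hχ le_rfl hs
  simp only [Finset.Icc_self, Finset.sum_singleton, Nat.cast_one, Real.one_rpow] at this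
  refine this.trans (le_of_eq ?_)
  ring

end character

lemma sum_rpow_le {Y : ℕ} {ε σ : ℝ} (hε : 0 < ε) (hε1 : ε ≤ 1) (hσ : 1 - ε ≤ σ) :
    ∑ n ∈ Finset.Icc 1 Y, (n : ℝ) ^ (-σ) ≤ (Y : ℝ) ^ ε / ε := by
  induction Y with
  | zero => simp [Real.zero_rpow hε.ne']
  | succ Y ih =>
    rw [Finset.sum_Icc_succ_top (by omega)]
    have hy : (1 : ℝ) ≤ (Y + 1 : ℕ) := by exact_mod_cast (by omega)
    have hy0 : (0 : ℝ) < (Y + 1 : ℕ) := by linarith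
    have h1 : ((Y + 1 : ℕ) : ℝ) ^ (-σ) ≤ ((Y + 1 : ℕ) : ℝ) ^ (ε - 1) :=
      Real.rpow_le_rpow_of_exponent_le hy (by linarith)
    have h2 : (Y : ℝ) ^ ε ≤ ((Y + 1 : ℕ) : ℝ) ^ ε - ε * ((Y + 1 : ℕ) : ℝ) ^ (ε - 1) := by
      have hb := _root_.rpow_one_add_le_one_add_mul_self (s := -1 / ((Y + 1 : ℕ) : ℝ)) (p := ε)
        (by rw [le_div_iff₀ hy0]; linarith) hε.le hε1
      have e1 : (Y : ℝ) = ((Y + 1 : ℕ) : ℝ) * (1 + -1 / ((Y + 1 : ℕ) : ℝ)) := by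
        field_simp; push_cast; ring
      have hnn : (0 : ℝ) ≤ 1 + -1 / ((Y + 1 : ℕ) : ℝ) := by
        rw [neg_div, ← sub_eq_add_neg, sub_nonneg, div_le_one hy0]; exact hy
      calc (Y : ℝ) ^ ε = ((Y + 1 : ℕ) : ℝ) ^ ε * (1 + -1 / ((Y + 1 : ℕ) : ℝ)) ^ ε := by
            conv_lhs => rw [e1]
            rw [Real.mul_rpow hy0.le hnn]
        _ ≤ ((Y + 1 : ℕ) : ℝ) ^ ε * (1 + ε * (-1 / ((Y + 1 : ℕ) : ℝ))) := by gcongr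
        _ = _ := by
            rw [Real.rpow_sub hy0, Real.rpow_one]; field_simp; ring
    have h3 : (Y : ℝ) ^ ε / ε ≤ ((Y + 1 : ℕ) : ℝ) ^ ε / ε - ((Y + 1 : ℕ) : ℝ) ^ (ε - 1) := by
      rw [div_le_iff₀ hε, sub_mul, div_mul_cancel₀ _ hε.ne']
      linarith
    linarith

lemma le_rpow_of_le_sum {q : ℕ} (hq0 : 0 < q) {ε Z : ℝ} (hε : 0 < ε) (hε1 : ε ≤ 1 / 2) {s : ℂ}
    (hs : 1 - ε ≤ s.re) (hs3 : s.re ≤ 3)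
    (hZ : ∀ Y : ℕ, 1 ≤ Y → q * (|s.im| + 2) ≤ Y → Z ≤ ∑ n ∈ Finset.Icc 1 Y, (n : ℝ) ^ (-s.re) +
      ‖s‖ * (q * ((Y : ℝ) ^ (-s.re) / s.re))) :
    Z ≤ (4 / ε + 12) * (q * (|s.im| + 2)) ^ ε := by
  set Y : ℕ := q * (⌈|s.im|⌉₊ + 2) with hYdef
  have hq : (1 : ℝ) ≤ q := by exact_mod_cast hq0
  have hY : 1 ≤ Y := Nat.one_le_iff_ne_zero.mpr (by positivity)
  have hY1 : (1 : ℝ) ≤ Y := by exact_mod_cast hY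
  have hY0 : (0 : ℝ) < Y := by linarith
  have hT := abs_nonneg s.im
  have hlow : q * (|s.im| + 2) ≤ (Y : ℝ) := by
    rw [hYdef]; push_cast
    gcongr
    exact Nat.le_ceil _
  have hup : (Y : ℝ) ≤ 2 * (q * (|s.im| + 2)) := by
    rw [hYdef]; push_cast
    have := (Nat.ceil_lt_add_one hT).le
    nlinarith
  have hYe : (Y : ℝ) ^ ε ≤ 2 * (q * (|s.im| + 2)) ^ ε := by
    calc (Y : ℝ) ^ ε ≤ (2 * (q * (|s.im| + 2))) ^ ε := by gcongr
      _ = 2 ^ ε * (q * (|s.im| + 2)) ^ ε := by rw [Real.mul_rpow] <;> positivity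
      _ ≤ 2 ^ (1 : ℝ) * (q * (|s.im| + 2)) ^ ε := by
          gcongr
          · norm_num
          · linarith
      _ = _ := by rw [Real.rpow_one]
  have hsre : 0 < s.re := by linarith
  refine (hZ Y hY hlow).trans ?_
  have h1 := sum_rpow_le (Y := Y) hε (by linarith) hs
  have h2 : ‖s‖ ≤ 3 / 2 * (|s.im| + 2) := by
    have := norm_le_abs_re_add_abs_im s
    rw [abs_of_pos hsre] at this
    linarith
  have h3 : (Y : ℝ) ^ (-s.re) ≤ (Y : ℝ) ^ ε / Y := by
    rw [← Real.rpow_sub_one hY0.ne']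
    exact Real.rpow_le_rpow_of_exponent_le hY1 (by linarith)
  have h4 : ‖s‖ * (q * ((Y : ℝ) ^ (-s.re) / s.re)) ≤ 6 * (Y : ℝ) ^ ε := by
    calc ‖s‖ * (q * ((Y : ℝ) ^ (-s.re) / s.re))
        ≤ (3 / 2 * (|s.im| + 2)) * (q * (((Y : ℝ) ^ ε / Y) / (1 / 2))) := by
          gcongr
          linarith
      _ = 3 * ((q * (|s.im| + 2)) / Y) * (Y : ℝ) ^ ε := by field_simp
      _ ≤ 3 * 1 * (Y : ℝ) ^ ε := by
          gcongr
          rw [div_le_one hY0]; exact hlow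
      _ ≤ _ := by linarith [Real.rpow_nonneg hY0.le ε]
  calc _ ≤ (Y : ℝ) ^ ε / ε + 6 * (Y : ℝ) ^ ε := add_le_add h1 h4
    _ = (1 / ε + 6) * (Y : ℝ) ^ ε := by ring
    _ ≤ (1 / ε + 6) * (2 * (q * (|s.im| + 2)) ^ ε) := by gcongr
    _ ≤ _ := by
        have : (0 : ℝ) ≤ (q * (|s.im| + 2)) ^ ε := by positivity
        have h5 : (0 : ℝ) < 1 / ε := by positivity
        have : (4 : ℝ) / ε = 4 * (1 / ε) := by ring
        rw [this]
        nlinarith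

section bound
variable {q : ℕ} [NeZero q] {χ : DirichletCharacter ℂ q}

lemma norm_LFunction_le_rpow {ε : ℝ} (hε : 0 < ε) (hε1 : ε ≤ 1 / 2) (hχ : χ ≠ 1) {s : ℂ}
    (hs : 1 - ε ≤ s.re) (hs3 : s.re ≤ 3) :
    ‖χ.LFunction s‖ ≤ (4 / ε + 12) * (q * (|s.im| + 2)) ^ ε :=
  le_rpow_of_le_sum (NeZero.pos q) hε hε1 hs hs3
    fun _ hY _ => norm_LFunction_le hχ hY (by linarith)

lemma norm_LSeries_le_rpow_of_periodic {f : ℕ → ℂ} (hf : Function.Periodic f q)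
    (h0 : ∑ k ∈ Finset.range q, f k = 0) (h1 : ∀ n, ‖f n‖ ≤ 1)
    {ε : ℝ} (hε : 0 < ε) (hε1 : ε ≤ 1 / 2) {s : ℂ}
    (hs : 1 < s.re) (hs3 : s.re ≤ 3) :
    ‖LSeries f s‖ ≤ (4 / ε + 12) * (q * (|s.im| + 2)) ^ ε := by
  refine le_rpow_of_le_sum (NeZero.pos q) hε hε1 (by linarith) hs3 fun Y hY _ => ?_
  rw [LSeries_eq_sum_add_tailIntegral h1 Y hs]
  refine (norm_add_le _ _).trans (add_le_add ?_ ?_)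
  · refine norm_sum_le_of_le _ fun n hn => ?_
    have hn : 0 < n := (Finset.mem_Icc.mp hn).1
    rw [norm_mul, norm_natCast_cpow_of_pos hn]
    simpa using mul_le_mul_of_nonneg_right (h1 n) (by positivity : (0:ℝ) ≤ n ^ (-s.re))
  · exact norm_tailIntegral_le hY (norm_tailSum_le_of_periodic (NeZero.pos q) hf h0 h1 Y)
      (by linarith)

lemma norm_tailIntegral_one_le {Y : ℕ} (hY : 1 ≤ Y) {s : ℂ} (hs : 1 < s.re) :
    ‖tailIntegral 1 Y s‖ ≤ 1 / ‖s - 1‖ + ‖s‖ * ((Y : ℝ) ^ (-s.re) / s.re) := by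
  have hY0 : (0 : ℝ) < Y := by exact_mod_cast hY
  have hYc : (Y : ℂ) ≠ 0 := by exact_mod_cast hY0.ne'
  have hs0 : s ≠ 0 := by rintro rfl; simp at hs; linarith
  have hs1 : s - 1 ≠ 0 := by
    intro h; rw [sub_eq_zero] at h; rw [h] at hs; simp at hs
  have h1 : ∫ t in Ioi (1 : ℝ), tailSum 1 Y t * (t : ℂ) ^ (-(s + 1)) =
      ∫ t in Ioi (Y : ℝ), tailSum 1 Y t * (t : ℂ) ^ (-(s + 1)) := by
    apply setIntegral_eq_of_subset_of_forall_sdiff_eq_zero measurableSet_Ioi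
    · exact Ioi_subset_Ioi (by exact_mod_cast hY)
    · intro t ht
      rw [tailSum_eq_zero, zero_mul]
      have := ht.2
      simp only [Set.mem_Ioi, not_lt] at this
      linarith
  have hi1 : IntegrableOn (fun t : ℝ => (t : ℂ) ^ (-s)) (Ioi (Y : ℝ)) :=
    integrableOn_Ioi_cpow_of_lt (by simpa using by linarith) hY0
  have hi2 : IntegrableOn (fun t : ℝ => (t : ℂ) ^ (-(s + 1))) (Ioi (Y : ℝ)) :=
    integrableOn_Ioi_cpow_of_lt (by simp; linarith) hY0
  have hi3 : IntegrableOn (fun t : ℝ => ((t - ⌊t⌋₊ : ℝ) : ℂ) * (t : ℂ) ^ (-(s + 1)))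
      (Ioi (Y : ℝ)) := by
    refine Integrable.mono' (g := fun t : ℝ => 1 * ‖(t : ℂ) ^ (-(s + 1))‖)
      (hi2.norm.const_mul 1) ?_ ?_
    · refine AEStronglyMeasurable.mul ?_ hi2.aestronglyMeasurable
      apply Measurable.aestronglyMeasurable
      apply Complex.measurable_ofReal.comp
      exact measurable_id.sub (measurable_from_top.comp Nat.measurable_floor)
    · filter_upwards [ae_restrict_mem measurableSet_Ioi] with t ht
      have ht0 : 0 < t := hY0.trans ht
      rw [norm_mul, Complex.norm_real, Real.norm_eq_abs,
        abs_of_nonneg (sub_nonneg.mpr (Nat.floor_le ht0.le))]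
      gcongr
      linarith [Nat.lt_floor_add_one t]
  have h2 : ∫ t in Ioi (Y : ℝ), tailSum 1 Y t * (t : ℂ) ^ (-(s + 1)) =
      ((∫ t in Ioi (Y : ℝ), (t : ℂ) ^ (-s)) - Y * ∫ t in Ioi (Y : ℝ), (t : ℂ) ^ (-(s + 1))) -
      ∫ t in Ioi (Y : ℝ), ((t - ⌊t⌋₊ : ℝ) : ℂ) * (t : ℂ) ^ (-(s + 1)) := by
    have hi4 : IntegrableOn (fun t : ℝ => (t : ℂ) ^ (-s) - Y * (t : ℂ) ^ (-(s + 1)))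
        (Ioi (Y : ℝ)) := hi1.sub (hi2.const_mul _)
    rw [← integral_const_mul, ← integral_sub hi1 (hi2.const_mul _), ← integral_sub hi4 hi3]
    apply setIntegral_congr_fun measurableSet_Ioi
    intro t ht
    have ht' : (Y : ℝ) < t := ht
    have ht0 : 0 < t := hY0.trans ht
    have e1 : tailSum 1 Y t = (⌊t⌋₊ : ℂ) - Y := by
      have hfl : Y ≤ ⌊t⌋₊ := Nat.le_floor ht'.le
      rw [tailSum, ← Finset.sum_filter]
      have : Finset.filter (fun k => Y < k) (Finset.Icc 1 ⌊t⌋₊) = Finset.Ioc Y ⌊t⌋₊ := by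
        ext k; simp; omega
      rw [this]
      simp [Nat.cast_sub hfl]
    have e2 : (t : ℂ) ^ (-s) = t * (t : ℂ) ^ (-(s + 1)) := by
      have : (-s : ℂ) = 1 + (-(s + 1)) := by ring
      rw [this, Complex.cpow_add _ _ (by exact_mod_cast ht0.ne'), cpow_one]
    simp only [e1, e2]
    push_cast
    ring
  rw [tailIntegral, h1, h2, integral_Ioi_cpow_of_lt (by simpa using by linarith) hY0,
    integral_Ioi_cpow_of_lt (by simp; linarith) hY0, mul_sub]
  have e3 : s * (-((Y : ℝ) : ℂ) ^ (-s + 1) / (-s + 1) - Y * (-((Y : ℝ) : ℂ) ^ (-(s + 1) + 1) /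
      (-(s + 1) + 1))) = (Y : ℂ) ^ (1 - s) / (s - 1) := by
    have e4 : ((Y : ℝ) : ℂ) ^ (-(s + 1) + 1) = (Y : ℂ) ^ (1 - s) / Y := by
      rw [show -(s + 1) + 1 = (1 - s) - 1 by ring, cpow_sub _ _ (by exact_mod_cast hYc), cpow_one]
      simp
    rw [e4, show -s + 1 = -(s - 1) by ring, show -(s + 1) + 1 = -s by ring,
      show -(s - 1) = 1 - s by ring]
    have : (1 : ℂ) - s ≠ 0 := by
      intro h; apply hs1; linear_combination -h
    push_cast
    field_simp
    ring
  rw [e3]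
  refine (norm_sub_le _ _).trans (add_le_add ?_ ?_)
  · rw [norm_div, norm_natCast_cpow_of_pos hY]
    gcongr
    apply Real.rpow_le_one_of_one_le_of_nonpos (by exact_mod_cast hY)
    simp; linarith
  · rw [norm_mul]
    gcongr
    have h3 : ∫ t in Ioi (Y : ℝ), t ^ (-s.re - 1) = (Y : ℝ) ^ (-s.re) / s.re := by
      rw [integral_Ioi_rpow_of_lt (by linarith) hY0, sub_add_cancel, neg_div_neg_eq]
    rw [← h3]
    apply norm_integral_le_of_norm_le
    · exact integrableOn_Ioi_rpow_of_lt (by linarith) hY0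
    · filter_upwards [ae_restrict_mem measurableSet_Ioi] with t ht
      have ht0 : 0 < t := hY0.trans ht
      rw [norm_mul, norm_cpow_eq_rpow_re_of_pos ht0, Complex.norm_real, Real.norm_eq_abs,
        abs_of_nonneg (sub_nonneg.mpr (Nat.floor_le ht0.le))]
      have : (-(s + 1)).re = -s.re - 1 := by simp; ring
      rw [this]
      have h5 : t - ⌊t⌋₊ ≤ 1 := by linarith [Nat.lt_floor_add_one t]
      exact mul_le_of_le_one_left (by positivity) h5

lemma norm_riemannZeta_le {ε : ℝ} (hε : 0 < ε) (hε1 : ε ≤ 1 / 2) {s : ℂ}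
    (hs : 1 < s.re) (hs3 : s.re ≤ 3) :
    ‖riemannZeta s‖ ≤ 1 / ‖s - 1‖ + (4 / ε + 12) * (|s.im| + 2) ^ ε := by
  rw [← sub_le_iff_le_add']
  have := le_rpow_of_le_sum (q := 1) (Z := ‖riemannZeta s‖ - 1 / ‖s - 1‖) one_pos hε hε1
    (by linarith) hs3 ?_
  · simpa using this
  intro Y hY _
  rw [sub_le_iff_le_add', ← LSeries_one_eq_riemannZeta hs,
    LSeries_eq_sum_add_tailIntegral (f := 1) (M := 1) (by simp) Y hs]
  refine (norm_add_le _ _).trans ?_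
  have h1 := norm_tailIntegral_one_le hY hs
  have h2 : ‖∑ n ∈ Finset.Icc 1 Y, (1 : ℕ → ℂ) n * (n : ℂ) ^ (-s)‖ ≤
      ∑ n ∈ Finset.Icc 1 Y, (n : ℝ) ^ (-s.re) := by
    refine norm_sum_le_of_le _ fun n hn => ?_
    have hn : 0 < n := (Finset.mem_Icc.mp hn).1
    rw [norm_mul, norm_natCast_cpow_of_pos hn]
    simp
  simp only [Nat.cast_one, one_mul]
  linarith

lemma norm_LFunction_one_le {ε : ℝ} (hε : 0 < ε) (hε1 : ε ≤ 1 / 2) {s : ℂ}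
    (hs : 1 < s.re) (hs3 : s.re ≤ 3) :
    ‖(1 : DirichletCharacter ℂ q).LFunction s‖ ≤
      1 / ‖s - 1‖ + 2 * ((4 / ε + 12) * (q * (|s.im| + 2)) ^ ε) := by
  have hq : (1 : ℝ) ≤ q := by exact_mod_cast NeZero.pos q
  have hq0 : (0 : ℝ) < q := by linarith
  set χ₀ : DirichletCharacter ℂ q := 1
  set S : ℂ := ∑ k ∈ Finset.range q, χ₀ k with hS
  have hχ : ∀ n : ℕ, χ₀ n = ((if Nat.Coprime n q then 1 else 0 : ℝ) : ℂ) := by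
    intro n
    by_cases h : Nat.Coprime n q
    · rw [if_pos h, MulChar.one_apply ((ZMod.isUnit_iff_coprime n q).mpr h)]; simp
    · rw [if_neg h, χ₀.map_nonunit (mt (ZMod.isUnit_iff_coprime n q).mp h)]; simp
  set ρ : ℝ := (∑ k ∈ Finset.range q, if Nat.Coprime k q then (1 : ℝ) else 0) / q with hρ
  have hρ0 : 0 ≤ ρ := by
    apply div_nonneg _ hq0.le
    apply Finset.sum_nonneg; intro i _; split_ifs <;> norm_num
  have hρ1 : ρ ≤ 1 := by
    rw [hρ, div_le_one hq0]
    calc _ ≤ ∑ k ∈ Finset.range q, (1 : ℝ) := by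
          apply Finset.sum_le_sum; intro i _; split_ifs <;> norm_num
      _ = q := by simp
  set f : ℕ → ℂ := fun n => χ₀ n - ρ with hf
  have hper : Function.Periodic f q := by intro n; simp [hf]
  have hf0 : ∑ k ∈ Finset.range q, f k = 0 := by
    simp only [hf, Finset.sum_sub_distrib, hχ, hρ]
    rw [Finset.sum_const, Finset.card_range, nsmul_eq_mul]
    have : (q : ℂ) ≠ 0 := by exact_mod_cast hq0.ne'
    push_cast
    field_simp
    ring
  have hf1 : ∀ n, ‖f n‖ ≤ 1 := by
    intro n
    simp only [hf, hχ]
    rw [← ofReal_sub, Complex.norm_real, Real.norm_eq_abs, abs_le]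
    split_ifs <;> constructor <;> linarith
  have e : LSeries (fun n => χ₀ n) s = LSeries f s + ρ * riemannZeta s := by
    rw [← LSeries_one_eq_riemannZeta hs]
    have : (fun n : ℕ => χ₀ n) = f + (ρ : ℂ) • (1 : ℕ → ℂ) := by
      ext n; simp [hf]
    have hfs := LSeriesSummable_of_bounded_of_one_lt_re (fun n _ => hf1 n) hs
    have h1s : LSeriesSummable ((ρ : ℂ) • (1 : ℕ → ℂ)) s := (LSeriesSummable_one_iff.mpr hs).smul _
    rw [this, LSeries_add hfs h1s, LSeries_smul]
  rw [DirichletCharacter.LFunction_eq_LSeries χ₀ hs, e]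
  refine (norm_add_le _ _).trans ?_
  have h1 := norm_LSeries_le_rpow_of_periodic hper hf0 hf1 hε hε1 hs hs3
  have h2 : ‖(ρ : ℂ) * riemannZeta s‖ ≤ ‖riemannZeta s‖ := by
    rw [norm_mul, Complex.norm_real, Real.norm_eq_abs, abs_of_nonneg hρ0]
    exact mul_le_of_le_one_left (norm_nonneg _) hρ1
  have h3 := norm_riemannZeta_le hε hε1 hs hs3
  have h4 : (|s.im| + 2) ^ ε ≤ (q * (|s.im| + 2)) ^ ε := by
    have := abs_nonneg s.im
    gcongr
    nlinarith
  have h5 : (4 / ε + 12) * (|s.im| + 2) ^ ε ≤ (4 / ε + 12) * (q * (|s.im| + 2)) ^ ε := by gcongr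
  linarith

end bound

end growth

section positiveCoefficients
open Complex MeasureTheory Set Filter Topology Asymptotics
open scoped ComplexOrder

lemma iteratedDeriv_inv_sub_one (k : ℕ) :
    iteratedDeriv k (fun s : ℂ => (s - 1)⁻¹) 2 = (-1) ^ k * k.factorial := by
  have h := iter_deriv_inv (𝕜 := ℂ) k (2 - 1)
  rw [← iteratedDeriv_eq_iterate] at h
  have := iteratedDeriv_comp_sub_const k (Inv.inv : ℂ → ℂ) (1 : ℂ)
  rw [this]
  simp only [h]
  norm_num

/-- Estermann's lower bound for the residue of a Dirichlet series with nonnegative coefficients. -/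
lemma le_norm_residue {a : ℕ → ℂ} (ha : 0 ≤ a) (ha1 : 1 ≤ (a 1).re)
    (hsum : ∀ s : ℂ, 1 < s.re → LSeriesSummable a s)
    {G : ℂ → ℂ} (hG : Differentiable ℂ G)
    (hGa : ∀ s : ℂ, 1 < s.re → LSeries a s = G s / (s - 1)) {Q : ℝ} (hQ : 1 ≤ Q)
    (hGQ : ∀ s ∈ Metric.closedBall (2 : ℂ) (3 / 2), ‖G s‖ ≤ Q) {β : ℝ} (hβ : 7 / 8 ≤ β) (hβ1 : β < 1)
    (hGβ : 0 ≤ (G β).re) :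
    (1 - β) / 8 * (32 * Q) ^ (-(4 * (1 - β))) ≤ ‖G 1‖ := by
  set H := dslope G 1 with hH
  have hHd : Differentiable ℂ H := by
    rw [← differentiableOn_univ, hH, differentiableOn_dslope univ_mem]
    exact hG.differentiableOn
  have hHs : ∀ s, s ≠ 1 → H s = (G s - G 1) / (s - 1) := by
    intro s hs
    rw [hH, dslope_of_ne _ hs, slope_def_field]
  have hHQ : ∀ s ∈ Metric.sphere (2 : ℂ) (3 / 2), ‖H s‖ ≤ 4 * Q := by
    intro s hs
    have h1 : 1 / 2 ≤ ‖s - 1‖ := by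
      have : ‖s - 2‖ = 3 / 2 := by simpa [dist_eq_norm] using hs
      have h2 : ‖s - 2‖ ≤ ‖s - 1‖ + ‖(1 : ℂ)‖ := by
        rw [show s - 2 = (s - 1) - 1 by ring]; exact norm_sub_le _ _
      rw [norm_one] at h2
      linarith
    have hs1 : s ≠ 1 := by rintro rfl; norm_num at h1
    rw [hHs s hs1, norm_div, div_le_iff₀ (by linarith)]
    have h2 := hGQ s (Metric.sphere_subset_closedBall hs)
    have h3 := hGQ 1 (by simp [dist_eq_norm]; norm_num)
    have := norm_sub_le (G s) (G 1)
    nlinarith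
  set h : ℕ → ℂ := fun k => iteratedDeriv k H 2 / k.factorial with hh
  have hfac : ∀ k : ℕ, (0 : ℝ) < k.factorial := fun k => by exact_mod_cast k.factorial_pos
  have hbound : ∀ k, ‖h k‖ ≤ 4 * Q * (2 / 3) ^ k := by
    intro k
    have := norm_iteratedDeriv_le_of_forall_mem_sphere_norm_le k (by norm_num : (0 : ℝ) < 3 / 2)
      hHd.diffContOnCl hHQ
    rw [hh]
    simp only [norm_div, Complex.norm_natCast]
    rw [div_le_iff₀ (hfac k)]
    refine this.trans (le_of_eq ?_)
    rw [div_pow, div_pow]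
    field_simp
  have habs : LSeries.abscissaOfAbsConv a < (2 : ℝ) := by
    refine lt_of_le_of_lt (LSeries.abscissaOfAbsConv_le_of_forall_lt_LSeriesSummable
      (x := 1) (fun y hy => hsum y (by simpa using hy))) ?_
    exact_mod_cast (by norm_num : (1 : ℝ) < 2)
  have hev : LSeries a =ᶠ[𝓝 (2 : ℂ)] fun s => H s + G 1 * (s - 1)⁻¹ := by
    have : {s : ℂ | 1 < s.re} ∈ 𝓝 (2 : ℂ) :=
      (isOpen_lt continuous_const continuous_re).mem_nhds (by simp)
    filter_upwards [this] with s hs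
    have hs1 : s ≠ 1 := by rintro rfl; simp at hs
    have : s - 1 ≠ 0 := sub_ne_zero.mpr hs1
    rw [hGa s hs, hHs s hs1]
    field_simp
    ring
  -- the coefficients in powers of `2 - s` are nonnegative
  have hcoef : ∀ k, 0 ≤ ((-1) ^ k * h k).re + (G 1).re := by
    intro k
    have h1 := LSeries.iteratedDeriv_alternating ha habs k
    have h2 : iteratedDeriv k (LSeries a) ((2 : ℝ) : ℂ) =
        iteratedDeriv k H 2 + G 1 * ((-1) ^ k * k.factorial) := by
      have : ((2 : ℝ) : ℂ) = 2 := by norm_num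
      rw [this, hev.iteratedDeriv_eq k, ← iteratedDeriv_inv_sub_one,
        ← iteratedDeriv_const_mul_field]
      have c1 : ContDiffAt ℂ k H 2 := hHd.contDiff.contDiffAt
      have c2 : ContDiffAt ℂ k (fun s : ℂ => G 1 * (s - 1)⁻¹) 2 := by
        refine contDiffAt_const.mul (ContDiffAt.inv (by fun_prop) (by norm_num))
      exact iteratedDeriv_fun_add c1 c2
    rw [h2] at h1
    have h3 : (-1 : ℂ) ^ k * (iteratedDeriv k H 2 + G 1 * ((-1) ^ k * k.factorial)) =
        (k.factorial : ℝ) * ((-1) ^ k * h k + G 1) := by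
      have h4 : iteratedDeriv k H 2 = k.factorial * h k := by
        rw [hh]; field_simp [(Nat.cast_ne_zero (R := ℂ)).mpr k.factorial_ne_zero]
      have h5 : ((-1 : ℂ) ^ k) * (-1) ^ k = 1 := by rw [← mul_pow]; simp
      rw [h4]; push_cast; linear_combination (G 1 * (k.factorial : ℂ)) * h5
    rw [h3, Complex.le_def] at h1
    have := h1.1
    rw [re_ofReal_mul, Complex.add_re, Complex.zero_re] at this
    exact nonneg_of_mul_nonneg_right this (hfac k)
  have hcoef0 : 1 ≤ (h 0).re + (G 1).re := by
    have h1 : LSeries a 2 = H 2 + G 1 := by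
      rw [hev.eq_of_nhds]; norm_num
    have h2 : h 0 = H 2 := by simp [hh]
    rw [h2, ← Complex.add_re, ← h1, LSeries]
    have hs := hsum 2 (by simp)
    rw [re_tsum hs]
    refine ha1.trans ?_
    have h3 : (a 1).re = (LSeries.term a 2 1).re := by simp [LSeries.term]
    rw [h3]
    refine (Complex.reCLM.summable hs).le_tsum 1 fun j _ => ?_
    have := LSeries.term_nonneg (ha j) (2 : ℝ)
    rw [Complex.le_def] at this
    simpa using this.1
  set δ := 1 - β with hδ
  have hδ0 : 0 < δ := by linarith
  have hδ8 : δ ≤ 1 / 8 := by linarith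
  have hHβ : HasSum (fun k => (-1) ^ k * h k * (1 + δ) ^ k) (H β) := by
    have := hasSum_taylorSeries_on_ball (f := H) (c := 2) (r := 3 / 2) (z := (β : ℂ))
      hHd.differentiableOn (by
        rw [Metric.mem_ball, dist_eq_norm, show (β : ℂ) - 2 = ((β - 2 : ℝ) : ℂ) by push_cast; ring,
          Complex.norm_real, Real.norm_eq_abs, abs_lt]
        constructor <;> linarith)
    have e : (β : ℂ) - 2 = (-1) * (1 + δ) := by rw [hδ]; push_cast; ring
    have e2 : (fun k => (-1) ^ k * h k * (1 + (δ : ℂ)) ^ k) = fun k : ℕ =>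
        (k.factorial : ℂ)⁻¹ • ((β : ℂ) - 2) ^ k • iteratedDeriv k H 2 := by
      funext k
      rw [e, mul_pow, hh]
      simp only [smul_eq_mul]
      ring
    rw [e2]
    exact this
  have hβre : (H β).re ≤ (G 1).re / δ := by
    have hb1 : (β : ℂ) ≠ 1 := by exact_mod_cast hβ1.ne
    have : H β = ((-(1 / δ) : ℝ) : ℂ) * (G β - G 1) := by
      rw [hHs _ hb1, hδ]; push_cast
      have : (β : ℂ) - 1 ≠ 0 := sub_ne_zero.mpr hb1
      have : 1 - (β : ℂ) ≠ 0 := sub_ne_zero.mpr hb1.symm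
      field_simp
      ring
    rw [this, re_ofReal_mul, Complex.sub_re]
    have : 0 ≤ (1 / δ) * (G β).re := by positivity
    have e : (G 1).re / δ = (1 / δ) * (G 1).re := by ring
    rw [e]; linarith
  obtain ⟨K, hK0, hK1, hK2⟩ : ∃ K : ℕ, 1 ≤ K ∧ 16 * Q * (3 / 4 : ℝ) ^ K ≤ 1 / 2 ∧
      (1 + δ) ^ K ≤ 4 * (32 * Q) ^ (4 * δ) := by
    have hl : 0 < Real.log (32 * Q) := Real.log_pos (by linarith)
    have hl43 : 1 / 4 ≤ Real.log (4 / 3) := by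
      have := Real.one_sub_inv_le_log_of_pos (by norm_num : (0 : ℝ) < 4 / 3)
      norm_num at this ⊢; linarith
    refine ⟨⌈4 * Real.log (32 * Q)⌉₊, Nat.one_le_ceil_iff.mpr (by positivity), ?_, ?_⟩
    · set K := ⌈4 * Real.log (32 * Q)⌉₊
      have hK : 4 * Real.log (32 * Q) ≤ K := Nat.le_ceil _
      have h1 : 32 * Q ≤ (4 / 3 : ℝ) ^ K := by
        rw [← Real.log_le_log_iff (by linarith) (by positivity), Real.log_pow]
        nlinarith
      have h2 : (3 / 4 : ℝ) ^ K * (4 / 3 : ℝ) ^ K = 1 := by rw [← mul_pow]; norm_num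
      have h3 : (0 : ℝ) < (3 / 4) ^ K := by positivity
      nlinarith
    · set K := ⌈4 * Real.log (32 * Q)⌉₊
      have hK : (K : ℝ) < 4 * Real.log (32 * Q) + 1 := Nat.ceil_lt_add_one (by positivity)
      calc (1 + δ) ^ K ≤ (Real.exp δ) ^ K := by
            gcongr; rw [add_comm]; exact Real.add_one_le_exp δ
        _ = Real.exp (K * δ) := by rw [← Real.exp_nat_mul]
        _ ≤ Real.exp (1 + Real.log (32 * Q) * (4 * δ)) := by
            apply Real.exp_le_exp.mpr; nlinarith
        _ = Real.exp 1 * (32 * Q) ^ (4 * δ) := by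
            rw [Real.exp_add, Real.rpow_def_of_pos (by linarith)]
        _ ≤ _ := by
            have := Real.exp_one_lt_d9
            gcongr; linarith
  have hmain : 1 - 16 * Q * (3 / 4 : ℝ) ^ K - (G 1).re * (((1 + δ) ^ K - 1) / δ) ≤ (H β).re := by
    have hre : HasSum (fun k => ((-1) ^ k * h k).re * (1 + δ) ^ k) (H β).re := by
      convert Complex.hasSum_re hHβ using 2 with k
      rw [← ofReal_one, ← ofReal_add, ← ofReal_pow, re_mul_ofReal]
    rw [← hre.tsum_eq, ← hre.summable.sum_add_tsum_nat_add K]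
    have ht : ∀ k, |((-1) ^ (k + K) * h (k + K)).re * (1 + δ) ^ (k + K)| ≤
        4 * Q * (3 / 4) ^ K * (3 / 4) ^ k := by
      intro k
      have e1 : |((-1) ^ (k + K) * h (k + K)).re| ≤ 4 * Q * (2 / 3) ^ (k + K) := by
        refine (abs_re_le_norm _).trans ?_
        rw [norm_mul, norm_pow, norm_neg, norm_one, one_pow, one_mul]
        exact hbound _
      rw [abs_mul, abs_of_nonneg (by positivity : 0 ≤ (1 + δ) ^ (k + K))]
      calc _ ≤ 4 * Q * (2 / 3) ^ (k + K) * (9 / 8) ^ (k + K) := by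
            gcongr; linarith
        _ = 4 * Q * (2 / 3 * (9 / 8)) ^ (k + K) := by rw [mul_assoc, ← mul_pow]
        _ = _ := by rw [pow_add]; norm_num; ring
    have hg : HasSum (fun k : ℕ => 4 * Q * (3 / 4 : ℝ) ^ K * (3 / 4) ^ k)
        (4 * Q * (3 / 4) ^ K * 4) := by
      have := (hasSum_geometric_of_lt_one (by norm_num : (0 : ℝ) ≤ 3 / 4) (by norm_num)).mul_left
        (4 * Q * (3 / 4 : ℝ) ^ K)
      rwa [show (1 - 3 / 4 : ℝ)⁻¹ = 4 by norm_num] at this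
    have htail := tsum_of_norm_bounded (E := ℝ) hg ht
    rw [Real.norm_eq_abs] at htail
    have htail := (abs_le.mp htail).1
    have hfin : 1 - (G 1).re * (((1 + δ) ^ K - 1) / δ) ≤
        ∑ k ∈ Finset.range K, ((-1) ^ k * h k).re * (1 + δ) ^ k := by
      have e2 : ((1 + δ) ^ K - 1) / δ = ∑ k ∈ Finset.range K, (1 + δ) ^ k := by
        rw [geom_sum_eq (by linarith)]; congr 1; ring
      rw [e2, sub_le_iff_le_add, Finset.mul_sum, ← Finset.sum_add_distrib]
      have e3 : ∀ k ∈ Finset.range K, 0 ≤ ((-1) ^ k * h k).re * (1 + δ) ^ k +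
          (G 1).re * (1 + δ) ^ k := by
        intro k _
        rw [← add_mul]
        exact mul_nonneg (hcoef k) (by positivity)
      refine le_trans ?_ (Finset.single_le_sum e3 (Finset.mem_range.mpr hK0))
      simpa using hcoef0
    linarith
  have hre : (G 1).re ≤ ‖G 1‖ := re_le_norm _
  have h1 : 1 / 2 ≤ (G 1).re * ((1 + δ) ^ K / δ) := by
    have : (G 1).re * (((1 + δ) ^ K - 1) / δ) = (G 1).re * ((1 + δ) ^ K / δ) - (G 1).re / δ := by
      ring
    linarith
  have h2 : 1 / 2 ≤ ‖G 1‖ * (4 * (32 * Q) ^ (4 * δ) / δ) := by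
    refine h1.trans ?_
    gcongr
  have hQp : 0 < (32 * Q) ^ (4 * δ) := Real.rpow_pos_of_pos (by linarith) _
  rw [Real.rpow_neg (by linarith), ← div_eq_mul_inv, div_le_iff₀ hQp]
  have : ‖G 1‖ * (4 * (32 * Q) ^ (4 * δ) / δ) = 4 * (‖G 1‖ * (32 * Q) ^ (4 * δ)) / δ := by ring
  rw [this, le_div_iff₀ hδ0] at h2
  linarith

end positiveCoefficients

section fourfoldProduct
open Complex MeasureTheory Set Filter Topology Asymptotics
open scoped ComplexOrder

/-- A character as an arithmetic function. -/
def charAF {q : ℕ} (χ : DirichletCharacter ℂ q) : ArithmeticFunction ℂ :=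
  toArithmeticFunction (χ ·)

/-- The entire function `(s - 1) ζ(s)`. -/
def zetaEntire : ℂ → ℂ := DirichletCharacter.LFunctionTrivChar₁ 1

lemma differentiable_zetaEntire : Differentiable ℂ zetaEntire :=
  DirichletCharacter.differentiable_LFunctionTrivChar₁ 1

lemma zetaEntire_one : zetaEntire 1 = 1 := by
  simp [zetaEntire, DirichletCharacter.LFunctionTrivChar₁]

lemma zetaEntire_of_ne {s : ℂ} (hs : s ≠ 1) : zetaEntire s = (s - 1) * riemannZeta s := by
  simp [zetaEntire, DirichletCharacter.LFunctionTrivChar₁, hs, DirichletCharacter.LFunctionTrivChar,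
    DirichletCharacter.LFunction_modOne_eq]

lemma LSeriesSummable_zetaAF {s : ℂ} (hs : 1 < s.re) :
    LSeriesSummable (fun n => (ArithmeticFunction.zeta : ArithmeticFunction ℂ) n) s :=
  ArithmeticFunction.LSeriesSummable_zeta_iff.mpr hs

lemma LSeries_zetaAF {s : ℂ} (hs : 1 < s.re) :
    LSeries (fun n => (ArithmeticFunction.zeta : ArithmeticFunction ℂ) n) s =
      zetaEntire s / (s - 1) := by
  have hs1 : s ≠ 1 := by rintro rfl; simp at hs
  have : s - 1 ≠ 0 := sub_ne_zero.mpr hs1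
  rw [zetaEntire_of_ne hs1, mul_div_cancel_left₀ _ this]
  exact ArithmeticFunction.LSeries_zeta_eq_riemannZeta hs

section characterProducts
variable {q : ℕ} [NeZero q] {χ ψ : DirichletCharacter ℂ q}

omit [NeZero q] in
lemma LSeriesSummable_charAF (χ : DirichletCharacter ℂ q) {s : ℂ} (hs : 1 < s.re) :
    LSeriesSummable (charAF χ) s := by
  refine LSeriesSummable_of_bounded_of_one_lt_re (m := 1) (fun n hn => ?_) hs
  rw [charAF, ← DirichletCharacter.apply_eq_toArithmeticFunction_apply χ hn]
  exact χ.norm_le_one _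

lemma LSeries_charAF (χ : DirichletCharacter ℂ q) {s : ℂ} (hs : 1 < s.re) :
    LSeries (charAF χ) s = χ.LFunction s := by
  rw [χ.LFunction_eq_LSeries hs]
  refine LSeries_congr (fun {n} hn => ?_) s
  rw [charAF, ← DirichletCharacter.apply_eq_toArithmeticFunction_apply χ hn]

/-- The coefficients of `ζ(s) L(s,χ) L(s,ψ) L(s,χψ)`. -/
def fourfold (χ ψ : DirichletCharacter ℂ q) : ArithmeticFunction ℂ :=
  (ArithmeticFunction.zeta * charAF χ) * (charAF ψ * charAF (χ * ψ))

omit [NeZero q] in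
lemma fourfold_comm (χ ψ : DirichletCharacter ℂ q) : fourfold χ ψ = fourfold ψ χ := by
  rw [fourfold, fourfold, mul_comm ψ χ]; ring

omit [NeZero q] in
lemma charAF_mul_apply_prime_pow (χ ψ : DirichletCharacter ℂ q) {p : ℕ} (hp : p.Prime) (k : ℕ) :
    (charAF ψ * charAF (χ * ψ)) (p ^ k) = ψ p ^ k * χ.zetaMul (p ^ k) := by
  have hpk : ∀ j, p ^ j ≠ 0 := fun j => (pow_pos hp.pos j).ne'
  rw [DirichletCharacter.zetaMul, ArithmeticFunction.mul_apply, ArithmeticFunction.mul_apply,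
    Finset.mul_sum]
  refine Finset.sum_congr rfl fun x hx => ?_
  have h := Nat.mem_divisorsAntidiagonal.mp hx
  have h1 : x.1 ≠ 0 := left_ne_zero_of_mul (h.1 ▸ hpk k)
  have h2 : x.2 ≠ 0 := right_ne_zero_of_mul (h.1 ▸ hpk k)
  rw [charAF, charAF, ← DirichletCharacter.apply_eq_toArithmeticFunction_apply _ h1,
    ← DirichletCharacter.apply_eq_toArithmeticFunction_apply _ h2,
    ← DirichletCharacter.apply_eq_toArithmeticFunction_apply _ h2, MulChar.mul_apply,
    ArithmeticFunction.natCoe_apply, ArithmeticFunction.zeta_apply_ne h1, ← map_pow, ← Nat.cast_pow,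
    ← h.1]
  push_cast
  rw [map_mul]; ring

omit [NeZero q] in
lemma zetaMul_prime_pow (χ : DirichletCharacter ℂ q) {p : ℕ} (hp : p.Prime) (k : ℕ) :
    χ.zetaMul (p ^ k) = ∑ i ∈ Finset.range (k + 1), χ p ^ i := by
  rw [DirichletCharacter.zetaMul, ArithmeticFunction.coe_zeta_mul_apply,
    Nat.sum_divisors_prime_pow hp]
  refine Finset.sum_congr rfl fun i _ => ?_
  rw [← DirichletCharacter.apply_eq_toArithmeticFunction_apply _ (pow_pos hp.pos i).ne']
  simp

omit [NeZero q] in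
lemma fourfold_prime_pow_nonneg (hχ : χ ^ 2 = 1) (hψ : ψ ^ 2 = 1) {p : ℕ} (hp : p.Prime) (k : ℕ) :
    0 ≤ fourfold χ ψ (p ^ k) := by
  have hred : ∀ χ ψ : DirichletCharacter ℂ q, χ ^ 2 = 1 →
      (∀ j, 0 ≤ ψ p ^ j * χ.zetaMul (p ^ j)) → 0 ≤ fourfold χ ψ (p ^ k) := by
    intro χ ψ hχ h
    rw [fourfold, ArithmeticFunction.mul_apply]
    refine Finset.sum_nonneg fun x hx => ?_
    have hx := (Nat.mem_divisorsAntidiagonal.mp hx).1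
    obtain ⟨j, -, hj⟩ := (Nat.dvd_prime_pow hp).mp (Dvd.intro_left x.1 hx)
    refine mul_nonneg (χ.zetaMul_nonneg hχ _) ?_
    rw [hj, charAF_mul_apply_prime_pow χ ψ hp]
    exact h j
  have hcase : ∀ χ ψ : DirichletCharacter ℂ q, χ ^ 2 = 1 → (0 ≤ ψ p) → 0 ≤ fourfold χ ψ (p ^ k) :=
    fun χ ψ hχ hψp => hred χ ψ hχ fun j => mul_nonneg (pow_nonneg hψp _) (χ.zetaMul_nonneg hχ _)
  rcases MulChar.isQuadratic_iff_sq_eq_one.mpr hψ p with h | h | h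
  · exact hcase χ ψ hχ h.ge
  · exact hcase χ ψ hχ (by rw [h]; exact zero_le_one)
  rcases MulChar.isQuadratic_iff_sq_eq_one.mpr hχ p with h' | h' | h'
  · rw [fourfold_comm]; exact hcase ψ χ hψ h'.ge
  · rw [fourfold_comm]; exact hcase ψ χ hψ (by rw [h']; exact zero_le_one)
  refine hred χ ψ hχ fun j => ?_
  rcases Nat.even_or_odd j with he | ho
  · rw [h, he.neg_one_pow, one_mul]; exact χ.zetaMul_nonneg hχ _
  · rw [zetaMul_prime_pow χ hp, h', neg_one_geom_sum, if_pos ho.add_one, mul_zero]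

omit [NeZero q] in
lemma isMultiplicative_fourfold (χ ψ : DirichletCharacter ℂ q) :
    (fourfold χ ψ).IsMultiplicative :=
  χ.isMultiplicative_zetaMul.mul ((DirichletCharacter.isMultiplicative_toArithmeticFunction ψ).mul
    (DirichletCharacter.isMultiplicative_toArithmeticFunction (χ * ψ)))

omit [NeZero q] in
lemma fourfold_nonneg (hχ : χ ^ 2 = 1) (hψ : ψ ^ 2 = 1) (n : ℕ) : 0 ≤ fourfold χ ψ n := by
  rcases eq_or_ne n 0 with rfl | hn
  · simp
  · rw [(isMultiplicative_fourfold χ ψ).multiplicative_factorization _ hn]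
    exact Finset.prod_nonneg fun p hp =>
      fourfold_prime_pow_nonneg hχ hψ (Nat.prime_of_mem_primeFactors hp) _

omit [NeZero q] in
lemma LSeriesSummable_fourfold (χ ψ : DirichletCharacter ℂ q) {s : ℂ} (hs : 1 < s.re) :
    LSeriesSummable (fourfold χ ψ) s :=
  ArithmeticFunction.LSeriesSummable_mul
    (ArithmeticFunction.LSeriesSummable_mul (LSeriesSummable_zetaAF hs) (LSeriesSummable_charAF χ hs))
    (ArithmeticFunction.LSeriesSummable_mul (LSeriesSummable_charAF ψ hs)
      (LSeriesSummable_charAF _ hs))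

lemma LSeries_fourfold (χ ψ : DirichletCharacter ℂ q) {s : ℂ} (hs : 1 < s.re) :
    LSeries (fourfold χ ψ) s =
      zetaEntire s * χ.LFunction s * ψ.LFunction s * (χ * ψ).LFunction s / (s - 1) := by
  rw [fourfold, ArithmeticFunction.LSeries_mul'
    (ArithmeticFunction.LSeriesSummable_mul (LSeriesSummable_zetaAF hs)
      (LSeriesSummable_charAF χ hs))
    (ArithmeticFunction.LSeriesSummable_mul (LSeriesSummable_charAF ψ hs)
      (LSeriesSummable_charAF _ hs)),
    ArithmeticFunction.LSeries_mul' (LSeriesSummable_zetaAF hs) (LSeriesSummable_charAF χ hs),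
    ArithmeticFunction.LSeries_mul' (LSeriesSummable_charAF ψ hs) (LSeriesSummable_charAF _ hs),
    LSeries_zetaAF hs, LSeries_charAF _ hs, LSeries_charAF _ hs, LSeries_charAF _ hs]
  ring

lemma LSeries_zetaMul (χ : DirichletCharacter ℂ q) {s : ℂ} (hs : 1 < s.re) :
    LSeries χ.zetaMul s = zetaEntire s * χ.LFunction s / (s - 1) := by
  have : χ.zetaMul = ArithmeticFunction.zeta * charAF χ := rfl
  rw [this, ArithmeticFunction.LSeries_mul' (LSeriesSummable_zetaAF hs)
    (LSeriesSummable_charAF χ hs), LSeries_zetaAF hs, LSeries_charAF _ hs]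
  ring

lemma norm_LFunction_le_on_closedBall (hχ : χ ≠ 1) {s : ℂ}
    (hs : s ∈ Metric.closedBall (2 : ℂ) (3 / 2)) : ‖χ.LFunction s‖ ≤ 8 * q := by
  have h1 : ‖s - 2‖ ≤ 3 / 2 := by simpa [dist_eq_norm] using hs
  have h2 : 1 / 2 ≤ s.re := by
    have := (abs_le.mp ((abs_re_le_norm _).trans h1)).1
    simp at this; linarith
  have h3 : ‖s‖ ≤ 7 / 2 := by
    have : ‖s‖ ≤ ‖s - 2‖ + ‖(2 : ℂ)‖ := by simpa using norm_add_le (s - 2) 2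
    norm_num at this; linarith
  have hq : (1 : ℝ) ≤ q := by exact_mod_cast NeZero.pos q
  refine (norm_LFunction_le_linear hχ (by linarith)).trans ?_
  have : ‖s‖ * q / s.re ≤ 7 * q := by
    rw [div_le_iff₀ (by linarith)]
    nlinarith
  linarith

lemma exists_norm_zetaEntire_le :
    ∃ C : ℝ, 1 ≤ C ∧ ∀ s ∈ Metric.closedBall (2 : ℂ) (3 / 2), ‖zetaEntire s‖ ≤ C := by
  obtain ⟨C, hC⟩ := (isCompact_closedBall (2 : ℂ) (3 / 2)).exists_bound_of_continuousOn
    differentiable_zetaEntire.continuous.continuousOn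
  exact ⟨max 1 C, le_max_left _ _, fun s hs => (hC s hs).trans (le_max_right _ _)⟩

lemma exists_zetaEntire_re_nonneg :
    ∃ δ : ℝ, 0 < δ ∧ δ ≤ 1 / 8 ∧ ∀ β : ℝ, 1 - δ ≤ β → β < 1 → 0 ≤ (zetaEntire β).re := by
  have h1 : ∀ᶠ s in 𝓝 (1 : ℂ), 0 < (zetaEntire s).re := by
    have : ContinuousAt (fun s => (zetaEntire s).re) 1 :=
      (continuous_re.comp differentiable_zetaEntire.continuous).continuousAt
    exact this.eventually_const_lt (by simp [zetaEntire_one])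
  obtain ⟨r, hr, h⟩ := Metric.eventually_nhds_iff.mp h1
  refine ⟨min (r / 2) (1 / 8), by positivity, min_le_right _ _, fun β hβ hβ1 => (h ?_).le⟩
  rw [dist_eq_norm, ← ofReal_one, ← ofReal_sub, Complex.norm_real, Real.norm_eq_abs, abs_lt]
  have := min_le_left (r / 2) (1 / 8)
  constructor <;> linarith

lemma exists_LFunction_eq_ofReal (hχ2 : χ ^ 2 = 1) (hχ : χ ≠ 1) {σ : ℝ} (hσ : 0 < σ) :
    ∃ r : ℝ, χ.LFunction σ = r := by
  have hreal : ∀ a : ZMod q, ∃ r : ℝ, χ a = r := by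
    intro a
    rcases MulChar.isQuadratic_iff_sq_eq_one.mpr hχ2 a with h | h | h
    · exact ⟨0, by simpa using h⟩
    · exact ⟨1, by simpa using h⟩
    · exact ⟨-1, by simpa using h⟩
  choose v hv using hreal
  rw [LFunction_eq_sum_add_tailIntegral hχ le_rfl (by simpa using hσ)]
  refine ⟨v 1 + σ * ∫ t in Ioi (1 : ℝ), (∑ k ∈ Finset.Icc 1 ⌊t⌋₊, if 1 < k then v k else 0) *
    t ^ (-(σ + 1)), ?_⟩
  push_cast
  congr 1
  · simp [← hv]
  · rw [tailIntegral, ← integral_complex_ofReal]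
    congr 1
    refine setIntegral_congr_fun measurableSet_Ioi fun t ht => ?_
    have ht0 : (0 : ℝ) ≤ t := zero_le_one.trans (le_of_lt ht)
    simp only [tailSum]
    push_cast [ofReal_cpow ht0]
    congr 1
    refine Finset.sum_congr rfl fun k _ => ?_
    split_ifs <;> simp [hv]

lemma LFunction_re_nonneg (hχ2 : χ ^ 2 = 1) (hχ : χ ≠ 1) {β : ℝ} (hβ0 : 0 < β) (hβ1 : β < 1)
    (hz : ∀ σ : ℝ, β ≤ σ → σ < 1 → χ.LFunction σ ≠ 0) : 0 ≤ (χ.LFunction β).re := by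
  by_contra! hneg
  have h2 : 0 < (χ.LFunction (2 : ℝ)).re := by
    have hs : 1 < ((2 : ℝ) : ℂ).re := by simp
    have hz2 : 0 < riemannZeta (2 : ℝ) := riemannZeta_pos_of_one_lt (by norm_num)
    have hF : 0 < LSeries χ.zetaMul (2 : ℝ) := by
      refine LSeries.positive (fun n => χ.zetaMul_nonneg hχ2 n)
        (χ.isMultiplicative_zetaMul.map_one ▸ zero_lt_one) ?_
      refine lt_of_le_of_lt (LSeries.abscissaOfAbsConv_le_of_forall_lt_LSeriesSummable
        (x := 1) (fun y hy => χ.LSeriesSummable_zetaMul (by simpa using hy))) ?_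
      exact_mod_cast (by norm_num : (1 : ℝ) < 2)
    have hne : ((2 : ℝ) : ℂ) ≠ 1 := by norm_num
    rw [LSeries_zetaMul χ hs, zetaEntire_of_ne hne, mul_assoc,
      mul_div_cancel_left₀ _ (sub_ne_zero.mpr hne)] at hF
    rw [pos_iff] at hF hz2
    rw [Complex.mul_re, ← hz2.2] at hF
    simp only [zero_mul, sub_zero] at hF
    exact (mul_pos_iff_of_pos_left hz2.1).mp hF.1
  have hcont : ContinuousOn (fun σ : ℝ => (χ.LFunction σ).re) (Icc β 2) :=
    (continuous_re.comp ((DirichletCharacter.differentiable_LFunction hχ).continuous.comp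
      continuous_ofReal)).continuousOn
  obtain ⟨σ, hσ, h0⟩ := intermediate_value_Icc (by linarith) hcont ⟨hneg.le, h2.le⟩
  obtain ⟨r, hr⟩ := exists_LFunction_eq_ofReal hχ2 hχ (σ := σ) (by linarith [hσ.1])
  have hL0 : χ.LFunction σ = 0 := by
    simp only [hr, ofReal_re] at h0
    rw [hr, h0, ofReal_zero]
  rcases lt_or_ge σ 1 with h | h
  · exact hz σ hσ.1 h hL0
  · exact χ.LFunction_ne_zero_of_one_le_re (Or.inl hχ) (by simpa using h) hL0

end characterProducts

end fourfoldProduct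

section siegelTheorem
open Complex MeasureTheory Set Filter Topology Asymptotics
open scoped ComplexOrder

lemma norm_LFunction_changeLevel_one_le {q m : ℕ} [NeZero q] [NeZero m]
    {χ : DirichletCharacter ℂ q} (hχ : χ ≠ 1) :
    ‖(DirichletCharacter.changeLevel (Dvd.intro_left m rfl : q ∣ m * q) χ).LFunction 1‖ ≤
      ‖χ.LFunction 1‖ * 2 ^ m := by
  rw [DirichletCharacter.LFunction_changeLevel _ χ (Or.inl hχ), norm_mul, norm_prod]
  gcongr
  have h1 : ∀ p ∈ (m * q).primeFactors, ‖1 - χ p * (p : ℂ) ^ (-1 : ℂ)‖ ≤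
      if p ∈ m.primeFactors then 2 else 1 := by
    intro p hp
    have hp' := Nat.prime_of_mem_primeFactors hp
    split_ifs with h
    · refine (norm_sub_le _ _).trans ?_
      have : ‖χ p * (p : ℂ) ^ (-1 : ℂ)‖ ≤ 1 := by
        rw [norm_mul, cpow_neg_one, norm_inv, Complex.norm_natCast]
        exact mul_le_one₀ (χ.norm_le_one _) (by positivity)
          (inv_le_one_of_one_le₀ (by exact_mod_cast hp'.one_le))
      rw [norm_one]; linarith
    · have hpq : p ∣ q := by
        have h2 : ¬ p ∣ m := fun h' => h (Nat.mem_primeFactors.mpr ⟨hp', h', NeZero.ne m⟩)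
        exact (hp'.dvd_mul.mp (Nat.dvd_of_mem_primeFactors hp)).resolve_left h2
      have : χ p = 0 := by
        apply χ.map_nonunit
        rw [ZMod.isUnit_iff_coprime]
        exact fun hc => hp'.one_lt.ne' (Nat.eq_one_of_dvd_coprimes hc dvd_rfl hpq)
      simp [this]
  refine (Finset.prod_le_prod (fun _ _ => norm_nonneg _) h1).trans ?_
  rw [Finset.prod_ite, Finset.prod_const, Finset.prod_const_one, mul_one]
  apply pow_le_pow_right₀ (by norm_num)
  refine (Finset.card_le_card (t := Finset.Icc 1 m) fun p hp => ?_).trans (by simp)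
  have := (Finset.mem_filter.mp hp).2
  exact Finset.mem_Icc.mpr ⟨(Nat.prime_of_mem_primeFactors this).one_le,
    Nat.le_of_dvd (NeZero.pos m) (Nat.dvd_of_mem_primeFactors this)⟩

section realCharacters
variable {q : ℕ} [NeZero q] {χ ψ : DirichletCharacter ℂ q}

/-- Lower bound for `L(1,χ)` when `ζ(β)L(β,χ) ≤ 0`. -/
lemma le_norm_LFunction_one (hχ2 : χ ^ 2 = 1) (hχ : χ ≠ 1) {C₀ : ℝ} (hC₀ : 1 ≤ C₀)
    (hζ : ∀ s ∈ Metric.closedBall (2 : ℂ) (3 / 2), ‖zetaEntire s‖ ≤ C₀)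
    {β : ℝ} (hβ : 7 / 8 ≤ β) (hβ1 : β < 1) (h0 : 0 ≤ (zetaEntire β * χ.LFunction β).re) :
    (1 - β) / 8 * (32 * (C₀ * (8 * q))) ^ (-(4 * (1 - β))) ≤ ‖χ.LFunction 1‖ := by
  have hq : (1 : ℝ) ≤ q := by exact_mod_cast NeZero.pos q
  have := le_norm_residue (a := χ.zetaMul) (fun n => χ.zetaMul_nonneg hχ2 n)
    (by rw [χ.isMultiplicative_zetaMul.map_one]; simp) (fun s hs => χ.LSeriesSummable_zetaMul hs)
    (G := fun s => zetaEntire s * χ.LFunction s)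
    (differentiable_zetaEntire.mul (DirichletCharacter.differentiable_LFunction hχ))
    (fun s hs => LSeries_zetaMul χ hs) (Q := C₀ * (8 * q)) (by nlinarith)
    (fun s hs => by
      rw [norm_mul]
      have := hζ s hs
      have := norm_LFunction_le_on_closedBall hχ hs
      gcongr) hβ hβ1 h0
  simpa [zetaEntire_one] using this

/-- Lower bound for `L(1,χ)L(1,ψ)L(1,χψ)` when `L(β,χ) = 0`. -/
lemma le_norm_LFunction_one_mul (hχ2 : χ ^ 2 = 1) (hψ2 : ψ ^ 2 = 1) (hχ : χ ≠ 1) (hψ : ψ ≠ 1)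
    (hχψ : χ * ψ ≠ 1) {C₀ : ℝ} (hC₀ : 1 ≤ C₀)
    (hζ : ∀ s ∈ Metric.closedBall (2 : ℂ) (3 / 2), ‖zetaEntire s‖ ≤ C₀)
    {β : ℝ} (hβ : 7 / 8 ≤ β) (hβ1 : β < 1) (h0 : χ.LFunction β = 0) :
    (1 - β) / 8 * (32 * (C₀ * (8 * q) ^ 3)) ^ (-(4 * (1 - β))) ≤
      ‖χ.LFunction 1‖ * ‖ψ.LFunction 1‖ * ‖(χ * ψ).LFunction 1‖ := by
  have hq : (1 : ℝ) ≤ q := by exact_mod_cast NeZero.pos q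
  have := le_norm_residue (a := fourfold χ ψ) (fun n => fourfold_nonneg hχ2 hψ2 n)
    (by rw [(isMultiplicative_fourfold χ ψ).map_one]; simp)
    (fun s hs => LSeriesSummable_fourfold χ ψ hs)
    (G := fun s => zetaEntire s * χ.LFunction s * ψ.LFunction s * (χ * ψ).LFunction s)
    (((differentiable_zetaEntire.mul (DirichletCharacter.differentiable_LFunction hχ)).mul
      (DirichletCharacter.differentiable_LFunction hψ)).mul
      (DirichletCharacter.differentiable_LFunction hχψ))
    (fun s hs => LSeries_fourfold χ ψ hs) (Q := C₀ * (8 * q) ^ 3)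
    (one_le_mul_of_one_le_of_one_le hC₀ (one_le_pow₀ (by linarith)))
    (fun s hs => by
      rw [norm_mul, norm_mul, norm_mul]
      have h1 := hζ s hs
      have h2 := norm_LFunction_le_on_closedBall hχ hs
      have h3 := norm_LFunction_le_on_closedBall hψ hs
      have h4 := norm_LFunction_le_on_closedBall hχψ hs
      calc _ ≤ C₀ * (8 * q) * (8 * q) * (8 * q) := by gcongr
        _ = _ := by ring) hβ hβ1 (by simp [h0])
  simpa [zetaEntire_one] using this

end realCharacters

lemma rpow_neg_mono_exponent {X δ ε : ℝ} (hX : 1 ≤ X) (h : δ ≤ ε) : X ^ (-ε) ≤ X ^ (-δ) :=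
  Real.rpow_le_rpow_of_exponent_le hX (by linarith)

/-- The contribution of a real zero of one real character to Siegel's theorem. -/
lemma siegel_of_zero {ε : ℝ} (hε : 0 < ε) (hε8 : ε ≤ 1 / 8) {m : ℕ} [NeZero m]
    {ψ : DirichletCharacter ℂ m} (hψ2 : ψ ^ 2 = 1) (hψ : ψ ≠ 1) {β : ℝ} (hβ : 1 - ε ≤ β)
    (hβ1 : β < 1) (hz : ψ.LFunction β = 0) :
    ∃ c : ℝ, 0 < c ∧ ∀ (q : ℕ) [NeZero q] (χ : DirichletCharacter ℂ q), χ ^ 2 = 1 → χ ≠ 1 →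
      c * (q : ℝ) ^ (-(14 * ε)) ≤ ‖χ.LFunction 1‖ := by
  obtain ⟨C₀, hC₀, hζ⟩ := exists_norm_zetaEntire_le
  set K : ℝ := 4 / ε + 12 with hK
  have hK1 : 1 ≤ K := by have : 0 < 4 / ε := by positivity
                         linarith
  have hm : (1 : ℝ) ≤ m := by exact_mod_cast NeZero.pos m
  have hδ : 0 < 1 - β := by linarith
  set A : ℝ := 32 * (C₀ * (8 * m) ^ 3) with hA
  have hA1 : 1 ≤ A := by
    have : 1 ≤ C₀ * (8 * (m:ℝ)) ^ 3 :=
      one_le_mul_of_one_le_of_one_le hC₀ (one_le_pow₀ (by linarith))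
    linarith
  have hA0 : 0 < A := by linarith
  have hK0 : 0 < K := by linarith
  have hm0 : (0 : ℝ) < m := by linarith
  refine ⟨(1 - β) / 8 * A ^ (-(4 * ε)) / (K ^ 2 * (2 * m) ^ (2 * ε)) / 2 ^ m, by
      have h1 := Real.rpow_pos_of_pos hA0 (-(4 * ε))
      have h2 := Real.rpow_pos_of_pos (show (0 : ℝ) < 2 * m by positivity) (2 * ε)
      exact div_pos (div_pos (mul_pos (by positivity) h1) (mul_pos (by positivity) h2))
        (by positivity), fun q _ χ hχ2 hχ => ?_⟩
  have hq : (1 : ℝ) ≤ q := by exact_mod_cast NeZero.pos q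
  have hq0 : (0 : ℝ) < q := by linarith
  have hdψ : m ∣ m * q := Dvd.intro q rfl
  have hdχ : q ∣ m * q := Dvd.intro_left m rfl
  set X := DirichletCharacter.changeLevel hdχ χ with hX
  set Y := DirichletCharacter.changeLevel hdψ ψ with hY
  have hX2 : X ^ 2 = 1 := by rw [hX, ← map_pow, hχ2, map_one]
  have hY2 : Y ^ 2 = 1 := by rw [hY, ← map_pow, hψ2, map_one]
  have hX1 : X ≠ 1 := fun h => hχ ((DirichletCharacter.changeLevel_eq_one_iff hdχ).mp h)
  have hY1 : Y ≠ 1 := fun h => hψ ((DirichletCharacter.changeLevel_eq_one_iff hdψ).mp h)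
  have hYz : Y.LFunction β = 0 := by
    rw [hY, DirichletCharacter.LFunction_changeLevel hdψ ψ (Or.inl hψ), hz, zero_mul]
  have hlow : (1 - β) / 8 * (A * (q : ℝ) ^ 3) ^ (-(4 * ε)) ≤
      ‖X.LFunction 1‖ * (K ^ 2 * (2 * (m * q)) ^ (2 * ε)) := by
    have hmono : (A * (q : ℝ) ^ 3) ^ (-(4 * ε)) ≤ (A * (q : ℝ) ^ 3) ^ (-(4 * (1 - β))) :=
      rpow_neg_mono_exponent (one_le_mul_of_one_le_of_one_le hA1 (one_le_pow₀ hq)) (by linarith)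
    have hmq : (1 : ℝ) ≤ 2 * (m * q) := by nlinarith
    by_cases hXY : Y * X = 1
    · have hYX : X = Y := by
        have : Y * Y = 1 := by rw [← sq, hY2]
        exact mul_left_cancel (hXY.trans this.symm)
      have h1 := le_norm_LFunction_one hX2 hX1 hC₀ hζ (by linarith) hβ1
        (by rw [hYX, hYz]; simp)
      have h2 : (A * (q : ℝ) ^ 3) ^ (-(4 * (1 - β))) ≤
          (32 * (C₀ * (8 * (m * q : ℕ)))) ^ (-(4 * (1 - β))) := by
        have hm' := NeZero.pos m
        have hq' := NeZero.pos q
        apply Real.rpow_le_rpow_of_nonpos (by positivity) _ (by linarith)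
        rw [hA]; push_cast
        have h3 : (8 * (m * q : ℝ)) ≤ (8 * (m * q)) ^ 3 := by
          apply le_self_pow₀ _ (by norm_num); nlinarith
        have h4 : 8 * (m * q : ℝ) ^ 1 ≤ (8 * m) ^ 3 * q ^ 3 := by
          refine le_trans (by simpa using h3) ?_
          rw [← mul_pow]; gcongr ?_ ^ 3; exact le_of_eq (by ring)
        rw [pow_one] at h4
        nlinarith
      have h3 : ‖X.LFunction 1‖ ≤ ‖X.LFunction 1‖ * (K ^ 2 * (2 * (m * q)) ^ (2 * ε)) := by
        apply le_mul_of_one_le_right (norm_nonneg _)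
        exact one_le_mul_of_one_le_of_one_le (one_le_pow₀ hK1)
          (Real.one_le_rpow hmq (by linarith))
      refine le_trans ?_ (h1.trans h3)
      gcongr
      exact hmono.trans h2
    · have h1 := le_norm_LFunction_one_mul hY2 hX2 hY1 hX1 hXY hC₀ hζ (by linarith) hβ1 hYz
      have hb1 := norm_LFunction_le_rpow hε (by linarith) hY1 (s := 1) (by simp; linarith)
        (by simp)
      have hb2 := norm_LFunction_le_rpow hε (by linarith) hXY (s := 1) (by simp; linarith)
        (by simp)
      simp only [one_im, abs_zero, zero_add, Nat.cast_mul] at hb1 hb2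
      rw [show (m * q * 2 : ℝ) = 2 * (m * q) by ring, ← hK] at hb1 hb2
      have e1 : (2 * (m * q : ℝ)) ^ (2 * ε) = (2 * (m * q)) ^ ε * (2 * (m * q)) ^ ε := by
        rw [← Real.rpow_add (by linarith)]; ring_nf
      have e2 : 32 * (C₀ * (8 * ((m * q : ℕ) : ℝ)) ^ 3) = A * q ^ 3 := by
        rw [hA]; push_cast; ring
      rw [e2] at h1
      calc (1 - β) / 8 * (A * (q : ℝ) ^ 3) ^ (-(4 * ε)) ≤
          (1 - β) / 8 * (A * (q : ℝ) ^ 3) ^ (-(4 * (1 - β))) := by gcongr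
        _ ≤ _ := h1
        _ ≤ (K * (2 * (m * q)) ^ ε) * ‖X.LFunction 1‖ * (K * (2 * (m * q)) ^ ε) := by gcongr
        _ = _ := by rw [e1]; ring
  have hup := norm_LFunction_changeLevel_one_le (m := m) hχ
  have e3 : (2 * (m * q : ℝ)) ^ (2 * ε) = (2 * m) ^ (2 * ε) * q ^ (2 * ε) := by
    rw [← mul_assoc, Real.mul_rpow (by linarith) hq0.le]
  have e4 : (A * (q : ℝ) ^ 3) ^ (-(4 * ε)) = A ^ (-(4 * ε)) * q ^ (-(12 * ε)) := by
    rw [Real.mul_rpow (by linarith) (by positivity), ← Real.rpow_natCast, ← Real.rpow_mul hq0.le]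
    congr 2; push_cast; ring
  have e5 : (q : ℝ) ^ (-(14 * ε)) * q ^ (2 * ε) = q ^ (-(12 * ε)) := by
    rw [← Real.rpow_add hq0]; congr 1; ring
  rw [e3, e4, ← e5] at hlow
  have hP : 0 < (2 * m : ℝ) ^ (2 * ε) := Real.rpow_pos_of_pos (by linarith) _
  have hQ : 0 < (q : ℝ) ^ (2 * ε) := Real.rpow_pos_of_pos hq0 _
  have hlow2 : (1 - β) / 8 * A ^ (-(4 * ε)) * (q : ℝ) ^ (-(14 * ε)) ≤
      ‖X.LFunction 1‖ * (K ^ 2 * (2 * m) ^ (2 * ε)) := by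
    refine le_of_mul_le_mul_right ?_ hQ
    calc _ = (1 - β) / 8 * (A ^ (-(4 * ε)) * (↑q ^ (-(14 * ε)) * ↑q ^ (2 * ε))) := by ring
      _ ≤ _ := hlow
      _ = _ := by ring
  have hlow3 := hlow2.trans (mul_le_mul_of_nonneg_right hup (by positivity))
  rw [div_mul_eq_mul_div, div_mul_eq_mul_div, div_div, div_le_iff₀ (by positivity)]
  calc _ ≤ _ := hlow3
    _ = _ := by ring

/-- **Siegel's theorem**. -/
theorem siegel {ε : ℝ} (hε : 0 < ε) :
    ∃ c : ℝ, 0 < c ∧ ∀ (q : ℕ) [NeZero q] (χ : DirichletCharacter ℂ q), χ ^ 2 = 1 → χ ≠ 1 →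
      c * (q : ℝ) ^ (-ε) ≤ ‖χ.LFunction 1‖ := by
  obtain ⟨δ, hδ, hδ8, hζre⟩ := exists_zetaEntire_re_nonneg
  set η := min (ε / 14) δ with hη
  have hη0 : 0 < η := by positivity
  have hηδ : η ≤ δ := min_le_right _ _
  have hηε : 14 * η ≤ ε := by have := min_le_left (ε / 14) δ; linarith
  suffices h : ∃ c : ℝ, 0 < c ∧ ∀ (q : ℕ) [NeZero q] (χ : DirichletCharacter ℂ q), χ ^ 2 = 1 →
      χ ≠ 1 → c * (q : ℝ) ^ (-(14 * η)) ≤ ‖χ.LFunction 1‖ by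
    obtain ⟨c, hc, h⟩ := h
    refine ⟨c, hc, fun q _ χ h2 h1 => le_trans ?_ (h q χ h2 h1)⟩
    have hq : (1 : ℝ) ≤ q := by exact_mod_cast NeZero.pos q
    have := rpow_neg_mono_exponent hq hηε
    gcongr
  by_cases hex : ∃ (m : ℕ) (_ : NeZero m) (ψ : DirichletCharacter ℂ m) (β : ℝ), ψ ^ 2 = 1 ∧ ψ ≠ 1 ∧
      1 - η ≤ β ∧ β < 1 ∧ ψ.LFunction β = 0
  · obtain ⟨m, _, ψ, β, hψ2, hψ, hβ, hβ1, hz⟩ := hex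
    exact siegel_of_zero hη0 (by linarith) hψ2 hψ hβ hβ1 hz
  · push Not at hex
    obtain ⟨C₀, hC₀, hζ⟩ := exists_norm_zetaEntire_le
    refine ⟨η / 8 * (32 * (C₀ * 8)) ^ (-(4 * η)), by positivity, fun q _ χ hχ2 hχ => ?_⟩
    have hq : (1 : ℝ) ≤ q := by exact_mod_cast NeZero.pos q
    have hre : 0 ≤ (zetaEntire (1 - η : ℝ) * χ.LFunction (1 - η : ℝ)).re := by
      obtain ⟨r, hr⟩ := exists_LFunction_eq_ofReal hχ2 hχ (σ := 1 - η) (by linarith)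
      have h1 := LFunction_re_nonneg hχ2 hχ (β := 1 - η) (by linarith) (by linarith)
        (fun σ h1 h2 => hex q inferInstance χ σ hχ2 hχ h1 h2)
      rw [hr, ofReal_re] at h1
      rw [hr, re_mul_ofReal]
      exact mul_nonneg (hζre _ (by linarith) (by linarith)) h1
    have := le_norm_LFunction_one hχ2 hχ hC₀ hζ (by linarith : 7 / 8 ≤ 1 - η) (by linarith) hre
    rw [sub_sub_cancel] at this
    refine le_trans ?_ this
    have e : (32 * (C₀ * (8 * (q : ℝ)))) ^ (-(4 * η)) =
        (32 * (C₀ * 8)) ^ (-(4 * η)) * (q : ℝ) ^ (-(4 * η)) := by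
      rw [← Real.mul_rpow (by positivity) (by positivity)]
      ring_nf
    rw [e, mul_assoc]
    have := rpow_neg_mono_exponent hq (by linarith : 4 * η ≤ 14 * η)
    gcongr

end siegelTheorem

section inverseBounds

open Complex MeasureTheory Set Filter Topology Asymptotics
open scoped ComplexOrder

/-- Deduce a lower bound up to `σ = 0` from the `3-4-1` inequality and a Lipschitz bound. -/
lemma le_norm_of_pow_four {f : ℝ → ℂ} {P : ℝ} (hP : 1 ≤ P)
    (hlip : ∀ σ₁ σ₂ : ℝ, 0 < σ₁ → σ₁ ≤ σ₂ → σ₂ ≤ 1 → ‖f σ₁ - f σ₂‖ ≤ P * (σ₂ - σ₁))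
    (h4 : ∀ σ : ℝ, 0 < σ → σ ≤ 1 → 1 ≤ (P / σ) ^ 3 * ‖f σ‖ ^ 4 * P) {σ : ℝ} (hσ : 0 < σ)
    (hσ1 : σ ≤ 1) : P⁻¹ ^ 7 / 16 ≤ ‖f σ‖ := by
  have hP0 : 0 < P := by linarith
  have hi : P⁻¹ ≤ 1 := inv_le_one_of_one_le₀ hP
  have hi0 : 0 < P⁻¹ := by positivity
  set σ₀ := P⁻¹ ^ 8 / 16 with hσ₀
  have key : ∀ σ : ℝ, σ₀ ≤ σ → σ ≤ 1 → P⁻¹ ^ 7 / 8 ≤ ‖f σ‖ := by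
    intro σ h1 h2
    have h0 : 0 < σ := lt_of_lt_of_le (by positivity) h1
    have h := h4 σ h0 h2
    by_contra! hlt
    have h3 : ‖f σ‖ ^ 4 < (P⁻¹ ^ 7 / 8) ^ 4 := by gcongr
    have h5 : (P / σ) ^ 3 ≤ (P / σ₀) ^ 3 := by gcongr
    have h6 : (P / σ) ^ 3 * ‖f σ‖ ^ 4 * P < (P / σ₀) ^ 3 * (P⁻¹ ^ 7 / 8) ^ 4 * P := by
      have : 0 < (P / σ₀) ^ 3 := by positivity
      refine mul_lt_mul_of_pos_right ?_ hP0
      exact lt_of_le_of_lt (mul_le_mul_of_nonneg_right h5 (by positivity))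
        (mul_lt_mul_of_pos_left h3 this)
    have h7 : (P / σ₀) ^ 3 * (P⁻¹ ^ 7 / 8) ^ 4 * P = 1 := by
      rw [hσ₀]; field_simp; norm_num
    linarith
  rcases le_total σ₀ σ with h | h
  · exact le_trans (by gcongr; norm_num) (key σ h hσ1)
  · have h0 : σ₀ ≤ 1 := by
      have : P⁻¹ ^ 8 ≤ 1 := pow_le_one₀ hi0.le hi
      rw [hσ₀]; linarith
    have h1 := key σ₀ le_rfl h0
    have h2 := hlip σ σ₀ hσ h h0
    have h3 : P * (σ₀ - σ) ≤ P⁻¹ ^ 7 / 16 := by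
      have : P * σ₀ = P⁻¹ ^ 7 / 16 := by rw [hσ₀]; field_simp
      nlinarith
    have h4 := norm_sub_norm_le (f σ₀) (f σ)
    rw [norm_sub_rev] at h4
    linarith

section derivativeBounds

variable {q : ℕ} [NeZero q] {χ : DirichletCharacter ℂ q}

lemma norm_iteratedDeriv_LFunction_le {ε : ℝ} (hε : 0 < ε) (hε1 : ε ≤ 1 / 2) (hχ : χ ≠ 1) (k : ℕ)
    {s : ℂ} (hs : 1 ≤ s.re) (hs2 : s.re ≤ 2) :
    ‖iteratedDeriv k χ.LFunction s‖ ≤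
      k.factorial * (2 * (4 / ε + 12)) / ε ^ k * (q * (|s.im| + 2)) ^ ε := by
  have hq : (1 : ℝ) ≤ q := by exact_mod_cast NeZero.pos q
  have hq0 : (0 : ℝ) < q := by linarith
  have h := norm_iteratedDeriv_le_of_forall_mem_sphere_norm_le (f := χ.LFunction) (c := s)
    (C := (4 / ε + 12) * (2 * (q * (|s.im| + 2)) ^ ε)) k hε
    (DirichletCharacter.differentiable_LFunction hχ).diffContOnCl (fun z hz => ?_)
  · refine h.trans (le_of_eq (by ring))
  · rw [mem_sphere_iff_norm] at hz
    have h1 := abs_re_le_norm (z - s)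
    have h2 := abs_im_le_norm (z - s)
    rw [hz, sub_re] at h1
    rw [hz, sub_im] at h2
    have h3 := abs_le.mp h1
    have h4 : |z.im| ≤ |s.im| + ε := by
      have := abs_sub_abs_le_abs_sub z.im s.im
      linarith
    refine (norm_LFunction_le_rpow hε hε1 hχ (s := z) (by linarith) (by linarith)).trans ?_
    gcongr
    calc ((q : ℝ) * (|z.im| + 2)) ^ ε ≤ (2 * (q * (|s.im| + 2))) ^ ε := by
          apply Real.rpow_le_rpow (by positivity) _ hε.le
          nlinarith [abs_nonneg s.im]
      _ = 2 ^ ε * (q * (|s.im| + 2)) ^ ε := Real.mul_rpow (by norm_num) (by positivity)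
      _ ≤ 2 * (q * (|s.im| + 2)) ^ ε := by
          gcongr
          calc (2 : ℝ) ^ ε ≤ 2 ^ (1 : ℝ) :=
                Real.rpow_le_rpow_of_exponent_le (by norm_num) (by linarith)
            _ = 2 := by norm_num

lemma norm_LFunction_sub_le {ε : ℝ} (hε : 0 < ε) (hε1 : ε ≤ 1 / 2) (hχ : χ ≠ 1) {s w : ℂ}
    (hs : 1 ≤ s.re) (hs2 : s.re ≤ 2) (hw : 1 ≤ w.re) (hw2 : w.re ≤ 2) (hws : |w.im| ≤ |s.im|) :
    ‖χ.LFunction s - χ.LFunction w‖ ≤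
      2 * (4 / ε + 12) / ε * (q * (|s.im| + 2)) ^ ε * ‖s - w‖ := by
  have hq0 : (0 : ℝ) < q := by exact_mod_cast NeZero.pos q
  have hsT : |s.im| ≤ |s.im| := le_rfl
  set T := |s.im| with hT
  clear_value T
  have hconv : Convex ℝ {z : ℂ | (1 ≤ z.re ∧ z.re ≤ 2) ∧ (-T ≤ z.im ∧ z.im ≤ T)} := by
    have e : {z : ℂ | (1 ≤ z.re ∧ z.re ≤ 2) ∧ (-T ≤ z.im ∧ z.im ≤ T)} =
        Complex.reLm ⁻¹' (Set.Icc 1 2) ∩ Complex.imLm ⁻¹' (Set.Icc (-T) T) := by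
      ext z; simp [Complex.reLm, Complex.imLm]
    rw [e]
    exact ((convex_Icc _ _).linear_preimage _).inter ((convex_Icc _ _).linear_preimage _)
  refine hconv.norm_image_sub_le_of_norm_deriv_le
    (fun z _ => (DirichletCharacter.differentiable_LFunction hχ z)) (fun z hz => ?_)
    (x := w) (y := s) ⟨⟨hw, hw2⟩, abs_le.mp hws⟩ ⟨⟨hs, hs2⟩, abs_le.mp (hT ▸ le_rfl)⟩
  have h := norm_iteratedDeriv_LFunction_le hε hε1 hχ 1 hz.1.1 hz.1.2
  rw [iteratedDeriv_one] at h
  refine h.trans ?_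
  have hz2 : |z.im| ≤ T := abs_le.mpr hz.2
  simp only [Nat.factorial_one, Nat.cast_one, one_mul, pow_one]
  gcongr

lemma one_le_product {σ : ℝ} (hσ : 0 < σ) (t : ℝ) :
    1 ≤ ‖(1 : DirichletCharacter ℂ q).LFunction (1 + σ)‖ ^ 3 *
      ‖χ.LFunction (1 + σ + I * t)‖ ^ 4 * ‖(χ ^ 2).LFunction (1 + σ + I * (2 * t : ℝ))‖ := by
  have := DirichletCharacter.norm_LFunction_product_ge_one χ hσ t
  rw [norm_mul, norm_mul, norm_pow, norm_pow] at this
  convert this using 4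
  push_cast; ring

end derivativeBounds

set_option maxHeartbeats 1600000 in
/-- Upper bound for `1/L` to the right of the line `Re s = 1`. -/
theorem exists_norm_inv_LFunction_le {ε : ℝ} (hε : 0 < ε) :
    ∃ C : ℝ, 0 < C ∧ ∀ (q : ℕ) [NeZero q] (χ : DirichletCharacter ℂ q), χ ≠ 1 → ∀ s : ℂ,
      1 < s.re → s.re ≤ 2 → ‖(χ.LFunction s)⁻¹‖ ≤ C * (q * (|s.im| + 2)) ^ ε := by
  set η := min (ε / 14) (1 / 2) with hηdef
  have hη : 0 < η := by positivity
  have hη1 : η ≤ 1 / 2 := min_le_right _ _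
  have hηε : 14 * η ≤ ε := by have := min_le_left (ε / 14) (1 / 2); linarith
  obtain ⟨c, hc, hsiegel⟩ := siegel hη
  set K : ℝ := 4 / η + 12 with hK
  have hK1 : 1 ≤ K := by have : 0 < 4 / η := by positivity
                         linarith
  set C₁ : ℝ := 2 * K / η with hC₁
  have hC₁0 : 0 < C₁ := by positivity
  set C : ℝ := 1 + C₁ + 20 * K + 4 * C₁ / c with hC
  have hC0 : 1 ≤ C := by have : 0 < 4 * C₁ / c := by positivity
                         linarith
  refine ⟨16 * C ^ 7 + 2 / c, by positivity, fun q _ χ hχ s hs hs2 => ?_⟩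
  have hq : (1 : ℝ) ≤ q := by exact_mod_cast NeZero.pos q
  have hq0 : (0 : ℝ) < q := by linarith
  set t := s.im with ht
  set Q : ℝ := q * (|t| + 2) with hQ
  have hQ1 : 1 ≤ Q := by nlinarith [abs_nonneg t]
  have hqQ : (q : ℝ) ≤ Q := by nlinarith [abs_nonneg t]
  set R : ℝ := Q ^ η with hR
  have hR1 : 1 ≤ R := Real.one_le_rpow hQ1 hη.le
  have hRR : R ^ 2 = Q ^ (2 * η) := by
    rw [hR, ← Real.rpow_natCast, ← Real.rpow_mul (by linarith)]; congr 1; push_cast; ring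
  set P := C * R ^ 2 with hP
  have hR2 : R ≤ R ^ 2 := by nlinarith
  have hR21 : 1 ≤ R ^ 2 := by nlinarith
  have hPexp : P = R ^ 2 + C₁ * R ^ 2 + 20 * (K * R ^ 2) + 4 * C₁ / c * R ^ 2 := by
    rw [hP, hC]; ring
  have hKR2 : K * R ≤ K * R ^ 2 := mul_le_mul_of_nonneg_left hR2 (by linarith)
  have hK0 : 0 < K * R := mul_pos (by linarith) (by linarith)
  have hCR2 : C₁ * R ≤ C₁ * R ^ 2 := mul_le_mul_of_nonneg_left hR2 hC₁0.le
  have hCR0 : 0 < C₁ * R := mul_pos hC₁0 (by linarith)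
  have hX0 : 0 < 4 * C₁ / c * R ^ 2 := by positivity
  have hP1 : 1 ≤ P := one_le_mul_of_one_le_of_one_le hC0 hR21
  have two_rpow : ∀ x : ℝ, 0 ≤ x → (2 * x) ^ η ≤ 2 * x ^ η := by
    intro x hx
    rw [Real.mul_rpow (by norm_num) hx]
    gcongr
    calc (2 : ℝ) ^ η ≤ 2 ^ (1 : ℝ) :=
          Real.rpow_le_rpow_of_exponent_le (by norm_num) (by linarith)
      _ = 2 := by norm_num
  have hs_eq : s = 1 + ((s.re - 1 : ℝ) : ℂ) + I * t := by
    apply Complex.ext <;> simp [ht]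
  set τ : ℝ := c * (q : ℝ) ^ (-η) / (4 * (C₁ * R)) with hτ
  have hτ0 : 0 < τ := by positivity
  have hqη : (q : ℝ) ^ η ≤ R := Real.rpow_le_rpow hq0.le hqQ hη.le
  have hτP : 1 / τ ≤ (4 * C₁ / c) * R ^ 2 := by
    rw [hτ, Real.rpow_neg hq0.le]
    have : 1 / (c * ((q : ℝ) ^ η)⁻¹ / (4 * (C₁ * R))) = 4 * C₁ / c * (R * q ^ η) := by
      have : 0 < (q : ℝ) ^ η := by positivity
      field_simp
    rw [this, sq]; gcongr
  have htriv : ∀ σ : ℝ, 0 < σ → σ ≤ 1 → ‖(1 : DirichletCharacter ℂ q).LFunction (1 + σ)‖ ≤ P / σ := by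
    intro σ h0 h1
    have h := norm_LFunction_one_le (q := q) hη hη1 (s := 1 + σ) (by simp [h0]) (by simp; linarith)
    simp only [add_sub_cancel_left, norm_real, Real.norm_eq_abs, abs_of_pos h0, add_im, one_im,
      ofReal_im, add_zero, abs_zero, zero_add] at h
    have h2 : ((q : ℝ) * 2) ^ η ≤ R := by
      apply Real.rpow_le_rpow (by positivity) _ hη.le
      rw [hQ]; gcongr; linarith [abs_nonneg t]
    have h3 : 2 * (K * (q * 2) ^ η) ≤ (2 * (K * R)) / σ := by
      rw [le_div_iff₀ h0]
      calc _ ≤ 2 * (K * (q * 2) ^ η) * 1 := by gcongr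
        _ ≤ _ := by rw [mul_one]; gcongr
    calc _ ≤ _ := h
      _ ≤ 1 / σ + (2 * (K * R)) / σ := by gcongr
      _ = (1 + 2 * (K * R)) / σ := by ring
      _ ≤ P / σ := by
        gcongr
        linarith
  -- the third factor
  have hthird : ∀ σ : ℝ, 0 < σ → σ ≤ 1 → (χ ^ 2 = 1 → τ ≤ |t| ∨ τ ≤ σ) →
      ‖(χ ^ 2).LFunction (1 + σ + I * (2 * t : ℝ))‖ ≤ P := by
    intro σ h0 h1 hor
    have him : (1 + σ + I * (2 * t : ℝ) : ℂ).im = 2 * t := by simp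
    have hre : (1 + σ + I * (2 * t : ℝ) : ℂ).re = 1 + σ := by simp
    have hb : ((q : ℝ) * (|2 * t| + 2)) ^ η ≤ 2 * R := by
      refine le_trans ?_ (two_rpow Q (by linarith))
      apply Real.rpow_le_rpow (by positivity) _ hη.le
      rw [hQ, abs_mul, abs_two]; nlinarith
    have hKR : 4 * (K * R) + (4 * C₁ / c) * R ^ 2 ≤ P := by linarith
    by_cases h2 : χ ^ 2 = 1
    · rw [h2]
      have h := norm_LFunction_one_le (q := q) hη hη1 (s := 1 + σ + I * (2 * t : ℝ))
        (by rw [hre]; linarith) (by rw [hre]; linarith)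
      rw [him] at h
      have hn : τ ≤ ‖(1 + σ + I * (2 * t : ℝ) : ℂ) - 1‖ := by
        have e : (1 + σ + I * (2 * t : ℝ) : ℂ) - 1 = σ + I * (2 * t : ℝ) := by ring
        rw [e]
        rcases hor h2 with h3 | h3
        · have := abs_im_le_norm (σ + I * (2 * t : ℝ) : ℂ)
          simp only [add_im, ofReal_im, mul_im, I_re, I_im, ofReal_re, zero_mul, one_mul,
            zero_add] at this
          rw [abs_mul, abs_two] at this
          linarith [abs_nonneg t]
        · have := abs_re_le_norm (σ + I * (2 * t : ℝ) : ℂ)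
          simp only [add_re, ofReal_re, mul_re, I_re, I_im, ofReal_im, zero_mul, mul_zero, sub_zero,
            add_zero] at this
          linarith [le_abs_self σ]
      calc _ ≤ _ := h
        _ ≤ 1 / τ + 2 * (K * (2 * R)) := by gcongr
        _ ≤ (4 * C₁ / c) * R ^ 2 + 2 * (K * (2 * R)) := by gcongr
        _ ≤ P := by linarith
    · have h := norm_LFunction_le_rpow hη hη1 h2 (s := 1 + σ + I * (2 * t : ℝ))
        (by rw [hre]; linarith) (by rw [hre]; linarith)
      rw [him] at h
      calc _ ≤ _ := h
        _ ≤ K * (2 * R) := by gcongr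
        _ ≤ P := by linarith
  have h341 : ∀ σ : ℝ, 0 < σ → σ ≤ 1 → (χ ^ 2 = 1 → τ ≤ |t| ∨ τ ≤ σ) →
      1 ≤ (P / σ) ^ 3 * ‖χ.LFunction (1 + σ + I * t)‖ ^ 4 * P := by
    intro σ h0 h1 hor
    refine (one_le_product (χ := χ) h0 t).trans ?_
    gcongr
    · exact htriv σ h0 h1
    · exact hthird σ h0 h1 hor
  have hPlow : P⁻¹ ^ 7 / 16 ≤ ‖χ.LFunction s‖ → ‖(χ.LFunction s)⁻¹‖ ≤
      (16 * C ^ 7 + 2 / c) * Q ^ ε := by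
    intro h
    rw [norm_inv]
    have h1 : (‖χ.LFunction s‖)⁻¹ ≤ (P⁻¹ ^ 7 / 16)⁻¹ := inv_anti₀ (by positivity) h
    have h2 : (P⁻¹ ^ 7 / 16)⁻¹ = 16 * C ^ 7 * R ^ 14 := by
      rw [inv_div, inv_pow, div_inv_eq_mul, hP]; ring
    have h3 : R ^ 14 ≤ Q ^ ε := by
      rw [hR, ← Real.rpow_natCast, ← Real.rpow_mul (by linarith)]
      apply Real.rpow_le_rpow_of_exponent_le hQ1
      push_cast; linarith
    calc _ ≤ _ := h1
      _ = _ := h2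
      _ ≤ (16 * C ^ 7 + 2 / c) * Q ^ ε := by
        gcongr
        have : 0 < 2 / c := by positivity
        linarith
  by_cases hcase : χ ^ 2 = 1 → τ ≤ |t|
  · apply hPlow
    have := le_norm_of_pow_four (f := fun σ => χ.LFunction (1 + σ + I * t)) hP1
      (fun σ₁ σ₂ h0 h12 h1 => ?_)
      (fun σ h0 h1 => h341 σ h0 h1 (fun h => Or.inl (hcase h))) (σ := s.re - 1) (by linarith)
      (by linarith)
    · rwa [← hs_eq] at this
    · have h := norm_LFunction_sub_le hη hη1 hχ (s := 1 + σ₁ + I * t) (w := 1 + σ₂ + I * t)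
        (by simp; linarith) (by simp; linarith) (by simp; linarith) (by simp; linarith) (by simp)
      simp only [add_im, one_im, ofReal_im, mul_im, I_re, I_im, ofReal_re, zero_mul, one_mul,
            zero_add, add_sub_add_right_eq_sub, add_sub_add_left_eq_sub] at h
      refine h.trans ?_
      rw [← ofReal_sub, norm_real, Real.norm_eq_abs, abs_sub_comm,
        abs_of_nonneg (show (0 : ℝ) ≤ σ₂ - σ₁ by linarith)]
      have : C₁ * R ≤ P := by linarith
      exact mul_le_mul_of_nonneg_right this (by linarith)
  · push Not at hcase
    obtain ⟨h2, htτ⟩ := hcase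
    rcases le_total τ (s.re - 1) with hσ | hσ
    · apply hPlow
      have h := h341 (s.re - 1) (by linarith) (by linarith) (fun _ => Or.inr hσ)
      rw [← hs_eq] at h
      by_contra! hlt
      have h3 : ‖χ.LFunction s‖ ^ 4 < (P⁻¹ ^ 7 / 16) ^ 4 := by gcongr
      have h4 : P / (s.re - 1) ≤ P ^ 2 := by
        rw [sq, div_eq_mul_one_div]
        gcongr
        calc 1 / (s.re - 1) ≤ 1 / τ := by gcongr
          _ ≤ _ := hτP
          _ ≤ P := by
            rw [hP]; gcongr; rw [hC]; linarith
      have h5 : (0 : ℝ) < s.re - 1 := by linarith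
      have h6 : (P / (s.re - 1)) ^ 3 * ‖χ.LFunction s‖ ^ 4 * P ≤
          (P ^ 2) ^ 3 * (P⁻¹ ^ 7 / 16) ^ 4 * P := by gcongr
      have h7 : (P ^ 2) ^ 3 * (P⁻¹ ^ 7 / 16) ^ 4 * P = P⁻¹ ^ 21 / 65536 := by
        have : 0 < P := by linarith
        field_simp
        norm_num
      have h8 : P⁻¹ ^ 21 ≤ 1 := pow_le_one₀ (by positivity) (inv_le_one_of_one_le₀ hP1)
      linarith
    · have h := norm_LFunction_sub_le hη hη1 hχ (s := s) (w := 1)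
        (by linarith) (by linarith) (by simp) (by simp) (by simp)
      have h3 := hsiegel q χ h2 hχ
      have h4 : ‖s - 1‖ ≤ 2 * τ := by
        refine (norm_le_abs_re_add_abs_im _).trans ?_
        rw [sub_re, sub_im, one_re, one_im, sub_zero, abs_of_pos (by linarith)]
        linarith
      have h5 : C₁ * R * ‖s - 1‖ ≤ c * (q : ℝ) ^ (-η) / 2 := by
        calc C₁ * R * ‖s - 1‖ ≤ C₁ * R * (2 * τ) := by gcongr
          _ = _ := by rw [hτ]; field_simp; norm_num
      have h6 : c * (q : ℝ) ^ (-η) / 2 ≤ ‖χ.LFunction s‖ := by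
        have := norm_sub_norm_le (χ.LFunction 1) (χ.LFunction s)
        rw [norm_sub_rev] at this
        have h' : ‖χ.LFunction s - χ.LFunction 1‖ ≤ C₁ * R * ‖s - 1‖ := h
        linarith
      rw [norm_inv]
      calc (‖χ.LFunction s‖)⁻¹ ≤ (c * (q : ℝ) ^ (-η) / 2)⁻¹ := inv_anti₀ (by positivity) h6
        _ = 2 / c * q ^ η := by
          rw [Real.rpow_neg hq0.le]; field_simp
        _ ≤ (16 * C ^ 7 + 2 / c) * Q ^ ε := by
          gcongr
          · have : 0 < C ^ 7 := by positivity
            linarith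
          · exact hqη.trans (Real.rpow_le_rpow_of_exponent_le hQ1 (by linarith))

end inverseBounds

section logDerivativeBounds

open Complex MeasureTheory Set Filter Topology Asymptotics
open scoped ComplexOrder

/-- Bounds for all derivatives of the logarithmic derivative to the right of `Re s = 1`. -/
theorem exists_norm_iteratedDeriv_logDeriv_le (k : ℕ) : ∀ {ε : ℝ}, 0 < ε →
    ∃ C : ℝ, 0 < C ∧ ∀ (q : ℕ) [NeZero q] (χ : DirichletCharacter ℂ q), χ ≠ 1 → ∀ s : ℂ,
      1 < s.re → s.re ≤ 2 →
      ‖iteratedDeriv k (logDeriv χ.LFunction) s‖ ≤ C * (q * (|s.im| + 2)) ^ ε := by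
  induction k using Nat.strong_induction_on with
  | _ k ih =>
  intro ε hε
  set η := min (ε / 3) (1 / 2) with hηdef
  have hη : 0 < η := by positivity
  have hη1 : η ≤ 1 / 2 := min_le_right _ _
  have hηε : 3 * η ≤ ε := by have := min_le_left (ε / 3) (1 / 2); linarith
  obtain ⟨C₁, hC₁, hinv⟩ := exists_norm_inv_LFunction_le hη
  have ih' : ∃ c : ℕ → ℝ, ∀ i < k, 0 < c i ∧ ∀ (q : ℕ) [NeZero q] (χ : DirichletCharacter ℂ q),
      χ ≠ 1 → ∀ s : ℂ, 1 < s.re → s.re ≤ 2 →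
      ‖iteratedDeriv i (logDeriv χ.LFunction) s‖ ≤ c i * (q * (|s.im| + 2)) ^ η := by
    choose! c hc using fun i (hi : i < k) => ih i hi hη
    exact ⟨c, hc⟩
  obtain ⟨c, hc⟩ := ih'
  set D : ℕ → ℝ := fun j => j.factorial * (2 * (4 / η + 12)) / η ^ j with hD
  have hD0 : ∀ j, 0 < D j := fun j => by positivity
  set M : ℝ := D (k + 1) + ∑ i ∈ Finset.range k, k.choose (i + 1) * D (i + 1) * c (k - (i + 1))
    with hM
  have hM0 : 0 < M := by
    refine add_pos_of_pos_of_nonneg (hD0 _) (Finset.sum_nonneg fun i hi => ?_)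
    have := (hc (k - (i + 1)) (by rw [Finset.mem_range] at hi; omega)).1
    have := hD0 (i + 1)
    positivity
  refine ⟨C₁ * M, by positivity, fun q _ χ hχ s hs hs2 => ?_⟩
  have hq : (1 : ℝ) ≤ q := by exact_mod_cast NeZero.pos q
  set Q : ℝ := q * (|s.im| + 2) with hQ
  have hQ1 : 1 ≤ Q := by nlinarith [abs_nonneg s.im]
  set R : ℝ := Q ^ η with hR
  have hR1 : 1 ≤ R := Real.one_le_rpow hQ1 hη.le
  have hd := DirichletCharacter.differentiable_LFunction hχ
  have hne : ∀ z : ℂ, 1 < z.re → χ.LFunction z ≠ 0 := fun z hz =>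
    χ.LFunction_ne_zero_of_one_le_re (Or.inl hχ) hz.le
  have hopen : {z : ℂ | 1 < z.re} ∈ 𝓝 s := (isOpen_lt continuous_const continuous_re).mem_nhds hs
  have heq : deriv χ.LFunction =ᶠ[𝓝 s] χ.LFunction * logDeriv χ.LFunction := by
    filter_upwards [hopen] with z hz
    simp only [Pi.mul_apply, logDeriv_apply]
    rw [mul_div_cancel₀ _ (hne z hz)]
  have hL : ContDiffAt ℂ k χ.LFunction s := hd.contDiff.contDiffAt
  have hg : ContDiffAt ℂ k (logDeriv χ.LFunction) s := by
    have hd' : ContDiff ℂ (k + 1 : ℕ) χ.LFunction := hd.contDiff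
    exact ((hd'.iterate_deriv' k 1).contDiffAt).div hL (hne s hs)
  have hmain := heq.iteratedDeriv_eq k
  rw [← iteratedDeriv_succ', iteratedDeriv_mul hL hg, Finset.sum_range_succ'] at hmain
  simp only [Nat.choose_zero_right, Nat.cast_one, one_mul, iteratedDeriv_zero, Nat.sub_zero] at hmain
  set S := ∑ i ∈ Finset.range k, (k.choose (i + 1) : ℂ) * iteratedDeriv (i + 1) χ.LFunction s *
    iteratedDeriv (k - (i + 1)) (logDeriv χ.LFunction) s with hS
  have hsol : iteratedDeriv k (logDeriv χ.LFunction) s =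
      (χ.LFunction s)⁻¹ * (iteratedDeriv (k + 1) χ.LFunction s - S) := by
    rw [hmain]; field_simp [hne s hs]; ring
  have hDj : ∀ j, ‖iteratedDeriv j χ.LFunction s‖ ≤ D j * R := fun j =>
    norm_iteratedDeriv_LFunction_le hη hη1 hχ j hs.le hs2
  have hSle : ‖S‖ ≤ (∑ i ∈ Finset.range k, k.choose (i + 1) * D (i + 1) * c (k - (i + 1))) *
      R ^ 2 := by
    rw [Finset.sum_mul]
    refine norm_sum_le_of_le _ fun i hi => ?_
    rw [Finset.mem_range] at hi
    rw [norm_mul, norm_mul, norm_natCast]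
    obtain ⟨h0, h1⟩ := hc (k - (i + 1)) (by omega)
    have h2 := h1 q χ hχ s hs hs2
    have h3 := hDj (i + 1)
    have h4 := hD0 (i + 1)
    calc _ ≤ (k.choose (i + 1) : ℝ) * (D (i + 1) * R) * (c (k - (i + 1)) * R) := by gcongr
      _ = _ := by ring
  rw [hsol, norm_mul]
  have h1 : ‖iteratedDeriv (k + 1) χ.LFunction s - S‖ ≤ M * R ^ 2 := by
    refine (norm_sub_le _ _).trans ?_
    have := hDj (k + 1)
    have h2 : D (k + 1) * R ≤ D (k + 1) * R ^ 2 := by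
      have := hD0 (k + 1)
      gcongr; nlinarith
    rw [hM, add_mul]; linarith
  have h3 : R ^ 3 ≤ Q ^ ε := by
    rw [hR, ← Real.rpow_natCast, ← Real.rpow_mul (by linarith)]
    apply Real.rpow_le_rpow_of_exponent_le hQ1
    push_cast; linarith
  calc _ ≤ (C₁ * R) * (M * R ^ 2) := by
        gcongr
        exact hinv q χ hχ s hs hs2
    _ = C₁ * M * R ^ 3 := by ring
    _ ≤ _ := by gcongr

lemma logMul_iterate (f : ℕ → ℂ) (k n : ℕ) :
    LSeries.logMul^[k] f n = (Real.log n : ℂ) ^ k * f n := by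
  induction k with
  | zero => simp
  | succ k ih =>
    rw [Function.iterate_succ_apply', LSeries.logMul, ih, ← natCast_log]; ring

/-- The coefficients `Λ(n) χ(n) (log n)^k`. -/
def mangoldtLog {q : ℕ} (χ : DirichletCharacter ℂ q) (k n : ℕ) : ℂ :=
  (Real.log n : ℂ) ^ k * (χ n * ArithmeticFunction.vonMangoldt n)

lemma mangoldtLog_eq {q : ℕ} (χ : DirichletCharacter ℂ q) (k : ℕ) :
    mangoldtLog χ k =
      LSeries.logMul^[k] (fun n => χ n * (ArithmeticFunction.vonMangoldt n : ℂ)) := by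
  ext n; rw [logMul_iterate, mangoldtLog]

lemma abscissa_mangoldt_le {q : ℕ} (χ : DirichletCharacter ℂ q) {s : ℂ} (hs : 1 < s.re) :
    LSeries.abscissaOfAbsConv (fun n => χ n * (ArithmeticFunction.vonMangoldt n : ℂ)) < s.re := by
  refine lt_of_le_of_lt (LSeries.abscissaOfAbsConv_le_of_forall_lt_LSeriesSummable' (x := 1) ?_)
    (by exact_mod_cast hs)
  intro y hy
  exact DirichletCharacter.LSeriesSummable_mul χ
    (ArithmeticFunction.LSeriesSummable_vonMangoldt (by simpa using by exact_mod_cast hy))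

lemma LSeriesSummable_mangoldtLog {q : ℕ} (χ : DirichletCharacter ℂ q) (k : ℕ) {s : ℂ}
    (hs : 1 < s.re) : LSeriesSummable (mangoldtLog χ k) s := by
  rw [mangoldtLog_eq]
  apply LSeriesSummable_of_abscissaOfAbsConv_lt_re
  rw [LSeries.absicssaOfAbsConv_logPowMul]
  exact abscissa_mangoldt_le χ hs

lemma norm_LSeries_mangoldtLog {q : ℕ} [NeZero q] (χ : DirichletCharacter ℂ q) (k : ℕ) {s : ℂ}
    (hs : 1 < s.re) :
    ‖LSeries (mangoldtLog χ k) s‖ = ‖iteratedDeriv k (logDeriv χ.LFunction) s‖ := by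
  have h := LSeries_iteratedDeriv k (abscissa_mangoldt_le χ hs)
  rw [mangoldtLog_eq]
  have h2 : ‖iteratedDeriv k (LSeries fun n => χ n * (ArithmeticFunction.vonMangoldt n : ℂ)) s‖ =
      ‖LSeries (LSeries.logMul^[k] fun n => χ n * (ArithmeticFunction.vonMangoldt n : ℂ)) s‖ := by
    rw [h]; simp
  rw [← h2]
  have hopen : {z : ℂ | 1 < z.re} ∈ 𝓝 s := (isOpen_lt continuous_const continuous_re).mem_nhds hs
  have heq : (LSeries fun n => χ n * (ArithmeticFunction.vonMangoldt n : ℂ)) =ᶠ[𝓝 s]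
      -logDeriv χ.LFunction := by
    filter_upwards [hopen] with z hz
    have h3 := DirichletCharacter.LSeries_twist_vonMangoldt_eq χ hz
    have h4 : deriv (LSeries fun n => χ n) z = deriv χ.LFunction z := by
      apply Filter.EventuallyEq.deriv_eq
      filter_upwards [(isOpen_lt continuous_const continuous_re).mem_nhds hz] with w hw
      exact (χ.LFunction_eq_LSeries hw).symm
    rw [h4, ← χ.LFunction_eq_LSeries hz] at h3
    rw [Pi.neg_apply, logDeriv_apply, ← neg_div, ← h3]
    rfl
  rw [heq.iteratedDeriv_eq k, iteratedDeriv_neg, norm_neg]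

theorem exists_norm_LSeries_mangoldtLog_le (k : ℕ) {ε : ℝ} (hε : 0 < ε) :
    ∃ C : ℝ, 0 < C ∧ ∀ (q : ℕ) [NeZero q] (χ : DirichletCharacter ℂ q), χ ≠ 1 → ∀ s : ℂ,
      1 < s.re → s.re ≤ 2 →
      ‖LSeries (mangoldtLog χ k) s‖ ≤ C * (q * (|s.im| + 2)) ^ ε := by
  obtain ⟨C, hC, h⟩ := exists_norm_iteratedDeriv_logDeriv_le k hε
  exact ⟨C, hC, fun q _ χ hχ s hs hs2 => by
    rw [norm_LSeries_mangoldtLog χ k hs]; exact h q χ hχ s hs hs2⟩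

end logDerivativeBounds

section triangleKernel

open Complex MeasureTheory Set Filter Topology Asymptotics
open scoped ComplexOrder

/-- The triangular cut-off `max (1 - u) 0`. -/
def triangle (u : ℝ) : ℂ := (max (1 - u) 0 : ℝ)

lemma continuous_triangle : Continuous triangle := by unfold triangle; fun_prop

lemma triangle_of_one_le {u : ℝ} (hu : 1 ≤ u) : triangle u = 0 := by
  simp [triangle, max_eq_right (by linarith : 1 - u ≤ 0)]

lemma triangle_of_le_one {u : ℝ} (hu : u ≤ 1) : triangle u = 1 - u := by
  simp [triangle, max_eq_left (by linarith : 0 ≤ 1 - u)]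

lemma mellinConvergent_triangle {s : ℂ} (hs : 0 < s.re) : MellinConvergent triangle s := by
  have h := betaIntegral_convergent (u := s) (v := 2) hs (by simp)
  rw [intervalIntegrable_iff_integrableOn_Ioc_of_le zero_le_one] at h
  refine IntegrableOn.of_forall_sdiff_eq_zero (s := Set.Ioc 0 1) (h.congr_fun (fun x hx => ?_)
    measurableSet_Ioc) measurableSet_Ioi (fun x hx => ?_)
  · simp only [triangle_of_le_one hx.2, smul_eq_mul]
    norm_num
  · have : 1 ≤ x := by
      by_contra! h
      exact hx.2 ⟨hx.1, h.le⟩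
    simp [triangle_of_one_le this]

lemma mellin_triangle {s : ℂ} (hs : 0 < s.re) : mellin triangle s = 1 / (s * (s + 1)) := by
  have h := betaIntegral_eval_nat_add_one_right hs 1
  simp only [Nat.factorial_one, Nat.cast_one, Finset.prod_range_succ, Finset.prod_range_zero,
    one_mul, Nat.cast_zero, add_zero] at h
  rw [← h, mellin, betaIntegral, intervalIntegral.integral_of_le zero_le_one,
    setIntegral_eq_of_subset_of_forall_sdiff_eq_zero (s := Set.Ioc 0 1) measurableSet_Ioi
      Set.Ioc_subset_Ioi_self]
  · refine setIntegral_congr_fun measurableSet_Ioc fun x hx => ?_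
    simp only [triangle_of_le_one hx.2, smul_eq_mul]
    norm_num
  · intro x hx
    have : 1 ≤ x := by
      by_contra! h
      exact hx.2 ⟨hx.1, h.le⟩
    simp [triangle_of_one_le this]

lemma sqrt_div_norm_le {σ t : ℝ} (hσ : 1 ≤ σ) :
    (|t| + 2) ^ (1 / 2 : ℝ) / ‖((σ + t * I) * (σ + t * I + 1) : ℂ)‖ ≤
      2 * (1 + ‖t‖ ^ 2) ^ (-(3 / 2 : ℝ) / 2) := by
  set X : ℝ := 1 + ‖t‖ ^ 2 with hX
  have hX1 : 1 ≤ X := by rw [hX]; nlinarith [sq_nonneg ‖t‖]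
  have hX0 : 0 < X := by linarith
  have ht : ‖t‖ ^ 2 = t ^ 2 := by simp
  have hn : ∀ a : ℝ, 1 ≤ a → X ^ (1 / 2 : ℝ) ≤ ‖(a + t * I : ℂ)‖ := by
    intro a ha
    rw [← Real.sqrt_eq_rpow, norm_def]
    apply Real.sqrt_le_sqrt
    simp only [normSq_apply, add_re, ofReal_re, mul_re, I_re, mul_zero, ofReal_im, I_im, mul_one,
      sub_self, add_zero, add_im, mul_im, zero_add]
    rw [hX, ht]; nlinarith
  have h1 := hn σ hσ
  have h2 := hn (σ + 1) (by linarith)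
  have h3 : (|t| + 2) ^ (1 / 2 : ℝ) ≤ 2 * X ^ (1 / 4 : ℝ) := by
    have : |t| + 2 ≤ 4 * X ^ (1 / 2 : ℝ) := by
      rw [← Real.sqrt_eq_rpow]
      have h5 : (|t| + 2) ^ 2 ≤ (4 * √X) ^ 2 := by
        rw [mul_pow, Real.sq_sqrt hX0.le, hX, ht, add_sq, sq_abs]
        nlinarith [sq_nonneg (|t| - 1), sq_abs t]
      exact le_of_sq_le_sq h5 (by positivity)
    calc (|t| + 2) ^ (1 / 2 : ℝ) ≤ (4 * X ^ (1 / 2 : ℝ)) ^ (1 / 2 : ℝ) := by gcongr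
      _ = 2 * X ^ (1 / 4 : ℝ) := by
        rw [Real.mul_rpow (by norm_num) (by positivity), ← Real.rpow_mul hX0.le]
        congr 1
        · rw [← Real.sqrt_eq_rpow, show (4 : ℝ) = 2 ^ 2 by norm_num, Real.sqrt_sq (by norm_num)]
        · norm_num
  rw [norm_mul]
  have e : (σ + t * I + 1 : ℂ) = ((σ + 1 : ℝ) : ℂ) + t * I := by push_cast; ring
  rw [e]
  calc _ ≤ 2 * X ^ (1 / 4 : ℝ) / (X ^ (1 / 2 : ℝ) * X ^ (1 / 2 : ℝ)) := by gcongr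
    _ = _ := by
      rw [← Real.rpow_add hX0, mul_div_assoc, ← Real.rpow_sub hX0]
      norm_num
where
  le_of_sq_le_sq {a b : ℝ} (h : a ^ 2 ≤ b ^ 2) (hb : 0 ≤ b) : a ≤ b := by
    exact abs_le_of_sq_le_sq' h hb |>.2

lemma integrable_majorant : Integrable fun t : ℝ => 2 * (1 + ‖t‖ ^ 2) ^ (-(3 / 2 : ℝ) / 2) :=
  (integrable_rpow_neg_one_add_norm_sq (by simp; norm_num)).const_mul 2

lemma integrable_kernel {σ : ℝ} (hσ : 1 ≤ σ) :
    Integrable fun t : ℝ => 1 / ((σ + t * I) * (σ + t * I + 1) : ℂ) := by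
  refine integrable_majorant.mono' ?_ (Eventually.of_forall fun t => ?_)
  · apply Continuous.aestronglyMeasurable
    refine Continuous.div (by fun_prop) (by fun_prop) fun t h => ?_
    have h1 : (σ + t * I : ℂ) ≠ 0 := fun h => by
      have := congrArg re h; simp at this; linarith
    have h2 : (σ + t * I + 1 : ℂ) ≠ 0 := fun h => by
      have := congrArg re h; simp at this; linarith
    exact mul_ne_zero h1 h2 h
  · refine le_trans ?_ (sqrt_div_norm_le hσ)
    rw [norm_div, norm_one]
    gcongr
    exact Real.one_le_rpow (by linarith [abs_nonneg t]) (by norm_num)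

lemma integral_kernel {σ : ℝ} (hσ : 1 ≤ σ) {x : ℝ} (hx : 0 < x) :
    ∫ t : ℝ, (x : ℂ) ^ (-(σ + t * I) : ℂ) * (1 / ((σ + t * I) * (σ + t * I + 1))) =
      2 * Real.pi * triangle x := by
  have h := mellinInv_mellin_eq σ triangle hx (mellinConvergent_triangle (by simp; linarith))
    (by
      refine (integrable_kernel hσ).congr (Eventually.of_forall fun t => ?_)
      simp only
      rw [mellin_triangle (by simp; linarith)]) continuous_triangle.continuousAt
  rw [← h, mellinInv]
  simp only [smul_eq_mul, real_smul]
  rw [← mul_assoc]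
  have : (2 * Real.pi : ℂ) * ((1 / (2 * Real.pi) : ℝ) : ℂ) = 1 := by
    push_cast
    have : (Real.pi : ℂ) ≠ 0 := by exact_mod_cast Real.pi_ne_zero
    field_simp
  rw [this, one_mul]
  congr 1; ext t
  rw [mellin_triangle (by simp; linarith)]

/-- A smoothed Perron formula, in the form of an upper bound. -/
theorem exists_norm_sum_triangle_le : ∃ J : ℝ, 0 < J ∧ ∀ (a : ℕ → ℂ) (σ M : ℝ) (Y : ℕ), a 0 = 0 →
    1 ≤ σ → 0 < Y → LSeriesSummable a σ →
    (∀ t : ℝ, ‖LSeries a (σ + t * I)‖ ≤ M * (|t| + 2) ^ (1 / 2 : ℝ)) →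
    ‖∑ n ∈ Finset.range Y, a n * ((Y : ℂ) - n)‖ ≤ J * M * (Y : ℝ) ^ (σ + 1) := by
  set J : ℝ := ∫ t : ℝ, 2 * (1 + ‖t‖ ^ 2) ^ (-(3 / 2 : ℝ) / 2) with hJ
  have hJ0 : 0 ≤ J := integral_nonneg fun t => by positivity
  refine ⟨J + 1, by linarith, fun a σ M Y ha hσ hY hsum hM => ?_⟩
  have hM0 : 0 ≤ M := by
    have := (norm_nonneg _).trans (hM 0)
    have h2 : (0 : ℝ) < (|0| + 2) ^ (1 / 2 : ℝ) := Real.rpow_pos_of_pos (by simp) _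
    exact nonneg_of_mul_nonneg_left this h2
  have hY0 : (0 : ℝ) < Y := by exact_mod_cast hY
  have hYc : (Y : ℂ) ≠ 0 := by exact_mod_cast hY.ne'
  set κ : ℝ → ℂ := fun t => 1 / ((σ + t * I) * (σ + t * I + 1)) with hκ
  have hκi : Integrable κ := integrable_kernel hσ
  set F : ℕ → ℝ → ℂ := fun n t => LSeries.term a (σ + t * I) n * (Y : ℂ) ^ (σ + t * I : ℂ) * κ t
    with hF
  have hre : ∀ t : ℝ, (σ + t * I : ℂ).re = σ := fun t => by simp
  have hYn : ∀ t : ℝ, ‖(Y : ℂ) ^ (σ + t * I : ℂ)‖ = (Y : ℝ) ^ σ := fun t => by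
    rw [norm_natCast_cpow_of_pos hY, hre]
  have hterm : ∀ n (t : ℝ), ‖LSeries.term a (σ + t * I) n‖ = ‖LSeries.term a σ n‖ := fun n t => by
    rw [LSeries.norm_term_eq, LSeries.norm_term_eq, hre, ofReal_re]
  have hnormF : ∀ n t, ‖F n t‖ = ‖LSeries.term a σ n‖ * (Y : ℝ) ^ σ * ‖κ t‖ := fun n t => by
    rw [hF]; simp only [norm_mul]; rw [hterm, hYn]
  have hFi : ∀ n, Integrable (F n) := fun n => by
    refine (hκi.norm.const_mul (‖LSeries.term a σ n‖ * (Y : ℝ) ^ σ)).mono' ?_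
      (Eventually.of_forall fun t => (hnormF n t).le)
    refine AEStronglyMeasurable.mul (AEStronglyMeasurable.mul ?_ ?_) hκi.1
    · apply Continuous.aestronglyMeasurable
      rcases Nat.eq_zero_or_pos n with rfl | hn
      · simp only [LSeries.term_zero]; fun_prop
      · simp only [LSeries.term_of_ne_zero hn.ne']
        have hn' : (n : ℂ) ≠ 0 := by exact_mod_cast hn.ne'
        refine Continuous.div (by fun_prop) ?_ fun t => by simp [cpow_eq_zero_iff, hn']
        exact Continuous.const_cpow (by fun_prop) (Or.inl hn')
    · exact (Continuous.const_cpow (by fun_prop) (Or.inl hYc)).aestronglyMeasurable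
  have hFs : Summable fun n => ∫ t, ‖F n t‖ := by
    simp only [hnormF]
    simp_rw [integral_const_mul]
    exact (hsum.norm.mul_right _).mul_right _
  have key := hasSum_integral_of_summable_integral_norm hFi hFs
  have hintF : ∀ n, ∫ t, F n t = 2 * Real.pi * (a n * triangle (n / Y)) := by
    intro n
    rcases Nat.eq_zero_or_pos n with rfl | hn
    · simp [hF, ha]
    · have hn0 : (0 : ℝ) < n := by exact_mod_cast hn
      have h := integral_kernel hσ (x := n / Y) (by positivity)
      have e : (2 * Real.pi * (a n * triangle (n / Y)) : ℂ) =
          a n * (2 * Real.pi * triangle (n / Y)) := by ring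
      rw [e, ← h, ← integral_const_mul]
      congr 1; ext t
      simp only [hF, hκ]
      rw [LSeries.term_of_ne_zero hn.ne']
      have e2 : (((n / Y : ℝ)) : ℂ) ^ (-(σ + t * I) : ℂ) =
          (Y : ℂ) ^ (σ + t * I : ℂ) / (n : ℂ) ^ (σ + t * I : ℂ) := by
        rw [show (n / Y : ℝ) = ((Y : ℝ)/ n)⁻¹ by rw [inv_div], ofReal_inv, cpow_neg,
          inv_cpow _ _ (by
            rw [Complex.arg_ofReal_of_nonneg (by positivity)]
            exact Real.pi_pos.ne), inv_inv, ofReal_div,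
          div_cpow_ofReal_nonneg hY0.le hn0.le]
        simp
      rw [e2]; ring
  have htsum : ∀ t, ∑' n, F n t = LSeries a (σ + t * I) * (Y : ℂ) ^ (σ + t * I : ℂ) * κ t := by
    intro t
    simp only [hF]
    rw [tsum_mul_right, tsum_mul_right]; rfl
  simp only [hintF, htsum] at key
  have hfin := hasSum_sum_of_ne_finset_zero (L := SummationFilter.unconditional ℕ) (f := fun n : ℕ => (2 * Real.pi *
    (a n * triangle (n / Y)) : ℂ)) (s := Finset.range Y) (fun n hn => by
      rw [Finset.mem_range, not_lt] at hn
      have hn' : (Y : ℝ) ≤ n := by exact_mod_cast hn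
      rw [triangle_of_one_le (by rw [le_div_iff₀ hY0]; linarith), mul_zero, mul_zero])
  have heq := hfin.unique key
  have hbound : ‖∫ t : ℝ, LSeries a (σ + t * I) * (Y : ℂ) ^ (σ + t * I : ℂ) * κ t‖ ≤
      M * (Y : ℝ) ^ σ * J := by
    rw [hJ, ← integral_const_mul]
    refine norm_integral_le_of_norm_le (integrable_majorant.const_mul _)
      (Eventually.of_forall fun t => ?_)
    rw [norm_mul, norm_mul, hYn, hκ]
    simp only [norm_div, norm_one]
    calc _ ≤ M * (|t| + 2) ^ (1 / 2 : ℝ) * (Y : ℝ) ^ σ *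
          (1 / ‖((σ + t * I) * (σ + t * I + 1) : ℂ)‖) := by gcongr; exact hM t
      _ = M * (Y : ℝ) ^ σ * ((|t| + 2) ^ (1 / 2 : ℝ) /
          ‖((σ + t * I) * (σ + t * I + 1) : ℂ)‖) := by ring
      _ ≤ _ := by gcongr; exact sqrt_div_norm_le hσ
  rw [← heq, ← Finset.mul_sum, norm_mul] at hbound
  have hpi : 1 ≤ ‖(2 * Real.pi : ℂ)‖ := by
    rw [norm_mul, norm_real, Real.norm_eq_abs, abs_of_pos Real.pi_pos]
    have := Real.pi_gt_three
    simp; linarith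
  have hsumeq : ∑ n ∈ Finset.range Y, a n * ((Y : ℂ) - n) =
      Y * ∑ n ∈ Finset.range Y, a n * triangle (n / Y) := by
    rw [Finset.mul_sum]
    refine Finset.sum_congr rfl fun n hn => ?_
    rw [Finset.mem_range] at hn
    rw [triangle_of_le_one (by rw [div_le_one hY0]; exact_mod_cast hn.le)]
    push_cast
    field_simp
  rw [hsumeq, norm_mul, norm_natCast]
  have h1 : ‖∑ n ∈ Finset.range Y, a n * triangle (n / Y)‖ ≤ M * (Y : ℝ) ^ σ * J :=
    le_trans (le_mul_of_one_le_left (norm_nonneg _) hpi) hbound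
  calc (Y : ℝ) * _ ≤ Y * (M * (Y : ℝ) ^ σ * J) := by gcongr
    _ = J * M * (Y : ℝ) ^ (σ + 1) := by rw [Real.rpow_add_one hY0.ne']; ring
    _ ≤ _ := by gcongr; linarith

end triangleKernel

section siegelWalfisz

open Complex MeasureTheory Set Filter Topology Asymptotics
open scoped ComplexOrder

/-- Abel's inequality. -/
lemma norm_sum_mul_le_of_antitone {w : ℕ → ℝ} {f : ℕ → ℂ} {M : ℝ} (hw : Antitone w)
    (hw0 : ∀ n, 0 ≤ w n) (hf : ∀ n, ‖∑ i ∈ Finset.range n, f i‖ ≤ M) (n : ℕ) :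
    ‖∑ i ∈ Finset.range n, (w i : ℂ) * f i‖ ≤ w 0 * M := by
  have hM : 0 ≤ M := (norm_nonneg _).trans (hf 0)
  have key : ∀ n, ‖∑ i ∈ Finset.range n, (w i : ℂ) * f i - w n * ∑ i ∈ Finset.range n, f i‖ ≤
      M * (w 0 - w n) := by
    intro n
    induction n with
    | zero => simp
    | succ n ih =>
      have e : ∑ i ∈ Finset.range (n + 1), (w i : ℂ) * f i -
          w (n + 1) * ∑ i ∈ Finset.range (n + 1), f i =
          (∑ i ∈ Finset.range n, (w i : ℂ) * f i - w n * ∑ i ∈ Finset.range n, f i) +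
          ((w n - w (n + 1) : ℝ) : ℂ) * ∑ i ∈ Finset.range (n + 1), f i := by
        rw [Finset.sum_range_succ, Finset.sum_range_succ]; push_cast; ring
      rw [e]
      refine (norm_add_le _ _).trans ?_
      have h1 : ‖((w n - w (n + 1) : ℝ) : ℂ) * ∑ i ∈ Finset.range (n + 1), f i‖ ≤
          (w n - w (n + 1)) * M := by
        rw [norm_mul, norm_real, Real.norm_eq_abs,
          abs_of_nonneg (by linarith [hw (Nat.le_succ n)])]
        have := hw (Nat.le_succ n)
        exact mul_le_mul_of_nonneg_left (hf _) (by linarith)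
      linarith
  have h := key n
  have h2 : ‖(w n : ℂ) * ∑ i ∈ Finset.range n, f i‖ ≤ w n * M := by
    rw [norm_mul, norm_real, Real.norm_eq_abs, abs_of_nonneg (hw0 n)]
    have := hw0 n
    gcongr; exact hf n
  have h3 := norm_add_le (∑ i ∈ Finset.range n, (w i : ℂ) * f i - w n * ∑ i ∈ Finset.range n, f i)
    (w n * ∑ i ∈ Finset.range n, f i)
  rw [sub_add_cancel] at h3
  linarith

lemma log_pow_le (x : ℝ) (hx : 1 ≤ x) (m : ℕ) : Real.log x ^ m ≤ m.factorial * x := by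
  have h := Real.pow_div_factorial_le_exp (Real.log x) (Real.log_nonneg hx) m
  rw [Real.exp_log (by linarith), div_le_iff₀ (by positivity)] at h
  linarith

lemma log_pow_le_sqrt (x : ℝ) (hx : 1 ≤ x) (m : ℕ) :
    Real.log x ^ m ≤ 2 ^ m * m.factorial * √x := by
  have h := log_pow_le (√x) (Real.one_le_sqrt.mpr hx) m
  rw [Real.log_sqrt (by linarith), div_pow, div_le_iff₀ (by positivity)] at h
  linarith

lemma norm_mangoldtLog_le {q : ℕ} (χ : DirichletCharacter ℂ q) (k n : ℕ) :
    ‖mangoldtLog χ k n‖ ≤ Real.log n ^ (k + 1) := by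
  have hl : 0 ≤ Real.log n := Real.log_natCast_nonneg n
  rw [mangoldtLog, norm_mul, norm_mul, norm_pow, norm_real, norm_real, Real.norm_eq_abs,
    Real.norm_eq_abs, abs_of_nonneg hl, abs_of_nonneg ArithmeticFunction.vonMangoldt_nonneg,
    pow_succ]
  gcongr
  calc _ ≤ 1 * Real.log n := by
        gcongr
        · exact DirichletCharacter.norm_le_one χ _
        · exact ArithmeticFunction.vonMangoldt_le_log
    _ = _ := one_mul _

lemma one_le_log {x : ℝ} (hx : 3 ≤ x) : 1 ≤ Real.log x := by
  rw [Real.le_log_iff_exp_le (by linarith)]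
  linarith [Real.exp_one_lt_d9]

theorem exists_norm_sum_mangoldtLog_le (k : ℕ) : ∃ C : ℝ, 0 < C ∧ ∀ (q : ℕ) [NeZero q]
    (χ : DirichletCharacter ℂ q), χ ≠ 1 → ∀ x y h : ℕ, 3 ≤ x → y ≤ x → h ≤ x →
    h * ‖∑ n ∈ Finset.range y, mangoldtLog χ k n‖ ≤
      C * q * x ^ 2 + h ^ 2 * (2 * Real.log x) ^ (k + 1) := by
  obtain ⟨C, hC, hbound⟩ := exists_norm_LSeries_mangoldtLog_le k (ε := 1 / 2) (by norm_num)
  obtain ⟨J, hJ, hperron⟩ := exists_norm_sum_triangle_le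
  refine ⟨2 * (J * C * 24), by positivity, fun q _ χ hχ x y h hx hy hh => ?_⟩
  have hq : (1 : ℝ) ≤ q := by exact_mod_cast NeZero.pos q
  have hx3 : (3 : ℝ) ≤ x := by exact_mod_cast hx
  have hx0 : (0 : ℝ) < x := by linarith
  set ℓ := Real.log x with hℓ
  have hℓ1 : 1 ≤ ℓ := one_le_log hx3
  have hℓ0 : 0 < ℓ := by linarith
  set a := mangoldtLog χ k with ha
  have hT : ∀ Y : ℕ, Y ≤ 2 * x → ‖∑ n ∈ Finset.range Y, a n * ((Y : ℂ) - n)‖ ≤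
      J * C * 24 * q * x ^ 2 := by
    intro Y hY
    rcases Nat.eq_zero_or_pos Y with rfl | hY0
    · simp; positivity
    have hσ : 1 < 1 + 1 / ℓ := by have : 0 < 1 / ℓ := by positivity
                                  linarith
    have hσ2 : 1 / ℓ ≤ 1 := by rw [div_le_one hℓ0]; exact hℓ1
    have h1 := hperron a (1 + 1 / ℓ) (C * q) Y (by simp [ha, mangoldtLog]) hσ.le hY0
      (LSeriesSummable_mangoldtLog χ k (by rw [ofReal_re]; exact hσ)) (fun t => by
        have him : (((1 + 1 / ℓ : ℝ) : ℂ) + t * I).im = t := by simp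
        have hre : (((1 + 1 / ℓ : ℝ) : ℂ) + t * I).re = 1 + 1 / ℓ := by
          rw [add_re, ofReal_re]; simp
        have := hbound q χ hχ (((1 + 1 / ℓ : ℝ) : ℂ) + t * I) (by rw [hre]; exact hσ)
          (by rw [hre]; linarith)
        rw [him, Real.mul_rpow (by linarith) (by positivity)] at this
        refine this.trans ?_
        rw [mul_assoc]
        gcongr
        calc (q : ℝ) ^ (1 / 2 : ℝ) ≤ (q : ℝ) ^ (1 : ℝ) :=
              Real.rpow_le_rpow_of_exponent_le hq (by norm_num)
          _ = q := Real.rpow_one _)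
    refine h1.trans ?_
    have h2 : (Y : ℝ) ^ (1 + 1 / ℓ + 1) ≤ 24 * x ^ 2 := by
      have hY2 : (Y : ℝ) ≤ 2 * x := by exact_mod_cast hY
      have h3 : (x : ℝ) ^ (1 / ℓ) = Real.exp 1 := by
        rw [Real.rpow_def_of_pos hx0, ← hℓ]; congr 1; field_simp
      have h4 : (2 : ℝ) ^ (1 / ℓ) ≤ 2 := by
        calc (2 : ℝ) ^ (1 / ℓ) ≤ 2 ^ (1 : ℝ) :=
              Real.rpow_le_rpow_of_exponent_le (by norm_num) hσ2
          _ = 2 := by norm_num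
      calc (Y : ℝ) ^ (1 + 1 / ℓ + 1) ≤ (2 * x : ℝ) ^ (1 + 1 / ℓ + 1) := by gcongr
        _ = (2 * x : ℝ) ^ (1 / ℓ) * (2 * x) ^ (2 : ℝ) := by
          rw [← Real.rpow_add (by positivity)]; congr 1; ring
        _ = 2 ^ (1 / ℓ) * Real.exp 1 * (4 * x ^ 2) := by
          rw [Real.mul_rpow (by norm_num) hx0.le, h3, Real.rpow_two]; ring
        _ ≤ 2 * 3 * (4 * x ^ 2) := by
          gcongr
          linarith [Real.exp_one_lt_d9]
        _ = _ := by ring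
    calc _ ≤ J * (C * q) * (24 * x ^ 2) := by gcongr
      _ = _ := by ring
  have e : (h : ℂ) * ∑ n ∈ Finset.range y, a n =
      ∑ n ∈ Finset.range (y + h), a n * (((y + h : ℕ) : ℂ) - n) -
      ∑ n ∈ Finset.range y, a n * ((y : ℂ) - n) -
      ∑ n ∈ Finset.range h, a (y + n) * ((h : ℂ) - n) := by
    rw [Finset.sum_range_add, Finset.mul_sum, eq_sub_iff_add_eq, eq_sub_iff_add_eq]
    have e1 : ∑ n ∈ Finset.range h, a (y + n) * ((h : ℂ) - n) =
        ∑ n ∈ Finset.range h, a (y + n) * (((y + h : ℕ) : ℂ) - ((y + n : ℕ) : ℂ)) := by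
      refine Finset.sum_congr rfl fun n _ => ?_
      push_cast; ring
    rw [e1]
    have e2 : ∑ n ∈ Finset.range y, (h : ℂ) * a n + ∑ n ∈ Finset.range y, a n * ((y : ℂ) - n) =
        ∑ n ∈ Finset.range y, a n * (((y + h : ℕ) : ℂ) - n) := by
      rw [← Finset.sum_add_distrib]
      refine Finset.sum_congr rfl fun n _ => ?_
      push_cast; ring
    rw [← e2]; ring
  have e' : (h : ℝ) * ‖∑ n ∈ Finset.range y, a n‖ = ‖(h : ℂ) * ∑ n ∈ Finset.range y, a n‖ := by
    rw [norm_mul, Complex.norm_natCast]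
  rw [e', e]
  have h1 := hT (y + h) (by omega)
  have h2 := hT y (by omega)
  have h3 : ‖∑ n ∈ Finset.range h, a (y + n) * ((h : ℂ) - n)‖ ≤ h ^ 2 * (2 * ℓ) ^ (k + 1) := by
    have : ∀ n ∈ Finset.range h, ‖a (y + n) * ((h : ℂ) - n)‖ ≤ (2 * ℓ) ^ (k + 1) * h := by
      intro n hn
      rw [Finset.mem_range] at hn
      rw [norm_mul]
      gcongr
      · refine (norm_mangoldtLog_le χ k _).trans ?_
        gcongr
        rcases Nat.eq_zero_or_pos (y + n) with h0 | h0
        · rw [h0]; simp; positivity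
        · have h5 : ((y + n : ℕ) : ℝ) ≤ x * x := by
            have : y + n ≤ x * x := by nlinarith
            exact_mod_cast this
          calc Real.log ((y + n : ℕ) : ℝ) ≤ Real.log (x * x) :=
                Real.log_le_log (by exact_mod_cast h0) h5
            _ = 2 * ℓ := by rw [Real.log_mul hx0.ne' hx0.ne']; ring
      · rw [← Nat.cast_sub hn.le, Complex.norm_natCast]
        exact_mod_cast Nat.sub_le _ _
    refine (norm_sum_le_of_le _ this).trans (le_of_eq ?_)
    rw [Finset.sum_const, Finset.card_range, nsmul_eq_mul]; ring
  calc _ ≤ J * C * 24 * q * x ^ 2 + J * C * 24 * q * x ^ 2 + h ^ 2 * (2 * ℓ) ^ (k + 1) := by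
        refine (norm_sub_le _ _).trans (add_le_add ((norm_sub_le _ _).trans (add_le_add h1 h2)) h3)
    _ = _ := by ring

/-- **The Siegel–Walfisz theorem** for non-principal characters. -/
theorem siegel_walfisz (A B : ℕ) : ∃ C : ℝ, 0 < C ∧ ∀ (q : ℕ) [NeZero q]
    (χ : DirichletCharacter ℂ q), χ ≠ 1 → ∀ x y : ℕ, 3 ≤ x → y ≤ x → (q : ℝ) ≤ Real.log x ^ B →
    ‖∑ n ∈ Finset.range y, χ n * (ArithmeticFunction.vonMangoldt n : ℂ)‖ ≤
      C * x / Real.log x ^ A := by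
  set m := A + B + 1 with hm
  set k := 2 * m with hk
  obtain ⟨C, hC, hbound⟩ := exists_norm_sum_mangoldtLog_le k
  set E : ℝ := m.factorial + 1 with hE
  set C₂ : ℝ := C + E * 2 ^ (k + 1) with hC₂
  refine ⟨2 * (2 ^ (A + 1) * (A + 1).factorial) + 2 * C₂ * 2 ^ k, by positivity,
    fun q _ χ hχ x y hx hy hq => ?_⟩
  have hx3 : (3 : ℝ) ≤ x := by exact_mod_cast hx
  have hx0 : (0 : ℝ) < x := by linarith
  set ℓ := Real.log x with hℓ
  have hℓ1 : 1 ≤ ℓ := one_le_log hx3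
  have hℓ0 : 0 < ℓ := by linarith
  -- partial sums of the weighted coefficients
  have hS : ∀ z : ℕ, z ≤ x → ‖∑ n ∈ Finset.range z, mangoldtLog χ k n‖ ≤
      C₂ * x * ℓ ^ (m + B + 1) := by
    intro z hz
    set h := ⌈(x : ℝ) / ℓ ^ m⌉₊ with hh
    have hhx : h ≤ x := by
      rw [hh, Nat.ceil_le]
      exact div_le_self hx0.le (one_le_pow₀ hℓ1)
    have hh1 : (x : ℝ) / ℓ ^ m ≤ h := Nat.le_ceil _
    have hh2 : (h : ℝ) ≤ E * x / ℓ ^ m := by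
      have h1 : (h : ℝ) < x / ℓ ^ m + 1 := Nat.ceil_lt_add_one (by positivity)
      have h2 : 1 ≤ m.factorial * x / ℓ ^ m := by
        rw [le_div_iff₀ (by positivity), one_mul]
        exact log_pow_le x (by linarith) m
      have : E * x / ℓ ^ m = x / ℓ ^ m + m.factorial * x / ℓ ^ m := by rw [hE]; ring
      linarith
    have hh0 : (0 : ℝ) < h := lt_of_lt_of_le (by positivity) hh1
    have h1 := hbound q χ hχ x z h hx hz hhx
    rw [← hℓ] at h1
    have h2 : ‖∑ n ∈ Finset.range z, mangoldtLog χ k n‖ ≤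
        C * q * x ^ 2 / h + h * (2 * ℓ) ^ (k + 1) := by
      rw [← mul_le_mul_iff_right₀ hh0]
      refine h1.trans (le_of_eq ?_)
      field_simp
    refine h2.trans ?_
    have h3 : C * q * x ^ 2 / h ≤ C * x * ℓ ^ (m + B + 1) := by
      rw [div_le_iff₀ hh0]
      calc C * q * (x : ℝ) ^ 2 ≤ C * ℓ ^ B * x ^ 2 := by gcongr
        _ = C * x * ℓ ^ (m + B) * (x / ℓ ^ m) := by
          rw [pow_add]; field_simp
        _ ≤ C * x * ℓ ^ (m + B + 1) * h := by
          gcongr ?_ * ?_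
          gcongr ?_ * ?_
          exact pow_le_pow_right₀ hℓ1 (by omega)
    have h4 : h * (2 * ℓ) ^ (k + 1) ≤ E * 2 ^ (k + 1) * x * ℓ ^ (m + B + 1) := by
      calc h * (2 * ℓ) ^ (k + 1) ≤ E * x / ℓ ^ m * (2 * ℓ) ^ (k + 1) := by gcongr
        _ = E * 2 ^ (k + 1) * x * ℓ ^ (m + 1) := by
          rw [hk, mul_pow]; field_simp; ring
        _ ≤ _ := by
          gcongr ?_ * ?_
          exact pow_le_pow_right₀ hℓ1 (by omega)
    rw [hC₂]; linarith
  have hC₂0 : 0 < C₂ := by positivity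
  set r := Nat.sqrt x with hr
  have hr1 : (r : ℝ) ≤ √x := Real.nat_sqrt_le_real_sqrt
  have hr2 : √x ≤ r + 1 := Real.real_sqrt_le_nat_sqrt_succ
  have hsq1 : 1 ≤ √(x : ℝ) := Real.one_le_sqrt.mpr (by linarith)
  have hsmall : ∀ z : ℕ, z ≤ x → ((z : ℝ) ≤ 2 * √x) →
      ‖∑ n ∈ Finset.range z, χ n * (ArithmeticFunction.vonMangoldt n : ℂ)‖ ≤
      2 * (2 ^ (A + 1) * (A + 1).factorial) * x / ℓ ^ A := by
    intro z hzx hz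
    have h1 : ∀ n ∈ Finset.range z, ‖χ n * (ArithmeticFunction.vonMangoldt n : ℂ)‖ ≤ ℓ := by
      intro n hn
      rw [Finset.mem_range] at hn
      have h2 := norm_mangoldtLog_le χ 0 n
      simp only [mangoldtLog, pow_zero, one_mul, zero_add, pow_one] at h2
      refine h2.trans ?_
      rcases Nat.eq_zero_or_pos n with rfl | h0
      · simp; positivity
      · exact Real.log_le_log (by exact_mod_cast h0) (by exact_mod_cast (by omega))
    refine (norm_sum_le_of_le _ h1).trans ?_
    rw [Finset.sum_const, Finset.card_range, nsmul_eq_mul, le_div_iff₀ (by positivity)]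
    have h2 := log_pow_le_sqrt x (by linarith) (A + 1)
    rw [← hℓ] at h2
    calc z * ℓ * ℓ ^ A = z * ℓ ^ (A + 1) := by ring
      _ ≤ 2 * √x * (2 ^ (A + 1) * (A + 1).factorial * √x) := by gcongr
      _ = 2 * (2 ^ (A + 1) * (A + 1).factorial) * (√x * √x) := by ring
      _ = _ := by rw [Real.mul_self_sqrt hx0.le]
  rcases le_total y (r + 1) with hyr | hyr
  · refine (hsmall y hy ?_).trans ?_
    · have : (y : ℝ) ≤ r + 1 := by exact_mod_cast hyr
      linarith
    · gcongr
      have : 0 < 2 * C₂ * 2 ^ k := by positivity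
      linarith
  · obtain ⟨d, rfl⟩ := Nat.exists_eq_add_of_le hyr
    rw [Finset.sum_range_add]
    have h1 := hsmall (r + 1) (by omega) (by push_cast; linarith)
    have hlow : ∀ n : ℕ, ℓ / 2 ≤ Real.log ((r + 1 + n : ℕ) : ℝ) := by
      intro n
      have : ℓ / 2 = Real.log (√x) := by rw [Real.log_sqrt hx0.le]
      rw [this]
      apply Real.log_le_log (by positivity)
      push_cast; linarith [Nat.cast_nonneg (α := ℝ) n]
    have hpos : ∀ n : ℕ, 0 < Real.log ((r + 1 + n : ℕ) : ℝ) := fun n =>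
      lt_of_lt_of_le (by positivity) (hlow n)
    have h2 := norm_sum_mul_le_of_antitone
      (w := fun n => if n ≤ d then (Real.log ((r + 1 + n : ℕ) : ℝ) ^ k)⁻¹ else 0)
      (f := fun n => if n < d then mangoldtLog χ k (r + 1 + n) else 0)
      (M := 2 * (C₂ * x * ℓ ^ (m + B + 1))) (fun i j hij => by
        simp only
        split_ifs with h3 h4
        · have h5 := hpos i
          gcongr
        · omega
        · exact inv_nonneg.mpr (pow_nonneg (hpos i).le _)
        · exact le_rfl) (fun n => by
        split_ifs
        · exact inv_nonneg.mpr (pow_nonneg (hpos n).le _)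
        · exact le_rfl) (fun n => by
        have e : ∑ i ∈ Finset.range n, (if i < d then mangoldtLog χ k (r + 1 + i) else 0) =
            ∑ i ∈ Finset.range (min n d), mangoldtLog χ k (r + 1 + i) := by
          rw [← Finset.sum_filter]
          refine Finset.sum_congr ?_ fun _ _ => rfl
          ext i; simp
        rw [e]
        have h3 := Finset.sum_range_add (mangoldtLog χ k) (r + 1) (min n d)
        rw [← sub_eq_iff_eq_add'] at h3
        rw [← h3]
        have := norm_sub_le (∑ i ∈ Finset.range (r + 1 + min n d), mangoldtLog χ k i)
          (∑ i ∈ Finset.range (r + 1), mangoldtLog χ k i)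
        have := hS (r + 1 + min n d) (by omega)
        have := hS (r + 1) (by omega)
        linarith) d
    have e : ∑ i ∈ Finset.range d, (((if i ≤ d then (Real.log ((r + 1 + i : ℕ) : ℝ) ^ k)⁻¹ else 0
        : ℝ)) : ℂ) * (if i < d then mangoldtLog χ k (r + 1 + i) else 0) =
        ∑ i ∈ Finset.range d, χ ((r + 1 + i : ℕ)) *
          (ArithmeticFunction.vonMangoldt (r + 1 + i) : ℂ) := by
      refine Finset.sum_congr rfl fun i hi => ?_
      rw [Finset.mem_range] at hi
      rw [if_pos hi.le, if_pos hi, mangoldtLog, ofReal_inv, ofReal_pow, inv_mul_cancel_left₀]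
      exact pow_ne_zero _ (by exact_mod_cast (hpos i).ne')
    rw [e] at h2
    simp only [zero_le, if_true] at h2
    have h3 : (Real.log ((r + 1 + 0 : ℕ) : ℝ) ^ k)⁻¹ * (2 * (C₂ * x * ℓ ^ (m + B + 1))) ≤
        2 * C₂ * 2 ^ k * x / ℓ ^ A := by
      have h4 : (Real.log ((r + 1 + 0 : ℕ) : ℝ) ^ k)⁻¹ ≤ ((ℓ / 2) ^ k)⁻¹ := by
        have := hlow 0
        gcongr
      calc _ ≤ ((ℓ / 2) ^ k)⁻¹ * (2 * (C₂ * x * ℓ ^ (m + B + 1))) := by gcongr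
        _ = _ := by
          have e1 : ℓ ^ k = ℓ ^ (m + B + 1) * ℓ ^ A := by
            rw [← pow_add]; congr 1; omega
          rw [div_pow, e1]
          field_simp
    refine (norm_add_le _ _).trans ?_
    rw [add_mul, add_div]
    exact add_le_add h1 (h2.trans h3)

end siegelWalfisz

section vaughanIdentity

open Complex (ofReal_sum ofReal_mul norm_real)

section vaughan
open ArithmeticFunction
open scoped ArithmeticFunction.Moebius ArithmeticFunction.zeta

lemma sum_Ioc_eq_sum_range {M : Type*} [AddCommMonoid M] (f : ℕ → M) (z : ℕ) :
    ∑ k ∈ Finset.Ioc 0 z, f k = ∑ k ∈ Finset.range z, f (k + 1) := by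
  induction z with
  | zero => simp
  | succ z ih => rw [Finset.sum_range_succ, ← ih, Finset.sum_Ioc_succ_top (Nat.zero_le z)]

lemma sum_Ioc_convolution_mul (f g : ArithmeticFunction ℝ) (F : ℕ → ℂ) (N : ℕ) :
    ∑ n ∈ Finset.Ioc 0 N, ((f * g) n : ℂ) * F n =
      ∑ d ∈ Finset.Ioc 0 N, (f d : ℂ) * ∑ k ∈ Finset.Ioc 0 (N / d), (g k : ℂ) * F (d * k) := by
  have h1 : ∑ n ∈ Finset.Ioc 0 N, ((f * g) n : ℂ) * F n =
      ∑ x ∈ Finset.Ioc 0 N ×ˢ Finset.Ioc 0 N with x.1 * x.2 ≤ N,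
        (f x.1 : ℂ) * ((g x.2 : ℂ) * F (x.1 * x.2)) := by
    trans ∑ n ∈ Finset.Ioc 0 N, ∑ x ∈ Finset.Ioc 0 N ×ˢ Finset.Ioc 0 N with x.1 * x.2 = n,
      (f x.1 : ℂ) * ((g x.2 : ℂ) * F (x.1 * x.2))
    · refine Finset.sum_congr rfl fun n hn ↦ ?_
      simp only [Finset.mem_Ioc] at hn
      rw [ArithmeticFunction.mul_apply, Nat.divisorsAntidiagonal_eq_prod_filter_of_le hn.1.ne' hn.2,
        ofReal_sum, Finset.sum_mul]
      refine Finset.sum_congr rfl fun x hx => ?_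
      rw [(Finset.mem_filter.mp hx).2, ofReal_mul, mul_assoc]
    · simp_rw [Finset.sum_filter]
      rw [Finset.sum_comm]
      exact Finset.sum_congr rfl fun _ _ ↦ (by simp_all)
  rw [h1, Finset.sum_filter, Finset.sum_product]
  refine Finset.sum_congr rfl fun n hn ↦ ?_
  simp only [Finset.sum_ite, not_le, Finset.sum_const_zero, add_zero, Finset.mul_sum]
  congr
  ext
  simp only [Finset.mem_filter, Finset.mem_Ioc, and_assoc, and_congr_right_iff] at hn ⊢
  intro _
  constructor
  · intro ⟨_, h⟩
    grw [← h, Nat.mul_div_cancel_left _ (by lia)]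
  · intro hm
    grw [hm]
    simp [Nat.mul_div_le, Nat.div_le_self]

/-- The part of an arithmetic function supported on `n ≤ U`. -/
def lowPart (f : ArithmeticFunction ℝ) (U : ℕ) : ArithmeticFunction ℝ :=
  ⟨fun n => if n ≤ U then f n else 0, by simp⟩

/-- The part of an arithmetic function supported on `n > U`. -/
def highPart (f : ArithmeticFunction ℝ) (U : ℕ) : ArithmeticFunction ℝ :=
  ⟨fun n => if n ≤ U then 0 else f n, by simp⟩

lemma lowPart_apply (f : ArithmeticFunction ℝ) (U n : ℕ) :
    lowPart f U n = if n ≤ U then f n else 0 := rfl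

lemma highPart_apply (f : ArithmeticFunction ℝ) (U n : ℕ) :
    highPart f U n = if n ≤ U then 0 else f n := rfl

lemma lowPart_add_highPart (f : ArithmeticFunction ℝ) (U : ℕ) :
    lowPart f U + highPart f U = f := by
  ext n
  rw [ArithmeticFunction.add_apply, lowPart_apply, highPart_apply]
  split_ifs <;> simp

/-- The coefficients `∑_{e ∣ n, e > U} Λ(e)` of Vaughan's identity. -/
def vaughanCoeff (U : ℕ) : ArithmeticFunction ℝ := highPart Λ U * ζ

lemma vaughanCoeff_apply (U n : ℕ) :
    vaughanCoeff U n = ∑ e ∈ n.divisors, highPart Λ U e := by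
  rw [vaughanCoeff, ArithmeticFunction.coe_mul_zeta_apply]

lemma vaughanCoeff_nonneg (U n : ℕ) : 0 ≤ vaughanCoeff U n := by
  rw [vaughanCoeff_apply]
  refine Finset.sum_nonneg fun e _ => ?_
  rw [highPart_apply]
  split_ifs
  · exact le_rfl
  · exact vonMangoldt_nonneg

lemma vaughanCoeff_le_log (U n : ℕ) : vaughanCoeff U n ≤ Real.log n := by
  rw [vaughanCoeff_apply, ← ArithmeticFunction.vonMangoldt_sum]
  refine Finset.sum_le_sum fun e _ => ?_
  rw [highPart_apply]
  split_ifs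
  · exact vonMangoldt_nonneg
  · exact le_rfl

lemma vaughanCoeff_eq_zero {U n : ℕ} (h : n ≤ U) : vaughanCoeff U n = 0 := by
  rw [vaughanCoeff_apply]
  refine Finset.sum_eq_zero fun e he => ?_
  rw [highPart_apply, if_pos ((Nat.divisor_le he).trans h)]

lemma vaughan_identity (U : ℕ) : (Λ : ArithmeticFunction ℝ) =
    lowPart Λ U + lowPart μ U * log - (lowPart μ U * lowPart Λ U) * ζ +
      highPart μ U * vaughanCoeff U := by
  have h1 := lowPart_add_highPart Λ U
  have h2 := lowPart_add_highPart (μ : ArithmeticFunction ℝ) U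
  have h3 : (ζ : ArithmeticFunction ℝ) * (μ : ArithmeticFunction ℝ) = 1 := coe_zeta_mul_coe_moebius
  have h4 : (Λ : ArithmeticFunction ℝ) * ζ = log := vonMangoldt_mul_zeta
  rw [vaughanCoeff, ← h4]
  set m₁ := lowPart (μ : ArithmeticFunction ℝ) U
  set m₂ := highPart (μ : ArithmeticFunction ℝ) U
  set l₁ := lowPart Λ U
  set l₂ := highPart Λ U
  rw [← h2] at h3
  rw [← h1]
  linear_combination (-l₂) * h3

lemma norm_sum_log_mul_le {f : ℕ → ℂ} {P : ℝ} (z : ℕ)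
    (hf : ∀ w, ‖∑ k ∈ Finset.Ioc 0 w, f k‖ ≤ P) :
    ‖∑ k ∈ Finset.Ioc 0 z, (Real.log k : ℂ) * f k‖ ≤ 2 * Real.log z * P := by
  have hP : 0 ≤ P := (norm_nonneg _).trans (hf 0)
  set w : ℕ → ℝ := fun i => if i < z then Real.log z - Real.log ((i + 1 : ℕ) : ℝ) else 0 with hw
  have hw0 : ∀ n, 0 ≤ w n := by
    intro n
    simp only [hw]
    split_ifs with h
    · rw [sub_nonneg]
      exact Real.log_le_log (by positivity) (by exact_mod_cast h)
    · exact le_rfl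
  have h1 := norm_sum_mul_le_of_antitone (w := w) (f := fun i => f (i + 1)) (M := P) (by
    intro i j hij
    by_cases hj : j < z
    · simp only [hw, if_pos hj, if_pos (lt_of_le_of_lt hij hj)]
      gcongr
    · have := hw0 i
      simpa only [hw, if_neg hj] using this) hw0 (fun n => by
    rw [← sum_Ioc_eq_sum_range]; exact hf n) z
  have h2 : ∑ k ∈ Finset.Ioc 0 z, (Real.log k : ℂ) * f k =
      (Real.log z : ℂ) * ∑ k ∈ Finset.Ioc 0 z, f k - ∑ i ∈ Finset.range z, (w i : ℂ) * f (i + 1) := by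
    rw [sum_Ioc_eq_sum_range, sum_Ioc_eq_sum_range, Finset.mul_sum, ← Finset.sum_sub_distrib]
    refine Finset.sum_congr rfl fun i hi => ?_
    simp only [hw, if_pos (Finset.mem_range.mp hi)]
    push_cast
    ring
  have h3 : w 0 ≤ Real.log z := by
    simp only [hw]
    split_ifs
    · simp
    · exact Real.log_natCast_nonneg z
  rw [h2]
  refine (norm_sub_le _ _).trans ?_
  rw [norm_mul, norm_real, Real.norm_eq_abs, abs_of_nonneg (Real.log_natCast_nonneg z)]
  have h4 : Real.log z * ‖∑ k ∈ Finset.Ioc 0 z, f k‖ ≤ Real.log z * P :=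
    mul_le_mul_of_nonneg_left (hf z) (Real.log_natCast_nonneg z)
  have h5 : w 0 * P ≤ Real.log z * P := mul_le_mul_of_nonneg_right h3 hP
  linarith

lemma abs_moebius_le (n : ℕ) : |((μ : ArithmeticFunction ℝ) n)| ≤ 1 := by
  rw [ArithmeticFunction.intCoe_apply]
  exact_mod_cast abs_moebius_le_one

lemma abs_lowPart_moebius_le (U n : ℕ) : |lowPart (μ : ArithmeticFunction ℝ) U n| ≤ 1 := by
  rw [lowPart_apply]
  split_ifs
  · exact abs_moebius_le n
  · simp

lemma abs_highPart_moebius_le (U n : ℕ) : |highPart (μ : ArithmeticFunction ℝ) U n| ≤ 1 := by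
  rw [highPart_apply]
  split_ifs
  · simp
  · exact abs_moebius_le n

lemma abs_lowPart_moebius_mul_le (U n : ℕ) :
    |(lowPart (μ : ArithmeticFunction ℝ) U * lowPart Λ U) n| ≤ Real.log n := by
  rw [ArithmeticFunction.mul_apply, ← ArithmeticFunction.vonMangoldt_sum,
    ← Nat.map_div_left_divisors, Finset.sum_map]
  refine (Finset.abs_sum_le_sum_abs _ _).trans (Finset.sum_le_sum fun e _ => ?_)
  rw [abs_mul]
  have h1 : |lowPart Λ U e| ≤ Λ e := by
    rw [lowPart_apply]
    split_ifs
    · rw [abs_of_nonneg vonMangoldt_nonneg]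
    · simp
  calc _ ≤ 1 * Λ e := mul_le_mul (abs_lowPart_moebius_le U _) h1 (abs_nonneg _) zero_le_one
    _ = _ := one_mul _

lemma lowPart_moebius_mul_eq_zero {U n : ℕ} (h : U ^ 2 < n) :
    (lowPart (μ : ArithmeticFunction ℝ) U * lowPart Λ U) n = 0 := by
  rw [ArithmeticFunction.mul_apply]
  refine Finset.sum_eq_zero fun x hx => ?_
  have hx1 := (Nat.mem_divisorsAntidiagonal.mp hx).1
  rw [lowPart_apply, lowPart_apply]
  split_ifs with h1 h2
  · nlinarith
  all_goals simp

theorem norm_sum_vonMangoldt_le {F : ℕ → ℂ} {P : ℝ} {U : ℕ} (y : ℕ) (hU : 1 ≤ U) (hP : 1 ≤ P)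
    (hF : ∀ n, ‖F n‖ ≤ 1)
    (hI : ∀ d, 0 < d → d ≤ U ^ 2 → ∀ z, ‖∑ k ∈ Finset.Ioc 0 z, F (d * k)‖ ≤ P) :
    ‖∑ n ∈ Finset.Ioc 0 y, (Λ n : ℂ) * F n‖ ≤ 4 * U ^ 2 * P * Real.log y +
      ‖∑ a ∈ Finset.Ioc 0 y, (highPart (μ : ArithmeticFunction ℝ) U a : ℂ) *
        ∑ b ∈ Finset.Ioc 0 (y / a), (vaughanCoeff U b : ℂ) * F (a * b)‖ := by
  have hl : 0 ≤ Real.log y := Real.log_natCast_nonneg y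
  have hU' : (1 : ℝ) ≤ U := by exact_mod_cast hU
  have hlog : ∀ n ∈ Finset.Ioc 0 y, Real.log n ≤ Real.log y := by
    intro n hn
    rw [Finset.mem_Ioc] at hn
    exact Real.log_le_log (by exact_mod_cast hn.1) (by exact_mod_cast hn.2)
  have hcount : ∀ (V : ℕ) (t : ℝ) (g : ℕ → ℂ), 0 ≤ t → (∀ n ∈ Finset.Ioc 0 y, ‖g n‖ ≤ t) →
      (∀ n, V < n → g n = 0) → ‖∑ n ∈ Finset.Ioc 0 y, g n‖ ≤ V * t := by
    intro V t g ht h1 h2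
    have h3 : ∑ n ∈ Finset.Ioc 0 y, g n = ∑ n ∈ (Finset.Ioc 0 y).filter (· ≤ V), g n := by
      rw [Finset.sum_filter]
      refine Finset.sum_congr rfl fun n _ => ?_
      split_ifs with h
      · rfl
      · exact h2 n (by omega)
    rw [h3]
    refine (norm_sum_le_of_le _ fun n hn => h1 n (Finset.mem_filter.mp hn).1).trans ?_
    rw [Finset.sum_const, nsmul_eq_mul]
    gcongr
    calc _ ≤ (Finset.Ioc 0 V).card := Finset.card_le_card fun n hn => by
            simp only [Finset.mem_filter, Finset.mem_Ioc] at hn ⊢; omega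
      _ = V := by simp
  have e : ∑ n ∈ Finset.Ioc 0 y, (Λ n : ℂ) * F n =
      ∑ n ∈ Finset.Ioc 0 y, (lowPart Λ U n : ℂ) * F n +
      ∑ n ∈ Finset.Ioc 0 y, ((lowPart (μ : ArithmeticFunction ℝ) U * log) n : ℂ) * F n -
      ∑ n ∈ Finset.Ioc 0 y,
        (((lowPart (μ : ArithmeticFunction ℝ) U * lowPart Λ U) * ζ : ArithmeticFunction ℝ) n : ℂ)
          * F n +
      ∑ n ∈ Finset.Ioc 0 y,
        ((highPart (μ : ArithmeticFunction ℝ) U * vaughanCoeff U) n : ℂ) * F n := by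
    rw [← Finset.sum_add_distrib, ← Finset.sum_sub_distrib, ← Finset.sum_add_distrib]
    refine Finset.sum_congr rfl fun n _ => ?_
    conv_lhs => rw [vaughan_identity U]
    rw [ArithmeticFunction.add_apply, sub_eq_add_neg, ArithmeticFunction.add_apply,
      ArithmeticFunction.neg_apply, ArithmeticFunction.add_apply]
    push_cast
    ring
  rw [sum_Ioc_convolution_mul _ log, sum_Ioc_convolution_mul _ (ζ : ArithmeticFunction ℝ),
    sum_Ioc_convolution_mul _ (vaughanCoeff U)] at e
  have b1 : ‖∑ n ∈ Finset.Ioc 0 y, (lowPart Λ U n : ℂ) * F n‖ ≤ U * Real.log y := by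
    refine hcount _ _ _ hl (fun n hn => ?_) (fun n hn => ?_)
    · rw [norm_mul, norm_real, Real.norm_eq_abs]
      have h1 : |lowPart Λ U n| ≤ Real.log y := by
        rw [lowPart_apply]
        split_ifs
        · rw [abs_of_nonneg vonMangoldt_nonneg]
          exact vonMangoldt_le_log.trans (hlog n hn)
        · simpa using hl
      calc _ ≤ Real.log y * 1 := mul_le_mul h1 (hF n) (norm_nonneg _) hl
        _ = _ := mul_one _
    · rw [lowPart_apply, if_neg (by omega)]; simp
  have b2 : ‖∑ d ∈ Finset.Ioc 0 y, (lowPart (μ : ArithmeticFunction ℝ) U d : ℂ) *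
      ∑ k ∈ Finset.Ioc 0 (y / d), (log k : ℂ) * F (d * k)‖ ≤ U * (2 * Real.log y * P) := by
    refine hcount _ _ _ (by positivity) (fun d hd => ?_) (fun n hn => ?_)
    · rw [norm_mul, norm_real, Real.norm_eq_abs]
      by_cases hdU : d ≤ U
      · have hd' := Finset.mem_Ioc.mp hd
        have h1 := norm_sum_log_mul_le (f := fun k => F (d * k)) (P := P) (y / d)
          (hI d hd'.1 (hdU.trans (by nlinarith)))
        have h2 : Real.log ((y / d : ℕ) : ℝ) ≤ Real.log y := by
          rcases Nat.eq_zero_or_pos (y / d) with h0 | h0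
          · rw [h0]; simpa using hl
          · exact Real.log_le_log (by exact_mod_cast h0) (by exact_mod_cast Nat.div_le_self _ _)
        calc _ ≤ 1 * (2 * Real.log ((y / d : ℕ) : ℝ) * P) :=
              mul_le_mul (abs_lowPart_moebius_le U d) h1 (norm_nonneg _) zero_le_one
          _ ≤ 2 * Real.log y * P := by rw [one_mul]; gcongr
      · rw [lowPart_apply, if_neg hdU, abs_zero, zero_mul]; positivity
    · rw [lowPart_apply, if_neg (by omega)]; simp
  have b3 : ‖∑ d ∈ Finset.Ioc 0 y,
      ((lowPart (μ : ArithmeticFunction ℝ) U * lowPart Λ U) d : ℂ) *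
      ∑ k ∈ Finset.Ioc 0 (y / d), ((ζ : ArithmeticFunction ℝ) k : ℂ) * F (d * k)‖ ≤
      (U ^ 2 : ℕ) * (Real.log y * P) := by
    refine hcount _ _ _ (by positivity) (fun d hd => ?_) (fun n hn => ?_)
    · rw [norm_mul, norm_real, Real.norm_eq_abs]
      have hd' := Finset.mem_Ioc.mp hd
      by_cases hdU : d ≤ U ^ 2
      · have h1 : ∑ k ∈ Finset.Ioc 0 (y / d), ((ζ : ArithmeticFunction ℝ) k : ℂ) * F (d * k) =
            ∑ k ∈ Finset.Ioc 0 (y / d), F (d * k) := by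
          refine Finset.sum_congr rfl fun k hk => ?_
          rw [Finset.mem_Ioc] at hk
          rw [natCoe_apply, zeta_apply, if_neg (by omega)]; simp
        rw [h1]
        exact mul_le_mul ((abs_lowPart_moebius_mul_le U d).trans (hlog d hd)) (hI d hd'.1 hdU _)
          (norm_nonneg _) hl
      · rw [lowPart_moebius_mul_eq_zero (by omega), abs_zero, zero_mul]; positivity
    · rw [lowPart_moebius_mul_eq_zero hn]; simp
  rw [e]
  refine (norm_add_le _ _).trans (add_le_add ?_ le_rfl)
  refine (norm_sub_le _ _).trans ((add_le_add ((norm_add_le _ _).trans (add_le_add b1 b2))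
    b3).trans ?_)
  push_cast
  have hPl : Real.log y ≤ Real.log y * P := le_mul_of_one_le_right hl hP
  have hUU : (U : ℝ) ≤ U ^ 2 := by nlinarith
  calc U * Real.log y + U * (2 * Real.log y * P) + U ^ 2 * (Real.log y * P)
      ≤ U ^ 2 * (Real.log y * P) + U ^ 2 * (2 * Real.log y * P) + U ^ 2 * (Real.log y * P) := by
        gcongr
    _ = _ := by ring

end vaughan

end vaughanIdentity

section additiveCharacters

open Complex (ofReal_sum ofReal_mul norm_real)
open scoped Real

/-- The additive character `x ↦ e^{2πix}`. -/
def ec (x : ℝ) : ℂ := Complex.exp ((2 * π * x : ℝ) * Complex.I)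

lemma ec_zero : ec 0 = 1 := by simp [ec]

lemma ec_add (x y : ℝ) : ec (x + y) = ec x * ec y := by
  rw [ec, ec, ec, ← Complex.exp_add]; congr 1; push_cast; ring

lemma norm_ec (x : ℝ) : ‖ec x‖ = 1 := Complex.norm_exp_ofReal_mul_I _

lemma ec_neg (x : ℝ) : ec (-x) = (starRingEnd ℂ) (ec x) := by
  rw [ec, ec, ← Complex.exp_conj]; congr 1
  rw [map_mul, Complex.conj_ofReal, Complex.conj_I]; push_cast; ring

lemma ec_int (n : ℤ) : ec n = 1 := by
  rw [ec, Complex.exp_eq_one_iff]; exact ⟨n, by push_cast; ring⟩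

lemma ec_add_int (x : ℝ) (n : ℤ) : ec (x + n) = ec x := by rw [ec_add, ec_int, mul_one]

lemma ec_nat_mul (n : ℕ) (x : ℝ) : ec (n * x) = ec x ^ n := by
  rw [ec, ec, ← Complex.exp_nat_mul]; congr 1; push_cast; ring

lemma ec_eq_one_iff (x : ℝ) : ec x = 1 ↔ ∃ n : ℤ, x = n := by
  constructor
  · intro h
    rw [ec, Complex.exp_eq_one_iff] at h
    obtain ⟨n, hn⟩ := h
    refine ⟨n, ?_⟩
    have h1 : ((2 * π * x : ℝ) : ℂ) = ((n * (2 * π) : ℝ) : ℂ) := by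
      apply mul_right_cancel₀ Complex.I_ne_zero
      rw [hn]; push_cast; ring
    have h2 : 2 * π * x = n * (2 * π) := by exact_mod_cast h1
    have := Real.pi_pos
    nlinarith
  · rintro ⟨n, rfl⟩; exact ec_int n

lemma norm_one_sub_ec (x : ℝ) : ‖1 - ec x‖ = 2 * |Real.sin (π * x)| := by
  have h := Complex.norm_exp_I_mul_ofReal_sub_one (2 * π * x)
  rw [norm_sub_rev, ec, mul_comm, h, Real.norm_eq_abs, abs_mul, abs_two]
  congr 3; ring

lemma four_mul_le_norm_one_sub_ec (x : ℝ) : 4 * |x - round x| ≤ ‖1 - ec x‖ := by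
  have h1 : ec x = ec (x - round x) := by
    rw [show x - round x = x + ((-round x : ℤ) : ℝ) by push_cast; ring, ec_add_int]
  rw [h1, norm_one_sub_ec]
  have h2 := abs_sub_round x
  have h3 : |π * (x - round x)| ≤ π / 2 := by
    rw [abs_mul, abs_of_pos Real.pi_pos]
    nlinarith [Real.pi_pos]
  have h4 := Real.mul_abs_le_abs_sin h3
  rw [abs_mul, abs_of_pos Real.pi_pos] at h4
  have h5 : 2 / π * (π * |x - round x|) = 2 * |x - round x| := by
    field_simp
  linarith

lemma norm_sum_ec_mul_le (x : ℝ) (z : ℕ) :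
    ‖∑ j ∈ Finset.range z, ec (j * x)‖ * (2 * |x - round x|) ≤ 1 := by
  have h1 : (∑ j ∈ Finset.range z, ec (j * x)) * (1 - ec x) = 1 - ec x ^ z := by
    simp_rw [ec_nat_mul]
    exact geom_sum_mul_neg (ec x) z
  have h2 : ‖∑ j ∈ Finset.range z, ec (j * x)‖ * ‖1 - ec x‖ ≤ 2 := by
    rw [← norm_mul, h1]
    refine (norm_sub_le _ _).trans ?_
    rw [norm_pow, norm_ec, one_pow, norm_one]; norm_num
  have h3 := four_mul_le_norm_one_sub_ec x
  have h4 := norm_nonneg (∑ j ∈ Finset.range z, ec (j * x))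
  nlinarith

lemma sum_range_ec_div {M : ℕ} (hM : 0 < M) (k : ℤ) :
    ∑ h ∈ Finset.range M, ec (h * (k / M)) = if (M : ℤ) ∣ k then (M : ℂ) else 0 := by
  have hM' : (M : ℝ) ≠ 0 := by positivity
  split_ifs with hd
  · obtain ⟨l, rfl⟩ := hd
    have : ∀ h ∈ Finset.range M, ec (h * (((M * l : ℤ) : ℝ) / M)) = 1 := by
      intro h _
      have : (h : ℝ) * (((M * l : ℤ) : ℝ) / M) = ((h * l : ℤ) : ℝ) := by
        push_cast; field_simp
      rw [this, ec_int]
    rw [Finset.sum_congr rfl this]; simp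
  · have h1 : (∑ h ∈ Finset.range M, ec (h * ((k : ℝ) / M))) * (1 - ec ((k : ℝ) / M)) = 0 := by
      simp_rw [ec_nat_mul]
      rw [geom_sum_mul_neg, ← ec_nat_mul, mul_div_cancel₀ _ hM', ec_int, sub_self]
    rcases mul_eq_zero.mp h1 with h2 | h2
    · exact h2
    · exfalso
      rw [sub_eq_zero, eq_comm, ec_eq_one_iff] at h2
      obtain ⟨n, hn⟩ := h2
      rw [div_eq_iff hM'] at hn
      exact hd ⟨n, by rw [mul_comm]; exact_mod_cast hn⟩

/-- Finite Fourier separation of the condition `b ≤ z`. -/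
lemma exists_cut_kernel (B : ℕ) : ∃ (γ ε : ℕ → ℕ → ℂ) (w : ℕ → ℝ), (∀ h, 0 ≤ w h) ∧
    (∀ h z, ‖ε h z‖ ≤ 1) ∧ (∀ h ∈ Finset.range (B + 1), ∀ z, ‖γ h z‖ ≤ w h) ∧
    ∑ h ∈ Finset.range (B + 1), w h ≤ 3 + Real.log B ∧
    ∀ z b, z ≤ B → b ≤ B →
      ∑ h ∈ Finset.range (B + 1), γ h z * ε h b = if b ≤ z then 1 else 0 := by
  set M := B + 1 with hM
  have hM0 : (0 : ℝ) < M := by positivity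
  refine ⟨fun h z => if z ≤ B then (1 / M) * ∑ j ∈ Finset.range (z + 1), ec (j * (-(h : ℝ) / M))
      else 0,
    fun h b => ec (h * (b / M)), fun h => if h = 0 then 1 else
      (1 / 2) * (1 / (h : ℝ) + 1 / ((M - h : ℕ) : ℝ)), ?_, ?_, ?_, ?_, ?_⟩
  · intro h; dsimp only; split_ifs <;> positivity
  · intro h z; rw [norm_ec]
  · intro h hh z
    have hhM := Finset.mem_range.mp hh
    dsimp only
    have hw : 0 ≤ if h = 0 then (1 : ℝ) else (1 / 2) * (1 / (h : ℝ) + 1 / ((M - h : ℕ) : ℝ)) := by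
      split_ifs <;> positivity
    by_cases hz : z ≤ B
    swap
    · rw [if_neg hz, norm_zero]; exact hw
    rw [if_pos hz, norm_mul, norm_div, norm_one, Complex.norm_natCast]
    by_cases h0 : h = 0
    · rw [if_pos h0, one_div, inv_mul_le_iff₀ hM0, mul_one]
      refine (norm_sum_le_of_le (f := fun j : ℕ => ec (j * (-(h : ℝ) / M))) (n := fun _ => 1) _
        (fun j _ => (norm_ec _).le)).trans ?_
      simp only [Finset.sum_const, Finset.card_range, nsmul_eq_mul, mul_one]
      exact_mod_cast (by omega)
    · rw [if_neg h0]
      have h1 := norm_sum_ec_mul_le (-(h : ℝ) / M) (z + 1)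
      have hh0 : (0 : ℝ) < h := by exact_mod_cast Nat.pos_of_ne_zero h0
      have hMh : (0 : ℝ) < ((M - h : ℕ) : ℝ) := by exact_mod_cast (by omega)
      have hMh' : ((M - h : ℕ) : ℝ) = M - h := by rw [Nat.cast_sub hhM.le]
      have h2 : 1 / (1 / (h : ℝ) + 1 / ((M - h : ℕ) : ℝ)) / M ≤ |-(h : ℝ) / M - round (-(h : ℝ) / M)| := by
        have h3 : 1 / (1 / (h : ℝ) + 1 / ((M - h : ℕ) : ℝ)) ≤ h := by
          rw [div_le_iff₀ (by positivity), mul_add, mul_one_div, div_self hh0.ne']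
          have : 0 ≤ (h : ℝ) * (1 / ((M - h : ℕ) : ℝ)) := by positivity
          linarith
        have h4 : 1 / (1 / (h : ℝ) + 1 / ((M - h : ℕ) : ℝ)) ≤ M - h := by
          rw [← hMh', div_le_iff₀ (by positivity), mul_add, mul_one_div (((M - h : ℕ) : ℝ)),
            mul_one_div (((M - h : ℕ) : ℝ)) (((M - h : ℕ) : ℝ)), div_self hMh.ne']
          have : 0 ≤ ((M - h : ℕ) : ℝ) / h := by positivity
          linarith
        rw [div_le_iff₀ hM0]
        have h5 : |-(h : ℝ) / M - round (-(h : ℝ) / M)| * M =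
            |-(h : ℝ) - round (-(h : ℝ) / M) * M| := by
          rw [← abs_of_pos hM0, ← abs_mul, abs_of_pos hM0, sub_mul]
          congr 2; field_simp
        rw [h5]
        rcases le_or_gt 0 (round (-(h : ℝ) / M)) with h6 | h6
        · have h7 : (0 : ℝ) ≤ round (-(h : ℝ) / M) := by exact_mod_cast h6
          refine h3.trans (le_trans ?_ (neg_le_abs _))
          nlinarith
        · have h7 : (round (-(h : ℝ) / M) : ℝ) ≤ -1 := by
            have : round (-(h : ℝ) / M) ≤ -1 := by omega
            calc (round (-(h : ℝ) / M) : ℝ) ≤ ((-1 : ℤ) : ℝ) := Int.cast_le.mpr this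
              _ = -1 := by norm_num
          refine h4.trans (le_trans ?_ (le_abs_self _))
          nlinarith
      set S := ‖∑ j ∈ Finset.range (z + 1), ec (j * (-(h : ℝ) / M))‖ with hS
      set D := 1 / (h : ℝ) + 1 / ((M - h : ℕ) : ℝ) with hD
      have hD0 : 0 < D := by positivity
      have h8 : S * (2 * (1 / D / M)) ≤ 1 := by
        refine le_trans ?_ h1
        gcongr
      have h9 : S * (2 * (1 / D / M)) = 2 * (1 / M * S) / D := by ring
      rw [h9, div_le_one hD0] at h8
      linarith
  · dsimp only
    rw [hM, Finset.sum_range_succ']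
    have h1 : ∀ h ∈ Finset.range B, (if h + 1 = 0 then (1 : ℝ) else
        (1 / 2) * (1 / ((h + 1 : ℕ) : ℝ) + 1 / ((B + 1 - (h + 1) : ℕ) : ℝ))) =
        (1 / 2) * (1 / ((h + 1 : ℕ) : ℝ)) + (1 / 2) * (1 / ((B - 1 - h + 1 : ℕ) : ℝ)) := by
      intro h hh
      rw [Finset.mem_range] at hh
      rw [if_neg (by omega), show B + 1 - (h + 1) = B - 1 - h + 1 by omega]; ring
    rw [Finset.sum_congr rfl h1, Finset.sum_add_distrib,
      Finset.sum_range_reflect (fun h => (1 / 2 : ℝ) * (1 / ((h + 1 : ℕ) : ℝ))) B, if_pos rfl,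
      ← Finset.mul_sum]
    have h2 := harmonic_le_one_add_log B
    rw [harmonic] at h2
    push_cast at h2 ⊢
    simp only [one_div] at h2 ⊢
    linarith
  · intro z b hz hb
    simp only [if_pos hz]
    have h1 : ∀ h ∈ Finset.range M,
        (1 / (M : ℂ)) * (∑ j ∈ Finset.range (z + 1), ec (j * (-(h : ℝ) / M))) * ec (h * (b / M)) =
        ∑ j ∈ Finset.range (z + 1), (1 / (M : ℂ)) * ec (h * ((((b : ℤ) - j : ℤ) : ℝ) / M)) := by
      intro h _
      rw [mul_assoc, Finset.sum_mul, Finset.mul_sum]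
      refine Finset.sum_congr rfl fun j _ => ?_
      rw [← ec_add]
      congr 2
      push_cast; ring
    rw [Finset.sum_congr rfl h1, Finset.sum_comm]
    simp_rw [← Finset.mul_sum]
    have h2 : ∀ j ∈ Finset.range (z + 1), ∑ h ∈ Finset.range M,
        ec (h * ((((b : ℤ) - j : ℤ) : ℝ) / M)) = if j = b then (M : ℂ) else 0 := by
      intro j hj
      rw [Finset.mem_range] at hj
      rw [sum_range_ec_div (by omega)]
      congr 1
      apply propext
      constructor
      · intro h3
        have h4 : (M : ℤ) ∣ (b : ℤ) - j := h3
        have h5 := Int.eq_zero_of_abs_lt_dvd h4 (by rw [abs_lt]; omega)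
        omega
      · rintro rfl; simp
    rw [Finset.sum_congr rfl h2, Finset.sum_ite_eq']
    simp only [Finset.mem_range, Nat.lt_succ_iff]
    split_ifs
    · have : (M : ℂ) ≠ 0 := by exact_mod_cast hM0.ne'
      field_simp
    · simp

end additiveCharacters

section bilinear
open ArithmeticFunction
open scoped ArithmeticFunction.Moebius

lemma sum_Ioc_mul_cut {B : ℕ} {γ ε : ℕ → ℕ → ℂ}
    (h : ∀ z b, z ≤ B → b ≤ B →
      ∑ h ∈ Finset.range (B + 1), γ h z * ε h b = if b ≤ z then 1 else 0)
    (s : Finset ℕ) (z : ℕ → ℕ) (hz : ∀ a ∈ s, z a ≤ B) (c d : ℕ → ℂ) (f : ℕ → ℕ → ℂ) :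
    ∑ a ∈ s, c a * ∑ b ∈ Finset.Ioc 0 (z a), d b * f a b =
      ∑ h ∈ Finset.range (B + 1), ∑ a ∈ s, (c a * γ h (z a)) *
        ∑ b ∈ Finset.Ioc 0 B, (d b * ε h b) * f a b := by
  rw [Finset.sum_comm]
  refine Finset.sum_congr rfl fun a ha => ?_
  have h1 : ∑ b ∈ Finset.Ioc 0 (z a), d b * f a b =
      ∑ b ∈ Finset.Ioc 0 B, (if b ≤ z a then 1 else 0) * (d b * f a b) := by
    simp_rw [ite_mul, one_mul, zero_mul]
    rw [← Finset.sum_filter]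
    refine Finset.sum_congr ?_ fun _ _ => rfl
    ext b
    have := hz a ha
    simp only [Finset.mem_Ioc, Finset.mem_filter]; omega
  have h2 : ∀ b ∈ Finset.Ioc 0 B, (if b ≤ z a then (1 : ℂ) else 0) * (d b * f a b) =
      ∑ h ∈ Finset.range (B + 1), (γ h (z a) * ε h b) * (d b * f a b) := by
    intro b hb
    rw [← Finset.sum_mul, h (z a) b (hz a ha) (Finset.mem_Ioc.mp hb).2]
  rw [h1, Finset.sum_congr rfl h2, Finset.sum_comm, Finset.mul_sum]
  refine Finset.sum_congr rfl fun h _ => ?_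
  simp_rw [Finset.mul_sum]
  refine Finset.sum_congr rfl fun b _ => ?_
  ring

lemma sum_Ioc_dyadic {M : Type*} [AddCommMonoid M] (g : ℕ → M) (U I : ℕ) :
    ∑ a ∈ Finset.Ioc U (2 ^ I * U), g a =
      ∑ i ∈ Finset.range I, ∑ a ∈ Finset.Ioc (2 ^ i * U) (2 * (2 ^ i * U)), g a := by
  induction I with
  | zero => simp
  | succ I ih =>
    rw [Finset.sum_range_succ, ← ih, ← mul_assoc, ← pow_succ',
      Finset.sum_Ioc_consecutive g (by nlinarith [Nat.one_le_two_pow (n := I)])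
      (by rw [pow_succ]; nlinarith [Nat.one_le_two_pow (n := I)])]

theorem sum_mul_norm_typeII_le {ι : Type*} (s : Finset ι) (ω : ι → ℝ) (hω : ∀ i ∈ s, 0 ≤ ω i)
    (F : ι → ℕ → ℂ) {U y : ℕ} (hU : 1 ≤ U) (hy : 3 ≤ y) {T : ℝ} (hT0 : 0 ≤ T)
    (hT : ∀ A B : ℕ, U ≤ A → U ≤ B → A * B ≤ y → ∀ c d : ℕ → ℂ, (∀ a, ‖c a‖ ≤ 1) →
      (∀ b, ‖d b‖ ≤ 1) → ∑ i ∈ s, ω i * ‖∑ a ∈ Finset.Ioc A (2 * A), c a *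
        ∑ b ∈ Finset.Ioc 0 B, d b * F i (a * b)‖ ≤ T) :
    ∑ i ∈ s, ω i * ‖∑ a ∈ Finset.Ioc 0 y, (highPart (μ : ArithmeticFunction ℝ) U a : ℂ) *
        ∑ b ∈ Finset.Ioc 0 (y / a), (vaughanCoeff U b : ℂ) * F i (a * b)‖ ≤
      12 * Real.log y ^ 3 * T := by
  have hy3 : (3 : ℝ) ≤ y := by exact_mod_cast hy
  have hl1 : 1 ≤ Real.log y := one_le_log hy3
  set I := Nat.log 2 y + 1 with hI
  have hI1 : y < 2 ^ I := Nat.lt_pow_succ_log_self (by norm_num) y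
  have hI2 : (I : ℝ) ≤ 3 * Real.log y := by
    have h1 : (Nat.log 2 y : ℝ) ≤ Real.log y / Real.log 2 := by
      have := Real.natLog_le_logb y 2
      rwa [Real.logb] at this
    have h2 : Real.log y / Real.log 2 ≤ 2 * Real.log y := by
      rw [div_le_iff₀ (Real.log_pos (by norm_num))]
      nlinarith [Real.log_two_gt_d9]
    rw [hI]; push_cast; linarith
  set g : ι → ℕ → ℂ := fun i a => (highPart (μ : ArithmeticFunction ℝ) U a : ℂ) *
        ∑ b ∈ Finset.Ioc 0 (y / a), (vaughanCoeff U b : ℂ) * F i (a * b) with hg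
  have hsum : ∀ i, ∑ a ∈ Finset.Ioc 0 y, g i a =
      ∑ j ∈ Finset.range I, ∑ a ∈ Finset.Ioc (2 ^ j * U) (2 * (2 ^ j * U)), g i a := by
    intro i
    rw [← sum_Ioc_dyadic]
    have h1 : ∑ a ∈ Finset.Ioc 0 y, g i a = ∑ a ∈ Finset.Ioc 0 (2 ^ I * U), g i a := by
      refine Finset.sum_subset (Finset.Ioc_subset_Ioc le_rfl (by nlinarith)) fun a _ ha2 => ?_
      simp only [Finset.mem_Ioc] at *
      rw [hg]
      simp only
      rw [Nat.div_eq_of_lt (by omega)]; simp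
    rw [h1]
    symm
    refine Finset.sum_subset (Finset.Ioc_subset_Ioc (Nat.zero_le _) le_rfl) fun a _ ha2 => ?_
    simp only [Finset.mem_Ioc] at *
    rw [hg]
    simp only
    rw [highPart_apply, if_pos (by omega)]; simp
  have hblock : ∀ j, ∑ i ∈ s, ω i * ‖∑ a ∈ Finset.Ioc (2 ^ j * U) (2 * (2 ^ j * U)), g i a‖ ≤
      4 * Real.log y ^ 2 * T := by
    intro j
    set A := 2 ^ j * U with hA
    have hUA : U ≤ A := by nlinarith [Nat.one_le_two_pow (n := j)]
    set B := y / A with hB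
    have hAB : A * B ≤ y := Nat.mul_div_le y A
    have hz : ∀ a ∈ Finset.Ioc A (2 * A), y / a ≤ B := by
      intro a ha
      exact Nat.div_le_div_left (Finset.mem_Ioc.mp ha).1.le (by omega)
    by_cases hBU : U ≤ B
    swap
    · have h0 : ∀ i ∈ s, ω i * ‖∑ a ∈ Finset.Ioc A (2 * A), g i a‖ = 0 := by
        intro i _
        rw [Finset.sum_eq_zero fun a ha => ?_]
        · simp
        · rw [hg]
          simp only
          rw [Finset.sum_eq_zero fun b hb => ?_]
          · simp
          · have := hz a ha
            rw [Finset.mem_Ioc] at hb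
            rw [vaughanCoeff_eq_zero (by omega)]; simp
      rw [Finset.sum_eq_zero h0]; positivity
    obtain ⟨γ, ε, w, hw, hε, hγ, hwsum, hker⟩ := exists_cut_kernel B
    have hBy : B ≤ y := Nat.div_le_self _ _
    have hB0 : 0 < B := by omega
    have hlB : Real.log B ≤ Real.log y :=
      Real.log_le_log (by exact_mod_cast hB0) (by exact_mod_cast hBy)
    have hl0 : 0 < Real.log y := by linarith
    -- normalized coefficients
    have key : ∀ h ∈ Finset.range (B + 1), ∑ i ∈ s, ω i * ‖∑ a ∈ Finset.Ioc A (2 * A),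
        ((highPart (μ : ArithmeticFunction ℝ) U a : ℂ) * γ h (y / a)) *
        ∑ b ∈ Finset.Ioc 0 B, ((vaughanCoeff U b : ℂ) * ε h b) * F i (a * b)‖ ≤
        w h * Real.log y * T := by
      intro h hh
      rcases (hw h).eq_or_lt with hw0 | hw0
      · have : ∀ z, γ h z = 0 := fun z => by
          have := hγ h hh z
          rw [← hw0] at this
          exact norm_le_zero_iff.mp this
        simp [this, ← hw0]
      have h1 := hT A B hUA hBU hAB
        (fun a => (highPart (μ : ArithmeticFunction ℝ) U a : ℂ) * γ h (y / a) / w h)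
        (fun b => if b ≤ B then (vaughanCoeff U b : ℂ) * ε h b / Real.log y else 0)
        (fun a => by
          rw [norm_div, norm_mul, Complex.norm_real, Complex.norm_real, Real.norm_eq_abs,
            Real.norm_eq_abs, abs_of_pos hw0, div_le_one hw0]
          calc _ ≤ 1 * w h := mul_le_mul (abs_highPart_moebius_le U a) (hγ h hh _)
                (norm_nonneg _) zero_le_one
            _ = _ := one_mul _)
        (fun b => by
          split_ifs with hb
          swap
          · simp
          rw [norm_div, norm_mul, Complex.norm_real, Complex.norm_real, Real.norm_eq_abs,
            Real.norm_eq_abs, abs_of_pos hl0, div_le_one hl0, abs_of_nonneg (vaughanCoeff_nonneg _ _)]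
          have h2 : vaughanCoeff U b ≤ Real.log y := by
            refine (vaughanCoeff_le_log U b).trans ?_
            rcases Nat.eq_zero_or_pos b with rfl | hb0
            · simpa using hl0.le
            · exact Real.log_le_log (by exact_mod_cast hb0) (by exact_mod_cast hb.trans hBy)
          calc _ ≤ Real.log y * 1 := mul_le_mul h2 (hε h b) (norm_nonneg _) hl0.le
            _ = _ := mul_one _)
      have h2 : ∀ i ∈ s, ω i * ‖∑ a ∈ Finset.Ioc A (2 * A),
          ((highPart (μ : ArithmeticFunction ℝ) U a : ℂ) * γ h (y / a)) *
          ∑ b ∈ Finset.Ioc 0 B, ((vaughanCoeff U b : ℂ) * ε h b) * F i (a * b)‖ =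
          w h * Real.log y * (ω i * ‖∑ a ∈ Finset.Ioc A (2 * A),
            ((highPart (μ : ArithmeticFunction ℝ) U a : ℂ) * γ h (y / a) / w h) *
            ∑ b ∈ Finset.Ioc 0 B, (if b ≤ B then (vaughanCoeff U b : ℂ) * ε h b / Real.log y
              else 0) * F i (a * b)‖) := by
        intro i _
        have h3 : ∑ a ∈ Finset.Ioc A (2 * A),
          ((highPart (μ : ArithmeticFunction ℝ) U a : ℂ) * γ h (y / a)) *
          ∑ b ∈ Finset.Ioc 0 B, ((vaughanCoeff U b : ℂ) * ε h b) * F i (a * b) =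
          ((w h * Real.log y : ℝ) : ℂ) * ∑ a ∈ Finset.Ioc A (2 * A),
            ((highPart (μ : ArithmeticFunction ℝ) U a : ℂ) * γ h (y / a) / w h) *
            ∑ b ∈ Finset.Ioc 0 B, (if b ≤ B then (vaughanCoeff U b : ℂ) * ε h b / Real.log y
              else 0) * F i (a * b) := by
          simp_rw [Finset.mul_sum]
          refine Finset.sum_congr rfl fun a _ => Finset.sum_congr rfl fun b hb => ?_
          rw [if_pos (Finset.mem_Ioc.mp hb).2]
          have h4 : (w h : ℂ) ≠ 0 := by exact_mod_cast hw0.ne'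
          have h5 : ((Real.log y : ℝ) : ℂ) ≠ 0 := by exact_mod_cast hl0.ne'
          rw [Complex.ofReal_mul]
          field_simp
        rw [h3, norm_mul, Complex.norm_real, Real.norm_eq_abs, abs_of_pos (by positivity)]
        ring
      rw [Finset.sum_congr rfl h2, ← Finset.mul_sum]
      gcongr
    calc ∑ i ∈ s, ω i * ‖∑ a ∈ Finset.Ioc A (2 * A), g i a‖
        ≤ ∑ i ∈ s, ω i * ∑ h ∈ Finset.range (B + 1), ‖∑ a ∈ Finset.Ioc A (2 * A),
          ((highPart (μ : ArithmeticFunction ℝ) U a : ℂ) * γ h (y / a)) *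
          ∑ b ∈ Finset.Ioc 0 B, ((vaughanCoeff U b : ℂ) * ε h b) * F i (a * b)‖ := by
          refine Finset.sum_le_sum fun i hi => mul_le_mul_of_nonneg_left ?_ (hω i hi)
          rw [hg]
          simp only
          rw [sum_Ioc_mul_cut hker _ _ hz]
          exact norm_sum_le _ _
      _ = ∑ h ∈ Finset.range (B + 1), ∑ i ∈ s, ω i * ‖∑ a ∈ Finset.Ioc A (2 * A),
          ((highPart (μ : ArithmeticFunction ℝ) U a : ℂ) * γ h (y / a)) *
          ∑ b ∈ Finset.Ioc 0 B, ((vaughanCoeff U b : ℂ) * ε h b) * F i (a * b)‖ := by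
          simp_rw [Finset.mul_sum]
          rw [Finset.sum_comm]
      _ ≤ ∑ h ∈ Finset.range (B + 1), w h * Real.log y * T := Finset.sum_le_sum key
      _ = (∑ h ∈ Finset.range (B + 1), w h) * (Real.log y * T) := by
          rw [Finset.sum_mul]; exact Finset.sum_congr rfl fun h _ => by ring
      _ ≤ (4 * Real.log y) * (Real.log y * T) := by
          gcongr
          linarith
      _ = _ := by ring
  calc ∑ i ∈ s, ω i * ‖∑ a ∈ Finset.Ioc 0 y, g i a‖
      ≤ ∑ i ∈ s, ω i * ∑ j ∈ Finset.range I,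
        ‖∑ a ∈ Finset.Ioc (2 ^ j * U) (2 * (2 ^ j * U)), g i a‖ := by
        refine Finset.sum_le_sum fun i hi => mul_le_mul_of_nonneg_left ?_ (hω i hi)
        rw [hsum]
        exact norm_sum_le _ _
    _ = ∑ j ∈ Finset.range I, ∑ i ∈ s,
        ω i * ‖∑ a ∈ Finset.Ioc (2 ^ j * U) (2 * (2 ^ j * U)), g i a‖ := by
        simp_rw [Finset.mul_sum]
        rw [Finset.sum_comm]
    _ ≤ ∑ j ∈ Finset.range I, 4 * Real.log y ^ 2 * T := Finset.sum_le_sum fun j _ => hblock j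
    _ = I * (4 * Real.log y ^ 2 * T) := by rw [Finset.sum_const, Finset.card_range, nsmul_eq_mul]
    _ ≤ 3 * Real.log y * (4 * Real.log y ^ 2 * T) := by gcongr
    _ = _ := by ring

end bilinear

section largeSieve
open Complex (normSq)
open scoped ComplexConjugate

lemma normSq_norm (z : ℂ) : ((‖z‖ ^ 2 : ℝ) : ℂ) = z * conj z := by
  rw [Complex.mul_conj, Complex.normSq_eq_norm_sq]

/-- Duality principle for bilinear forms. -/
lemma sum_norm_sq_duality {ι κ : Type*} (s : Finset ι) (t : Finset κ) (M : ι → κ → ℂ) {K : ℝ}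
    (h : ∀ b : ι → ℂ, ∑ n ∈ t, ‖∑ r ∈ s, b r * M r n‖ ^ 2 ≤ K * ∑ r ∈ s, ‖b r‖ ^ 2)
    (hK : 0 ≤ K) (c : κ → ℂ) :
    ∑ r ∈ s, ‖∑ n ∈ t, c n * M r n‖ ^ 2 ≤ K * ∑ n ∈ t, ‖c n‖ ^ 2 := by
  set S := ∑ r ∈ s, ‖∑ n ∈ t, c n * M r n‖ ^ 2 with hS
  have hS0 : 0 ≤ S := Finset.sum_nonneg fun _ _ => by positivity
  set b : ι → ℂ := fun r => conj (∑ n ∈ t, c n * M r n) with hb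
  have h1 : (S : ℂ) = ∑ n ∈ t, c n * ∑ r ∈ s, b r * M r n := by
    rw [hS, Complex.ofReal_sum]
    simp_rw [Finset.mul_sum]
    rw [Finset.sum_comm]
    refine Finset.sum_congr rfl fun r _ => ?_
    rw [normSq_norm, Finset.sum_mul]
    exact Finset.sum_congr rfl fun n _ => by simp only [hb]; ring
  have h2 : S ≤ ∑ n ∈ t, ‖c n‖ * ‖∑ r ∈ s, b r * M r n‖ := by
    have : S = ‖(S : ℂ)‖ := by rw [Complex.norm_real, Real.norm_of_nonneg hS0]
    rw [this, h1]
    exact (norm_sum_le _ _).trans (Finset.sum_le_sum fun _ _ => (norm_mul _ _).le)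
  have h3 : S ^ 2 ≤ (∑ n ∈ t, ‖c n‖ ^ 2) * (K * S) := by
    calc S ^ 2 ≤ (∑ n ∈ t, ‖c n‖ * ‖∑ r ∈ s, b r * M r n‖) ^ 2 := by gcongr
      _ ≤ (∑ n ∈ t, ‖c n‖ ^ 2) * ∑ n ∈ t, ‖∑ r ∈ s, b r * M r n‖ ^ 2 :=
        Finset.sum_mul_sq_le_sq_mul_sq _ _ _
      _ ≤ (∑ n ∈ t, ‖c n‖ ^ 2) * (K * S) := by
        refine mul_le_mul_of_nonneg_left ((h b).trans_eq ?_)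
          (Finset.sum_nonneg fun _ _ => by positivity)
        simp only [hb, hS, Complex.norm_conj]
  rcases hS0.eq_or_lt with h0 | h0
  · rw [← h0]; exact mul_nonneg hK (Finset.sum_nonneg fun _ _ => by positivity)
  · refine le_of_mul_le_mul_right ?_ h0
    nlinarith

lemma sum_inv_sq_le_of_spaced {ι : Type*} (s : Finset ι) (f : ι → ℝ) {δ : ℝ} (hδ : 0 < δ)
    (h0 : ∀ i ∈ s, δ ≤ f i) (h1 : ∀ i ∈ s, ∀ j ∈ s, i ≠ j → δ ≤ |f i - f j|) :
    ∑ i ∈ s, 1 / (f i) ^ 2 ≤ 2 / δ ^ 2 := by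
  have hinj : Set.InjOn (fun i => ⌊f i / δ⌋₊) s := by
    intro i hi j hj hij
    by_contra hne
    have h2 := h1 i hi j hj hne
    have h3 : |f i / δ - f j / δ| < 1 := by
      have a1 := Nat.floor_le (show 0 ≤ f i / δ from div_nonneg (hδ.le.trans (h0 i hi)) hδ.le)
      have a2 := Nat.floor_le (show 0 ≤ f j / δ from div_nonneg (hδ.le.trans (h0 j hj)) hδ.le)
      have a3 := Nat.lt_floor_add_one (f i / δ)
      have a4 := Nat.lt_floor_add_one (f j / δ)
      have a5 : (⌊f i / δ⌋₊ : ℝ) = ⌊f j / δ⌋₊ := by exact_mod_cast hij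
      rw [abs_lt]; constructor <;> linarith
    rw [← sub_div, abs_div, abs_of_pos hδ, div_lt_one hδ] at h3
    linarith
  have hpi : Real.pi ^ 2 / 6 ≤ 2 := by
    have := Real.pi_lt_d2
    have := Real.pi_pos
    nlinarith
  calc ∑ i ∈ s, 1 / (f i) ^ 2
      ≤ ∑ i ∈ s, (1 / δ ^ 2) * (1 / ((⌊f i / δ⌋₊ : ℝ)) ^ 2) := by
        refine Finset.sum_le_sum fun i hi => ?_
        have h2 : 1 ≤ f i / δ := by rw [le_div_iff₀ hδ]; linarith [h0 i hi]
        have h3 : (1 : ℝ) ≤ ⌊f i / δ⌋₊ := by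
          exact_mod_cast (Nat.one_le_floor_iff _).mpr h2
        have h4 := Nat.floor_le (show 0 ≤ f i / δ by linarith)
        rw [le_div_iff₀ hδ] at h4
        rw [div_mul_div_comm, one_mul, ← mul_pow]
        apply one_div_le_one_div_of_le (by positivity)
        gcongr
        linarith
    _ = (1 / δ ^ 2) * ∑ k ∈ s.image (fun i => ⌊f i / δ⌋₊), 1 / (k : ℝ) ^ 2 := by
        rw [Finset.sum_image hinj, Finset.mul_sum]
    _ ≤ (1 / δ ^ 2) * 2 := by
        gcongr
        exact (sum_le_hasSum _ (fun _ _ => by positivity) hasSum_zeta_two).trans hpi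
    _ = 2 / δ ^ 2 := by ring

lemma sum_inv_dist_sq_le {ι : Type*} [DecidableEq ι] (s : Finset ι) (α : ι → ℝ) {δ : ℝ}
    (hδ : 0 < δ)
    (h : ∀ r ∈ s, ∀ t ∈ s, r ≠ t → δ ≤ |(α r - α t) - round (α r - α t)|) {r : ι} (hr : r ∈ s) :
    ∑ t ∈ s.erase r, 1 / |(α r - α t) - round (α r - α t)| ^ 2 ≤ 4 / δ ^ 2 := by
  set y : ι → ℝ := fun t => (α r - α t) - round (α r - α t) with hy
  have h0 : ∀ t ∈ s.erase r, δ ≤ |y t| := fun t ht =>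
    h r hr t (Finset.mem_of_mem_erase ht) (Finset.ne_of_mem_erase ht).symm
  have hsep : ∀ i ∈ s, ∀ j ∈ s, i ≠ j → δ ≤ |y i - y j| := by
    intro i hi j hj hij
    refine (h j hj i hi hij.symm).trans
      ((round_le (α j - α i) (round (α r - α i) - round (α r - α j))).trans_eq ?_)
    simp only [hy]; push_cast; congr 1; ring
  rw [← Finset.sum_filter_add_sum_filter_not _ (fun t => 0 ≤ y t)]
  have e1 : ∑ t ∈ (s.erase r).filter (fun t => 0 ≤ y t), 1 / |y t| ^ 2 ≤ 2 / δ ^ 2 := by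
    refine (Finset.sum_congr rfl fun t _ => ?_).trans_le
      (sum_inv_sq_le_of_spaced ((s.erase r).filter (fun t => 0 ≤ y t)) y hδ ?_ ?_)
    · rw [sq_abs]
    · intro i hi
      rw [Finset.mem_filter] at hi
      simpa [abs_of_nonneg hi.2] using h0 i hi.1
    · intro i hi j hj hij
      exact hsep i (Finset.mem_of_mem_erase (Finset.mem_filter.mp hi).1) j
        (Finset.mem_of_mem_erase (Finset.mem_filter.mp hj).1) hij
  have e2 : ∑ t ∈ (s.erase r).filter (fun t => ¬ 0 ≤ y t), 1 / |y t| ^ 2 ≤ 2 / δ ^ 2 := by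
    refine (Finset.sum_congr rfl fun t _ => ?_).trans_le
      (sum_inv_sq_le_of_spaced ((s.erase r).filter (fun t => ¬ 0 ≤ y t)) (fun t => - y t) hδ ?_ ?_)
    · rw [sq_abs, neg_sq]
    · intro i hi
      rw [Finset.mem_filter, not_le] at hi
      simpa [abs_of_neg hi.2] using h0 i hi.1
    · intro i hi j hj hij
      have := hsep i (Finset.mem_of_mem_erase (Finset.mem_filter.mp hi).1) j
        (Finset.mem_of_mem_erase (Finset.mem_filter.mp hj).1) hij
      rwa [abs_sub_comm, show y j - y i = - y i - - y j by ring] at this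
  calc _ ≤ 2 / δ ^ 2 + 2 / δ ^ 2 := add_le_add e1 e2
    _ = 4 / δ ^ 2 := by ring

lemma norm_sum_ec_sq_le (x : ℝ) (z : ℕ) (hx : 0 < |x - round x|) :
    ‖∑ j ∈ Finset.range z, ec (j * x)‖ ^ 2 ≤ 1 / 4 * (1 / |x - round x| ^ 2) := by
  have h := norm_sum_ec_mul_le x z
  have h1 : ‖∑ j ∈ Finset.range z, ec (j * x)‖ ≤ 1 / (2 * |x - round x|) := by
    rwa [le_div_iff₀ (by positivity)]
  calc _ ≤ (1 / (2 * |x - round x|)) ^ 2 := by gcongr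
    _ = _ := by field_simp; norm_num

/-- Sums of exponentials at well-spaced frequencies (dual large sieve). -/
lemma sum_norm_sq_sum_ec_le {ι : Type*} (s : Finset ι) (α : ι → ℝ) {δ : ℝ}
    (hδ : 0 < δ)
    (h : ∀ r ∈ s, ∀ t ∈ s, r ≠ t → δ ≤ |(α r - α t) - round (α r - α t)|) (H : ℕ)
    (hH : 1 / δ ≤ H) (b : ι → ℂ) :
    ∑ n ∈ Finset.range H, ‖∑ r ∈ s, b r * ec (n * α r)‖ ^ 2 ≤ 5 * H * ∑ r ∈ s, ‖b r‖ ^ 2 := by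
  classical
  have hH0 : 0 < (H : ℝ) := lt_of_lt_of_le (by positivity) hH
  set T : ℝ → ℂ := fun x => ∑ r ∈ s, b r * ec (x * α r) with hT
  set E : ℝ → ℂ := fun x => ∑ j ∈ Finset.range (2 * H), ec (j * x) with hE
  have hexp : (∑ j ∈ Finset.range (2 * H), ∑ k ∈ Finset.range (2 * H),
      ((‖T ((j : ℝ) - k)‖ ^ 2 : ℝ) : ℂ)) =
      ∑ r ∈ s, ∑ t ∈ s, b r * conj (b t) * ((‖E (α r - α t)‖ ^ 2 : ℝ) : ℂ) := by
    have h1 : ∀ x : ℝ, ((‖T x‖ ^ 2 : ℝ) : ℂ) =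
        ∑ r ∈ s, ∑ t ∈ s, b r * conj (b t) * ec (x * (α r - α t)) := by
      intro x
      rw [normSq_norm, hT, map_sum, Finset.sum_mul_sum]
      refine Finset.sum_congr rfl fun r _ => Finset.sum_congr rfl fun t _ => ?_
      rw [map_mul, ← ec_neg, show x * (α r - α t) = x * α r + -(x * α t) by ring, ec_add]
      ring
    have h2 : ∀ x : ℝ, ((‖E x‖ ^ 2 : ℝ) : ℂ) =
        ∑ j ∈ Finset.range (2 * H), ∑ k ∈ Finset.range (2 * H), ec (((j : ℝ) - k) * x) := by
      intro x
      rw [normSq_norm, hE, map_sum, Finset.sum_mul_sum]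
      refine Finset.sum_congr rfl fun r _ => Finset.sum_congr rfl fun t _ => ?_
      rw [← ec_neg, ← ec_add]; congr 1; ring
    simp_rw [h1, h2, Finset.mul_sum]
    calc _ = ∑ j ∈ Finset.range (2 * H), ∑ r ∈ s, ∑ k ∈ Finset.range (2 * H), ∑ t ∈ s,
          b r * conj (b t) * ec (((j : ℝ) - k) * (α r - α t)) :=
          Finset.sum_congr rfl fun _ _ => Finset.sum_comm
      _ = ∑ r ∈ s, ∑ j ∈ Finset.range (2 * H), ∑ t ∈ s, ∑ k ∈ Finset.range (2 * H),
          b r * conj (b t) * ec (((j : ℝ) - k) * (α r - α t)) := by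
          rw [Finset.sum_comm]
          exact Finset.sum_congr rfl fun _ _ => Finset.sum_congr rfl fun _ _ => Finset.sum_comm
      _ = _ := Finset.sum_congr rfl fun _ _ => Finset.sum_comm
  have hrow : ∀ r ∈ s, ∑ t ∈ s, ‖E (α r - α t)‖ ^ 2 ≤ 5 * H ^ 2 := by
    intro r hr
    rw [← Finset.add_sum_erase _ _ hr]
    have e1 : ‖E (α r - α r)‖ ^ 2 = 4 * H ^ 2 := by
      simp [hE, ec_zero]; ring
    have e2 : ∑ t ∈ s.erase r, ‖E (α r - α t)‖ ^ 2 ≤ H ^ 2 := by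
      calc _ ≤ ∑ t ∈ s.erase r, 1 / 4 * (1 / |(α r - α t) - round (α r - α t)| ^ 2) :=
            Finset.sum_le_sum fun t ht => norm_sum_ec_sq_le _ _ (hδ.trans_le
              (h r hr t (Finset.mem_of_mem_erase ht) (Finset.ne_of_mem_erase ht).symm))
        _ ≤ 1 / 4 * (4 / δ ^ 2) := by
            rw [← Finset.mul_sum]
            gcongr
            exact sum_inv_dist_sq_le s α hδ h hr
        _ = (1 / δ) ^ 2 := by ring
        _ ≤ H ^ 2 := by gcongr
    linarith
  have hup : ∑ j ∈ Finset.range (2 * H), ∑ k ∈ Finset.range (2 * H), ‖T ((j : ℝ) - k)‖ ^ 2 ≤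
      5 * H ^ 2 * ∑ r ∈ s, ‖b r‖ ^ 2 := by
    have e0 : ∑ j ∈ Finset.range (2 * H), ∑ k ∈ Finset.range (2 * H), ‖T ((j : ℝ) - k)‖ ^ 2 ≤
        ∑ r ∈ s, ∑ t ∈ s, ‖b r‖ * ‖b t‖ * ‖E (α r - α t)‖ ^ 2 := by
      have e1 : (0 : ℝ) ≤ ∑ j ∈ Finset.range (2 * H), ∑ k ∈ Finset.range (2 * H),
        ‖T ((j : ℝ) - k)‖ ^ 2 := by positivity
      rw [← Real.norm_of_nonneg e1, ← Complex.norm_real]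
      push_cast
      push_cast at hexp
      rw [hexp]
      refine (norm_sum_le _ _).trans (Finset.sum_le_sum fun r _ =>
        (norm_sum_le _ _).trans (Finset.sum_le_sum fun t _ => ?_))
      simp
    have hsymm : ∀ r t, ‖E (α r - α t)‖ = ‖E (α t - α r)‖ := by
      intro r t
      rw [← Complex.norm_conj (E (α t - α r))]
      simp only [hE, map_sum, ← ec_neg]
      congr 2; ext j; congr 1; ring
    refine e0.trans ?_
    calc _ ≤ ∑ r ∈ s, ∑ t ∈ s, (1 / 2 * (‖b r‖ ^ 2 * ‖E (α r - α t)‖ ^ 2) +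
          1 / 2 * (‖b t‖ ^ 2 * ‖E (α t - α r)‖ ^ 2)) := by
          refine Finset.sum_le_sum fun r _ => Finset.sum_le_sum fun t _ => ?_
          rw [hsymm t r]
          nlinarith [sq_nonneg (‖b r‖ - ‖b t‖), sq_nonneg (‖E (α r - α t)‖),
            mul_nonneg (sq_nonneg (‖b r‖ - ‖b t‖)) (sq_nonneg (‖E (α r - α t)‖))]
      _ = ∑ r ∈ s, ‖b r‖ ^ 2 * ∑ t ∈ s, ‖E (α r - α t)‖ ^ 2 := by
          simp_rw [Finset.sum_add_distrib]
          rw [Finset.sum_comm (f := fun r t => 1 / 2 * (‖b t‖ ^ 2 * ‖E (α t - α r)‖ ^ 2)),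
            ← Finset.sum_add_distrib]
          refine Finset.sum_congr rfl fun r _ => ?_
          rw [← Finset.sum_add_distrib, Finset.mul_sum]
          exact Finset.sum_congr rfl fun t _ => by ring
      _ ≤ ∑ r ∈ s, ‖b r‖ ^ 2 * (5 * H ^ 2) := by
          gcongr with r hr
          exact hrow r hr
      _ = _ := by rw [← Finset.sum_mul]; ring
  have hlow : H * ∑ n ∈ Finset.range H, ‖T n‖ ^ 2 ≤
      ∑ j ∈ Finset.range (2 * H), ∑ k ∈ Finset.range (2 * H), ‖T ((j : ℝ) - k)‖ ^ 2 := by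
    rw [Finset.sum_comm]
    calc H * ∑ n ∈ Finset.range H, ‖T n‖ ^ 2
        = ∑ k ∈ Finset.range H, ∑ n ∈ Finset.range H, ‖T n‖ ^ 2 := by simp
      _ ≤ ∑ k ∈ Finset.range H, ∑ j ∈ Finset.range (2 * H), ‖T ((j : ℝ) - k)‖ ^ 2 := by
          refine Finset.sum_le_sum fun k hk => ?_
          have hk' := Finset.mem_range.mp hk
          calc ∑ n ∈ Finset.range H, ‖T n‖ ^ 2
              = ∑ n ∈ Finset.range H, ‖T (((k + n : ℕ) : ℝ) - k)‖ ^ 2 := by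
                refine Finset.sum_congr rfl fun n _ => ?_
                push_cast; congr 3; ring
            _ = ∑ j ∈ Finset.Ico k (k + H), ‖T ((j : ℝ) - k)‖ ^ 2 := by
                rw [Finset.sum_Ico_eq_sum_range]; simp
            _ ≤ _ := by
                refine Finset.sum_le_sum_of_subset_of_nonneg ?_ fun _ _ _ => by positivity
                intro j hj
                rw [Finset.mem_Ico] at hj
                rw [Finset.mem_range]; omega
      _ ≤ _ := by
          refine Finset.sum_le_sum_of_subset_of_nonneg ?_ fun _ _ _ => by positivity
          exact Finset.range_mono (by omega)
  have := hlow.trans hup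
  refine le_of_mul_le_mul_left ?_ hH0
  calc _ ≤ _ := this
    _ = _ := by ring

end largeSieve

section minorArcs
open ArithmeticFunction

lemma inv_two_mul_den_le {α : ℝ} {t : ℚ} (h : |α - t| ≤ 1 / (t.den : ℝ) ^ 2) {k : ℤ} (hk : k ≠ 0)
    (hk2 : 2 * |k| ≤ t.den) : 1 / (2 * (t.den : ℝ)) ≤ |k * α - round (k * α)| := by
  set q := t.den with hq
  have hq0 : (0 : ℝ) < q := by exact_mod_cast t.den_pos
  set m := round (k * α) with hm
  have hne : t.num * k - m * q ≠ 0 := by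
    intro h0
    have h1 : (q : ℤ) ∣ t.num * k := ⟨m, by linarith⟩
    have h2 : (q : ℤ) ∣ k := by
      refine IsCoprime.dvd_of_dvd_mul_left ?_ h1
      rw [Int.isCoprime_iff_gcd_eq_one, Int.gcd_comm]
      exact t.reduced
    have h3 := Int.le_of_dvd (abs_pos.mpr hk) ((dvd_abs _ _).mpr h2)
    have := abs_pos.mpr hk
    omega
  have h1 : (1 : ℝ) ≤ |(t.num * k - m * q : ℤ)| := by exact_mod_cast Int.one_le_abs hne
  have ht : (t : ℝ) = t.num / q := by
    rw [hq]; exact Rat.cast_def t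
  have h2 : k * α - m = (t.num * k - m * q : ℤ) / q + k * (α - t) := by
    rw [ht]; push_cast; field_simp; ring
  have h3 : |k * (α - t)| ≤ 1 / (2 * (q : ℝ)) := by
    rw [abs_mul]
    have h4 : |(k : ℝ)| ≤ q / 2 := by
      have : (2 : ℝ) * |(k : ℝ)| ≤ q := by exact_mod_cast hk2
      linarith
    calc _ ≤ (q : ℝ) / 2 * (1 / (q : ℝ) ^ 2) := mul_le_mul h4 h (abs_nonneg _) (by positivity)
      _ = _ := by field_simp
  have h5 : 1 / (q : ℝ) ≤ |((t.num * k - m * q : ℤ) : ℝ) / q| := by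
    rw [abs_div, abs_of_pos hq0]; gcongr
    exact_mod_cast h1
  have h6 : 1 / (q : ℝ) = 1 / (2 * q) + 1 / (2 * q) := by field_simp; norm_num
  rw [h2]
  have := abs_sub_abs_le_abs_sub (((t.num * k - m * q : ℤ) : ℝ) / q) (-(k * (α - t)))
  rw [abs_neg, sub_neg_eq_add] at this
  linarith

/-- Bilinear exponential sums over `α * a * b`. -/
lemma norm_sum_bilinear_ec_sq_le {α : ℝ} {t : ℚ} (h : |α - t| ≤ 1 / (t.den : ℝ) ^ 2)
    (hq : 2 ≤ t.den) (A B : ℕ) (hB : 1 ≤ B) (c d : ℕ → ℂ) (hc : ∀ a, ‖c a‖ ≤ 1)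
    (hd : ∀ b, ‖d b‖ ≤ 1) :
    ‖∑ a ∈ Finset.Ioc A (2 * A), c a * ∑ b ∈ Finset.Ioc 0 B, d b * ec (↑(a * b) * α)‖ ^ 2 ≤
      20 * (A * B) * (2 * A / t.den + 1) * (B + t.den) := by
  set q := t.den with hqd
  have hq0 : (0 : ℝ) < q := by exact_mod_cast t.den_pos
  set l := q / 2 with hl
  have hl0 : 0 < l := by omega
  have hlq : (q : ℝ) ≤ 4 * l := by
    have : q ≤ 4 * l := by omega
    exact_mod_cast this
  set J := Finset.Icc (A / l) (2 * A / l) with hJ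
  have hJcard : (J.card : ℝ) ≤ 2 * (2 * A / q + 1) := by
    have h1 : J.card ≤ A / l + 2 := by
      rw [hJ, Nat.card_Icc]
      have : 2 * A / l ≤ 2 * (A / l) + 1 := by
        rw [← Nat.lt_succ_iff, Nat.div_lt_iff_lt_mul hl0]
        have := Nat.lt_mul_div_succ A hl0
        nlinarith
      omega
    have h2 : ((A / l : ℕ) : ℝ) ≤ 4 * A / q := by
      refine Nat.cast_div_le.trans ?_
      rw [div_le_div_iff₀ (by exact_mod_cast hl0) hq0]
      nlinarith [Nat.cast_nonneg (α := ℝ) A]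
    have h3 : (J.card : ℝ) ≤ (A / l : ℕ) + 2 := by exact_mod_cast h1
    calc (J.card : ℝ) ≤ 4 * A / q + 2 := by linarith
      _ = _ := by ring
  set G : ℕ → ℕ → ℂ := fun j b =>
    ∑ a ∈ (Finset.Ioc A (2 * A)).filter (fun a => a / l = j), c a * ec (b * (α * a)) with hG
  have hsum : ∑ a ∈ Finset.Ioc A (2 * A), c a * ∑ b ∈ Finset.Ioc 0 B, d b * ec (↑(a * b) * α) =
      ∑ b ∈ Finset.Ioc 0 B, d b * ∑ j ∈ J, G j b := by
    simp_rw [Finset.mul_sum]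
    rw [Finset.sum_comm]
    refine Finset.sum_congr rfl fun b _ => ?_
    rw [← Finset.mul_sum, hG]
    simp only
    rw [Finset.sum_fiberwise_of_maps_to (fun a ha => ?_), Finset.mul_sum]
    · refine Finset.sum_congr rfl fun a _ => ?_
      rw [show ((a * b : ℕ) : ℝ) * α = b * (α * a) by push_cast; ring]; ring
    · rw [Finset.mem_Ioc] at ha
      rw [hJ, Finset.mem_Icc]
      exact ⟨Nat.div_le_div_right ha.1.le, Nat.div_le_div_right ha.2⟩
  set H := B + 1 + 2 * q with hH
  have hblock : ∀ j, ∑ b ∈ Finset.range H, ‖G j b‖ ^ 2 ≤ 5 * H *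
      ((Finset.Ioc A (2 * A)).filter (fun a => a / l = j)).card := by
    intro j
    refine (sum_norm_sq_sum_ec_le ((Finset.Ioc A (2 * A)).filter (fun a => a / l = j))
      (fun a => α * a) (δ := 1 / (2 * q)) (by positivity) ?_ H ?_ c).trans ?_
    · intro r hr s hs hrs
      have h1 : r / l = j := (Finset.mem_filter.mp hr).2
      have h2 : s / l = j := (Finset.mem_filter.mp hs).2
      have h3 := Nat.div_mul_le_self r l
      have h4 := Nat.div_mul_le_self s l
      have h5 := Nat.lt_div_mul_add (a := r) hl0
      have h6 := Nat.lt_div_mul_add (a := s) hl0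
      rw [h1] at h3 h5
      rw [h2] at h4 h6
      have := inv_two_mul_den_le h (k := (r : ℤ) - s) (by omega) (by
        have : |(r : ℤ) - s| ≤ l := abs_le.mpr ⟨by omega, by omega⟩
        omega)
      push_cast at this
      rwa [show α * r - α * s = ((r : ℝ) - s) * α by ring]
    · rw [one_div_one_div, hH]; push_cast; linarith
    · gcongr
      calc _ ≤ ∑ r ∈ (Finset.Ioc A (2 * A)).filter (fun a => a / l = j), (1 : ℝ) :=
            Finset.sum_le_sum fun r _ => pow_le_one₀ (norm_nonneg _) (hc r)
        _ = _ := by simp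
  have hcards : ∑ j ∈ J, (((Finset.Ioc A (2 * A)).filter (fun a => a / l = j)).card : ℝ) = A := by
    rw [← Nat.cast_sum, ← Finset.card_eq_sum_card_fiberwise]
    · simp; omega
    · intro a ha
      simp only [Finset.coe_Ioc, Set.mem_Ioc] at ha
      rw [hJ, Finset.coe_Icc, Set.mem_Icc]
      exact ⟨Nat.div_le_div_right ha.1.le, Nat.div_le_div_right ha.2⟩
  rw [hsum]
  calc ‖∑ b ∈ Finset.Ioc 0 B, d b * ∑ j ∈ J, G j b‖ ^ 2
      ≤ (∑ b ∈ Finset.Ioc 0 B, 1 * ‖∑ j ∈ J, G j b‖) ^ 2 := by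
        gcongr
        refine (norm_sum_le _ _).trans (Finset.sum_le_sum fun b _ => ?_)
        rw [norm_mul]; gcongr; exact hd b
    _ ≤ (∑ b ∈ Finset.Ioc 0 B, 1 ^ 2) * ∑ b ∈ Finset.Ioc 0 B, ‖∑ j ∈ J, G j b‖ ^ 2 :=
        Finset.sum_mul_sq_le_sq_mul_sq _ _ _
    _ = B * ∑ b ∈ Finset.Ioc 0 B, ‖∑ j ∈ J, G j b‖ ^ 2 := by simp
    _ ≤ B * ∑ b ∈ Finset.range H, J.card * ∑ j ∈ J, ‖G j b‖ ^ 2 := by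
        gcongr
        refine (Finset.sum_le_sum fun b _ => ?_).trans
          (Finset.sum_le_sum_of_subset_of_nonneg ?_ fun _ _ _ => by positivity)
        · calc _ ≤ (∑ j ∈ J, ‖G j b‖) ^ 2 := by gcongr; exact norm_sum_le _ _
            _ ≤ _ := sq_sum_le_card_mul_sum_sq
        · intro b hb
          rw [Finset.mem_Ioc] at hb
          rw [Finset.mem_range]; omega
    _ = B * J.card * ∑ j ∈ J, ∑ b ∈ Finset.range H, ‖G j b‖ ^ 2 := by
        rw [← Finset.mul_sum, Finset.sum_comm]; ring
    _ ≤ B * (2 * (2 * A / q + 1)) * ∑ j ∈ J, 5 * H *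
        (((Finset.Ioc A (2 * A)).filter (fun a => a / l = j)).card : ℝ) := by
        gcongr with j hj
        · exact hblock j
    _ = B * (2 * (2 * A / q + 1)) * (5 * H * A) := by rw [← Finset.mul_sum, hcards]
    _ ≤ B * (2 * (2 * A / q + 1)) * (5 * (2 * (B + q)) * A) := by
        gcongr
        rw [hH]; push_cast
        have : (1 : ℝ) ≤ B := by exact_mod_cast hB
        linarith
    _ = _ := by ring

/-- Vinogradov's estimate for exponential sums over primes. -/
theorem norm_sum_vonMangoldt_ec_le {α : ℝ} {t : ℚ} (h : |α - t| ≤ 1 / (t.den : ℝ) ^ 2) {U y : ℕ}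
    (hU : 1 ≤ U) (hUq : 2 * U ^ 2 ≤ t.den) (hy : 3 ≤ y) :
    ‖∑ n ∈ Finset.Ioc 0 y, (Λ n : ℂ) * ec (n * α)‖ ≤
      4 * U ^ 2 * t.den * Real.log y + 12 * Real.log y ^ 3 *
        (y * √(80 * (1 / t.den + 1 / U + t.den / y))) := by
  set q := t.den with hqd
  have hq0 : (0 : ℝ) < q := by exact_mod_cast t.den_pos
  have hU0 : (0 : ℝ) < U := by exact_mod_cast hU
  have hy0 : (0 : ℝ) < y := by positivity
  have hq2 : 2 ≤ q := by nlinarith [Nat.one_le_pow 2 U hU]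
  refine (norm_sum_vonMangoldt_le (F := fun n => ec (n * α)) (P := q) y hU
    (by exact_mod_cast (by omega : 1 ≤ q)) (fun n => (norm_ec _).le) ?_).trans ?_
  · intro d hd hdU z
    have h1 := inv_two_mul_den_le h (k := d) (by omega) (by rw [abs_of_nonneg (by omega)]; omega)
    have h2 := norm_sum_ec_mul_le (((d : ℤ) : ℝ) * α) z
    have h3 : ∑ k ∈ Finset.Ioc 0 z, ec (↑(d * k) * α) =
        ec (d * α) * ∑ j ∈ Finset.range z, ec (j * (((d : ℤ) : ℝ) * α)) := by
      rw [Finset.mul_sum, ← Finset.Ico_add_one_add_one_eq_Ioc, Finset.sum_Ico_eq_sum_range]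
      refine Finset.sum_congr (by congr 1) fun j _ => ?_
      rw [← ec_add]; congr 1; push_cast; ring
    rw [h3, norm_mul, norm_ec, one_mul]
    rw [← hqd, div_le_iff₀ (by positivity)] at h1
    set X := ‖∑ j ∈ Finset.range z, ec (j * (((d : ℤ) : ℝ) * α))‖
    have hX : 0 ≤ X := norm_nonneg _
    nlinarith
  · gcongr
    have h1 := sum_mul_norm_typeII_le (Finset.univ : Finset Unit) (fun _ => 1) (by simp)
      (fun _ n => ec (n * α)) hU hy (T := y * √(80 * (1 / q + 1 / U + q / y))) (by positivity) ?_
    · simpa using h1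
    · intro A B hA hB hAB c d hc hd
      simp only [Finset.univ_unique, one_mul, Finset.sum_const, Finset.card_singleton, one_smul]
      refine (pow_le_pow_iff_left₀ (norm_nonneg _) (by positivity) two_ne_zero).mp
        ((norm_sum_bilinear_ec_sq_le h hq2 A B (by omega) c d hc hd).trans ?_)
      rw [mul_pow, Real.sq_sqrt (by positivity)]
      have hABy : (A * B : ℝ) ≤ y := by exact_mod_cast hAB
      have hA1 : (A : ℝ) ≤ y / U := by
        rw [le_div_iff₀ hU0]
        have : A * U ≤ y := (Nat.mul_le_mul_left A hB).trans hAB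
        exact_mod_cast this
      have hB1 : (B : ℝ) ≤ y / U := by
        rw [le_div_iff₀ hU0]
        have : B * U ≤ y := (by nlinarith : B * U ≤ A * B).trans hAB
        exact_mod_cast this
      calc 20 * (A * B : ℝ) * (2 * A / q + 1) * (B + q)
          = 20 * (A * B : ℝ) * (2 * (A * B) / q + 2 * A + B + q) := by field_simp; ring
        _ ≤ 20 * y * (2 * y / q + 2 * (y / U) + y / U + q) := by gcongr
        _ ≤ 20 * y * (4 * y / q + 4 * (y / U) + 4 * q) := by
            refine mul_le_mul_of_nonneg_left ?_ (by positivity)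
            have h2 : 0 ≤ y / (U : ℝ) := by positivity
            have h3 : 0 ≤ y / (q : ℝ) := by positivity
            rw [mul_div_assoc, mul_div_assoc]
            linarith
        _ = _ := by field_simp; ring

end minorArcs

section multiplicativeLargeSieve
open scoped ComplexConjugate
open ZMod (stdAddChar)

/-- The Dirichlet characters modulo `m` (no characters for `m = 0`). -/
def chars (m : ℕ) : Finset (DirichletCharacter ℂ m) :=
  if h : m = 0 then ∅ else haveI : NeZero m := ⟨h⟩; Finset.univ

lemma chars_eq_univ (m : ℕ) [NeZero m] : chars m = Finset.univ := by
  rw [chars, dif_neg (NeZero.ne m)]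

lemma mem_chars {m : ℕ} (hm : m ≠ 0) (χ : DirichletCharacter ℂ m) : χ ∈ chars m := by
  have : NeZero m := ⟨hm⟩
  rw [chars_eq_univ]; exact Finset.mem_univ _

open Classical in
/-- The primitive Dirichlet characters modulo `m`. -/
def primChars (m : ℕ) : Finset (DirichletCharacter ℂ m) :=
  (chars m).filter fun χ => χ.IsPrimitive

lemma mem_primChars {m : ℕ} (hm : m ≠ 0) (χ : DirichletCharacter ℂ m) :
    χ ∈ primChars m ↔ χ.IsPrimitive := by
  simp [primChars, mem_chars hm]

lemma stdAddChar_natCast {r : ℕ} [NeZero r] (n : ℕ) :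
    stdAddChar (n : ZMod r) = ec (n / r) := by
  have := ZMod.stdAddChar_coe (N := r) n
  push_cast at this
  rw [this, ec]; congr 1; push_cast; ring

lemma isPrimitive_inv {r : ℕ} {χ : DirichletCharacter ℂ r} (h : χ.IsPrimitive) :
    χ⁻¹.IsPrimitive := by
  rw [DirichletCharacter.isPrimitive_def] at *
  rw [DirichletCharacter.conductor_inv, h]

lemma norm_gaussSum_sq {r : ℕ} [NeZero r] {χ : DirichletCharacter ℂ r} (h : χ.IsPrimitive) :
    ‖gaussSum χ stdAddChar‖ ^ 2 = r := by
  have hconj : conj (gaussSum χ stdAddChar) = ∑ j : ZMod r, χ⁻¹ j * stdAddChar (-j) := by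
    rw [gaussSum, map_sum]
    refine Finset.sum_congr rfl fun j _ => ?_
    rw [map_mul, AddChar.map_neg_eq_conj, ← MulChar.star_eq_inv]
    rfl
  have h1 := congr_fun (ZMod.dft_dft (N := r) χ) (-1)
  rw [neg_neg, map_one, smul_eq_mul, mul_one, ZMod.dft_apply] at h1
  have h2 : ∑ j : ZMod r, stdAddChar (-(j * -1)) • (ZMod.dft χ) j =
      gaussSum χ stdAddChar * conj (gaussSum χ stdAddChar) := by
    rw [hconj, Finset.mul_sum]
    refine Fintype.sum_equiv (Equiv.neg _) _ _ fun j => ?_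
    rw [h.fourierTransform_eq_inv_mul_gaussSum]
    simp; ring
  rw [h2, ← normSq_norm] at h1
  exact_mod_cast h1

lemma sum_norm_sq_sum_char_mul {r : ℕ} [NeZero r] (S : ZMod r → ℂ) :
    ∑ χ : DirichletCharacter ℂ r, ‖∑ b, χ b * S b‖ ^ 2 =
      r.totient * ∑ b : (ZMod r)ˣ, ‖S b‖ ^ 2 := by
  classical
  have h0 : ∀ χ : DirichletCharacter ℂ r, ∑ b, χ b * S b =
      ∑ b : (ZMod r)ˣ, χ b * S b := by
    intro χ
    symm
    refine (Finset.sum_map Finset.univ ⟨((↑) : (ZMod r)ˣ → ZMod r), Units.val_injective⟩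
      (fun b => χ b * S b)).symm.trans ?_
    refine Finset.sum_subset (Finset.subset_univ _) fun b _ hb => ?_
    rw [χ.map_nonunit, zero_mul]
    rintro ⟨u, rfl⟩
    exact hb (by simp)
  have h1 : (∑ χ : DirichletCharacter ℂ r, ((‖∑ b, χ b * S b‖ ^ 2 : ℝ) : ℂ)) =
      r.totient * ∑ b : (ZMod r)ˣ, ((‖S b‖ ^ 2 : ℝ) : ℂ) := by
    calc _ = ∑ χ : DirichletCharacter ℂ r, ∑ a : (ZMod r)ˣ, ∑ b : (ZMod r)ˣ,
          (conj (S a) * S b) * (χ (a : ZMod r)⁻¹ * χ b) := by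
          refine Finset.sum_congr rfl fun χ _ => ?_
          rw [h0, normSq_norm, map_sum, mul_comm, Finset.sum_mul_sum]
          refine Finset.sum_congr rfl fun a _ => Finset.sum_congr rfl fun b _ => ?_
          have : conj (χ (a : ZMod r)) = χ (a : ZMod r)⁻¹ := by
            rw [ZMod.inv_coe_unit, ← Ring.inverse_unit, ← MulChar.inv_apply, ← MulChar.star_eq_inv]
            rfl
          rw [map_mul, this]; ring
      _ = ∑ a : (ZMod r)ˣ, ∑ b : (ZMod r)ˣ, (conj (S a) * S b) *
          ∑ χ : DirichletCharacter ℂ r, (χ (a : ZMod r)⁻¹ * χ b) := by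
          rw [Finset.sum_comm]
          refine Finset.sum_congr rfl fun a _ => ?_
          rw [Finset.sum_comm]
          simp_rw [Finset.mul_sum]
      _ = _ := by
          rw [Finset.mul_sum]
          refine Finset.sum_congr rfl fun a _ => ?_
          rw [Finset.sum_eq_single a]
          · rw [DirichletCharacter.sum_char_inv_mul_char_eq ℂ a.isUnit, if_pos rfl, normSq_norm]
            ring
          · intro b _ hb
            rw [DirichletCharacter.sum_char_inv_mul_char_eq ℂ a.isUnit, if_neg, mul_zero]
            exact fun h => hb (Units.ext h.symm)
          · simp
  exact_mod_cast h1

lemma primChars_sum_le {r : ℕ} (hr : 0 < r) (s : Finset ℕ) (c : ℕ → ℂ) :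
    (r : ℝ) / r.totient * ∑ χ ∈ primChars r, ‖∑ n ∈ s, c n * χ n‖ ^ 2 ≤
      ∑ b ∈ (Finset.range r).filter (fun b => r.Coprime b),
        ‖∑ n ∈ s, c n * ec (n * (b / r))‖ ^ 2 := by
  classical
  have : NeZero r := ⟨hr.ne'⟩
  have hr0 : (0 : ℝ) < r := by exact_mod_cast hr
  have hφ : (0 : ℝ) < r.totient := by exact_mod_cast Nat.totient_pos.mpr hr
  set S : ZMod r → ℂ := fun b => ∑ n ∈ s, c n * stdAddChar ((n : ZMod r) * b) with hS
  have h1 : ∀ χ ∈ primChars r, (r : ℝ) * ‖∑ n ∈ s, c n * χ n‖ ^ 2 = ‖∑ b, χ⁻¹ b * S b‖ ^ 2 := by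
    intro χ hχ
    rw [mem_primChars hr.ne'] at hχ
    have h2 := isPrimitive_inv hχ
    rw [← norm_gaussSum_sq h2, ← mul_pow, ← norm_mul]
    congr 2
    rw [hS, Finset.mul_sum]
    simp_rw [Finset.mul_sum]
    rw [Finset.sum_comm]
    refine Finset.sum_congr rfl fun n _ => ?_
    have h3 := gaussSum_mulShift_of_isPrimitive (stdAddChar (N := r)) h2 (n : ZMod r)
    rw [inv_inv] at h3
    calc _ = c n * (χ n * gaussSum χ⁻¹ stdAddChar) := by ring
      _ = _ := by
        rw [← h3, gaussSum, Finset.mul_sum]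
        refine Finset.sum_congr rfl fun b _ => ?_
        rw [AddChar.mulShift_apply]; ring
  have h4 : ∑ χ ∈ primChars r, ‖∑ b, χ⁻¹ b * S b‖ ^ 2 ≤
      r.totient * ∑ b : (ZMod r)ˣ, ‖S b‖ ^ 2 := by
    rw [← sum_norm_sq_sum_char_mul]
    calc _ ≤ ∑ χ : DirichletCharacter ℂ r, ‖∑ b, χ⁻¹ b * S b‖ ^ 2 :=
          Finset.sum_le_sum_of_subset_of_nonneg (Finset.subset_univ _) fun _ _ _ => by positivity
      _ = _ := Fintype.sum_equiv (Equiv.inv _) _ _ fun _ => rfl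
  have h5 : ∑ b : (ZMod r)ˣ, ‖S b‖ ^ 2 = ∑ b ∈ (Finset.range r).filter (fun b => r.Coprime b),
        ‖∑ n ∈ s, c n * ec (n * (b / r))‖ ^ 2 := by
    refine Finset.sum_bij (fun u _ => (u : ZMod r).val) ?_ ?_ ?_ ?_
    · intro u _
      rw [Finset.mem_filter, Finset.mem_range]
      exact ⟨ZMod.val_lt _, (ZMod.val_coe_unit_coprime u).symm⟩
    · intro u _ v _ huv
      exact Units.ext (ZMod.val_injective r huv)
    · intro b hb
      rw [Finset.mem_filter, Finset.mem_range] at hb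
      refine ⟨ZMod.unitOfCoprime b hb.2.symm, Finset.mem_univ _, ?_⟩
      rw [ZMod.coe_unitOfCoprime, ZMod.val_natCast_of_lt hb.1]
    · intro u _
      simp only [hS]
      congr 2
      refine Finset.sum_congr rfl fun n _ => ?_
      congr 1
      have : (n : ZMod r) * (u : ZMod r) = ((n * (u : ZMod r).val : ℕ) : ZMod r) := by
        push_cast; rw [ZMod.natCast_zmod_val]
      rw [this, stdAddChar_natCast]; congr 1; push_cast; ring
  rw [div_mul_eq_mul_div, Finset.mul_sum, Finset.sum_congr rfl h1, div_le_iff₀ hφ, ← h5]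
  linarith

lemma farey_spacing {R r t b d : ℕ} (hr : 0 < r) (ht : 0 < t) (hrR : r ≤ R) (htR : t ≤ R)
    (hb : b < r) (hd : d < t) (hrb : r.Coprime b) (htd : t.Coprime d) (hne : ¬ (r = t ∧ b = d)) :
    1 / (R : ℝ) ^ 2 ≤ |((b : ℝ) / r - d / t) - round ((b : ℝ) / r - d / t)| := by
  set m := round ((b : ℝ) / r - d / t)
  have hr0 : (0 : ℝ) < r := by exact_mod_cast hr
  have ht0 : (0 : ℝ) < t := by exact_mod_cast ht
  have h0 : (b * t - d * r - m * r * t : ℤ) ≠ 0 := by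
    intro h0
    have h1 : (r : ℤ) ∣ b * t := ⟨d + m * t, by linarith⟩
    have h2 : (t : ℤ) ∣ d * r := ⟨b - m * r, by linarith⟩
    have h3 : r ∣ t := hrb.dvd_of_dvd_mul_left (by exact_mod_cast h1)
    have h4 : t ∣ r := htd.dvd_of_dvd_mul_left (by exact_mod_cast h2)
    have h5 : r = t := Nat.dvd_antisymm h3 h4
    subst h5
    have h6 : (b : ℤ) - d = m * r := by
      have : ((b : ℤ) - d - m * r) * r = 0 := by linarith
      rcases mul_eq_zero.mp this with h | h
      · linarith
      · omega
    have h7 : ((b : ℤ) - d) = 0 := by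
      refine Int.eq_zero_of_abs_lt_dvd (m := r) ⟨m, by linarith⟩ ?_
      rw [abs_lt]; constructor <;> omega
    exact hne ⟨rfl, by omega⟩
  have h1 : (1 : ℝ) ≤ |((b * t - d * r - m * r * t : ℤ) : ℝ)| := by
    exact_mod_cast Int.one_le_abs h0
  have h2 : (b : ℝ) / r - d / t - m = ((b * t - d * r - m * r * t : ℤ) : ℝ) / (r * t) := by
    push_cast; field_simp
  rw [h2, abs_div, abs_of_pos (mul_pos hr0 ht0)]
  have h3 : (r : ℝ) ≤ R := by exact_mod_cast hrR
  have h4 : (t : ℝ) ≤ R := by exact_mod_cast htR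
  apply div_le_div₀ (abs_nonneg _) h1 (by positivity)
  rw [sq]; gcongr

/-- The multiplicative large sieve inequality. -/
theorem multiplicative_large_sieve (R H : ℕ) (hH : R ^ 2 ≤ H) (c : ℕ → ℂ) :
    ∑ r ∈ Finset.Ioc 0 R, (r : ℝ) / r.totient *
      ∑ χ ∈ primChars r, ‖∑ n ∈ Finset.range H, c n * χ n‖ ^ 2 ≤
      5 * H * ∑ n ∈ Finset.range H, ‖c n‖ ^ 2 := by
  rcases Nat.eq_zero_or_pos R with rfl | hR
  · simp; positivity
  refine (Finset.sum_le_sum fun r hr => primChars_sum_le (Finset.mem_Ioc.mp hr).1 _ c).trans ?_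
  rw [← Finset.sum_sigma (Finset.Ioc 0 R)
    (fun r => (Finset.range r).filter (fun b => r.Coprime b))
    (fun p => ‖∑ n ∈ Finset.range H, c n * ec (n * ((p.2 : ℝ) / p.1))‖ ^ 2)]
  refine sum_norm_sq_duality _ _ (fun (p : Σ _ : ℕ, ℕ) (n : ℕ) => ec (n * ((p.2 : ℝ) / p.1))) ?_
    (by positivity) c
  intro b
  refine sum_norm_sq_sum_ec_le _ (fun p : Σ _ : ℕ, ℕ => (p.2 : ℝ) / p.1)
    (δ := 1 / (R : ℝ) ^ 2) (by positivity) ?_ H ?_ b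
  · rintro ⟨r, b⟩ hp ⟨t, d⟩ hq hne
    simp only [Finset.mem_sigma, Finset.mem_Ioc, Finset.mem_filter, Finset.mem_range] at hp hq
    refine farey_spacing hp.1.1 hq.1.1 hp.1.2 hq.1.2 hp.2.1 hq.2.1 hp.2.2 hq.2.2 ?_
    rintro ⟨rfl, rfl⟩
    exact hne rfl
  · rw [one_div_one_div]; exact_mod_cast hH

end multiplicativeLargeSieve

section bilinearCharacters

lemma changeLevel_apply_natCast {r s : ℕ} (χ : DirichletCharacter ℂ r) (h : r ∣ r * s) (a : ℕ) :
    DirichletCharacter.changeLevel h χ (a : ZMod (r * s)) =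
      (if a.Coprime s then 1 else 0) * χ (a : ZMod r) := by
  by_cases hc : a.Coprime (r * s)
  · have h1 : IsCoprime (a : ℤ) ((r * s : ℕ) : ℤ) := Nat.isCoprime_iff_coprime.mpr hc
    have := DirichletCharacter.changeLevel_eq_cast_of_dvd' χ h h1
    rw [if_pos (Nat.Coprime.coprime_mul_left_right hc), one_mul]
    exact_mod_cast this
  · rw [MulChar.map_nonunit _ (by rwa [ZMod.isUnit_iff_coprime])]
    by_cases hs : a.Coprime s
    · have hr : ¬ a.Coprime r := fun hr => hc (hr.mul_right hs)
      rw [MulChar.map_nonunit χ (by rwa [ZMod.isUnit_iff_coprime]), mul_zero]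
    · rw [if_neg hs, zero_mul]

lemma sum_chars_le {m R : ℕ} (hm : 0 < m) (f : DirichletCharacter ℂ m → ℝ)
    (g : ∀ r : ℕ, DirichletCharacter ℂ r → ℝ) (hg : ∀ r χ, 0 ≤ g r χ)
    (hfg : ∀ (r : ℕ) (h : r ∣ m) (χ : DirichletCharacter ℂ r),
      f (DirichletCharacter.changeLevel h χ) ≤ g r χ) :
    ∑ ψ ∈ (chars m).filter (fun ψ => R < ψ.conductor), f ψ ≤
      ∑ r ∈ m.divisors, if R < r then ∑ χ ∈ primChars r, g r χ else 0 := by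
  have : NeZero m := ⟨hm.ne'⟩
  have hmaps : ∀ ψ ∈ (chars m).filter (fun ψ => R < ψ.conductor), ψ.conductor ∈ m.divisors :=
    fun ψ _ => Nat.mem_divisors.mpr ⟨ψ.conductor_dvd_level, hm.ne'⟩
  rw [← Finset.sum_fiberwise_of_maps_to hmaps]
  refine Finset.sum_le_sum fun r hr => ?_
  have hrm := Nat.dvd_of_mem_divisors hr
  have hr0 : r ≠ 0 := (Nat.pos_of_mem_divisors hr).ne'
  split_ifs with hR
  · have hsub : ((chars m).filter (fun ψ => R < ψ.conductor)).filter (fun ψ => ψ.conductor = r) ⊆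
        (primChars r).image (DirichletCharacter.changeLevel hrm) := by
      intro ψ hψ
      simp only [Finset.mem_filter] at hψ
      obtain ⟨_, rfl⟩ := hψ
      rw [Finset.mem_image]
      refine ⟨ψ.primitiveCharacter, ?_, ψ.changeLevel_primitiveCharacter⟩
      rw [mem_primChars hr0]
      exact ψ.primitiveCharacter_isPrimitive
    calc _ ≤ ∑ ψ ∈ ((chars m).filter (fun ψ => R < ψ.conductor)).filter
            (fun ψ => ψ.conductor = r), max (f ψ) 0 :=
          Finset.sum_le_sum fun _ _ => le_max_left _ _
      _ ≤ ∑ ψ ∈ (primChars r).image (DirichletCharacter.changeLevel hrm), max (f ψ) 0 :=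
          Finset.sum_le_sum_of_subset_of_nonneg hsub fun _ _ _ => le_max_right _ _
      _ = ∑ χ ∈ primChars r, max (f (DirichletCharacter.changeLevel hrm χ)) 0 :=
          Finset.sum_image fun _ _ _ _ h => DirichletCharacter.changeLevel_injective hrm h
      _ ≤ _ := Finset.sum_le_sum fun χ _ => max_le (hfg r hrm χ) (hg r χ)
  · rw [Finset.sum_eq_zero]
    intro ψ hψ
    simp only [Finset.mem_filter] at hψ
    omega

lemma sum_divisors_pair_le (K : ℕ) (h : ℕ → ℕ → ℝ) (hh : ∀ r s, 0 ≤ h r s) :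
    ∑ m ∈ Finset.Ioc 0 K, ∑ r ∈ m.divisors, h r (m / r) ≤
      ∑ s ∈ Finset.Ioc 0 K, ∑ r ∈ Finset.Ioc 0 K, h r s := by
  classical
  rw [Finset.sum_sigma', Finset.sum_sigma']
  set t := (Finset.Ioc 0 K).sigma fun m => m.divisors
  have hinj : Set.InjOn (fun p : Σ _ : ℕ, ℕ => (⟨p.1 / p.2, p.2⟩ : Σ _ : ℕ, ℕ)) t := by
    rintro ⟨m, r⟩ hp ⟨m', r'⟩ hp' heq
    simp only [t, Finset.mem_sigma, Finset.mem_Ioc, Nat.mem_divisors, Finset.mem_coe] at hp hp'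
    simp only [Sigma.mk.injEq, heq_eq_eq] at heq
    obtain ⟨h1, rfl⟩ := heq
    rw [← Nat.div_mul_cancel hp.2.1, ← Nat.div_mul_cancel hp'.2.1, h1]
  rw [← Finset.sum_image (f := fun p : Σ _ : ℕ, ℕ => h p.2 p.1) hinj]
  refine Finset.sum_le_sum_of_subset_of_nonneg ?_ fun _ _ _ => hh _ _
  intro p hp
  rw [Finset.mem_image] at hp
  obtain ⟨⟨m, r⟩, hp, rfl⟩ := hp
  simp only [t, Finset.mem_sigma, Finset.mem_Ioc, Nat.mem_divisors] at *
  obtain ⟨⟨hm, hmK⟩, ⟨k, rfl⟩, -⟩ := hp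
  have hr : 0 < r := Nat.pos_of_mul_pos_right hm
  have hk : 0 < k := Nat.pos_of_mul_pos_left hm
  rw [Nat.mul_div_cancel_left k hr]
  refine ⟨⟨hk, ?_⟩, hr, ?_⟩ <;> nlinarith

lemma inv_totient_le {s : ℕ} (hs : 0 < s) :
    1 / (s.totient : ℝ) ≤ ∑ _d ∈ s.divisors, 1 / (s : ℝ) := by
  have h1 : s ≤ s.divisors.card * s.totient := by
    calc s = ∑ d ∈ s.divisors, d.totient := (Nat.sum_totient s).symm
      _ ≤ ∑ _d ∈ s.divisors, s.totient := Finset.sum_le_sum fun d hd =>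
          Nat.le_of_dvd (Nat.totient_pos.mpr hs) (Nat.totient_dvd_of_dvd (Nat.dvd_of_mem_divisors hd))
      _ = _ := by simp
  have h2 : (0 : ℝ) < s.totient := by exact_mod_cast Nat.totient_pos.mpr hs
  have h3 : (0 : ℝ) < s := by exact_mod_cast hs
  rw [Finset.sum_const, nsmul_eq_mul, mul_one_div, div_le_div_iff₀ h2 h3, one_mul]
  exact_mod_cast h1

lemma sum_Ioc_one_div_le (K : ℕ) :
    ∑ d ∈ Finset.Ioc 0 K, 1 / (d : ℝ) ≤ 1 + Real.log K := by
  have h := harmonic_le_one_add_log K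
  refine le_of_eq_of_le ?_ h
  rw [harmonic, sum_Ioc_eq_sum_range]
  push_cast
  simp

lemma sum_inv_totient_le (K : ℕ) :
    ∑ s ∈ Finset.Ioc 0 K, 1 / (s.totient : ℝ) ≤ (1 + Real.log K) ^ 2 := by
  calc _ ≤ ∑ s ∈ Finset.Ioc 0 K, ∑ d ∈ s.divisors, 1 / (d : ℝ) * (1 / ((s / d : ℕ) : ℝ)) := by
        refine Finset.sum_le_sum fun s hs => (inv_totient_le (Finset.mem_Ioc.mp hs).1).trans_eq ?_
        refine Finset.sum_congr rfl fun d hd => ?_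
        rw [div_mul_div_comm, one_mul, ← Nat.cast_mul,
          Nat.mul_div_cancel' (Nat.dvd_of_mem_divisors hd)]
    _ ≤ ∑ s ∈ Finset.Ioc 0 K, ∑ d ∈ Finset.Ioc 0 K, 1 / (d : ℝ) * (1 / (s : ℝ)) :=
        sum_divisors_pair_le K (fun d s => 1 / (d : ℝ) * (1 / (s : ℝ))) fun _ _ => by positivity
    _ = (∑ s ∈ Finset.Ioc 0 K, 1 / (s : ℝ)) ^ 2 := by
        rw [sq, Finset.sum_mul_sum]
        exact Finset.sum_congr rfl fun _ _ => Finset.sum_congr rfl fun _ _ => mul_comm _ _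
    _ ≤ _ := by
        gcongr
        exact sum_Ioc_one_div_le K

lemma sum_primChars_sq_le {R X Y : ℕ} (hXY : X ≤ Y) (c : ℕ → ℂ) (hc : ∀ n, ‖c n‖ ≤ 1) :
    ∑ r ∈ Finset.Ioc 0 R, (r : ℝ) / r.totient *
      ∑ χ ∈ primChars r, ‖∑ n ∈ Finset.Ioc X Y, c n * χ n‖ ^ 2 ≤
      5 * (Y + 1 + R ^ 2) * ((Y : ℝ) - X) := by
  set H := Y + 1 + R ^ 2 with hH
  have h1 : ∀ (r : ℕ) (χ : DirichletCharacter ℂ r), ∑ n ∈ Finset.Ioc X Y, c n * χ n =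
      ∑ n ∈ Finset.range H, (if n ∈ Finset.Ioc X Y then c n else 0) * χ n := by
    intro r χ
    simp_rw [ite_mul, zero_mul]
    rw [← Finset.sum_filter]
    refine Finset.sum_congr ?_ fun _ _ => rfl
    ext n
    simp only [Finset.mem_filter, Finset.mem_range, Finset.mem_Ioc]
    have := Nat.zero_le (R ^ 2)
    omega
  simp_rw [h1]
  refine (multiplicative_large_sieve R H (by omega) _).trans ?_
  have h2 : ∑ n ∈ Finset.range H, ‖if n ∈ Finset.Ioc X Y then c n else 0‖ ^ 2 ≤ (Y : ℝ) - X := by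
    calc _ ≤ ∑ n ∈ Finset.range H, if n ∈ Finset.Ioc X Y then (1 : ℝ) else 0 := by
          refine Finset.sum_le_sum fun n _ => ?_
          split_ifs
          · exact pow_le_one₀ (norm_nonneg _) (hc n)
          · simp
      _ ≤ ((Finset.Ioc X Y).card : ℝ) := by
          rw [Finset.sum_boole]
          exact_mod_cast Finset.card_le_card fun n hn => (Finset.mem_filter.mp hn).2
      _ = _ := by rw [Nat.card_Ioc, Nat.cast_sub hXY]
  calc _ ≤ 5 * (H : ℝ) * ((Y : ℝ) - X) := by gcongr
    _ = _ := by rw [hH]; push_cast; ring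

lemma sum_primChars_block_le {R A B : ℕ} (hR : 1 ≤ R) (hA : 1 ≤ A) (hB : 1 ≤ B)
    (c d : ℕ → ℂ) (hc : ∀ n, ‖c n‖ ≤ 1) (hd : ∀ n, ‖d n‖ ≤ 1) :
    ∑ r ∈ Finset.Ioc R (2 * R), 1 / (r.totient : ℝ) * ∑ χ ∈ primChars r,
      ‖∑ a ∈ Finset.Ioc A (2 * A), c a * χ a‖ * ‖∑ b ∈ Finset.Ioc 0 B, d b * χ b‖ ≤
      20 * (A * B / R + A * √B + B * √A + R * √(A * B)) := by
  have hR0 : (1 : ℝ) ≤ R := by exact_mod_cast hR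
  have hA0 : (1 : ℝ) ≤ A := by exact_mod_cast hA
  have hB0 : (1 : ℝ) ≤ B := by exact_mod_cast hB
  set t := (Finset.Ioc R (2 * R)).sigma primChars with ht
  set w : (Σ r : ℕ, DirichletCharacter ℂ r) → ℝ := fun p => √((p.1 : ℝ) / p.1.totient) with hw
  set X : (Σ r : ℕ, DirichletCharacter ℂ r) → ℝ := fun p =>
    ‖∑ a ∈ Finset.Ioc A (2 * A), c a * p.2 a‖ with hX
  set Y : (Σ r : ℕ, DirichletCharacter ℂ r) → ℝ := fun p =>
    ‖∑ b ∈ Finset.Ioc 0 B, d b * p.2 b‖ with hY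
  have hw2 : ∀ p, w p ^ 2 = (p.1 : ℝ) / p.1.totient := fun p => Real.sq_sqrt (by positivity)
  have hsq : ∀ (Z : (Σ r : ℕ, DirichletCharacter ℂ r) → ℝ) (V : ℝ),
      ∑ r ∈ Finset.Ioc 0 (2 * R), (r : ℝ) / r.totient * ∑ χ ∈ primChars r, Z ⟨r, χ⟩ ^ 2 ≤ V →
      ∑ p ∈ t, (w p * Z p) ^ 2 ≤ V := by
    intro Z V hV
    refine le_trans ?_ hV
    rw [ht, Finset.sum_sigma]
    refine le_trans (Finset.sum_le_sum_of_subset_of_nonneg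
      (Finset.Ioc_subset_Ioc (Nat.zero_le R) le_rfl)
      fun _ _ _ => Finset.sum_nonneg fun _ _ => by positivity) (le_of_eq ?_)
    refine Finset.sum_congr rfl fun r _ => ?_
    rw [Finset.mul_sum]
    exact Finset.sum_congr rfl fun χ _ => by rw [mul_pow, hw2]
  have h1 := hsq X _ (sum_primChars_sq_le (R := 2 * R) (show A ≤ 2 * A by omega) c hc)
  have h2 := hsq Y _ (sum_primChars_sq_le (R := 2 * R) (Nat.zero_le B) d hd)
  have h3 : ∑ r ∈ Finset.Ioc R (2 * R), 1 / (r.totient : ℝ) * ∑ χ ∈ primChars r,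
      ‖∑ a ∈ Finset.Ioc A (2 * A), c a * χ a‖ * ‖∑ b ∈ Finset.Ioc 0 B, d b * χ b‖ ≤
      1 / R * ∑ p ∈ t, (w p * X p) * (w p * Y p) := by
    rw [ht, Finset.sum_sigma, Finset.mul_sum]
    refine Finset.sum_le_sum fun r hr => ?_
    rw [Finset.mul_sum, Finset.mul_sum]
    refine Finset.sum_le_sum fun χ _ => ?_
    rw [Finset.mem_Ioc] at hr
    have hr1 : (R : ℝ) ≤ r := by exact_mod_cast hr.1.le
    have hr2 : (0 : ℝ) < r.totient := by exact_mod_cast Nat.totient_pos.mpr (by omega)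
    calc _ = 1 / (R : ℝ) * (((R : ℝ) / r.totient) * (X ⟨r, χ⟩ * Y ⟨r, χ⟩)) := by
          simp only [hX, hY]; field_simp
      _ ≤ 1 / (R : ℝ) * (((r : ℝ) / r.totient) * (X ⟨r, χ⟩ * Y ⟨r, χ⟩)) := by gcongr
      _ = _ := by rw [← hw2 ⟨r, χ⟩]; ring
  have h4 := Finset.sum_mul_sq_le_sq_mul_sq t (fun p => w p * X p) (fun p => w p * Y p)
  set S := ∑ p ∈ t, (w p * X p) * (w p * Y p) with hS
  set u := √(A : ℝ) with hu
  set v := √(B : ℝ) with hv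
  have hu2 : u ^ 2 = A := Real.sq_sqrt (by positivity)
  have hv2 : v ^ 2 = B := Real.sq_sqrt (by positivity)
  have huv : √((A : ℝ) * B) = u * v := Real.sqrt_mul (by positivity) _
  have hu0 : 0 ≤ u := Real.sqrt_nonneg _
  have hv0 : 0 ≤ v := Real.sqrt_nonneg _
  have h5 : S ≤ 20 * (u * (u + R)) * (v * (v + R)) := by
    refine (abs_le_of_sq_le_sq' (h4.trans ?_) (by positivity)).2
    push_cast at h1 h2
    calc _ ≤ (5 * (2 * (A : ℝ) + 1 + (2 * R) ^ 2) * (2 * A - A)) *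
          (5 * ((B : ℝ) + 1 + (2 * R) ^ 2) * (B - 0)) :=
          mul_le_mul h1 (by simpa using h2) (Finset.sum_nonneg fun _ _ => by positivity)
            (by nlinarith [sq_nonneg (2 * R : ℝ)])
      _ ≤ (20 * (A * (A + R ^ 2))) * (20 * (B * (B + R ^ 2))) := by
          apply mul_le_mul <;> nlinarith [sq_nonneg (R : ℝ)]
      _ = (20 * 20) * (u ^ 2 * (u ^ 2 + R ^ 2)) * (v ^ 2 * (v ^ 2 + R ^ 2)) := by
          rw [hu2, hv2]; ring
      _ ≤ (20 * 20) * (u ^ 2 * (u + R) ^ 2) * (v ^ 2 * (v + R) ^ 2) := by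
          gcongr
          · nlinarith
          · nlinarith
      _ = _ := by ring
  refine h3.trans ?_
  calc _ ≤ 1 / (R : ℝ) * (20 * (u * (u + R)) * (v * (v + R))) := by gcongr
    _ = 20 * (u ^ 2 * v ^ 2 / R + u ^ 2 * v + v ^ 2 * u + R * (u * v)) := by field_simp; ring
    _ = _ := by rw [hu2, hv2, huv]

lemma sum_primChars_bilinear_le {R K y U A B : ℕ} (hR : 1 ≤ R) (hU : 1 ≤ U) (hA : U ≤ A)
    (hB : U ≤ B) (hAB : A * B ≤ y) (hKy : K ≤ y) (hy : 3 ≤ y)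
    (c d : ℕ → ℂ) (hc : ∀ n, ‖c n‖ ≤ 1) (hd : ∀ n, ‖d n‖ ≤ 1) :
    ∑ r ∈ Finset.Ioc 0 K, (if R < r then 1 / (r.totient : ℝ) * ∑ χ ∈ primChars r,
      ‖∑ a ∈ Finset.Ioc A (2 * A), c a * χ a‖ * ‖∑ b ∈ Finset.Ioc 0 B, d b * χ b‖ else 0) ≤
      60 * Real.log y * (y / R + 2 * (y / √U) + K * √y) := by
  have hl : 1 ≤ Real.log y := one_le_log (by exact_mod_cast hy)
  have hR0 : (1 : ℝ) ≤ R := by exact_mod_cast hR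
  have hU0 : (1 : ℝ) ≤ U := by exact_mod_cast hU
  have hA0 : (U : ℝ) ≤ A := by exact_mod_cast hA
  have hB0 : (U : ℝ) ≤ B := by exact_mod_cast hB
  have hABy : (A : ℝ) * B ≤ y := by exact_mod_cast hAB
  set G : ℕ → ℝ := fun r => 1 / (r.totient : ℝ) * ∑ χ ∈ primChars r,
      ‖∑ a ∈ Finset.Ioc A (2 * A), c a * χ a‖ * ‖∑ b ∈ Finset.Ioc 0 B, d b * χ b‖ with hG
  have hG0 : ∀ r, 0 ≤ G r := fun r => by positivity
  set M : ℝ := 20 * (y / R + 2 * (y / √U) + K * √y) with hM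
  have hM0 : 0 ≤ M := by positivity
  have hdiv : ∀ x z : ℕ, U ≤ z → x * z ≤ y → (x : ℝ) * √z ≤ y / √U := by
    intro x z hz hxz
    rw [le_div_iff₀ (by positivity)]
    calc (x : ℝ) * √z * √U ≤ x * √z * √z := by gcongr
      _ = x * z := by rw [mul_assoc, Real.mul_self_sqrt (by positivity)]
      _ ≤ y := by exact_mod_cast hxz
  have hblock : ∀ j, ∑ r ∈ Finset.Ioc (2 ^ j * R) (2 * (2 ^ j * R)),
      (if r ≤ K then G r else 0) ≤ M := by
    intro j
    set Q := 2 ^ j * R with hQ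
    have hRQ : R ≤ Q := by nlinarith [Nat.one_le_two_pow (n := j)]
    rcases lt_or_ge K Q with h | h
    · rw [Finset.sum_eq_zero]
      · exact hM0
      · intro r hr
        rw [Finset.mem_Ioc] at hr
        rw [if_neg (by omega)]
    · calc _ ≤ ∑ r ∈ Finset.Ioc Q (2 * Q), G r := by
            refine Finset.sum_le_sum fun r _ => ?_
            split_ifs
            · exact le_rfl
            · exact hG0 r
        _ ≤ 20 * (A * B / Q + A * √B + B * √A + Q * √(A * B)) :=
            sum_primChars_block_le (by omega) (by omega) (by omega) c d hc hd
        _ ≤ 20 * (y / R + y / √U + y / √U + K * √y) := by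
            have h1 := hdiv A B hB hAB
            have h2 := hdiv B A hA (by rwa [mul_comm])
            have h3 : (R : ℝ) ≤ Q := by exact_mod_cast hRQ
            have h4 : (Q : ℝ) ≤ K := by exact_mod_cast h
            gcongr
        _ = M := by rw [hM]; ring
  set I := Nat.log 2 y + 1 with hI
  have hI1 : y < 2 ^ I := Nat.lt_pow_succ_log_self (by norm_num) y
  have hI2 : (I : ℝ) ≤ 3 * Real.log y := by
    have h1 : (Nat.log 2 y : ℝ) ≤ Real.log y / Real.log 2 := by
      have := Real.natLog_le_logb y 2
      rwa [Real.logb] at this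
    have h2 : Real.log y / Real.log 2 ≤ 2 * Real.log y := by
      rw [div_le_iff₀ (Real.log_pos (by norm_num))]
      nlinarith [Real.log_two_gt_d9]
    rw [hI]; push_cast; linarith
  calc ∑ r ∈ Finset.Ioc 0 K, (if R < r then G r else 0)
      = ∑ r ∈ (Finset.Ioc 0 K).filter (fun r => R < r), (if r ≤ K then G r else 0) := by
        rw [Finset.sum_filter]
        refine Finset.sum_congr rfl fun r hr => ?_
        rw [if_pos (Finset.mem_Ioc.mp hr).2]
    _ ≤ ∑ r ∈ Finset.Ioc R (2 ^ I * R), (if r ≤ K then G r else 0) := by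
        refine Finset.sum_le_sum_of_subset_of_nonneg ?_ fun r _ _ => ?_
        · intro r hr
          rw [Finset.mem_filter, Finset.mem_Ioc] at hr
          rw [Finset.mem_Ioc]
          refine ⟨hr.2, ?_⟩
          nlinarith
        · split_ifs
          · exact hG0 r
          · exact le_rfl
    _ = ∑ j ∈ Finset.range I, ∑ r ∈ Finset.Ioc (2 ^ j * R) (2 * (2 ^ j * R)),
        (if r ≤ K then G r else 0) := sum_Ioc_dyadic _ _ _
    _ ≤ ∑ j ∈ Finset.range I, M := Finset.sum_le_sum fun j _ => hblock j
    _ = I * M := by simp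
    _ ≤ 3 * Real.log y * M := by gcongr
    _ = _ := by rw [hM]; ring

/-- Bilinear sums over all characters of large conductor, with moduli up to `K`. -/
theorem sum_chars_bilinear_le {R K y U A B : ℕ} (hR : 1 ≤ R) (hU : 1 ≤ U) (hA : U ≤ A)
    (hB : U ≤ B) (hAB : A * B ≤ y) (hKy : K ≤ y) (hy : 3 ≤ y)
    (c d : ℕ → ℂ) (hc : ∀ n, ‖c n‖ ≤ 1) (hd : ∀ n, ‖d n‖ ≤ 1) :
    ∑ m ∈ Finset.Ioc 0 K, 1 / (m.totient : ℝ) * ∑ ψ ∈ (chars m).filter (fun ψ => R < ψ.conductor),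
      ‖∑ a ∈ Finset.Ioc A (2 * A), c a * ψ a‖ * ‖∑ b ∈ Finset.Ioc 0 B, d b * ψ b‖ ≤
      (1 + Real.log y) ^ 2 * (60 * Real.log y * (y / R + 2 * (y / √U) + K * √y)) := by
  set e : ℕ → ℕ → ℂ := fun s a => if a.Coprime s then 1 else 0 with he
  have he1 : ∀ s a, ‖e s a‖ ≤ 1 := by
    intro s a; simp only [he]; split_ifs <;> simp
  set g : ℕ → ∀ r : ℕ, DirichletCharacter ℂ r → ℝ := fun s r χ =>
    ‖∑ a ∈ Finset.Ioc A (2 * A), (c a * e s a) * χ a‖ *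
      ‖∑ b ∈ Finset.Ioc 0 B, (d b * e s b) * χ b‖ with hg
  have hg0 : ∀ s r χ, 0 ≤ g s r χ := fun s r χ => by simp only [hg]; positivity
  set h : ℕ → ℕ → ℝ := fun r s => 1 / (s.totient : ℝ) *
    (if R < r then 1 / (r.totient : ℝ) * ∑ χ ∈ primChars r, g s r χ else 0) with hh
  have hh0 : ∀ r s, 0 ≤ h r s := by
    intro r s
    simp only [hh]
    refine mul_nonneg (by positivity) ?_
    split_ifs
    · exact mul_nonneg (by positivity) (Finset.sum_nonneg fun _ _ => hg0 _ _ _)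
    · exact le_rfl
  calc _ ≤ ∑ m ∈ Finset.Ioc 0 K, ∑ r ∈ m.divisors, h r (m / r) := by
        refine Finset.sum_le_sum fun m hm => ?_
        have hm0 : 0 < m := (Finset.mem_Ioc.mp hm).1
        have hmφ : (0 : ℝ) < m.totient := by exact_mod_cast Nat.totient_pos.mpr hm0
        have hrow := sum_chars_le (R := R) hm0 (fun ψ => ‖∑ a ∈ Finset.Ioc A (2 * A), c a * ψ a‖ *
          ‖∑ b ∈ Finset.Ioc 0 B, d b * ψ b‖) (fun r χ => g (m / r) r χ)
          (fun r χ => hg0 _ _ _) ?_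
        · refine (mul_le_mul_of_nonneg_left hrow (by positivity)).trans ?_
          rw [Finset.mul_sum]
          refine Finset.sum_le_sum fun r hr => ?_
          simp only [hh]
          split_ifs
          · obtain ⟨s, rfl⟩ := Nat.dvd_of_mem_divisors hr
            have hr0 : 0 < r := Nat.pos_of_mul_pos_right hm0
            have hs0 : 0 < s := Nat.pos_of_mul_pos_left hm0
            rw [Nat.mul_div_cancel_left s hr0, ← mul_assoc]
            refine mul_le_mul_of_nonneg_right ?_ (Finset.sum_nonneg fun _ _ => hg0 _ _ _)
            rw [div_mul_div_comm, one_mul]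
            have h1 : (0 : ℝ) < r.totient := by exact_mod_cast Nat.totient_pos.mpr hr0
            have h2 : (0 : ℝ) < s.totient := by exact_mod_cast Nat.totient_pos.mpr hs0
            refine one_div_le_one_div_of_le (by positivity) ?_
            rw [mul_comm]
            exact_mod_cast Nat.totient_super_multiplicative r s
          · simp
        · rintro r ⟨s, rfl⟩ χ
          have hr0 : 0 < r := Nat.pos_of_mul_pos_right hm0
          simp only [hg, Nat.mul_div_cancel_left s hr0, changeLevel_apply_natCast]
          simp only [he, mul_assoc]
          exact le_rfl
    _ ≤ ∑ s ∈ Finset.Ioc 0 K, ∑ r ∈ Finset.Ioc 0 K, h r s := sum_divisors_pair_le K h hh0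
    _ ≤ ∑ s ∈ Finset.Ioc 0 K, 1 / (s.totient : ℝ) *
        (60 * Real.log y * (y / R + 2 * (y / √U) + K * √y)) := by
        refine Finset.sum_le_sum fun s _ => ?_
        simp only [hh]
        rw [← Finset.mul_sum]
        refine mul_le_mul_of_nonneg_left ?_ (by positivity)
        refine sum_primChars_bilinear_le hR hU hA hB hAB hKy hy _ _ (fun n => ?_) (fun n => ?_)
        · rw [norm_mul]; exact mul_le_one₀ (hc n) (norm_nonneg _) (he1 s n)
        · rw [norm_mul]; exact mul_le_one₀ (hd n) (norm_nonneg _) (he1 s n)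
    _ = (∑ s ∈ Finset.Ioc 0 K, 1 / (s.totient : ℝ)) *
        (60 * Real.log y * (y / R + 2 * (y / √U) + K * √y)) := by rw [Finset.sum_mul]
    _ ≤ _ := by
        have hl : 1 ≤ Real.log y := one_le_log (by exact_mod_cast hy)
        refine mul_le_mul_of_nonneg_right ((sum_inv_totient_le K).trans ?_) (by positivity)
        rcases Nat.eq_zero_or_pos K with rfl | hK
        · simp only [Nat.cast_zero, Real.log_zero]; gcongr; linarith
        · have : 0 ≤ Real.log K := Real.log_natCast_nonneg K
          gcongr

end bilinearCharacters

section twistedCharacters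
open ArithmeticFunction

lemma sum_vonMangoldt_not_coprime_le {m : ℕ} (hm : m ≠ 0) (y : ℕ) :
    ∑ n ∈ (Finset.Ioc 0 y).filter (fun n => ¬ n.Coprime m), vonMangoldt n ≤
      2 * Real.log y * Real.log m := by
  classical
  set S := (Finset.Ioc 0 y).filter (fun n => ¬ n.Coprime m) with hS
  set t := m.primeFactors ×ˢ Finset.Ioc 0 (Nat.log 2 y) with ht
  have hsub : S.filter IsPrimePow ⊆ t.image fun p => p.1 ^ p.2 := by
    intro n hn
    simp only [hS, Finset.mem_filter, Finset.mem_Ioc] at hn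
    obtain ⟨⟨⟨hn0, hny⟩, hc⟩, hpp⟩ := hn
    obtain ⟨p, k, hp, hk, rfl⟩ := (isPrimePow_nat_iff _).mp hpp
    rw [Nat.coprime_pow_left_iff hk, hp.coprime_iff_not_dvd, not_not] at hc
    rw [Finset.mem_image]
    refine ⟨(p, k), ?_, rfl⟩
    simp only [ht, Finset.mem_product, Nat.mem_primeFactors, Finset.mem_Ioc]
    refine ⟨⟨hp, hc, hm⟩, hk, ?_⟩
    apply Nat.le_log_of_pow_le (by norm_num)
    exact (Nat.pow_le_pow_left hp.two_le k).trans hny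
  have h2 : (Nat.log 2 y : ℝ) ≤ 2 * Real.log y := by
    rcases Nat.eq_zero_or_pos y with rfl | hy
    · simp
    have h := Nat.pow_log_le_self 2 hy.ne'
    have h' : (2 : ℝ) ^ Nat.log 2 y ≤ y := by exact_mod_cast h
    have h3 := Real.log_le_log (by positivity) h'
    rw [Real.log_pow] at h3
    have := Real.log_two_gt_d9
    nlinarith [(Nat.log 2 y).cast_nonneg (α := ℝ)]
  have h3 : ∑ p ∈ m.primeFactors, Real.log p ≤ Real.log m := by
    rw [← Real.log_prod (fun p hp => by
      have := (Nat.prime_of_mem_primeFactors hp).pos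
      positivity)]
    apply Real.log_le_log
    · apply Finset.prod_pos
      intro p hp
      have := (Nat.prime_of_mem_primeFactors hp).pos
      positivity
    · have h := Nat.le_of_dvd (Nat.pos_of_ne_zero hm) (Nat.prod_primeFactors_dvd m)
      rw [← Nat.cast_prod]
      exact Nat.cast_le.mpr h
  calc ∑ n ∈ S, vonMangoldt n = ∑ n ∈ S.filter IsPrimePow, vonMangoldt n := by
        refine (Finset.sum_filter_of_ne fun n _ h => ?_).symm
        exact vonMangoldt_ne_zero_iff.mp h
    _ ≤ ∑ n ∈ t.image (fun p => p.1 ^ p.2), vonMangoldt n :=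
        Finset.sum_le_sum_of_subset_of_nonneg hsub fun _ _ _ => vonMangoldt_nonneg
    _ ≤ ∑ p ∈ t, vonMangoldt (p.1 ^ p.2) :=
        Finset.sum_image_le_of_nonneg fun _ _ => vonMangoldt_nonneg
    _ = ∑ p ∈ m.primeFactors, ∑ k ∈ Finset.Ioc 0 (Nat.log 2 y), Real.log p := by
        rw [ht, Finset.sum_product]
        refine Finset.sum_congr rfl fun p hp => Finset.sum_congr rfl fun k hk => ?_
        rw [vonMangoldt_apply_pow (Finset.mem_Ioc.mp hk).1.ne',
          vonMangoldt_apply_prime (Nat.prime_of_mem_primeFactors hp)]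
    _ = Nat.log 2 y * ∑ p ∈ m.primeFactors, Real.log p := by
        simp [Finset.mul_sum]
    _ ≤ 2 * Real.log y * Real.log m := by
        gcongr

lemma card_chars_conductor_le {m : ℕ} (hm : 0 < m) (R : ℕ) :
    ((chars m).filter (fun ψ => ψ.conductor ≤ R)).card ≤ R ^ 2 := by
  classical
  have hsub : (chars m).filter (fun ψ => ψ.conductor ≤ R) ⊆
      (Finset.Ioc 0 R).biUnion fun r => if h : r ∣ m then
        (chars r).image (DirichletCharacter.changeLevel h) else ∅ := by
    intro ψ hψ
    have h0 : ψ.conductor ≠ 0 := fun h => hm.ne' (by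
      have := ψ.conductor_dvd_level; rw [h] at this; exact Nat.eq_zero_of_zero_dvd this)
    rw [Finset.mem_biUnion]
    refine ⟨ψ.conductor, Finset.mem_Ioc.mpr ⟨Nat.pos_of_ne_zero h0, (Finset.mem_filter.mp hψ).2⟩, ?_⟩
    rw [dif_pos ψ.conductor_dvd_level, Finset.mem_image]
    exact ⟨ψ.primitiveCharacter, mem_chars h0 _, ψ.changeLevel_primitiveCharacter⟩
  refine (Finset.card_le_card hsub).trans (Finset.card_biUnion_le.trans ?_)
  calc _ ≤ ∑ r ∈ Finset.Ioc 0 R, R := by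
        refine Finset.sum_le_sum fun r hr => ?_
        rw [Finset.mem_Ioc] at hr
        split_ifs with h
        · refine Finset.card_image_le.trans ?_
          have : NeZero r := ⟨hr.1.ne'⟩
          rw [chars_eq_univ, Finset.card_univ, ← Nat.card_eq_fintype_card,
            DirichletCharacter.card_eq_totient_of_hasEnoughRootsOfUnity]
          exact (Nat.totient_le r).trans hr.2
        · simp
    _ = R ^ 2 := by simp [sq]

/-- The product of two Dirichlet characters of different levels. -/
def charMul {q m : ℕ} (ξ : DirichletCharacter ℂ q) (ψ : DirichletCharacter ℂ m) :
    DirichletCharacter ℂ (q * m) :=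
  DirichletCharacter.changeLevel (dvd_mul_right q m) ξ *
    DirichletCharacter.changeLevel (dvd_mul_left m q) ψ

lemma charMul_apply {q m : ℕ} (ξ : DirichletCharacter ℂ q) (ψ : DirichletCharacter ℂ m) (n : ℕ) :
    charMul ξ ψ n = ξ n * ψ n := by
  by_cases hc : n.Coprime (q * m)
  · have h1 : IsCoprime (n : ℤ) ((q * m : ℕ) : ℤ) := Nat.isCoprime_iff_coprime.mpr hc
    have h2 := DirichletCharacter.changeLevel_eq_cast_of_dvd' ξ (dvd_mul_right q m) h1
    have h3 := DirichletCharacter.changeLevel_eq_cast_of_dvd' ψ (dvd_mul_left m q) h1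
    rw [charMul, MulChar.mul_apply]
    simp only [Int.cast_natCast] at h2 h3
    rw [h2, h3]
  · rw [MulChar.map_nonunit _ (by rwa [ZMod.isUnit_iff_coprime])]
    rw [Nat.coprime_mul_iff_right, not_and_or] at hc
    rcases hc with hc | hc
    · rw [MulChar.map_nonunit ξ (by rwa [ZMod.isUnit_iff_coprime]), zero_mul]
    · rw [MulChar.map_nonunit ψ (by rwa [ZMod.isUnit_iff_coprime]), mul_zero]

/-- `ξ` takes the value `-1` at some residue which is `1` modulo the odd part of its level, so that
twisting by characters of odd level cannot make it principal. -/
def OddlyNontrivial {q : ℕ} (ξ : DirichletCharacter ℂ q) : Prop :=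
  ∀ m : ℕ, Odd m → ∃ w : ℕ, ξ w = -1 ∧ w ≡ 1 [MOD m]

lemma oddlyNontrivial_of_modEq {q u j v : ℕ} (hq : q = u * 2 ^ j) {ξ : DirichletCharacter ℂ q}
    (hv : v ≡ 1 [MOD u]) (hξ : ξ v = -1) : OddlyNontrivial ξ := by
  intro m hm
  have hgcd : Nat.gcd q m ∣ u := by
    rw [hq, Nat.Coprime.gcd_mul_right_cancel u]
    · exact Nat.gcd_dvd_left _ _
    · exact Nat.Coprime.pow_left j (Nat.coprime_two_left.mpr hm)
  obtain ⟨w, hw1, hw2⟩ := Nat.chineseRemainder' (hv.of_dvd hgcd)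
  refine ⟨w, ?_, hw2⟩
  rw [(ZMod.natCast_eq_natCast_iff _ _ _).mpr hw1, hξ]

lemma charMul_ne_one {q m : ℕ} {ξ : DirichletCharacter ℂ q} (hξ : OddlyNontrivial ξ) (hm : Odd m)
    (ψ : DirichletCharacter ℂ m) : charMul ξ ψ ≠ 1 := by
  intro h
  obtain ⟨w, hw1, hw2⟩ := hξ m hm
  have h1 := charMul_apply ξ ψ w
  have h2 : ψ w = 1 := by
    rw [(ZMod.natCast_eq_natCast_iff _ _ _).mpr hw2]; simp
  rw [h, hw1, h2] at h1
  by_cases hu : IsUnit ((w : ℕ) : ZMod (q * m))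
  · rw [MulChar.one_apply hu] at h1
    norm_num at h1
  · rw [MulChar.map_nonunit _ hu] at h1
    norm_num at h1

lemma norm_sum_Ioc_charMul_le {q m : ℕ} (hq : 0 < q) {ξ : DirichletCharacter ℂ q}
    (hξ : OddlyNontrivial ξ) (hm : Odd m) (ψ : DirichletCharacter ℂ m) (d z : ℕ) :
    ‖∑ k ∈ Finset.Ioc 0 z, ξ (d * k : ℕ) * ψ (d * k : ℕ)‖ ≤ q * m := by
  have : NeZero (q * m) := ⟨(Nat.mul_pos hq hm.pos).ne'⟩
  have h : ∀ k : ℕ, ξ (d * k : ℕ) * ψ (d * k : ℕ) = charMul ξ ψ d * charMul ξ ψ k := by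
    intro k
    rw [← charMul_apply, Nat.cast_mul, map_mul]
  rw [Finset.sum_congr rfl fun k _ => h k, ← Finset.mul_sum, norm_mul]
  have h1 : ‖∑ k ∈ Finset.Ioc 0 z, charMul ξ ψ k‖ ≤ (q * m : ℕ) := by
    rw [← Finset.Ico_add_one_add_one_eq_Ioc]
    apply norm_sum_Ico_le_of_periodic (NeZero.pos _) (periodic_char _)
    · rw [sum_range_zmod (fun a => charMul ξ ψ a)]
      exact MulChar.sum_eq_zero_of_ne_one (charMul_ne_one hξ hm ψ)
    · intro n; exact DirichletCharacter.norm_le_one _ _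
  calc _ ≤ 1 * ((q * m : ℕ) : ℝ) := by
        gcongr
        exact DirichletCharacter.norm_le_one _ _
    _ = _ := by push_cast; ring

end twistedCharacters

section primesInProgressions
open ArithmeticFunction

/-- The sum of `Λ(n) ξ(n)` over `n ≤ y` with `n ≡ 1` modulo `m`. -/
def progSum {q : ℕ} (ξ : DirichletCharacter ℂ q) (m y : ℕ) : ℂ :=
  ∑ n ∈ (Finset.Ioc 0 y).filter (fun n => n ≡ 1 [MOD m]), (vonMangoldt n : ℂ) * ξ n

/-- The sum of `Λ(n) ξ(n) ψ(n)` over `n ≤ y`. -/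
def twistSum {q m : ℕ} (ξ : DirichletCharacter ℂ q) (ψ : DirichletCharacter ℂ m) (y : ℕ) : ℂ :=
  ∑ n ∈ Finset.Ioc 0 y, (vonMangoldt n : ℂ) * (ξ n * ψ n)

lemma norm_progSum_le_sum_chars {q m : ℕ} (ξ : DirichletCharacter ℂ q) (hm : 0 < m) (y : ℕ) :
    ‖progSum ξ m y‖ ≤ 1 / (m.totient : ℝ) * ∑ ψ ∈ chars m, ‖twistSum ξ ψ y‖ := by
  have : NeZero m := ⟨hm.ne'⟩
  have hφ : (0 : ℝ) < m.totient := by exact_mod_cast Nat.totient_pos.mpr hm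
  have h : (m.totient : ℂ) * progSum ξ m y = ∑ ψ ∈ chars m, twistSum ξ ψ y := by
    simp only [twistSum]
    rw [Finset.sum_comm, progSum, Finset.sum_filter, Finset.mul_sum]
    refine Finset.sum_congr rfl fun n _ => ?_
    have h1 : ∀ ψ : DirichletCharacter ℂ m, (vonMangoldt n : ℂ) * (ξ n * ψ n) =
        (vonMangoldt n : ℂ) * ξ n * ψ n := fun ψ => by ring
    simp only [h1]
    rw [← Finset.mul_sum, chars_eq_univ, DirichletCharacter.sum_characters_eq]
    have h2 : (n : ZMod m) = 1 ↔ n ≡ 1 [MOD m] := by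
      rw [← Nat.cast_one, ZMod.natCast_eq_natCast_iff]
    by_cases h3 : n ≡ 1 [MOD m]
    · rw [if_pos h3, if_pos (h2.mpr h3)]; ring
    · rw [if_neg h3, if_neg (mt h2.mp h3)]; ring
  have h3 : (m.totient : ℝ) * ‖progSum ξ m y‖ ≤ ∑ ψ ∈ chars m, ‖twistSum ξ ψ y‖ := by
    have := norm_sum_le (chars m) fun ψ => twistSum ξ ψ y
    rwa [← h, norm_mul, Complex.norm_natCast] at this
  rw [one_div, inv_mul_eq_div, le_div_iff₀ hφ]
  linarith

lemma norm_twistSum_le_primitive {q m y : ℕ} {T : ℝ} (ξ : DirichletCharacter ℂ q) (hm : m ≠ 0)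
    (ψ : DirichletCharacter ℂ m) (hT : ‖twistSum ξ ψ.primitiveCharacter y‖ ≤ T) :
    ‖twistSum ξ ψ y‖ ≤ T + 2 * Real.log y * Real.log m := by
  have hsub : ‖twistSum ξ ψ y - twistSum ξ ψ.primitiveCharacter y‖ ≤
      2 * Real.log y * Real.log m := by
    rw [twistSum, twistSum, ← Finset.sum_sub_distrib]
    refine (norm_sum_le _ _).trans (le_trans ?_ (sum_vonMangoldt_not_coprime_le hm y))
    rw [Finset.sum_filter]
    refine Finset.sum_le_sum fun n _ => ?_
    by_cases hc : ¬ n.Coprime m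
    · rw [if_pos hc]
      have h1 : ψ n = 0 := MulChar.map_nonunit _ (by rwa [ZMod.isUnit_iff_coprime])
      rw [h1, mul_zero, mul_zero, zero_sub, norm_neg, norm_mul, norm_mul, Complex.norm_real,
        Real.norm_of_nonneg vonMangoldt_nonneg]
      have h2 := ξ.norm_le_one (n : ZMod q)
      have h3 := ψ.primitiveCharacter.norm_le_one (n : ZMod ψ.conductor)
      exact mul_le_of_le_one_right vonMangoldt_nonneg (mul_le_one₀ h2 (norm_nonneg _) h3)
    · rw [if_neg hc]
      rw [not_not] at hc
      have h1 : IsCoprime (n : ℤ) (m : ℤ) := Nat.isCoprime_iff_coprime.mpr hc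
      have h2 := DirichletCharacter.changeLevel_eq_cast_of_dvd' ψ.primitiveCharacter
        ψ.conductor_dvd_level h1
      rw [ψ.changeLevel_primitiveCharacter] at h2
      simp only [Int.cast_natCast] at h2
      rw [h2, sub_self, norm_zero]
  calc ‖twistSum ξ ψ y‖ = ‖(twistSum ξ ψ y - twistSum ξ ψ.primitiveCharacter y) +
        twistSum ξ ψ.primitiveCharacter y‖ := by rw [sub_add_cancel]
    _ ≤ _ := norm_add_le _ _
    _ ≤ _ := by linarith

lemma sum_norm_typeII_chars_le {q R K y U : ℕ} (ξ : DirichletCharacter ℂ q) (hR : 1 ≤ R)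
    (hU : 1 ≤ U) (hKy : K ≤ y) (hy : 3 ≤ y) :
    ∑ m ∈ Finset.Ioc 0 K, 1 / (m.totient : ℝ) *
      ∑ ψ ∈ (chars m).filter (fun ψ => R < ψ.conductor),
        ‖∑ a ∈ Finset.Ioc 0 y, (highPart (moebius : ArithmeticFunction ℝ) U a : ℂ) *
          ∑ b ∈ Finset.Ioc 0 (y / a), (vaughanCoeff U b : ℂ) *
            (ξ (a * b : ℕ) * ψ (a * b : ℕ))‖ ≤
      12 * Real.log y ^ 3 * ((1 + Real.log y) ^ 2 *
        (60 * Real.log y * (y / R + 2 * (y / √U) + K * √y))) := by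
  classical
  have hl : 0 ≤ Real.log y := Real.log_natCast_nonneg y
  set s := (Finset.Ioc 0 K).sigma fun m => (chars m).filter (fun ψ => R < ψ.conductor) with hs
  have key := sum_mul_norm_typeII_le s (fun i => 1 / (i.1.totient : ℝ)) (fun _ _ => by positivity)
    (fun i n => ξ n * i.2 n) hU hy
    (T := (1 + Real.log y) ^ 2 * (60 * Real.log y * (y / R + 2 * (y / √U) + K * √y)))
    (by positivity) ?_
  · rw [hs, Finset.sum_sigma] at key
    simpa only [Finset.mul_sum] using key
  · intro A B hA hB hAB c d hc hd
    have h := sum_chars_bilinear_le hR hU hA hB hAB hKy hy (fun a => c a * ξ a)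
      (fun b => d b * ξ b)
      (fun a => by rw [norm_mul]; exact mul_le_one₀ (hc a) (norm_nonneg _) (ξ.norm_le_one _))
      (fun b => by rw [norm_mul]; exact mul_le_one₀ (hd b) (norm_nonneg _) (ξ.norm_le_one _))
    refine le_trans (le_of_eq ?_) h
    rw [hs, Finset.sum_sigma]
    refine Finset.sum_congr rfl fun m _ => ?_
    rw [Finset.mul_sum]
    refine Finset.sum_congr rfl fun ψ _ => ?_
    rw [← norm_mul, Finset.sum_mul]
    congr 2
    refine Finset.sum_congr rfl fun a _ => ?_
    rw [Finset.mul_sum, Finset.mul_sum]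
    refine Finset.sum_congr rfl fun b _ => ?_
    push_cast
    rw [map_mul, map_mul]
    ring

lemma sum_norm_progSum_le {q R K y U : ℕ} {T : ℝ} (hq : 0 < q) {ξ : DirichletCharacter ℂ q}
    (hξ : OddlyNontrivial ξ) (hR : 1 ≤ R) (hU : 1 ≤ U) (hKy : K ≤ y) (hy : 3 ≤ y) (hT0 : 0 ≤ T)
    (hT : ∀ r : ℕ, Odd r → r ≤ R → ∀ χ : DirichletCharacter ℂ r, ‖twistSum ξ χ y‖ ≤ T) :
    ∑ m ∈ (Finset.Ioc 0 K).filter Odd, ‖progSum ξ m y‖ ≤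
      (1 + Real.log y) ^ 2 * (R ^ 2 * (T + 2 * Real.log y * Real.log y)) +
      4 * U ^ 2 * (q * K ^ 2) * Real.log y +
      12 * Real.log y ^ 3 * ((1 + Real.log y) ^ 2 *
        (60 * Real.log y * (y / R + 2 * (y / √U) + K * √y))) := by
  have hl : 0 ≤ Real.log y := Real.log_natCast_nonneg y
  set V : ∀ m, DirichletCharacter ℂ m → ℝ := fun m ψ =>
    ‖∑ a ∈ Finset.Ioc 0 y, (highPart (moebius : ArithmeticFunction ℝ) U a : ℂ) *
      ∑ b ∈ Finset.Ioc 0 (y / a), (vaughanCoeff U b : ℂ) *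
        (ξ (a * b : ℕ) * ψ (a * b : ℕ))‖ with hV
  have hKlog : ∀ m ∈ Finset.Ioc 0 K, Real.log m ≤ Real.log y := by
    intro m hm
    rw [Finset.mem_Ioc] at hm
    have h1 : (0 : ℝ) < m := by exact_mod_cast hm.1
    exact Real.log_le_log h1 (by exact_mod_cast hm.2.trans hKy)
  have hterm : ∀ m ∈ (Finset.Ioc 0 K).filter Odd, ‖progSum ξ m y‖ ≤
      1 / (m.totient : ℝ) * (R ^ 2 * (T + 2 * Real.log y * Real.log y)) +
      4 * U ^ 2 * (q * K) * Real.log y +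
      1 / (m.totient : ℝ) * ∑ ψ ∈ (chars m).filter (fun ψ => R < ψ.conductor), V m ψ := by
    intro m hm
    rw [Finset.mem_filter] at hm
    obtain ⟨hmK, hodd⟩ := hm
    have hm0 := (Finset.mem_Ioc.mp hmK).1
    have hmle := (Finset.mem_Ioc.mp hmK).2
    have : NeZero m := ⟨hm0.ne'⟩
    have hφ : (0 : ℝ) < m.totient := by exact_mod_cast Nat.totient_pos.mpr hm0
    refine (norm_progSum_le_sum_chars ξ hm0 y).trans ?_
    rw [← Finset.sum_filter_add_sum_filter_not (chars m) (fun ψ => R < ψ.conductor), mul_add]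
    have hlow : ∑ ψ ∈ (chars m).filter (fun ψ => ¬ R < ψ.conductor), ‖twistSum ξ ψ y‖ ≤
        R ^ 2 * (T + 2 * Real.log y * Real.log y) := by
      calc _ ≤ ∑ ψ ∈ (chars m).filter (fun ψ => ψ.conductor ≤ R),
            (T + 2 * Real.log y * Real.log y) := by
            simp only [not_lt]
            refine Finset.sum_le_sum fun ψ hψ => ?_
            refine (norm_twistSum_le_primitive ξ hm0.ne' ψ (hT _ (hodd.of_dvd_nat
              ψ.conductor_dvd_level) (Finset.mem_filter.mp hψ).2 _)).trans ?_
            have := hKlog m hmK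
            gcongr
        _ ≤ _ := by
            rw [Finset.sum_const, nsmul_eq_mul]
            gcongr
            exact_mod_cast card_chars_conductor_le hm0 R
    have hhigh : ∑ ψ ∈ (chars m).filter (fun ψ => R < ψ.conductor), ‖twistSum ξ ψ y‖ ≤
        m.totient * (4 * U ^ 2 * (q * K) * Real.log y) +
        ∑ ψ ∈ (chars m).filter (fun ψ => R < ψ.conductor), V m ψ := by
      have hone : ∀ ψ : DirichletCharacter ℂ m, ‖twistSum ξ ψ y‖ ≤
          4 * U ^ 2 * (q * K) * Real.log y + V m ψ := by
        intro ψ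
        refine norm_sum_vonMangoldt_le (F := fun n => ξ n * ψ n) (P := q * K) y hU ?_ ?_ ?_
        · have h1 : 1 ≤ q * K := Nat.mul_pos hq (hm0.trans_le hmle)
          exact_mod_cast h1
        · intro n
          rw [norm_mul]
          exact mul_le_one₀ (ξ.norm_le_one _) (norm_nonneg _) (ψ.norm_le_one _)
        · intro d _ _ z
          refine (norm_sum_Ioc_charMul_le hq hξ hodd ψ d z).trans ?_
          gcongr
      calc _ ≤ ∑ ψ ∈ (chars m).filter (fun ψ => R < ψ.conductor),
            (4 * U ^ 2 * (q * K) * Real.log y + V m ψ) := Finset.sum_le_sum fun ψ _ => hone ψ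
        _ ≤ _ := by
          rw [Finset.sum_add_distrib, Finset.sum_const, nsmul_eq_mul]
          gcongr
          refine (Finset.card_le_card (Finset.filter_subset _ _)).trans ?_
          rw [chars_eq_univ, Finset.card_univ, ← Nat.card_eq_fintype_card,
            DirichletCharacter.card_eq_totient_of_hasEnoughRootsOfUnity]
    calc _ ≤ 1 / (m.totient : ℝ) * (m.totient * (4 * U ^ 2 * (q * K) * Real.log y) +
          ∑ ψ ∈ (chars m).filter (fun ψ => R < ψ.conductor), V m ψ) +
          1 / (m.totient : ℝ) * (R ^ 2 * (T + 2 * Real.log y * Real.log y)) := by gcongr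
      _ = _ := by field_simp; ring
  refine (Finset.sum_le_sum hterm).trans ((Finset.sum_le_sum_of_subset_of_nonneg
    (Finset.filter_subset _ _) fun _ _ _ => ?_).trans ?_)
  · positivity
  rw [Finset.sum_add_distrib, Finset.sum_add_distrib, ← Finset.sum_mul, Finset.sum_const,
    nsmul_eq_mul, Nat.card_Ioc, Nat.sub_zero]
  refine add_le_add (add_le_add ?_ (le_of_eq (by ring)))
    (sum_norm_typeII_chars_le ξ hR hU hKy hy)
  have h1 := sum_inv_totient_le K
  have h2 : Real.log K ≤ Real.log y := by
    rcases Nat.eq_zero_or_pos K with rfl | hK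
    · simpa using hl
    · exact hKlog K (by simp; omega)
  have h3 : 0 ≤ Real.log K := Real.log_natCast_nonneg K
  have h4 : (1 + Real.log K) ^ 2 ≤ (1 + Real.log y) ^ 2 := by gcongr
  gcongr
  exact h1.trans h4

end primesInProgressions

section primesInProgressionsAverage
open ArithmeticFunction

lemma card_Ioc_modEq_le {m : ℕ} (hm : 0 < m) (a H v : ℕ) :
    (((Finset.Ioc a (a + H)).filter (fun n => n ≡ v [MOD m])).card : ℝ) ≤ H / m + 1 := by
  have hm' : (0 : ℝ) < m := by exact_mod_cast hm
  have h := Nat.Ioc_filter_modEq_card a (a + H) hm v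
  have h1 : (((Finset.Ioc a (a + H)).filter (fun n => n ≡ v [MOD m])).card : ℝ) =
      ((max (⌊(((a + H : ℕ) : ℚ) - v) / m⌋ - ⌊((a : ℚ) - v) / m⌋) 0 : ℤ) : ℝ) := by
    exact_mod_cast h
  rw [h1, Int.cast_max, Int.cast_zero, Int.cast_sub]
  apply max_le _ (by positivity)
  have h2 : ((⌊(((a + H : ℕ) : ℚ) - v) / m⌋ : ℚ) : ℝ) ≤ ((((a + H : ℕ) : ℚ) - v) / m : ℚ) := by
    exact_mod_cast Int.floor_le _
  have h3 : (((((a : ℚ) - v) / m : ℚ)) : ℝ) < ((⌊((a : ℚ) - v) / m⌋ + 1 : ℚ) : ℝ) :=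
    Rat.cast_lt.mpr (Int.lt_floor_add_one _)
  push_cast at h2 h3 ⊢
  have h4 : ((a : ℝ) + H - v) / m = (a - v) / m + H / m := by ring
  linarith

lemma sum_vonMangoldt_modEq_le {m : ℕ} (hm : 0 < m) {a H N : ℕ} (hN : a + H ≤ N) (v : ℕ) :
    ∑ n ∈ (Finset.Ioc a (a + H)).filter (fun n => n ≡ v [MOD m]), vonMangoldt n ≤
      Real.log N * (H / m + 1) := by
  calc _ ≤ ∑ n ∈ (Finset.Ioc a (a + H)).filter (fun n => n ≡ v [MOD m]), Real.log N := by
        refine Finset.sum_le_sum fun n hn => vonMangoldt_le_log.trans ?_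
        rw [Finset.mem_filter, Finset.mem_Ioc] at hn
        have h1 : (0 : ℝ) < n := by exact_mod_cast (by omega : 0 < n)
        exact Real.log_le_log h1 (by exact_mod_cast hn.1.2.trans hN)
    _ ≤ _ := by
        rw [Finset.sum_const, nsmul_eq_mul, mul_comm]
        have := card_Ioc_modEq_le hm a H v
        have := Real.log_natCast_nonneg N
        gcongr

lemma norm_progSum_sub_le {q : ℕ} (ξ : DirichletCharacter ℂ q) {m : ℕ} (hm : 0 < m) {a H N : ℕ}
    (hN : a + H ≤ N) :
    ‖progSum ξ m (a + H) - progSum ξ m a‖ ≤ Real.log N * (H / m + 1) := by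
  have h : progSum ξ m (a + H) - progSum ξ m a =
      ∑ n ∈ (Finset.Ioc a (a + H)).filter (fun n => n ≡ 1 [MOD m]), (vonMangoldt n : ℂ) * ξ n := by
    rw [progSum, progSum, Finset.sum_filter, Finset.sum_filter, Finset.sum_filter, sub_eq_iff_eq_add']
    exact (Finset.sum_Ioc_consecutive _ (Nat.zero_le a) (Nat.le_add_right a H)).symm
  rw [h]
  refine (norm_sum_le _ _).trans (le_trans ?_ (sum_vonMangoldt_modEq_le hm hN 1))
  refine Finset.sum_le_sum fun n _ => ?_
  rw [norm_mul, Complex.norm_real, Real.norm_of_nonneg vonMangoldt_nonneg]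
  exact mul_le_of_le_one_right vonMangoldt_nonneg (ξ.norm_le_one _)

lemma sum_log_mul_le (K H : ℕ) (l : ℝ) (hl : 0 ≤ l) :
    ∑ m ∈ (Finset.Ioc 0 K).filter Odd, l * ((H : ℝ) / m + 1) ≤
      l * (H * (1 + Real.log K) + K) := by
  refine (Finset.sum_le_sum_of_subset_of_nonneg (Finset.filter_subset _ _)
    fun _ _ _ => by positivity).trans ?_
  rw [← Finset.mul_sum, Finset.sum_add_distrib]
  have h1 := sum_Ioc_one_div_le K
  have h2 : ∑ m ∈ Finset.Ioc 0 K, (H : ℝ) / m = H * ∑ m ∈ Finset.Ioc 0 K, 1 / (m : ℝ) := by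
    rw [Finset.mul_sum]; simp [div_eq_mul_inv]
  rw [h2]
  simp only [Finset.sum_const, Nat.card_Ioc, nsmul_eq_mul, Nat.sub_zero, mul_one]
  gcongr

lemma twistSum_eq {q m : ℕ} (ξ : DirichletCharacter ℂ q) (ψ : DirichletCharacter ℂ m) (y : ℕ) :
    twistSum ξ ψ y = ∑ n ∈ Finset.range (y + 1), charMul ξ ψ n * (vonMangoldt n : ℂ) := by
  rw [twistSum, Finset.sum_range_succ', sum_Ioc_eq_sum_range]
  simp only [charMul_apply, Nat.cast_zero, ArithmeticFunction.map_zero, Complex.ofReal_zero,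
    mul_zero, add_zero]
  exact Finset.sum_congr rfl fun n _ => mul_comm _ _

lemma exists_norm_twistSum_le (A B : ℕ) : ∃ C : ℝ, 0 < C ∧ ∀ N : ℕ, 3 ≤ N → ∀ (q r : ℕ), 0 < q →
    Odd r → (q * r : ℝ) ≤ Real.log N ^ B → ∀ (ξ : DirichletCharacter ℂ q)
    (χ : DirichletCharacter ℂ r), OddlyNontrivial ξ → ∀ y ≤ N,
    ‖twistSum ξ χ y‖ ≤ C * N / Real.log N ^ A := by
  obtain ⟨C, hC, h⟩ := siegel_walfisz A B
  refine ⟨2 * C, by positivity, fun N hN q r hq hr hqr ξ χ hξ y hy => ?_⟩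
  have : NeZero (q * r) := ⟨(Nat.mul_pos hq hr.pos).ne'⟩
  have hN3 : (3 : ℝ) ≤ N := by exact_mod_cast hN
  have hl : 1 ≤ Real.log N := one_le_log hN3
  have hle : Real.log N ≤ Real.log (2 * N : ℕ) := by
    apply Real.log_le_log (by linarith)
    push_cast; linarith
  rw [twistSum_eq]
  refine (h (q * r) (charMul ξ χ) (charMul_ne_one hξ hr χ) (2 * N) (y + 1) (by omega) (by omega)
    ?_).trans ?_
  · push_cast at hqr ⊢
    exact hqr.trans (by push_cast at hle; gcongr)
  · have : C * ((2 * N : ℕ) : ℝ) = 2 * C * N := by push_cast; ring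
    rw [this]
    gcongr

lemma sum_norm_progSum_le_trivial {q : ℕ} (ξ : DirichletCharacter ℂ q) {K y N : ℕ} (hK : K ≤ N)
    (hy : y ≤ N) (hN : 3 ≤ N) :
    ∑ m ∈ (Finset.Ioc 0 K).filter Odd, ‖progSum ξ m y‖ ≤
      Real.log N * (y * (2 * Real.log N) + K) := by
  have hN3 : (3 : ℝ) ≤ N := by exact_mod_cast hN
  have hl : 1 ≤ Real.log N := one_le_log hN3
  have h1 : Real.log K ≤ Real.log N := by
    rcases Nat.eq_zero_or_pos K with rfl | hK0
    · simp; linarith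
    · exact Real.log_le_log (by exact_mod_cast hK0) (by exact_mod_cast hK)
  calc _ ≤ ∑ m ∈ (Finset.Ioc 0 K).filter Odd, Real.log N * ((y : ℝ) / m + 1) := by
        refine Finset.sum_le_sum fun m hm => ?_
        rw [Finset.mem_filter, Finset.mem_Ioc] at hm
        have := norm_progSum_sub_le ξ hm.1.1 (a := 0) (H := y) (N := N) (by omega)
        simpa [progSum] using this
    _ ≤ Real.log N * (y * (1 + Real.log K) + K) := sum_log_mul_le _ _ _ (by linarith)
    _ ≤ _ := by gcongr; linarith

set_option maxHeartbeats 1000000 in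
/-- A Bombieri–Vinogradov type estimate for the twisted prime sums `progSum ξ m y`, `m` odd. -/
theorem exists_sum_norm_progSum_le (A E : ℕ) : ∃ c₀ : ℕ, ∃ C : ℝ, 0 < C ∧ ∀ N : ℕ, 3 ≤ N →
    ∀ q : ℕ, 0 < q → (q : ℝ) ≤ Real.log N ^ E → ∀ ξ : DirichletCharacter ℂ q, OddlyNontrivial ξ →
    ∀ K : ℕ, (K : ℝ) ≤ √N / Real.log N ^ c₀ → ∀ y ≤ N,
    ∑ m ∈ (Finset.Ioc 0 K).filter Odd, ‖progSum ξ m y‖ ≤ C * N / Real.log N ^ A := by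
  obtain ⟨B, hB⟩ : ∃ B : ℕ, B = A + 6 := ⟨_, rfl⟩
  obtain ⟨A₁, hA₁⟩ : ∃ A₁ : ℕ, A₁ = A + 2 + 2 * B := ⟨_, rfl⟩
  obtain ⟨c₀, hc₀⟩ : ∃ c₀ : ℕ, c₀ = 4 * B + E + 1 + A := ⟨_, rfl⟩
  obtain ⟨C₁, hC₁, hsw⟩ := exists_norm_twistSum_le A₁ (E + B)
  obtain ⟨M₁, hM₁1, hM₁⟩ : ∃ M : ℝ, 1 ≤ M ∧ ∀ x : ℝ, 1 ≤ x → 2 * Real.log x ^ (A + 2) ≤ M * x :=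
    ⟨2 * (A + 2).factorial, by
      have : (1 : ℝ) ≤ (A + 2).factorial := by exact_mod_cast Nat.factorial_pos _
      linarith, fun x hx => by linarith [log_pow_le x hx (A + 2)]⟩
  obtain ⟨M₂, hM₂0, hM₂⟩ : ∃ M : ℝ, 0 < M ∧ ∀ x : ℝ, 1 ≤ x → Real.log x ^ (A + 1) ≤ M * √x :=
    ⟨2 ^ (A + 1) * (A + 1).factorial, by positivity, fun x hx => log_pow_le_sqrt x hx (A + 1)⟩
  obtain ⟨M₃, hM₃0, hM₃⟩ : ∃ M : ℝ, 0 < M ∧ ∀ x : ℝ, 1 ≤ x →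
      Real.log x ^ (A + 2 * B + 4) ≤ M * x :=
    ⟨(A + 2 * B + 4).factorial, by positivity, fun x hx => log_pow_le x hx _⟩
  have hM₁0 : 0 < M₁ := by linarith
  refine ⟨c₀, 2 * M₁ + M₂ + 4 * C₁ + 8 * M₃ + 16 + 14400, by positivity, ?_⟩
  intro N hN q hq hqE ξ hξ K hK y hy
  have hN3 : (3 : ℝ) ≤ N := by exact_mod_cast hN
  have hl : 1 ≤ Real.log N := one_le_log hN3
  set ℓ := Real.log N with hℓ
  have hl0 : 0 < ℓ := by linarith
  have hpow : ∀ {i j : ℕ}, i ≤ j → ℓ ^ i ≤ ℓ ^ j := fun h => pow_le_pow_right₀ hl h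
  have hpow1 : ∀ j : ℕ, 1 ≤ ℓ ^ j := fun j => one_le_pow₀ hl
  have hsN : √N * √N = N := Real.mul_self_sqrt (by linarith)
  have hsN1 : 1 ≤ √N := Real.one_le_sqrt.mpr (by linarith)
  have hsle : √N ≤ N := by nlinarith
  set X : ℝ := N / ℓ ^ A with hX
  have hX0 : 0 < X := by positivity
  have hKs : (K : ℝ) ≤ √N := hK.trans (div_le_self (by positivity) (hpow1 _))
  have hKN : K ≤ N := by exact_mod_cast hKs.trans hsle
  have hgoal : ∀ b : ℝ, b ≤ (2 * M₁ + M₂ + 4 * C₁ + 8 * M₃ + 16 + 14400) * X →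
      b ≤ (2 * M₁ + M₂ + 4 * C₁ + 8 * M₃ + 16 + 14400) * N / ℓ ^ A := by
    intro b hb; rwa [mul_div_assoc]
  apply hgoal
  have hMX₁ : 0 < M₁ * X := mul_pos hM₁0 hX0
  have hMX₂ : 0 < M₂ * X := mul_pos hM₂0 hX0
  by_cases hsmall : (y : ℝ) * ℓ ^ (A + 2) ≤ M₁ * N
  · -- trivial range
    refine (sum_norm_progSum_le_trivial ξ hKN hy hN).trans ?_
    have h1 : y * ℓ ^ 2 ≤ M₁ * X := by
      rw [hX, mul_div_assoc', le_div_iff₀ (by positivity)]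
      calc _ = y * ℓ ^ (A + 2) := by ring
        _ ≤ _ := hsmall
    have h2 : ℓ * K ≤ M₂ * X := by
      rw [hX, mul_div_assoc', le_div_iff₀ (by positivity)]
      have h3 : ℓ ^ (A + 1) ≤ M₂ * √N := hM₂ N (by linarith)
      calc ℓ * K * ℓ ^ A = ℓ ^ (A + 1) * K := by ring
        _ ≤ M₂ * √N * √N := mul_le_mul h3 hKs (by positivity) (by positivity)
        _ = M₂ * N := by rw [mul_assoc, hsN]
    have h3 : 0 ≤ (4 * C₁ + 8 * M₃ + 16 + 14400) * X := by positivity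
    linarith
  · push Not at hsmall
    have hy3 : 3 ≤ y := by
      by_contra hlt
      have h2 : (y : ℝ) ≤ 2 := by exact_mod_cast (by omega : y ≤ 2)
      have h3 := hM₁ N (by linarith)
      have : (y : ℝ) * ℓ ^ (A + 2) ≤ 2 * ℓ ^ (A + 2) := by gcongr
      linarith
    have hKy : K ≤ y := by
      have h1 : (K : ℝ) * ℓ ^ (A + 2) ≤ y * ℓ ^ (A + 2) := by
        rw [le_div_iff₀ (by positivity)] at hK
        calc (K : ℝ) * ℓ ^ (A + 2) ≤ K * ℓ ^ c₀ := by
              have := hpow (show A + 2 ≤ c₀ by omega)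
              gcongr
          _ ≤ M₁ * N := by nlinarith
          _ ≤ _ := hsmall.le
      exact_mod_cast le_of_mul_le_mul_right h1 (by positivity)
    set R := ⌊ℓ ^ B⌋₊ with hR
    set U := ⌈ℓ ^ (2 * B)⌉₊ with hU
    have hR1 : 1 ≤ R := Nat.le_floor (by simpa using hpow1 B)
    have hRle : (R : ℝ) ≤ ℓ ^ B := Nat.floor_le (by positivity)
    have hRge : ℓ ^ B ≤ 2 * R := by
      have h1 := Nat.lt_floor_add_one (ℓ ^ B)
      have h2 : (1 : ℝ) ≤ R := by exact_mod_cast hR1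
      linarith
    have hUge : ℓ ^ (2 * B) ≤ U := Nat.le_ceil _
    have hUle : (U : ℝ) ≤ 2 * ℓ ^ (2 * B) := by
      have := Nat.ceil_lt_add_one (show 0 ≤ ℓ ^ (2 * B) by positivity)
      linarith [hpow1 (2 * B)]
    have hU1 : 1 ≤ U := Nat.one_le_ceil_iff.mpr (by positivity)
    have hsU : ℓ ^ B ≤ √U := by
      apply Real.le_sqrt_of_sq_le
      calc (ℓ ^ B) ^ 2 = ℓ ^ (2 * B) := by ring
        _ ≤ _ := hUge
    set T : ℝ := C₁ * N / ℓ ^ A₁ with hT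
    have hT0 : 0 ≤ T := by positivity
    have hyN : (y : ℝ) ≤ N := by exact_mod_cast hy
    have hy0 : (0 : ℝ) < y := by exact_mod_cast (by omega : 0 < y)
    have hly : Real.log y ≤ ℓ := Real.log_le_log hy0 hyN
    have hly0 : 0 ≤ Real.log y := Real.log_natCast_nonneg y
    have hly1 : 1 + Real.log y ≤ 2 * ℓ := by linarith
    refine (sum_norm_progSum_le hq hξ hR1 hU1 hKy hy3 hT0 (T := T) ?_).trans ?_
    · intro r hr hrR χ
      refine hsw N hN q r hq hr ?_ ξ χ hξ y hy
      have h1 : (r : ℝ) ≤ ℓ ^ B := le_trans (by exact_mod_cast hrR) hRle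
      calc (q * r : ℝ) ≤ ℓ ^ E * ℓ ^ B := by gcongr
        _ = ℓ ^ (E + B) := (pow_add _ _ _).symm
    have t1 : (1 + Real.log y) ^ 2 * (R ^ 2 * (T + 2 * Real.log y * Real.log y)) ≤
        (4 * C₁ + 8 * M₃) * X := by
      calc _ ≤ (2 * ℓ) ^ 2 * ((ℓ ^ B) ^ 2 * (T + 2 * ℓ * ℓ)) := by gcongr
        _ = 4 * C₁ * X + 8 * ℓ ^ (2 * B + 4) := by
          rw [hT, hX, hA₁]
          field_simp
          ring
        _ ≤ 4 * C₁ * X + 8 * (M₃ * X) := by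
          gcongr
          rw [hX, mul_div_assoc', le_div_iff₀ (by positivity)]
          calc ℓ ^ (2 * B + 4) * ℓ ^ A = ℓ ^ (A + 2 * B + 4) := by ring
            _ ≤ _ := hM₃ N (by linarith)
        _ = _ := by ring
    have hK2 : (K : ℝ) ^ 2 * ℓ ^ (4 * B + E + 1) ≤ X := by
      rw [le_div_iff₀ (by positivity)] at hK
      rw [hX, le_div_iff₀ (by positivity)]
      have h1 : (K * ℓ ^ c₀) ^ 2 ≤ √N ^ 2 := by gcongr
      rw [Real.sq_sqrt (by linarith)] at h1
      calc (K : ℝ) ^ 2 * ℓ ^ (4 * B + E + 1) * ℓ ^ A = K ^ 2 * ℓ ^ c₀ := by rw [hc₀]; ring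
        _ ≤ K ^ 2 * ℓ ^ (2 * c₀) := by
          have := hpow (show c₀ ≤ 2 * c₀ by omega)
          gcongr
        _ = (K * ℓ ^ c₀) ^ 2 := by ring
        _ ≤ N := h1
    have t2 : 4 * U ^ 2 * (q * K ^ 2) * Real.log y ≤ 16 * X := by
      calc _ ≤ 4 * (2 * ℓ ^ (2 * B)) ^ 2 * (ℓ ^ E * K ^ 2) * ℓ := by gcongr
        _ = 16 * (K ^ 2 * ℓ ^ (4 * B + E + 1)) := by ring
        _ ≤ _ := by gcongr
    have hKs2 : (K : ℝ) * √N * ℓ ^ 6 ≤ X := by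
      rw [le_div_iff₀ (by positivity)] at hK
      rw [hX, le_div_iff₀ (by positivity)]
      calc (K : ℝ) * √N * ℓ ^ 6 * ℓ ^ A = K * ℓ ^ (A + 6) * √N := by ring
        _ ≤ K * ℓ ^ c₀ * √N := by
          have := hpow (show A + 6 ≤ c₀ by omega)
          gcongr
        _ ≤ √N * √N := by gcongr
        _ = N := hsN
    have t3 : 12 * Real.log y ^ 3 * ((1 + Real.log y) ^ 2 *
        (60 * Real.log y * (y / R + 2 * (y / √U) + K * √y))) ≤ 14400 * X := by
      have h1 : (y : ℝ) / R ≤ 2 * (N / ℓ ^ B) := by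
        rw [div_le_iff₀ (by exact_mod_cast hR1)]
        have : 2 * (N / ℓ ^ B) * R = N * (2 * R / ℓ ^ B) := by ring
        rw [this]
        have h2 : 1 ≤ 2 * R / ℓ ^ B := by rwa [le_div_iff₀ (by positivity), one_mul]
        nlinarith
      have h2 : (y : ℝ) / √U ≤ N / ℓ ^ B := by gcongr
      have h3 : √(y : ℝ) ≤ √N := Real.sqrt_le_sqrt hyN
      calc _ ≤ 12 * ℓ ^ 3 * ((2 * ℓ) ^ 2 * (60 * ℓ * (2 * (N / ℓ ^ B) + 2 * (N / ℓ ^ B) +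
            K * √N))) := by gcongr
        _ = 11520 * X + 2880 * (K * √N * ℓ ^ 6) := by
          rw [hX, hB]
          field_simp
          ring
        _ ≤ 11520 * X + 2880 * X := by gcongr
        _ = _ := by ring
    refine (add_le_add (add_le_add t1 t2) t3).trans ?_
    linarith

end primesInProgressionsAverage

section primesInProgressionsWeighted
open ArithmeticFunction

set_option maxHeartbeats 400000 in
theorem exists_sum_norm_progSum_max_le (A E : ℕ) : ∃ c₀ : ℕ, ∃ C : ℝ, 0 < C ∧ ∀ N : ℕ, 3 ≤ N →
    ∀ q : ℕ, 0 < q → (q : ℝ) ≤ Real.log N ^ E → ∀ ξ : DirichletCharacter ℂ q, OddlyNontrivial ξ →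
    ∀ K : ℕ, (K : ℝ) ≤ √N / Real.log N ^ c₀ → ∀ Y : ℕ → ℕ, (∀ m, Y m ≤ N) →
    ∑ m ∈ (Finset.Ioc 0 K).filter Odd, ‖progSum ξ m (Y m)‖ ≤ C * N / Real.log N ^ A := by
  obtain ⟨c₀, C, hC, hfix⟩ := exists_sum_norm_progSum_le (2 * A + 2) E
  obtain ⟨M₁, hM₁0, hM₁⟩ : ∃ M : ℝ, 0 < M ∧ ∀ x : ℝ, 1 ≤ x → Real.log x ^ (A + 2) ≤ M * x :=
    ⟨(A + 2).factorial, by positivity, fun x hx => log_pow_le x hx (A + 2)⟩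
  obtain ⟨M₂, hM₂0, hM₂⟩ : ∃ M : ℝ, 0 < M ∧ ∀ x : ℝ, 1 ≤ x → Real.log x ^ (A + 1) ≤ M * √x :=
    ⟨2 ^ (A + 1) * (A + 1).factorial, by positivity, fun x hx => log_pow_le_sqrt x hx (A + 1)⟩
  refine ⟨c₀, 2 * C + 2 * (1 + M₁) + M₂, by positivity, ?_⟩
  intro N hN q hq hqE ξ hξ K hK Y hY
  have hN3 : (3 : ℝ) ≤ N := by exact_mod_cast hN
  have hN0 : (0 : ℝ) < N := by linarith
  have hl : 1 ≤ Real.log N := one_le_log hN3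
  have hfix' := hfix N hN q hq hqE ξ hξ K hK
  have hM₁' := hM₁ N (by linarith)
  have hM₂' := hM₂ N (by linarith)
  have hsN : √N * √N = (N : ℝ) := Real.mul_self_sqrt (by linarith)
  have hsN1 : 1 ≤ √(N : ℝ) := Real.one_le_sqrt.mpr (by linarith)
  have hKs : (K : ℝ) ≤ √N := hK.trans (div_le_self (by positivity) (one_le_pow₀ hl))
  have hKlog : Real.log K ≤ Real.log N := by
    rcases Nat.eq_zero_or_pos K with rfl | hK0
    · simp; linarith
    · exact Real.log_le_log (by exact_mod_cast hK0) (by nlinarith)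
  have hstep : ∀ m ∈ (Finset.Ioc 0 K).filter Odd, ∀ a h H : ℕ, a + h ≤ N → h ≤ H →
      ‖progSum ξ m (a + h)‖ ≤ ‖progSum ξ m a‖ + Real.log N * (H / m + 1) := by
    intro m hm a h H hN' hH
    have hm0 := (Finset.mem_Ioc.mp (Finset.mem_filter.mp hm).1).1
    have h1 := norm_progSum_sub_le ξ hm0 hN'
    have h2 : Real.log N * ((h : ℝ) / m + 1) ≤ Real.log N * ((H : ℝ) / m + 1) := by gcongr
    have h3 := norm_le_insert' (progSum ξ m (a + h)) (progSum ξ m a)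
    linarith
  have htriv := fun H => sum_log_mul_le K H (Real.log N) (by linarith)
  generalize Real.log N = ℓ at *
  have hl0 : 0 < ℓ := by linarith
  set X : ℝ := N / ℓ ^ A with hX
  set H := ⌈(N : ℝ) / ℓ ^ (A + 2)⌉₊ with hH
  have hH1 : 1 ≤ H := Nat.one_le_ceil_iff.mpr (by positivity)
  have hHge : (N : ℝ) ≤ ℓ ^ (A + 2) * H := by
    have := Nat.le_ceil ((N : ℝ) / ℓ ^ (A + 2))
    rwa [div_le_iff₀' (by positivity)] at this
  have hHle : ℓ ^ (A + 2) * H ≤ (1 + M₁) * N := by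
    have h1 := (Nat.ceil_lt_add_one (show 0 ≤ (N : ℝ) / ℓ ^ (A + 2) by positivity)).le
    calc ℓ ^ (A + 2) * H ≤ ℓ ^ (A + 2) * ((N : ℝ) / ℓ ^ (A + 2) + 1) := by gcongr
      _ = N + ℓ ^ (A + 2) := by field_simp
      _ ≤ _ := by linarith
  set J := N / H with hJ
  have hJle : (J : ℝ) ≤ ℓ ^ (A + 2) := by
    have h1 : (J : ℝ) * H ≤ N := by exact_mod_cast Nat.div_mul_le_self N H
    have h2 : (0 : ℝ) < H := by exact_mod_cast hH1
    exact le_of_mul_le_mul_right (h1.trans hHge) h2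
  have hpt : ∀ m ∈ (Finset.Ioc 0 K).filter Odd, ‖progSum ξ m (Y m)‖ ≤
      ∑ j ∈ Finset.range (J + 1), ‖progSum ξ m (H * j)‖ + ℓ * (H / m + 1) := by
    intro m hm
    have h1 := hstep m hm (H * (Y m / H)) (Y m % H) H (by rw [Nat.div_add_mod]; exact hY m)
      (Nat.mod_lt _ hH1).le
    rw [Nat.div_add_mod] at h1
    refine h1.trans (add_le_add ?_ le_rfl)
    refine Finset.single_le_sum (f := fun j => ‖progSum ξ m (H * j)‖) (fun _ _ => norm_nonneg _) ?_
    rw [Finset.mem_range, Nat.lt_succ_iff]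
    exact Nat.div_le_div_right (hY m)
  refine (Finset.sum_le_sum hpt).trans ?_
  rw [Finset.sum_add_distrib, Finset.sum_comm]
  have h1 : ∑ j ∈ Finset.range (J + 1), ∑ m ∈ (Finset.Ioc 0 K).filter Odd,
      ‖progSum ξ m (H * j)‖ ≤ 2 * C * X := by
    calc _ ≤ ∑ j ∈ Finset.range (J + 1), C * N / ℓ ^ (2 * A + 2) := by
          refine Finset.sum_le_sum fun j hj => hfix' _ ?_
          rw [Finset.mem_range, Nat.lt_succ_iff] at hj
          exact (Nat.mul_le_mul_left H hj).trans (Nat.mul_div_le N H)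
      _ = (J + 1) * (C * N / ℓ ^ (2 * A + 2)) := by simp
      _ ≤ (2 * ℓ ^ (A + 2)) * (C * N / ℓ ^ (2 * A + 2)) := by
          gcongr
          linarith [one_le_pow₀ hl (n := A + 2)]
      _ = _ := by
          rw [hX]
          field_simp
          ring
  have h2 : ℓ * (H * (1 + Real.log K) + K) ≤ (2 * (1 + M₁) + M₂) * X := by
    rw [hX, mul_div_assoc', le_div_iff₀ (by positivity)]
    calc ℓ * (H * (1 + Real.log K) + K) * ℓ ^ A ≤ ℓ * (H * (2 * ℓ) + √N) * ℓ ^ A := by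
          gcongr; linarith
      _ = 2 * (ℓ ^ (A + 2) * H) + ℓ ^ (A + 1) * √N := by ring
      _ ≤ 2 * ((1 + M₁) * N) + M₂ * √N * √N := by gcongr
      _ = _ := by rw [mul_assoc M₂, hsN]; ring
  refine (add_le_add h1 ((htriv H).trans h2)).trans (le_of_eq ?_)
  rw [hX]; ring

lemma norm_one_sub_ec_le (β : ℝ) : ‖1 - ec β‖ ≤ 2 * Real.pi * |β| := by
  rw [norm_one_sub_ec]
  have h : |Real.sin (Real.pi * β)| ≤ |Real.pi * β| := Real.abs_sin_le_abs
  rw [abs_mul, abs_of_pos Real.pi_pos] at h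
  linarith

lemma sum_Ioc_mul_eq (f w : ℕ → ℂ) {Y N : ℕ} (h : Y ≤ N) :
    ∑ n ∈ Finset.Ioc Y N, f n * w n =
      w N * (∑ n ∈ Finset.Ioc 0 N, f n - ∑ n ∈ Finset.Ioc 0 Y, f n) +
      ∑ k ∈ Finset.Ico Y N, (∑ n ∈ Finset.Ioc 0 k, f n - ∑ n ∈ Finset.Ioc 0 Y, f n) *
        (w k - w (k + 1)) := by
  induction N, h using Nat.le_induction with
  | base => simp
  | succ N h ih =>
    rw [Finset.sum_Ioc_succ_top h, Finset.sum_Ioc_succ_top (Nat.zero_le N),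
      Finset.sum_Ico_succ_top h, ih]
    ring

lemma norm_sum_Ioc_mul_ec_le (f : ℕ → ℂ) (β : ℝ) {Y N : ℕ} (h : Y ≤ N) :
    ‖∑ n ∈ Finset.Ioc Y N, f n * ec (n * β)‖ ≤
      ‖∑ n ∈ Finset.Ioc 0 N, f n‖ + ‖∑ n ∈ Finset.Ioc 0 Y, f n‖ +
      2 * Real.pi * |β| * ∑ k ∈ Finset.range N,
        (‖∑ n ∈ Finset.Ioc 0 k, f n‖ + ‖∑ n ∈ Finset.Ioc 0 Y, f n‖) := by
  rw [sum_Ioc_mul_eq f (fun n => ec (n * β)) h]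
  refine (norm_add_le _ _).trans (add_le_add ?_ ?_)
  · rw [norm_mul, norm_ec, one_mul]
    exact norm_sub_le _ _
  · rw [Finset.mul_sum]
    refine (norm_sum_le _ _).trans ((Finset.sum_le_sum fun k _ => ?_).trans
      (Finset.sum_le_sum_of_subset_of_nonneg ?_ fun _ _ _ => by positivity))
    · have h1 : ec (k * β) - ec ((k + 1 : ℕ) * β) = ec (k * β) * (1 - ec β) := by
        rw [mul_sub, ← ec_add]; push_cast; ring_nf
      rw [h1, norm_mul, norm_mul, norm_ec, one_mul, mul_comm]
      gcongr
      · exact norm_one_sub_ec_le β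
      · exact norm_sub_le _ _
    · intro k hk
      simp only [Finset.mem_Ico, Finset.mem_range] at *
      omega

lemma progSum_eq_sum_ite {q : ℕ} (ξ : DirichletCharacter ℂ q) (m y : ℕ) :
    progSum ξ m y = ∑ n ∈ Finset.Ioc 0 y, if n ≡ 1 [MOD m] then (vonMangoldt n : ℂ) * ξ n else 0 := by
  rw [progSum, Finset.sum_filter]

/-- A function on residues modulo `q` which changes sign under multiplication by `v` is a
combination of the characters with `ξ v = -1`. -/
lemma exists_character_expansion {q : ℕ} [NeZero q] (F : ZMod q → ℂ) (hF : ∀ a, ‖F a‖ ≤ 1)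
    {v : ZMod q} (hv : IsUnit v) (hFv : ∀ a, IsUnit a → F (v * a) = -F a) :
    ∃ c : DirichletCharacter ℂ q → ℂ, (∀ ξ, ‖c ξ‖ ≤ 1) ∧ (∀ ξ, c ξ ≠ 0 → ξ v = -1) ∧
      ∀ b, IsUnit b → F b = ∑ ξ, c ξ * ξ b := by
  have hφ : (0 : ℝ) < q.totient := by exact_mod_cast Nat.totient_pos.mpr (NeZero.pos q)
  have hφ' : (q.totient : ℂ) ≠ 0 := by exact_mod_cast hφ.ne'
  have hcard : ((Finset.univ : Finset (ZMod q)ˣ).card : ℝ) = q.totient := by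
    rw [Finset.card_univ, ZMod.card_units_eq_totient]
  refine ⟨fun ξ => (q.totient : ℂ)⁻¹ * ∑ a : (ZMod q)ˣ, F a * ξ (a : ZMod q)⁻¹, ?_, ?_, ?_⟩
  · intro ξ
    rw [norm_mul, norm_inv, Complex.norm_natCast, inv_mul_le_iff₀ hφ, mul_one, ← hcard]
    calc _ ≤ ∑ a : (ZMod q)ˣ, ‖F a * ξ (a : ZMod q)⁻¹‖ := norm_sum_le _ _
      _ ≤ ∑ a : (ZMod q)ˣ, 1 := by
        refine Finset.sum_le_sum fun a _ => ?_
        rw [norm_mul]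
        exact mul_le_one₀ (hF _) (norm_nonneg _) (ξ.norm_le_one _)
      _ = _ := by simp
  · intro ξ hξ
    obtain ⟨u, rfl⟩ := hv
    have hu : ξ (u : ZMod q) ≠ 0 := (u.isUnit.map ξ).ne_zero
    have h1 : ξ (u : ZMod q) * ∑ a : (ZMod q)ˣ, F a * ξ (a : ZMod q)⁻¹ =
        -∑ a : (ZMod q)ˣ, F a * ξ (a : ZMod q)⁻¹ := by
      conv_lhs => rw [← Equiv.sum_comp (Equiv.mulLeft u)]
      rw [Finset.mul_sum, ← Finset.sum_neg_distrib]
      refine Finset.sum_congr rfl fun a _ => ?_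
      have h5 : ((u : ZMod q) * a)⁻¹ = (a : ZMod q)⁻¹ * (u : ZMod q)⁻¹ := by
        rw [← Units.val_mul, ZMod.inv_coe_unit, ZMod.inv_coe_unit, ZMod.inv_coe_unit, mul_inv_rev,
          Units.val_mul]
      rw [Equiv.coe_mulLeft, Units.val_mul, hFv _ a.isUnit, h5, map_mul]
      have h2 : ξ (u : ZMod q) * ξ (u : ZMod q)⁻¹ = 1 := by
        rw [← map_mul, ZMod.mul_inv_of_unit _ u.isUnit, map_one]
      linear_combination (-F a * ξ (a : ZMod q)⁻¹) * h2
    have h3 := right_ne_zero_of_mul hξ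
    have h4 : (ξ (u : ZMod q) + 1) * ∑ a : (ZMod q)ˣ, F a * ξ (a : ZMod q)⁻¹ = 0 := by
      rw [add_mul, h1]; ring
    exact eq_neg_of_add_eq_zero_left ((mul_eq_zero.mp h4).resolve_right h3)
  · rintro _ ⟨b, rfl⟩
    have h1 : ∑ ξ : DirichletCharacter ℂ q, ((q.totient : ℂ)⁻¹ * ∑ a : (ZMod q)ˣ, F a *
        ξ (a : ZMod q)⁻¹) * ξ (b : ZMod q) = (q.totient : ℂ)⁻¹ * ∑ a : (ZMod q)ˣ, F a *
        ∑ ξ : DirichletCharacter ℂ q, ξ (a : ZMod q)⁻¹ * ξ (b : ZMod q) := by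
      simp only [Finset.mul_sum, Finset.sum_mul]
      rw [Finset.sum_comm]
      refine Finset.sum_congr rfl fun a _ => Finset.sum_congr rfl fun ξ _ => ?_
      ring
    rw [h1]
    simp only [DirichletCharacter.sum_char_inv_mul_char_eq ℂ (Units.isUnit _), Units.val_inj]
    rw [Finset.sum_eq_single b (fun a _ hab => by rw [if_neg hab, mul_zero]) (by simp), if_pos rfl]
    field_simp

end primesInProgressionsWeighted

section primesInProgressionsPeriodic
open ArithmeticFunction

lemma sum_norm_progSum_ec_le {q : ℕ} {ξ : DirichletCharacter ℂ q} {s : Finset ℕ} {N : ℕ} {B β : ℝ}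
    (hB : ∀ Y : ℕ → ℕ, (∀ m, Y m ≤ N) → ∑ m ∈ s, ‖progSum ξ m (Y m)‖ ≤ B)
    {Y : ℕ → ℕ} (hY : ∀ m, Y m ≤ N) :
    ∑ m ∈ s, ‖∑ n ∈ (Finset.Ioc (Y m) N).filter (fun n => n ≡ 1 [MOD m]),
      (vonMangoldt n : ℂ) * ξ n * ec (n * β)‖ ≤ 2 * B * (1 + 2 * Real.pi * (|β| * N)) := by
  have hpt : ∀ m ∈ s, ‖∑ n ∈ (Finset.Ioc (Y m) N).filter (fun n => n ≡ 1 [MOD m]),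
      (vonMangoldt n : ℂ) * ξ n * ec (n * β)‖ ≤
      ‖progSum ξ m N‖ + ‖progSum ξ m (Y m)‖ + 2 * Real.pi * |β| * ∑ k ∈ Finset.range N,
        (‖progSum ξ m k‖ + ‖progSum ξ m (Y m)‖) := by
    intro m _
    have h := norm_sum_Ioc_mul_ec_le
      (fun n => if n ≡ 1 [MOD m] then (vonMangoldt n : ℂ) * ξ n else 0) β (hY m)
    simp only [← progSum_eq_sum_ite] at h
    rw [Finset.sum_filter]
    simpa only [ite_mul, zero_mul] using h
  refine (Finset.sum_le_sum hpt).trans ?_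
  rw [Finset.sum_add_distrib, Finset.sum_add_distrib, ← Finset.mul_sum, Finset.sum_comm]
  simp only [Finset.sum_add_distrib]
  have h1 := hB Y hY
  have h2 := hB (fun _ => N) (fun _ => le_rfl)
  have h3 : ∑ k ∈ Finset.range N, ∑ m ∈ s, ‖progSum ξ m k‖ ≤ N * B := by
    calc _ ≤ ∑ k ∈ Finset.range N, B :=
          Finset.sum_le_sum fun k hk => hB (fun _ => k) (fun _ => (Finset.mem_range.mp hk).le)
      _ = _ := by simp
  have h4 : ∑ k ∈ Finset.range N, ∑ m ∈ s, ‖progSum ξ m (Y m)‖ ≤ N * B := by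
    rw [Finset.sum_const, Finset.card_range, nsmul_eq_mul]
    gcongr
  calc _ ≤ B + B + 2 * Real.pi * |β| * (N * B + N * B) := by
        have := Real.pi_pos
        gcongr
    _ = _ := by ring

/-- A Bombieri–Vinogradov type estimate for primes weighted by a function on residues modulo `q`
which changes sign under multiplication by a unit congruent to `1` modulo the odd part of `q`. -/
theorem exists_sum_norm_periodic_le (A E : ℕ) : ∃ c₀ : ℕ, ∃ C : ℝ, 0 < C ∧ ∀ N : ℕ, 3 ≤ N →
    ∀ q u j v : ℕ, 0 < q → q = u * 2 ^ j → (q : ℝ) ≤ Real.log N ^ E → v ≡ 1 [MOD u] →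
    v.Coprime q → ∀ F : ℕ → ℂ, (∀ n, ‖F n‖ ≤ 1) → (∀ a b, a ≡ b [MOD q] → F a = F b) →
    (∀ n, n.Coprime q → F (v * n) = -F n) → ∀ β : ℝ, |β| * N ≤ Real.log N ^ E →
    ∀ K : ℕ, (K : ℝ) ≤ √N / Real.log N ^ c₀ → ∀ Y : ℕ → ℕ, (∀ m, Y m ≤ N) →
    ∑ m ∈ (Finset.Ioc 0 K).filter Odd,
      ‖∑ n ∈ (Finset.Ioc (Y m) N).filter (fun n => n ≡ 1 [MOD m]),
        (vonMangoldt n : ℂ) * F n * ec (n * β)‖ ≤ C * N / Real.log N ^ A := by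
  obtain ⟨c₀, C, hC, hmax⟩ := exists_sum_norm_progSum_max_le (A + 2 * E) E
  obtain ⟨M, hM0, hM⟩ : ∃ M : ℝ, 0 < M ∧ ∀ x : ℝ, 1 ≤ x → Real.log x ^ (A + E + 1) ≤ M * √x :=
    ⟨2 ^ (A + E + 1) * (A + E + 1).factorial, by positivity, fun x hx => log_pow_le_sqrt x hx _⟩
  refine ⟨c₀, 16 * C + 2 * M, by positivity, ?_⟩
  intro N hN q u j v hq hqu hqE hvu hvq F hF1 hFper hFv β hβ K hK Y hY
  have : NeZero q := ⟨hq.ne'⟩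
  have hN3 : (3 : ℝ) ≤ N := by exact_mod_cast hN
  have hl : 1 ≤ Real.log N := one_le_log hN3
  have hsN : √N * √N = (N : ℝ) := Real.mul_self_sqrt (by linarith)
  have hKs : (K : ℝ) ≤ √N := hK.trans (div_le_self (by positivity) (one_le_pow₀ hl))
  have hFval : ∀ n : ℕ, F (n : ZMod q).val = F n := fun n =>
    hFper _ _ (by rw [ZMod.val_natCast]; exact Nat.mod_modEq n q)
  obtain ⟨c, hc1, hc2, hc3⟩ := exists_character_expansion (fun a : ZMod q => F a.val)
    (fun a => hF1 _) (v := (v : ZMod q)) ((ZMod.isUnit_iff_coprime _ _).mpr hvq) (by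
      intro a ha
      have h1 : a = ((a.val : ℕ) : ZMod q) := (ZMod.natCast_zmod_val a).symm
      rw [h1, ← Nat.cast_mul, hFval, hFval]
      apply hFv
      rwa [← ZMod.isUnit_iff_coprime, ← h1])
  set Ξ : Finset (DirichletCharacter ℂ q) := Finset.univ.filter fun ξ => ξ v = -1 with hΞ
  set W : DirichletCharacter ℂ q → ℕ → ℂ := fun ξ m =>
    ∑ n ∈ (Finset.Ioc (Y m) N).filter (fun n => n ≡ 1 [MOD m]),
      (vonMangoldt n : ℂ) * ξ n * ec (n * β) with hW
  have hpt : ∀ m ∈ (Finset.Ioc 0 K).filter Odd,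
      ‖∑ n ∈ (Finset.Ioc (Y m) N).filter (fun n => n ≡ 1 [MOD m]),
        (vonMangoldt n : ℂ) * F n * ec (n * β)‖ ≤
      ∑ ξ ∈ Ξ, ‖W ξ m‖ + 2 * Real.log N * Real.log q := by
    intro m _
    set t := (Finset.Ioc (Y m) N).filter (fun n => n ≡ 1 [MOD m]) with ht
    have hdec : ∑ n ∈ t, (vonMangoldt n : ℂ) * F n * ec (n * β) =
        ∑ ξ, c ξ * W ξ m +
        ∑ n ∈ t.filter (fun n => ¬ n.Coprime q), (vonMangoldt n : ℂ) * F n * ec (n * β) := by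
      rw [← Finset.sum_filter_add_sum_filter_not t (fun n => n.Coprime q)]
      congr 1
      simp only [hW, Finset.mul_sum]
      rw [Finset.sum_comm, Finset.sum_filter]
      refine Finset.sum_congr rfl fun n _ => ?_
      split_ifs with hn
      · have h1 := hc3 n ((ZMod.isUnit_iff_coprime _ _).mpr hn)
        simp only [hFval] at h1
        rw [h1, Finset.mul_sum, Finset.sum_mul]
        exact Finset.sum_congr rfl fun ξ _ => by ring
      · symm
        apply Finset.sum_eq_zero
        intro ξ _
        rw [MulChar.map_nonunit ξ (by rwa [ZMod.isUnit_iff_coprime])]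
        ring
    rw [hdec]
    refine (norm_add_le _ _).trans (add_le_add ?_ ?_)
    · refine (norm_sum_le _ _).trans ?_
      rw [hΞ, Finset.sum_filter]
      refine Finset.sum_le_sum fun ξ _ => ?_
      rw [norm_mul]
      split_ifs with h
      · exact mul_le_of_le_one_left (norm_nonneg _) (hc1 ξ)
      · rw [by_contra fun h' => h (hc2 ξ h')]
        simp
    · refine (norm_sum_le _ _).trans (le_trans ?_ (sum_vonMangoldt_not_coprime_le hq.ne' N))
      refine (Finset.sum_le_sum fun n _ => ?_).trans
        (Finset.sum_le_sum_of_subset_of_nonneg ?_ fun _ _ _ => vonMangoldt_nonneg)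
      · rw [norm_mul, norm_mul, norm_ec, mul_one, Complex.norm_real,
          Real.norm_of_nonneg vonMangoldt_nonneg]
        exact mul_le_of_le_one_right vonMangoldt_nonneg (hF1 n)
      · intro n hn
        simp only [ht, Finset.mem_filter, Finset.mem_Ioc] at hn ⊢
        exact ⟨⟨by omega, hn.1.1.2⟩, hn.2⟩
  have hξ : ∀ ξ ∈ Ξ, ∑ m ∈ (Finset.Ioc 0 K).filter Odd, ‖W ξ m‖ ≤
      2 * (C * N / Real.log N ^ (A + 2 * E)) * (1 + 2 * Real.pi * (|β| * N)) := by
    intro ξ hξ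
    have hodd := oddlyNontrivial_of_modEq hqu hvu (Finset.mem_filter.mp hξ).2
    exact sum_norm_progSum_ec_le (hmax N hN q hq hqE ξ hodd K hK) hY
  have hcard : (Ξ.card : ℝ) ≤ Real.log N ^ E := by
    refine le_trans ?_ hqE
    have h1 : Ξ.card ≤ q.totient := by
      refine (Finset.card_le_card (Finset.filter_subset _ _)).trans ?_
      rw [Finset.card_univ, ← Nat.card_eq_fintype_card,
        DirichletCharacter.card_eq_totient_of_hasEnoughRootsOfUnity]
    exact_mod_cast h1.trans (Nat.totient_le q)
  have hlq : Real.log q ≤ Real.log N ^ E := by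
    have := Real.log_le_sub_one_of_pos (show (0 : ℝ) < q by exact_mod_cast hq)
    linarith
  have hM' := hM N (by linarith)
  refine (Finset.sum_le_sum hpt).trans ?_
  rw [Finset.sum_add_distrib, Finset.sum_comm, Finset.sum_const, nsmul_eq_mul]
  have hcardK : (((Finset.Ioc 0 K).filter Odd).card : ℝ) ≤ √N := by
    refine le_trans ?_ hKs
    exact_mod_cast (Finset.card_le_card (Finset.filter_subset _ _)).trans (by simp)
  have h1 := Finset.sum_le_sum hξ
  rw [Finset.sum_const, nsmul_eq_mul] at h1
  clear hmax hM
  generalize Real.log N = ℓ at *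
  have hl0 : 0 < ℓ := by linarith
  have hlE : 1 ≤ ℓ ^ E := one_le_pow₀ hl
  have h2 : 1 + 2 * Real.pi * (|β| * N) ≤ 8 * ℓ ^ E := by
    have h3 : 2 * Real.pi * (|β| * N) ≤ 7 * ℓ ^ E := by
      have := Real.pi_lt_d2
      have := Real.pi_pos
      gcongr
      linarith
    linarith
  calc _ ≤ ℓ ^ E * (2 * (C * N / ℓ ^ (A + 2 * E)) * (8 * ℓ ^ E)) + √N * (2 * ℓ * ℓ ^ E) := by
        refine add_le_add (h1.trans ?_) ?_
        · gcongr
        · gcongr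
    _ ≤ 16 * C * N / ℓ ^ A + 2 * M * N / ℓ ^ A := by
        refine add_le_add (le_of_eq ?_) ?_
        · field_simp
          ring
        · rw [le_div_iff₀ (by positivity)]
          calc √N * (2 * ℓ * ℓ ^ E) * ℓ ^ A = 2 * ℓ ^ (A + E + 1) * √N := by ring
            _ ≤ 2 * (M * √N) * √N := by gcongr
            _ = 2 * M * (√N * √N) := by ring
            _ = 2 * M * N := by rw [hsN]
    _ = _ := by ring

end primesInProgressionsPeriodic

section divisorMoments

lemma card_divisors_mul_le (a b : ℕ) :
    (a * b).divisors.card ≤ a.divisors.card * b.divisors.card := by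
  classical
  rw [Nat.divisors_mul]
  exact Finset.card_mul_le

lemma sum_sum_divisors_le (K : ℕ) (f : ℕ → ℕ → ℝ) (hf : ∀ r s, 0 ≤ f r s) :
    ∑ n ∈ Finset.Ioc 0 K, ∑ d ∈ n.divisors, f d (n / d) ≤
      ∑ d ∈ Finset.Ioc 0 K, ∑ m ∈ Finset.Ioc 0 (K / d), f d m := by
  refine le_trans (le_of_eq ?_) ((sum_divisors_pair_le K
    (fun d m => if d * m ≤ K then f d m else 0)
    fun r s => by split_ifs; exacts [hf _ _, le_rfl]).trans_eq ?_)
  · refine Finset.sum_congr rfl fun n hn => Finset.sum_congr rfl fun d hd => ?_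
    rw [if_pos]
    rw [Nat.mul_div_cancel' (Nat.dvd_of_mem_divisors hd)]
    exact (Finset.mem_Ioc.mp hn).2
  · rw [Finset.sum_comm]
    refine Finset.sum_congr rfl fun d hd => ?_
    have hd0 := (Finset.mem_Ioc.mp hd).1
    rw [← Finset.sum_filter]
    refine Finset.sum_congr ?_ fun _ _ => rfl
    ext m
    simp only [Finset.mem_filter, Finset.mem_Ioc, Nat.le_div_iff_mul_le hd0]
    constructor
    · rintro ⟨⟨h1, h2⟩, h3⟩
      exact ⟨h1, by rwa [mul_comm]⟩
    · rintro ⟨h1, h2⟩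
      exact ⟨⟨h1, (Nat.le_mul_of_pos_right m hd0).trans h2⟩, by rwa [mul_comm]⟩

lemma sum_card_divisors_le (K : ℕ) :
    ∑ n ∈ Finset.Ioc 0 K, (n.divisors.card : ℝ) ≤ K * (1 + Real.log K) := by
  calc _ = ∑ n ∈ Finset.Ioc 0 K, ∑ d ∈ n.divisors, (1 : ℝ) := by simp
    _ ≤ ∑ d ∈ Finset.Ioc 0 K, ∑ m ∈ Finset.Ioc 0 (K / d), (1 : ℝ) :=
        sum_sum_divisors_le K (fun _ _ => 1) fun _ _ => zero_le_one
    _ ≤ ∑ d ∈ Finset.Ioc 0 K, K * (1 / (d : ℝ)) := by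
        refine Finset.sum_le_sum fun d _ => ?_
        simp only [Finset.sum_const, Nat.card_Ioc, tsub_zero, nsmul_eq_mul, mul_one]
        exact Nat.cast_div_le.trans_eq (by ring)
    _ = K * ∑ d ∈ Finset.Ioc 0 K, 1 / (d : ℝ) := by rw [Finset.mul_sum]
    _ ≤ _ := by gcongr; exact sum_Ioc_one_div_le K

lemma sum_card_divisors_div_le (K : ℕ) :
    ∑ n ∈ Finset.Ioc 0 K, (n.divisors.card : ℝ) / n ≤ (1 + Real.log K) ^ 2 := by
  calc _ = ∑ n ∈ Finset.Ioc 0 K, ∑ d ∈ n.divisors, 1 / (d : ℝ) * (1 / ((n / d : ℕ) : ℝ)) := by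
        refine Finset.sum_congr rfl fun n hn => ?_
        rw [div_eq_mul_one_div, ← nsmul_eq_mul, ← Finset.sum_const]
        refine Finset.sum_congr rfl fun d hd => ?_
        rw [one_div_mul_one_div, ← Nat.cast_mul, Nat.mul_div_cancel' (Nat.dvd_of_mem_divisors hd)]
    _ ≤ ∑ s ∈ Finset.Ioc 0 K, ∑ r ∈ Finset.Ioc 0 K, 1 / (r : ℝ) * (1 / (s : ℝ)) :=
        sum_divisors_pair_le K (fun r s => 1 / (r : ℝ) * (1 / (s : ℝ))) fun _ _ => by positivity
    _ = (∑ d ∈ Finset.Ioc 0 K, 1 / (d : ℝ)) ^ 2 := by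
        rw [sq, Finset.sum_mul_sum, Finset.sum_comm]
    _ ≤ _ := by gcongr; exact sum_Ioc_one_div_le K

lemma sum_card_divisors_sq_le (K : ℕ) :
    ∑ n ∈ Finset.Ioc 0 K, (n.divisors.card : ℝ) ^ 2 ≤ K * (1 + Real.log K) ^ 3 := by
  calc _ = ∑ n ∈ Finset.Ioc 0 K, ∑ d ∈ n.divisors, ((d * (n / d)).divisors.card : ℝ) := by
        refine Finset.sum_congr rfl fun n _ => ?_
        rw [sq, ← nsmul_eq_mul, ← Finset.sum_const]
        refine Finset.sum_congr rfl fun d hd => ?_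
        rw [Nat.mul_div_cancel' (Nat.dvd_of_mem_divisors hd)]
    _ ≤ ∑ d ∈ Finset.Ioc 0 K, ∑ m ∈ Finset.Ioc 0 (K / d), ((d * m).divisors.card : ℝ) :=
        sum_sum_divisors_le K (fun d m => ((d * m).divisors.card : ℝ)) fun _ _ => by positivity
    _ ≤ ∑ d ∈ Finset.Ioc 0 K, (d.divisors.card : ℝ) / d * (K * (1 + Real.log K)) := by
        refine Finset.sum_le_sum fun d hd => ?_
        have hd0 := (Finset.mem_Ioc.mp hd).1
        calc _ ≤ ∑ m ∈ Finset.Ioc 0 (K / d), (d.divisors.card : ℝ) * m.divisors.card := by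
              refine Finset.sum_le_sum fun m _ => ?_
              exact_mod_cast card_divisors_mul_le d m
          _ ≤ d.divisors.card * ((K / d : ℕ) * (1 + Real.log (K / d : ℕ))) := by
              rw [← Finset.mul_sum]
              gcongr
              exact sum_card_divisors_le _
          _ ≤ d.divisors.card * (K / d * (1 + Real.log K)) := by
              rcases Nat.eq_zero_or_pos (K / d) with h | h
              · rw [h]
                simp only [Nat.cast_zero, zero_mul, mul_zero]
                have := Real.log_natCast_nonneg K
                positivity
              · have := Real.log_natCast_nonneg (K / d)
                gcongr
                · exact Nat.cast_div_le
                · exact Nat.div_le_self _ _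
          _ = _ := by ring
    _ = (∑ d ∈ Finset.Ioc 0 K, (d.divisors.card : ℝ) / d) * (K * (1 + Real.log K)) := by
        rw [Finset.sum_mul]
    _ ≤ (1 + Real.log K) ^ 2 * (K * (1 + Real.log K)) := by
        have := Real.log_natCast_nonneg K
        gcongr
        exact sum_card_divisors_div_le K
    _ = _ := by ring

/-- Splitting off powers of two from the summation variable. -/
lemma sum_Ioc_le_sum_odd_add (K k : ℕ) (f : ℕ → ℝ) (hf : ∀ n, 0 ≤ f n) :
    ∑ n ∈ Finset.Ioc 0 K, f n ≤
      ∑ i ∈ Finset.range k, ∑ m ∈ (Finset.Ioc 0 K).filter Odd, f (2 ^ i * m) +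
        ∑ m ∈ Finset.Ioc 0 K, f (2 ^ k * m) := by
  induction k with
  | zero => simp
  | succ k ih =>
    refine ih.trans ?_
    rw [Finset.sum_range_succ, add_assoc]
    gcongr
    rw [← Finset.sum_filter_add_sum_filter_not (Finset.Ioc 0 K) Odd (fun m => f (2 ^ k * m))]
    gcongr
    have h1 : (Finset.Ioc 0 K).filter (fun m => ¬ Odd m) ⊆
        (Finset.Ioc 0 K).image (fun m => 2 * m) := by
      intro m hm
      simp only [Finset.mem_filter, Finset.mem_Ioc, Nat.not_odd_iff_even, Finset.mem_image] at hm ⊢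
      obtain ⟨⟨h0, hK⟩, r, rfl⟩ := hm
      exact ⟨r, ⟨by omega, by omega⟩, by ring⟩
    refine (Finset.sum_le_sum_of_subset_of_nonneg h1 fun _ _ _ => hf _).trans_eq ?_
    rw [Finset.sum_image fun a _ b _ h => by simpa using h]
    refine Finset.sum_congr rfl fun m _ => ?_
    rw [pow_succ, mul_assoc]

end divisorMoments

section divisorSums
open ArithmeticFunction

lemma abs_chi4_le (n : ℕ) : |chi4 n| ≤ 1 := by
  unfold chi4; split_ifs <;> norm_num

lemma abs_r2_le (D R : ℝ) (m : ℕ) : |r2 D R m| ≤ m.divisors.card := by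
  refine (Finset.abs_sum_le_sum_abs _ _).trans ?_
  refine (Finset.sum_le_card_nsmul _ _ 1 fun d _ => ?_).trans (by simp)
  split_ifs
  exacts [abs_chi4_le d, by simp]

lemma abs_r3_le (D R : ℝ) (m : ℕ) : |r3 D R m| ≤ m.divisors.card := by
  refine (Finset.abs_sum_le_sum_abs _ _).trans ?_
  refine (Finset.sum_le_card_nsmul _ _ 1 fun d _ => ?_).trans (by simp)
  split_ifs
  exacts [abs_chi4_le d, by simp]

lemma r3_eq_sum_Ioc {D R : ℝ} (hR : 0 < R / D) {m K : ℕ} (hm : m ≠ 0)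
    (hK : (m : ℝ) < (K + 1) * (R / D)) :
    r3 D R m = ∑ e ∈ Finset.Ioc 0 K,
      if e ∣ m ∧ ⌈e * (R / D)⌉₊ ≤ m then chi4 (m / e) else 0 := by
  rw [r3, ← Nat.sum_div_divisors, ← Finset.sum_filter, ← Finset.sum_filter]
  have key : ∀ e, e ∣ m → 0 < e → (R / D ≤ ((m / e : ℕ) : ℝ) ↔ e * (R / D) ≤ m) := by
    intro e he h0
    have : (0 : ℝ) < e := by exact_mod_cast h0
    rw [Nat.cast_div he this.ne', le_div_iff₀ this, mul_comm]
  refine Finset.sum_congr ?_ fun _ _ => rfl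
  ext e
  simp only [Finset.mem_filter, Nat.mem_divisors, Finset.mem_Ioc, Nat.ceil_le]
  constructor
  · rintro ⟨⟨he, _⟩, h⟩
    have he0 := Nat.pos_of_dvd_of_pos he (Nat.pos_of_ne_zero hm)
    rw [key e he he0] at h
    refine ⟨⟨he0, ?_⟩, he, h⟩
    have h1 : (e : ℝ) < K + 1 := lt_of_mul_lt_mul_right (h.trans_lt hK) hR.le
    exact Nat.lt_succ_iff.mp (by exact_mod_cast h1)
  · rintro ⟨⟨he0, _⟩, he, h⟩
    exact ⟨⟨he, hm⟩, (key e he he0).mpr h⟩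

/-- The residue-class function `n ↦ χ((n - 1) / 2 ^ k)`, extended by zero. -/
def chiTwist (k n : ℕ) : ℝ :=
  if n ≡ 1 + 2 ^ k [MOD 2 ^ (k + 2)] then 1
  else if n ≡ 1 + 3 * 2 ^ k [MOD 2 ^ (k + 2)] then -1 else 0

lemma abs_chiTwist_le (k n : ℕ) : |chiTwist k n| ≤ 1 := by
  unfold chiTwist; split_ifs <;> norm_num

lemma chiTwist_congr {k a b : ℕ} (h : a ≡ b [MOD 2 ^ (k + 2)]) : chiTwist k a = chiTwist k b := by
  have h1 : ∀ c, (a ≡ c [MOD 2 ^ (k + 2)]) ↔ (b ≡ c [MOD 2 ^ (k + 2)]) := fun c =>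
    ⟨fun h' => h.symm.trans h', fun h' => h.trans h'⟩
  simp only [chiTwist, h1]

lemma chiTwist_mul {k n v : ℕ} (hn : Odd n) (hv : v ≡ 1 + 2 ^ (k + 1) [MOD 2 ^ (k + 2)]) :
    chiTwist k (v * n) = -chiTwist k n := by
  have h1 : v * n ≡ n + 2 ^ (k + 1) [MOD 2 ^ (k + 2)] := by
    obtain ⟨r, rfl⟩ := hn
    refine (hv.mul_right _).trans ?_
    have : (1 + 2 ^ (k + 1)) * (2 * r + 1) = (2 * r + 1 + 2 ^ (k + 1)) + 2 ^ (k + 2) * r := by ring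
    rw [this]
    exact (Nat.modEq_zero_iff_dvd.mpr (dvd_mul_right _ _)).add_left _ |>.trans (by rfl)
  rw [chiTwist_congr h1]
  have hA : n + 2 ^ (k + 1) ≡ 1 + 2 ^ k [MOD 2 ^ (k + 2)] ↔
      n ≡ 1 + 3 * 2 ^ k [MOD 2 ^ (k + 2)] := by
    have h2 : (1 + 3 * 2 ^ k) + 2 ^ (k + 1) ≡ 1 + 2 ^ k [MOD 2 ^ (k + 2)] := by
      rw [show (1 + 3 * 2 ^ k) + 2 ^ (k + 1) = (1 + 2 ^ k) + 2 ^ (k + 2) by ring]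
      exact Nat.add_modEq_right
    exact ⟨fun h => Nat.ModEq.add_right_cancel' _ (h.trans h2.symm), fun h =>
      (h.add_right _).trans h2⟩
  have hB : n + 2 ^ (k + 1) ≡ 1 + 3 * 2 ^ k [MOD 2 ^ (k + 2)] ↔
      n ≡ 1 + 2 ^ k [MOD 2 ^ (k + 2)] := by
    have h2 : (1 + 2 ^ k) + 2 ^ (k + 1) = 1 + 3 * 2 ^ k := by ring
    rw [← h2]
    exact ⟨fun h => Nat.ModEq.add_right_cancel' _ h, fun h => h.add_right _⟩
  have hC : ¬ (1 + 2 ^ k ≡ 1 + 3 * 2 ^ k [MOD 2 ^ (k + 2)]) := by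
    intro h
    have h3 := Nat.ModEq.add_left_cancel' _ h
    rw [show (2 : ℕ) ^ (k + 2) = 2 ^ k * 4 by ring, show 3 * 2 ^ k = 2 ^ k * 3 by ring] at h3
    nth_rewrite 2 [← mul_one (2 ^ k)] at h3
    have h4 := Nat.ModEq.mul_left_cancel' (by positivity) h3
    exact absurd h4 (by decide)
  simp only [chiTwist, hA, hB]
  by_cases h5 : n ≡ 1 + 2 ^ k [MOD 2 ^ (k + 2)]
  · have h6 : ¬ (n ≡ 1 + 3 * 2 ^ k [MOD 2 ^ (k + 2)]) := fun h6 => hC (h5.symm.trans h6)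
    simp [h5, h6]
  · by_cases h6 : n ≡ 1 + 3 * 2 ^ k [MOD 2 ^ (k + 2)] <;> simp [h5, h6]

lemma chi4_div_eq_chiTwist {k m n : ℕ} (hm : Odd m) (hn : 0 < n) :
    (if 2 ^ k * m ∣ n - 1 then chi4 ((n - 1) / (2 ^ k * m)) else 0) =
      if n ≡ 1 [MOD m] then chi4 m * chiTwist k n else 0 := by
  have hmod : n ≡ 1 [MOD m] ↔ m ∣ n - 1 := by
    rw [Nat.ModEq.comm, Nat.modEq_iff_dvd' hn]
  simp only [hmod]
  have hm0 : 0 < m := hm.pos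
  by_cases h1 : 2 ^ k * m ∣ n - 1
  · rw [if_pos h1, if_pos ((dvd_mul_left _ _).trans h1)]
    obtain ⟨t, ht⟩ := h1
    have hn' : n = 1 + 2 ^ k * (m * t) := by rw [← mul_assoc, ← ht]; omega
    rw [ht, Nat.mul_div_cancel_left _ (by positivity)]
    have h2 : ∀ a, (n ≡ 1 + a * 2 ^ k [MOD 2 ^ (k + 2)]) ↔ (m * t) % 4 = a % 4 := by
      intro a
      rw [hn', show (2 : ℕ) ^ (k + 2) = 2 ^ k * 4 by ring, mul_comm a]
      constructor
      · intro h
        exact Nat.ModEq.mul_left_cancel' (by positivity) (Nat.ModEq.add_left_cancel' _ h)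
      · intro h
        exact (Nat.ModEq.mul_left' _ h).add_left _
    have h3 := h2 1
    rw [one_mul] at h3
    simp only [chiTwist, chi4, h3, h2 3, Nat.mul_mod m t]
    have hm2 : m % 4 = 1 ∨ m % 4 = 3 := by
      have := Nat.odd_iff.mp hm
      omega
    have ht4 : t % 4 < 4 := Nat.mod_lt _ (by norm_num)
    generalize t % 4 = r at *
    rcases hm2 with h | h <;> rw [h] <;> interval_cases r <;> norm_num
  · rw [if_neg h1]
    by_cases h2 : m ∣ n - 1
    · rw [if_pos h2]
      have h3 : ¬ 2 ^ k ∣ n - 1 := fun h3 => h1 <|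
        Nat.Coprime.mul_dvd_of_dvd_of_dvd (Nat.Coprime.pow_left _ (Nat.coprime_two_left.mpr hm))
          h3 h2
      have h4 : ∀ a, ¬ (n ≡ 1 + a * 2 ^ k [MOD 2 ^ (k + 2)]) := by
        intro a h
        apply h3
        have h5 := h.of_dvd (pow_dvd_pow 2 (Nat.le_add_right k 2))
        have h6 : n ≡ 1 [MOD 2 ^ k] := h5.trans (by
          simp [Nat.ModEq])
        rwa [Nat.ModEq.comm, Nat.modEq_iff_dvd' hn] at h6
      have h5 := h4 1
      rw [one_mul] at h5
      simp [chiTwist, h5, h4 3]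
    · rw [if_neg h2]

end divisorSums

section exponentialSums
open ArithmeticFunction

/-- The exponential sum over prime powers. -/
def primeExpSum (N : ℕ) (α : ℝ) : ℂ := ∑ n ∈ Finset.Ioc 0 N, (vonMangoldt n : ℂ) * ec (n * α)

/-- The exponential sum over prime powers weighted by `r₃(n - 1)`. -/
def primeExpSumR3 (D R : ℝ) (N : ℕ) (α : ℝ) : ℂ :=
  ∑ n ∈ Finset.Ioc 0 N, (vonMangoldt n : ℂ) * r3 D R (n - 1) * ec (n * α)

lemma vonMangoldt_mul_r3_eq {D R : ℝ} (hR : 0 < R / D) {n N K : ℕ} (hn : n ∈ Finset.Ioc 0 N)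
    (hK : (N : ℝ) < (K + 1) * (R / D)) :
    vonMangoldt n * r3 D R (n - 1) = ∑ e ∈ Finset.Ioc 0 K,
      if e ∣ n - 1 ∧ min ⌈e * (R / D)⌉₊ N < n then
        vonMangoldt n * chi4 ((n - 1) / e) else 0 := by
  obtain ⟨h0, hN⟩ := Finset.mem_Ioc.mp hn
  by_cases h1 : n - 1 = 0
  · have : n = 1 := by omega
    subst this
    simp
  rw [r3_eq_sum_Ioc hR h1 (lt_of_le_of_lt (by exact_mod_cast (Nat.sub_le n 1).trans hN) hK),
    Finset.mul_sum]
  refine Finset.sum_congr rfl fun e _ => ?_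
  rw [mul_ite, mul_zero]
  have : ⌈e * (R / D)⌉₊ ≤ n - 1 ↔ min ⌈e * (R / D)⌉₊ N < n := by
    rw [min_lt_iff]
    omega
  simp only [this]

lemma norm_primeExpSumR3_le {D R : ℝ} (hR : 0 < R / D) {N K : ℕ}
    (hK : (N : ℝ) < (K + 1) * (R / D)) (k : ℕ) (α : ℝ) :
    ‖primeExpSumR3 D R N α‖ ≤
      ∑ i ∈ Finset.range k, ∑ m ∈ (Finset.Ioc 0 K).filter Odd,
        ‖∑ n ∈ (Finset.Ioc (min ⌈(2 ^ i * m : ℕ) * (R / D)⌉₊ N) N).filter (fun n => n ≡ 1 [MOD m]),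
          (vonMangoldt n : ℂ) * chiTwist i n * ec (n * α)‖ +
      ∑ m ∈ Finset.Ioc 0 K, ∑ n ∈ (Finset.Ioc 0 N).filter (fun n => n ≡ 1 [MOD 2 ^ k * m]),
        vonMangoldt n := by
  set Z : ℕ → ℂ := fun e => ∑ n ∈ Finset.Ioc (min ⌈e * (R / D)⌉₊ N) N,
    (vonMangoldt n : ℂ) * ((if e ∣ n - 1 then chi4 ((n - 1) / e) else 0 : ℝ) : ℂ) * ec (n * α)
    with hZ
  have h1 : primeExpSumR3 D R N α = ∑ e ∈ Finset.Ioc 0 K, Z e := by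
    have h2 : ∀ n ∈ Finset.Ioc 0 N, (vonMangoldt n : ℂ) * r3 D R (n - 1) * ec (n * α) =
        ∑ e ∈ Finset.Ioc 0 K, if min ⌈e * (R / D)⌉₊ N < n then
          (vonMangoldt n : ℂ) * ((if e ∣ n - 1 then chi4 ((n - 1) / e) else 0 : ℝ) : ℂ) *
            ec (n * α) else 0 := by
      intro n hn
      rw [← Complex.ofReal_mul, vonMangoldt_mul_r3_eq hR hn hK, Complex.ofReal_sum,
        Finset.sum_mul]
      refine Finset.sum_congr rfl fun e _ => ?_
      by_cases ha : e ∣ n - 1 <;> by_cases hb : min ⌈e * (R / D)⌉₊ N < n <;> simp [ha, hb]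
    rw [primeExpSumR3, Finset.sum_congr rfl h2, Finset.sum_comm]
    refine Finset.sum_congr rfl fun e _ => ?_
    rw [← Finset.sum_filter]
    refine Finset.sum_congr ?_ fun _ _ => rfl
    ext n
    simp only [Finset.mem_filter, Finset.mem_Ioc]
    omega
  rw [h1]
  refine (norm_sum_le _ _).trans ((sum_Ioc_le_sum_odd_add K k (fun e => ‖Z e‖)
    fun _ => norm_nonneg _).trans (add_le_add ?_ ?_))
  · refine Finset.sum_le_sum fun i _ => Finset.sum_le_sum fun m hm => ?_
    have hodd := (Finset.mem_filter.mp hm).2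
    have h2 : Z (2 ^ i * m) = chi4 m *
        ∑ n ∈ (Finset.Ioc (min ⌈(2 ^ i * m : ℕ) * (R / D)⌉₊ N) N).filter (fun n => n ≡ 1 [MOD m]),
          (vonMangoldt n : ℂ) * chiTwist i n * ec (n * α) := by
      rw [Finset.sum_filter, Finset.mul_sum]
      refine Finset.sum_congr rfl fun n hn => ?_
      rw [chi4_div_eq_chiTwist hodd (by have := (Finset.mem_Ioc.mp hn).1; omega)]
      split_ifs
      · push_cast
        ring
      · simp
    rw [h2, norm_mul, Complex.norm_real]
    exact mul_le_of_le_one_left (norm_nonneg _) (abs_chi4_le m)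
  · refine Finset.sum_le_sum fun m _ => ?_
    refine (norm_sum_le _ _).trans ?_
    rw [Finset.sum_filter]
    refine (Finset.sum_le_sum fun n hn => ?_).trans (Finset.sum_le_sum_of_subset_of_nonneg
      (Finset.Ioc_subset_Ioc_left (Nat.zero_le _)) fun n _ _ => ?_)
    · have hn0 : 0 < n := by have := (Finset.mem_Ioc.mp hn).1; omega
      have hmod : n ≡ 1 [MOD 2 ^ k * m] ↔ 2 ^ k * m ∣ n - 1 := by
        rw [Nat.ModEq.comm, Nat.modEq_iff_dvd' hn0]
      rw [norm_mul, norm_mul, norm_ec, mul_one, Complex.norm_real, Complex.norm_real,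
        Real.norm_of_nonneg vonMangoldt_nonneg]
      simp only [hmod]
      split_ifs
      · exact mul_le_of_le_one_right vonMangoldt_nonneg (abs_chi4_le _)
      · simp
    · split_ifs
      exacts [vonMangoldt_nonneg, le_rfl]

lemma sum_sum_vonMangoldt_modEq_le (N K k : ℕ) :
    ∑ m ∈ Finset.Ioc 0 K, ∑ n ∈ (Finset.Ioc 0 N).filter (fun n => n ≡ 1 [MOD 2 ^ k * m]),
      vonMangoldt n ≤ Real.log N * (N / 2 ^ k * (1 + Real.log K) + K) := by
  have h : ∀ m ∈ Finset.Ioc 0 K,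
      ∑ n ∈ (Finset.Ioc 0 N).filter (fun n => n ≡ 1 [MOD 2 ^ k * m]), vonMangoldt n ≤
      Real.log N * (N / 2 ^ k * (1 / m) + 1) := by
    intro m hm
    have hm0 := (Finset.mem_Ioc.mp hm).1
    have := sum_vonMangoldt_modEq_le (show 0 < 2 ^ k * m by positivity)
      (show 0 + N ≤ N by simp) 1
    rw [zero_add] at this
    refine this.trans_eq ?_
    push_cast
    field_simp
  refine (Finset.sum_le_sum h).trans ?_
  rw [← Finset.mul_sum, Finset.sum_add_distrib, ← Finset.mul_sum]
  have := Real.log_natCast_nonneg N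
  have := sum_Ioc_one_div_le K
  simp only [Finset.sum_const, Nat.card_Ioc, tsub_zero, nsmul_eq_mul, mul_one]
  gcongr

end exponentialSums

section majorArcs
open ArithmeticFunction

lemma two_le_log {x : ℝ} (hx : 8 ≤ x) : 2 ≤ Real.log x := by
  have h1 : Real.log 8 ≤ Real.log x := Real.log_le_log (by norm_num) hx
  have h2 : Real.log 8 = 3 * Real.log 2 := by
    rw [show (8 : ℝ) = 2 ^ 3 by norm_num, Real.log_pow]
    norm_num
  have := Real.log_two_gt_d9
  linarith

lemma ec_nat_mul_rat_congr {t : ℚ} {a b q : ℕ} (hq : t.den ∣ q) (h : a ≡ b [MOD q]) :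
    ec (a * (t : ℝ)) = ec (b * (t : ℝ)) := by
  obtain ⟨c, hc⟩ := (Nat.modEq_iff_dvd.mp (h.of_dvd hq))
  have hden : (t.den : ℝ) ≠ 0 := by exact_mod_cast t.den_ne_zero
  have h1 : (t : ℝ) = t.num / t.den := by exact_mod_cast (Rat.num_div_den t).symm
  have h2 : (b : ℝ) = a + t.den * c := by
    have : (b : ℤ) = a + t.den * c := by omega
    exact_mod_cast this
  have h3 : (b : ℝ) * t = a * t + ((c * t.num : ℤ) : ℝ) := by
    rw [h2, h1]
    push_cast
    field_simp
  rw [h3, ec_add_int]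

lemma ec_add_half_den {t : ℚ} (h4 : 4 ∣ t.den) {n : ℕ} (hn : n.Coprime t.den) :
    ec (((1 + t.den / 2) * n : ℕ) * (t : ℝ)) = -ec (n * (t : ℝ)) := by
  have hden : (t.den : ℝ) ≠ 0 := by exact_mod_cast t.den_ne_zero
  have h1 : (t : ℝ) = t.num / t.den := by exact_mod_cast (Rat.num_div_den t).symm
  have h2 : 2 ∣ t.den := (by norm_num : 2 ∣ 4).trans h4
  have hn2 : Odd n := by
    rw [← Nat.coprime_two_right]
    exact hn.coprime_dvd_right h2
  have ha2 : Odd t.num := by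
    have h3 := t.reduced.coprime_dvd_right h2
    rw [Nat.coprime_two_right] at h3
    exact Int.natAbs_odd.mp h3
  obtain ⟨r, hr⟩ : Odd ((n : ℤ) * t.num) := ((Int.odd_coe_nat n).mpr hn2).mul ha2
  have h5 : (((1 + t.den / 2) * n : ℕ) : ℝ) * t = n * t + (1 / 2 + (r : ℤ)) := by
    have h6 : (n : ℝ) * t.num = 2 * r + 1 := by exact_mod_cast hr
    push_cast [Nat.cast_div h2 (by norm_num : ((2 : ℕ) : ℝ) ≠ 0)]
    rw [add_mul, add_mul, one_mul]
    congr 1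
    rw [h1]
    field_simp
    linarith
  rw [h5, ec_add, ec_add_int]
  have h7 : ec (1 / 2) = -1 := by
    rw [ec, ← Complex.exp_pi_mul_I]
    congr 1
    push_cast
    ring
  rw [h7]
  ring

lemma coprime_add_half_den {q : ℕ} (h4 : 4 ∣ q) : (1 + q / 2).Coprime q := by
  obtain ⟨r, rfl⟩ := h4
  rw [show 1 + 4 * r / 2 = 1 + 2 * r by omega]
  have h1 : (1 + 2 * r).Coprime 4 := by
    have : (1 + 2 * r).Coprime 2 := by rw [Nat.coprime_two_right]; exact ⟨r, by ring⟩
    simpa using Nat.Coprime.pow_right 2 this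
  exact h1.mul_right (by simp [Nat.coprime_comm])

/-- On a major arc whose centre has denominator divisible by `4`, the exponential sum over primes
is small. -/
theorem exists_norm_primeExpSum_le (B : ℕ) : ∃ C : ℝ, 0 < C ∧ ∃ N₀ : ℕ, ∀ N : ℕ, N₀ ≤ N →
    ∀ t : ℚ, 4 ∣ t.den → (t.den : ℝ) ≤ Real.log N ^ B → ∀ β : ℝ, |β| * N ≤ Real.log N ^ B →
    ‖primeExpSum N (t + β)‖ ≤ C * N / Real.log N ^ 6 := by
  obtain ⟨c₀, C, hC, h⟩ := exists_sum_norm_periodic_le 6 B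
  obtain ⟨M, hM0, hM⟩ : ∃ M : ℝ, 0 < M ∧ ∀ x : ℝ, 1 ≤ x → Real.log x ^ (c₀ + 1) ≤ M * √x :=
    ⟨2 ^ (c₀ + 1) * (c₀ + 1).factorial, by positivity, fun x hx => log_pow_le_sqrt x hx _⟩
  have hlog : Filter.Tendsto (fun N : ℕ => Real.log N) Filter.atTop Filter.atTop :=
    Real.tendsto_log_atTop.comp tendsto_natCast_atTop_atTop
  obtain ⟨N₁, hN₁⟩ := Filter.eventually_atTop.mp (hlog.eventually_ge_atTop M)
  refine ⟨C, hC, max 3 N₁, fun N hN t h4 hden β hβ => ?_⟩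
  have hN3 : (3 : ℝ) ≤ N := by exact_mod_cast (le_max_left _ _).trans hN
  have hl : 1 ≤ Real.log N := one_le_log hN3
  have hlM := hN₁ N ((le_max_right _ _).trans hN)
  obtain ⟨j, u, hu, hqu⟩ := Nat.exists_eq_two_pow_mul_odd t.den_ne_zero
  have hj : 1 ≤ j := by
    by_contra hj
    have : j = 0 := by omega
    rw [this, pow_zero, one_mul] at hqu
    rw [hqu] at h4
    obtain ⟨r, rfl⟩ := hu
    omega
  have hv : 1 + t.den / 2 ≡ 1 [MOD u] := by
    obtain ⟨i, rfl⟩ : ∃ i, j = i + 1 := ⟨j - 1, by omega⟩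
    have : t.den / 2 = 2 ^ i * u := by
      rw [hqu, pow_succ, show 2 ^ i * 2 * u = 2 * (2 ^ i * u) by ring,
        Nat.mul_div_cancel_left _ (by norm_num)]
    rw [this]
    simp [Nat.ModEq]
  have h1 : ((1 : ℕ) : ℝ) ≤ √N / Real.log N ^ c₀ := by
    rw [le_div_iff₀ (by positivity), Nat.cast_one, one_mul]
    have h2 := hM N (by linarith)
    rw [pow_succ] at h2
    have h3 : Real.log N ^ c₀ * M ≤ √N * M := by
      calc _ ≤ Real.log N ^ c₀ * Real.log N := by gcongr
        _ ≤ M * √N := h2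
        _ = _ := by ring
    exact le_of_mul_le_mul_right h3 hM0
  have key := h N ((le_max_left _ _).trans hN) t.den u j (1 + t.den / 2) t.pos
    (by rw [mul_comm]; exact hqu) hden hv (coprime_add_half_den h4) (fun n => ec (n * (t : ℝ)))
    (fun n => (norm_ec _).le) (fun a b hab => ec_nat_mul_rat_congr dvd_rfl hab)
    (fun n hn => ec_add_half_den h4 hn) β hβ 1 h1 (fun _ => 0) (fun _ => Nat.zero_le _)
  have h2 : (Finset.Ioc 0 1).filter Odd = {1} := by decide
  rw [h2, Finset.sum_singleton, Finset.filter_true_of_mem fun n _ => Nat.modEq_one] at key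
  refine le_of_eq_of_le ?_ key
  rw [primeExpSum]
  congr 1
  refine Finset.sum_congr rfl fun n _ => ?_
  rw [mul_add, ec_add]
  ring

/-- On a major arc whose centre has denominator not divisible by `4`, the exponential sum over
primes weighted by `r₃` is small. -/
theorem exists_norm_primeExpSumR3_le (B : ℕ) : ∃ c₀ : ℕ, ∃ C : ℝ, 0 < C ∧ ∀ N : ℕ, 8 ≤ N →
    ∀ D : ℝ, 0 < D → D ≤ √N / Real.log N ^ c₀ →
    ∀ t : ℚ, ¬ 4 ∣ t.den → (t.den : ℝ) ≤ Real.log N ^ B → ∀ β : ℝ, |β| * N ≤ Real.log N ^ B →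
    ‖primeExpSumR3 D N N (t + β)‖ ≤ C * N / Real.log N ^ 6 := by
  obtain ⟨c₀, C, hC, h⟩ := exists_sum_norm_periodic_le 14 (B + 10)
  obtain ⟨M, hM0, hM⟩ : ∃ M : ℝ, 0 < M ∧ ∀ x : ℝ, 1 ≤ x → Real.log x ^ 7 ≤ M * √x :=
    ⟨2 ^ 7 * Nat.factorial 7, by positivity, fun x hx => log_pow_le_sqrt x hx _⟩
  refine ⟨c₀, C + 2 + M, by positivity, fun N hN D hD hDN t h4 hden β hβ => ?_⟩
  have hN8 : (8 : ℝ) ≤ N := by exact_mod_cast hN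
  have hl : 2 ≤ Real.log N := two_le_log hN8
  have hsN : √N * √N = (N : ℝ) := Real.mul_self_sqrt (by linarith)
  have hDs : D ≤ √N := hDN.trans (div_le_self (by positivity) (one_le_pow₀ (by linarith)))
  have hKD : ((⌊D⌋₊ : ℕ) : ℝ) ≤ D := Nat.floor_le hD.le
  have hR : (0 : ℝ) < N / D := by positivity
  have hK : (N : ℝ) < ((⌊D⌋₊ : ℕ) + 1) * (N / D) := by
    calc (N : ℝ) = D * (N / D) := by field_simp
      _ < _ := by gcongr; exact Nat.lt_floor_add_one D
  obtain ⟨k, hk1, hk2⟩ := exists_nat_pow_near (show 1 ≤ Real.log N ^ 8 from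
    one_le_pow₀ (by linarith)) (show (1 : ℝ) < 2 by norm_num)
  refine (norm_primeExpSumR3_le hR hK (k + 1) (t + β)).trans ?_
  have hmain : ∀ i ∈ Finset.range (k + 1), ∑ m ∈ (Finset.Ioc 0 ⌊D⌋₊).filter Odd,
      ‖∑ n ∈ (Finset.Ioc (min ⌈(2 ^ i * m : ℕ) * (N / D)⌉₊ N) N).filter (fun n => n ≡ 1 [MOD m]),
        (vonMangoldt n : ℂ) * chiTwist i n * ec (n * (t + β))‖ ≤ C * N / Real.log N ^ 14 := by
    intro i hi
    obtain ⟨j, u, hu, hqu⟩ := Nat.exists_eq_two_pow_mul_odd t.den_ne_zero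
    have hj : j ≤ 1 := by
      by_contra hj
      apply h4
      rw [hqu, show j = (j - 2) + 2 by omega, pow_add]
      exact ⟨2 ^ (j - 2) * u, by ring⟩
    obtain ⟨v, hvu, hv2⟩ := Nat.chineseRemainder
      (Nat.Coprime.pow_right (i + 2) (Nat.coprime_two_right.mpr hu)) 1 (1 + 2 ^ (i + 1))
    have hv2' : v ≡ 1 [MOD 2] := by
      refine (hv2.of_dvd (dvd_pow_self 2 (by omega))).trans ?_
      rw [pow_succ]
      simp [Nat.ModEq]
    have hvodd : Odd v := Nat.odd_iff.mpr hv2'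
    have hq0 : 0 < u * 2 ^ (i + 2) := Nat.mul_pos hu.pos (by positivity)
    have hvq : v.Coprime (u * 2 ^ (i + 2)) := by
      refine Nat.Coprime.mul_right ?_ (Nat.Coprime.pow_right _ (Nat.coprime_two_right.mpr hvodd))
      have h1 := hvu.gcd_eq
      rwa [Nat.gcd_one_left] at h1
    have hdvd : t.den ∣ u * 2 ^ 1 := by
      rw [hqu, mul_comm]
      exact mul_dvd_mul_left u (pow_dvd_pow 2 hj)
    have hdvd' : t.den ∣ u * 2 ^ (i + 2) :=
      hdvd.trans (mul_dvd_mul_left u (pow_dvd_pow 2 (by omega)))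
    have hqE : ((u * 2 ^ (i + 2) : ℕ) : ℝ) ≤ Real.log N ^ (B + 10) := by
      have h1 : (u : ℝ) ≤ Real.log N ^ B := by
        refine le_trans ?_ hden
        rw [hqu]
        exact_mod_cast Nat.le_mul_of_pos_left u (by positivity)
      have h2 : (2 : ℝ) ^ (i + 2) ≤ Real.log N ^ 8 * 2 ^ 2 := by
        rw [pow_add]
        gcongr
        refine le_trans ?_ hk1
        exact pow_le_pow_right₀ (by norm_num) (by have := Finset.mem_range.mp hi; omega)
      push_cast
      calc (u : ℝ) * 2 ^ (i + 2) ≤ Real.log N ^ B * (Real.log N ^ 8 * 2 ^ 2) := by gcongr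
        _ ≤ Real.log N ^ B * (Real.log N ^ 8 * Real.log N ^ 2) := by gcongr
        _ = _ := by ring
    have hvn : ∀ n : ℕ, v * n ≡ n [MOD u * 2 ^ 1] := by
      intro n
      have h1 : v ≡ 1 [MOD u * 2 ^ 1] := by
        rw [← Nat.modEq_and_modEq_iff_modEq_mul
          (Nat.Coprime.pow_right 1 (Nat.coprime_two_right.mpr hu))]
        exact ⟨hvu, by simpa using hv2'⟩
      simpa using h1.mul_right n
    have hβ' : |β| * N ≤ Real.log N ^ (B + 10) :=
      hβ.trans (pow_le_pow_right₀ (by linarith) (by omega))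
    have key := h N (by omega) (u * 2 ^ (i + 2)) u (i + 2) v hq0 rfl hqE hvu hvq
      (fun n => chiTwist i n * ec (n * (t : ℝ))) (fun n => by
        rw [norm_mul, norm_ec, mul_one, Complex.norm_real]
        exact abs_chiTwist_le i n)
      (fun a b hab => by
        rw [ec_nat_mul_rat_congr hdvd' hab, chiTwist_congr (hab.of_dvd (dvd_mul_left _ _))])
      (fun n hn => by
        have hno : Odd n := by
          rw [← Nat.coprime_two_right]
          exact hn.coprime_dvd_right ((dvd_pow_self 2 (by omega)).trans (dvd_mul_left _ _))
        rw [ec_nat_mul_rat_congr hdvd (hvn n), chiTwist_mul hno hv2]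
        push_cast
        ring)
      β hβ' ⌊D⌋₊ (hKD.trans hDN) (fun m => min ⌈(2 ^ i * m : ℕ) * (N / D)⌉₊ N)
      (fun m => min_le_right _ _)
    refine le_of_eq_of_le (Finset.sum_congr rfl fun m _ => ?_) key
    congr 1
    refine Finset.sum_congr rfl fun n _ => ?_
    rw [mul_add, ec_add]
    ring
  have h1 := Finset.sum_le_sum hmain
  rw [Finset.sum_const, Finset.card_range, nsmul_eq_mul] at h1
  have h2 := sum_sum_vonMangoldt_modEq_le N ⌊D⌋₊ (k + 1)
  have h3 : ((k + 1 : ℕ) : ℝ) ≤ Real.log N ^ 8 := by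
    refine le_trans ?_ hk1
    exact_mod_cast Nat.lt_two_pow_self
  have h4 : Real.log (⌊D⌋₊ : ℕ) ≤ Real.log N := by
    rcases Nat.eq_zero_or_pos ⌊D⌋₊ with h0 | h0
    · rw [h0, Nat.cast_zero, Real.log_zero]
      linarith
    · refine Real.log_le_log (by exact_mod_cast h0) ?_
      have : √(N : ℝ) ≤ N := by
        rw [Real.sqrt_le_left (by linarith)]
        nlinarith
      linarith
  have hM7 := hM N (by linarith)
  have hKs : ((⌊D⌋₊ : ℕ) : ℝ) ≤ √N := hKD.trans hDs
  clear h hM hmain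
  have hlK : 0 ≤ Real.log (⌊D⌋₊ : ℕ) := Real.log_natCast_nonneg _
  generalize Real.log (⌊D⌋₊ : ℕ) = κ at *
  generalize ((⌊D⌋₊ : ℕ) : ℝ) = K at *
  generalize Real.log N = ℓ at *
  have hl0 : 0 < ℓ := by linarith
  have h5 : ((k + 1 : ℕ) : ℝ) * (C * N / ℓ ^ 14) ≤ C * N / ℓ ^ 6 := by
    calc _ ≤ ℓ ^ 8 * (C * N / ℓ ^ 14) := by gcongr
      _ = _ := by field_simp
  have h6 : ℓ * (N / 2 ^ (k + 1) * (1 + κ) + K) ≤ (2 + M) * N / ℓ ^ 6 := by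
    calc _ ≤ ℓ * (N / ℓ ^ 8 * (ℓ + ℓ) + √N) := by
          gcongr
          linarith
      _ = 2 * N / ℓ ^ 6 + ℓ * √N := by field_simp; ring
      _ ≤ 2 * N / ℓ ^ 6 + M * N / ℓ ^ 6 := by
          gcongr
          rw [le_div_iff₀ (by positivity)]
          calc ℓ * √N * ℓ ^ 6 = ℓ ^ 7 * √N := by ring
            _ ≤ M * √N * √N := by gcongr
            _ = M * (√N * √N) := by ring
            _ = M * N := by rw [hsN]
      _ = _ := by ring
  calc _ ≤ C * N / ℓ ^ 6 + (2 + M) * N / ℓ ^ 6 := by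
        exact add_le_add (h1.trans h5) (h2.trans h6)
    _ = _ := by ring

end majorArcs

section dichotomy
open ArithmeticFunction

/-- The exponential sum over primes is small on the minor arcs. -/
lemma norm_primeExpSum_minor_le {N : ℕ} (hN : 8 ≤ N) {α : ℝ} {t : ℚ}
    (h : |α - t| ≤ 1 / (t.den : ℝ) ^ 2) (h1 : Real.log N ^ 50 < t.den)
    (h2 : (t.den : ℝ) ≤ N / Real.log N ^ 50) :
    ‖primeExpSum N α‖ ≤ 220 * N / Real.log N ^ 6 := by
  have hN8 : (8 : ℝ) ≤ N := by exact_mod_cast hN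
  have hl : 2 ≤ Real.log N := two_le_log hN8
  have hl1 : 1 ≤ Real.log N := by linarith
  have hx1 : 1 ≤ Real.log N ^ 20 := one_le_pow₀ hl1
  have hU1 : 1 ≤ ⌊Real.log N ^ 20⌋₊ := Nat.le_floor (by exact_mod_cast hx1)
  have hUle : ((⌊Real.log N ^ 20⌋₊ : ℕ) : ℝ) ≤ Real.log N ^ 20 := Nat.floor_le (by positivity)
  have hUge := Nat.lt_floor_add_one (Real.log N ^ 20)
  have hU1' : (1 : ℝ) ≤ (⌊Real.log N ^ 20⌋₊ : ℕ) := by exact_mod_cast hU1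
  have hUq : 2 * ⌊Real.log N ^ 20⌋₊ ^ 2 ≤ t.den := by
    have : 2 * ((⌊Real.log N ^ 20⌋₊ : ℕ) : ℝ) ^ 2 ≤ t.den := by
      calc _ ≤ Real.log N * (Real.log N ^ 20) ^ 2 := by gcongr
        _ = Real.log N ^ 41 := by ring
        _ ≤ Real.log N ^ 50 := pow_le_pow_right₀ hl1 (by norm_num)
        _ ≤ _ := h1.le
    exact_mod_cast this
  refine (norm_sum_vonMangoldt_ec_le h hU1 hUq (by omega)).trans ?_
  generalize ((⌊Real.log N ^ 20⌋₊ : ℕ) : ℝ) = U at *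
  have hq0 : (0 : ℝ) < t.den := by exact_mod_cast t.den_pos
  generalize (t.den : ℝ) = q at *
  generalize Real.log N = ℓ at *
  have hl0 : 0 < ℓ := by linarith
  have ha : 4 * U ^ 2 * q * ℓ ≤ 4 * N / ℓ ^ 6 := by
    calc _ ≤ 4 * (ℓ ^ 20) ^ 2 * (N / ℓ ^ 50) * ℓ := by gcongr
      _ = 4 * N / ℓ ^ 9 := by field_simp
      _ ≤ 4 * N / ℓ ^ 6 := by
          gcongr
          norm_num
  have hb1 : 1 / q ≤ 1 / ℓ ^ 20 := by
    apply one_div_le_one_div_of_le (by positivity)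
    exact (pow_le_pow_right₀ hl1 (by norm_num)).trans h1.le
  have hb2 : 1 / U ≤ 2 / ℓ ^ 20 := by
    rw [div_le_div_iff₀ (by linarith) (by positivity)]
    linarith
  have hb3 : q / N ≤ 1 / ℓ ^ 20 := by
    rw [div_le_iff₀ (by linarith)]
    calc q ≤ N / ℓ ^ 50 := h2
      _ ≤ N / ℓ ^ 20 := by
          gcongr
          norm_num
      _ = _ := by ring
  have hb : √(80 * (1 / q + 1 / U + q / N)) ≤ 18 / ℓ ^ 10 := by
    apply Real.sqrt_le_iff.mpr ⟨by positivity, ?_⟩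
    calc _ ≤ 80 * (1 / ℓ ^ 20 + 2 / ℓ ^ 20 + 1 / ℓ ^ 20) := by gcongr
      _ = 320 / ℓ ^ 20 := by ring
      _ ≤ 324 / ℓ ^ 20 := by gcongr; norm_num
      _ = _ := by ring
  calc _ ≤ 4 * N / ℓ ^ 6 + 12 * ℓ ^ 3 * (N * (18 / ℓ ^ 10)) := by gcongr
    _ = 4 * N / ℓ ^ 6 + 216 * N / ℓ ^ 7 := by field_simp; ring
    _ ≤ 4 * N / ℓ ^ 6 + 216 * N / ℓ ^ 6 := by
        gcongr
        norm_num
    _ = _ := by ring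

/-- At every frequency, one of the two exponential sums is small. -/
theorem exists_primeExpSum_dichotomy : ∃ c₀ : ℕ, ∃ C : ℝ, 0 < C ∧ ∃ N₀ : ℕ, ∀ N : ℕ, N₀ ≤ N →
    ∀ D : ℝ, 0 < D → D ≤ √N / Real.log N ^ c₀ → ∀ α : ℝ,
    ‖primeExpSum N α‖ ≤ C * N / Real.log N ^ 6 ∨
      ‖primeExpSumR3 D N N α‖ ≤ C * N / Real.log N ^ 6 := by
  obtain ⟨C₁, hC₁, N₁, h₁⟩ := exists_norm_primeExpSum_le 50
  obtain ⟨c₀, C₂, hC₂, h₂⟩ := exists_norm_primeExpSumR3_le 50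
  obtain ⟨M, hM0, hM⟩ : ∃ M : ℝ, 0 < M ∧ ∀ x : ℝ, 1 ≤ x → Real.log x ^ 50 ≤ M * √x :=
    ⟨2 ^ 50 * Nat.factorial 50, by positivity, fun x hx => log_pow_le_sqrt x hx _⟩
  refine ⟨c₀, 220 + C₁ + C₂, by positivity, max (max 8 N₁) ⌈M ^ 2⌉₊, fun N hN D hD hDN α => ?_⟩
  have hN8 : 8 ≤ N := (le_max_left _ _).trans ((le_max_left _ _).trans hN)
  have hN1 : N₁ ≤ N := (le_max_right _ _).trans ((le_max_left _ _).trans hN)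
  have hNM : M ^ 2 ≤ N := (Nat.le_ceil _).trans (by exact_mod_cast (le_max_right _ _).trans hN)
  have hN8' : (8 : ℝ) ≤ N := by exact_mod_cast hN8
  have hl : 2 ≤ Real.log N := two_le_log hN8'
  have hl0 : 0 < Real.log N := by linarith
  have hsN : √N * √N = (N : ℝ) := Real.mul_self_sqrt (by linarith)
  have hLN : 1 ≤ N / Real.log N ^ 50 := by
    rw [le_div_iff₀ (by positivity), one_mul]
    refine (hM N (by linarith)).trans ?_
    calc M * √N ≤ √N * √N := by
          gcongr
          exact Real.le_sqrt_of_sq_le hNM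
      _ = _ := hsN
  obtain ⟨t, ht1, ht2⟩ := Real.exists_rat_abs_sub_le_and_den_le α
    (Nat.floor_pos.mpr hLN)
  have hq0 : (0 : ℝ) < t.den := by exact_mod_cast t.den_pos
  have hfl : ((⌊N / Real.log N ^ 50⌋₊ : ℕ) : ℝ) ≤ N / Real.log N ^ 50 := Nat.floor_le (by positivity)
  have hfu := Nat.lt_floor_add_one (N / Real.log N ^ 50)
  have hqf : (t.den : ℝ) ≤ (⌊N / Real.log N ^ 50⌋₊ : ℕ) := by exact_mod_cast ht2
  have hmono : ∀ c : ℝ, c ≤ 220 + C₁ + C₂ → ∀ x : ℝ, x ≤ c * N / Real.log N ^ 6 →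
      x ≤ (220 + C₁ + C₂) * N / Real.log N ^ 6 := fun c hc x hx => hx.trans (by gcongr)
  by_cases hq : Real.log N ^ 50 < t.den
  · left
    refine hmono 220 (by linarith) _ (norm_primeExpSum_minor_le hN8 (ht1.trans ?_) hq
      (hqf.trans hfl))
    rw [sq]
    gcongr
    linarith
  · have hβ : |α - t| * N ≤ Real.log N ^ 50 := by
      calc _ ≤ 1 / ((N / Real.log N ^ 50) * 1) * N := by
            gcongr
            refine ht1.trans ?_
            have : (1 : ℝ) ≤ t.den := by exact_mod_cast t.den_pos
            gcongr
        _ = _ := by field_simp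
    have hα : α = t + (α - t) := by ring
    by_cases h4 : 4 ∣ t.den
    · left
      have := h₁ N hN1 t h4 (not_lt.mp hq) (α - t) hβ
      rw [← hα] at this
      exact hmono C₁ (by linarith) _ this
    · right
      have := h₂ N hN8 D hD hDN t h4 (not_lt.mp hq) (α - t) hβ
      rw [← hα] at this
      exact hmono C₂ (by linarith) _ this

end dichotomy

section circleMethod

/-- Parseval's identity for trigonometric polynomials sampled at the points `h / M`. -/
lemma sum_norm_sq_trig_eq {K M : ℕ} (hM : 0 < M) (hK : K ≤ M) (a : ℕ → ℂ) :
    ∑ h ∈ Finset.range M, ‖∑ n ∈ Finset.range K, a n * ec (n * (h / M : ℝ))‖ ^ 2 =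
      M * ∑ n ∈ Finset.range K, ‖a n‖ ^ 2 := by
  have hMr : (M : ℝ) ≠ 0 := by positivity
  have h1 : ∀ h : ℕ, ((‖∑ n ∈ Finset.range K, a n * ec (n * (h / M : ℝ))‖ ^ 2 : ℝ) : ℂ) =
      ∑ n ∈ Finset.range K, ∑ m ∈ Finset.range K, a n * (starRingEnd ℂ) (a m) *
        ec (h * (((n - m : ℤ) : ℝ) / M)) := by
    intro h
    rw [Complex.ofReal_pow, ← Complex.mul_conj', map_sum, Finset.sum_mul_sum]
    refine Finset.sum_congr rfl fun n _ => Finset.sum_congr rfl fun m _ => ?_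
    rw [map_mul, ← ec_neg]
    have h2 : (h : ℝ) * (((n - m : ℤ) : ℝ) / M) = n * (h / M) + -(m * (h / M)) := by
      push_cast
      ring
    rw [h2, ec_add]
    ring
  have h3 : ((∑ h ∈ Finset.range M, ‖∑ n ∈ Finset.range K, a n * ec (n * (h / M : ℝ))‖ ^ 2 : ℝ) : ℂ)
      = ((M * ∑ n ∈ Finset.range K, ‖a n‖ ^ 2 : ℝ) : ℂ) := by
    rw [Complex.ofReal_sum, Finset.sum_congr rfl fun h _ => h1 h, Finset.sum_comm,
      Complex.ofReal_mul, Complex.ofReal_sum, Finset.mul_sum]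
    refine Finset.sum_congr rfl fun n hn => ?_
    rw [Finset.sum_comm]
    simp_rw [← Finset.mul_sum, sum_range_ec_div hM]
    rw [Finset.sum_eq_single_of_mem n hn]
    · simp only [sub_self, dvd_zero, if_true]
      rw [Complex.mul_conj', Complex.ofReal_pow, Complex.ofReal_natCast]
      ring
    · intro m hm hmn
      rw [if_neg, mul_zero]
      intro hd
      have hn' := Finset.mem_range.mp hn
      have hm' := Finset.mem_range.mp hm
      have := Int.eq_zero_of_abs_lt_dvd hd (by rw [abs_lt]; constructor <;> omega)
      omega
  exact_mod_cast h3

lemma sum_mul_sum_trig_eq (N : ℕ) (f g : ℕ → ℝ) (α : ℝ) :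
    (∑ n ∈ Finset.range (N + 1), (f n : ℂ) * ec (n * α)) *
      (∑ n ∈ Finset.range (N + 1), (g n : ℂ) * ec (n * α)) =
    ∑ k ∈ Finset.range (2 * N + 1), ((∑ b ∈ Finset.range (N + 1), ∑ c ∈ Finset.range (N + 1),
      if b + c = k then f b * g c else 0 : ℝ) : ℂ) * ec (k * α) := by
  rw [Finset.sum_mul_sum]
  simp_rw [Complex.ofReal_sum, Finset.sum_mul]
  rw [Finset.sum_comm (s := Finset.range (2 * N + 1))]
  refine Finset.sum_congr rfl fun b hb => ?_
  rw [Finset.sum_comm (s := Finset.range (2 * N + 1))]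
  refine Finset.sum_congr rfl fun c hc => ?_
  have hb' := Finset.mem_range.mp hb
  have hc' := Finset.mem_range.mp hc
  rw [Finset.sum_eq_single_of_mem (b + c) (Finset.mem_range.mpr (by omega))]
  · rw [if_pos rfl, Nat.cast_add, add_mul, ec_add]
    push_cast
    ring
  · intro k _ hk
    rw [if_neg (Ne.symm hk), Complex.ofReal_zero, zero_mul]

/-- A bound for a ternary convolution when at each frequency one of two of the exponential sums
is small. -/
theorem ternary_sq_le (N : ℕ) (u f g : ℕ → ℝ) {η : ℝ} (hη : ∀ α : ℝ,
      ‖∑ n ∈ Finset.range (N + 1), (g n : ℂ) * ec (n * α)‖ ≤ η ∨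
      ‖∑ n ∈ Finset.range (N + 1), (f n : ℂ) * ec (n * α)‖ ≤ η) :
    (∑ a ∈ Finset.range (N + 1), ∑ b ∈ Finset.range (N + 1), ∑ c ∈ Finset.range (N + 1),
      if a + b + c = N then u a * f b * g c else 0) ^ 2 ≤
    (∑ n ∈ Finset.range (N + 1), u n ^ 2) * (η ^ 2 *
      (∑ n ∈ Finset.range (N + 1), f n ^ 2 + ∑ n ∈ Finset.range (N + 1), g n ^ 2)) := by
  set G : ℕ → ℝ := fun k => ∑ b ∈ Finset.range (N + 1), ∑ c ∈ Finset.range (N + 1),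
    if b + c = k then f b * g c else 0 with hG
  have h1 : (∑ a ∈ Finset.range (N + 1), ∑ b ∈ Finset.range (N + 1), ∑ c ∈ Finset.range (N + 1),
      if a + b + c = N then u a * f b * g c else 0) =
      ∑ a ∈ Finset.range (N + 1), u a * G (N - a) := by
    refine Finset.sum_congr rfl fun a ha => ?_
    have ha' := Finset.mem_range.mp ha
    simp only [hG, Finset.mul_sum]
    refine Finset.sum_congr rfl fun b _ => Finset.sum_congr rfl fun c _ => ?_
    have : a + b + c = N ↔ b + c = N - a := by omega
    simp only [this, mul_ite, mul_zero, mul_assoc]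
  have h2 : ∑ a ∈ Finset.range (N + 1), G (N - a) ^ 2 ≤
      ∑ k ∈ Finset.range (2 * N + 1), G k ^ 2 := by
    have h := Finset.sum_range_reflect (fun k => G k ^ 2) (N + 1)
    simp only [Nat.add_sub_cancel] at h
    rw [h]
    exact Finset.sum_le_sum_of_subset_of_nonneg (Finset.range_mono (by omega))
      fun _ _ _ => sq_nonneg _
  have h3 : (2 * N + 1 : ℕ) * ∑ k ∈ Finset.range (2 * N + 1), G k ^ 2 ≤
      (2 * N + 1 : ℕ) * (η ^ 2 * (∑ n ∈ Finset.range (N + 1), f n ^ 2 +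
        ∑ n ∈ Finset.range (N + 1), g n ^ 2)) := by
    have hp : ∀ (K : ℕ) (_ : K ≤ 2 * N + 1) (w : ℕ → ℝ),
        (2 * N + 1 : ℕ) * ∑ n ∈ Finset.range K, w n ^ 2 = ∑ h ∈ Finset.range (2 * N + 1),
          ‖∑ n ∈ Finset.range K, (w n : ℂ) * ec (n * (h / (2 * N + 1 : ℕ) : ℝ))‖ ^ 2 := by
      intro K hK w
      rw [sum_norm_sq_trig_eq (Nat.succ_pos _) hK]
      congr 1
      refine Finset.sum_congr rfl fun n _ => ?_
      rw [Complex.norm_real, Real.norm_eq_abs, sq_abs]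
    have hr : (2 * N + 1 : ℕ) * (η ^ 2 * (∑ n ∈ Finset.range (N + 1), f n ^ 2 +
        ∑ n ∈ Finset.range (N + 1), g n ^ 2)) =
        η ^ 2 * ((2 * N + 1 : ℕ) * ∑ n ∈ Finset.range (N + 1), f n ^ 2 +
          (2 * N + 1 : ℕ) * ∑ n ∈ Finset.range (N + 1), g n ^ 2) := by ring
    rw [hr, hp _ le_rfl G, hp _ (by omega) f, hp _ (by omega) g, ← Finset.sum_add_distrib,
      Finset.mul_sum]
    refine Finset.sum_le_sum fun h _ => ?_
    rw [← sum_mul_sum_trig_eq, norm_mul, mul_pow]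
    rcases hη (h / (2 * N + 1 : ℕ) : ℝ) with h4 | h4
    · have h5 := pow_le_pow_left₀ (norm_nonneg _) h4 2
      nlinarith [sq_nonneg ‖∑ n ∈ Finset.range (N + 1),
        (f n : ℂ) * ec (n * (h / (2 * N + 1 : ℕ) : ℝ))‖, sq_nonneg (η * ‖∑ n ∈
          Finset.range (N + 1), (g n : ℂ) * ec (n * (h / (2 * N + 1 : ℕ) : ℝ))‖)]
    · have h5 := pow_le_pow_left₀ (norm_nonneg _) h4 2
      nlinarith [sq_nonneg ‖∑ n ∈ Finset.range (N + 1),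
        (g n : ℂ) * ec (n * (h / (2 * N + 1 : ℕ) : ℝ))‖, sq_nonneg (η * ‖∑ n ∈
          Finset.range (N + 1), (f n : ℂ) * ec (n * (h / (2 * N + 1 : ℕ) : ℝ))‖)]
  have h4 := le_of_mul_le_mul_left h3 (by positivity)
  rw [h1]
  refine (Finset.sum_mul_sq_le_sq_mul_sq _ _ _).trans ?_
  exact mul_le_mul_of_nonneg_left (h2.trans h4) (Finset.sum_nonneg fun _ _ => sq_nonneg _)

end circleMethod

section primesVersusPrimePowers
open ArithmeticFunction

/-- The logarithm restricted to primes. -/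
def primeLog (n : ℕ) : ℝ := if n.Prime then Real.log n else 0

lemma primeLog_nonneg (n : ℕ) : 0 ≤ primeLog n := by
  unfold primeLog
  split_ifs
  exacts [Real.log_natCast_nonneg n, le_rfl]

lemma primeLog_le {n N : ℕ} (h : n ≤ N) : primeLog n ≤ Real.log N := by
  unfold primeLog
  split_ifs with hp
  · exact Real.log_le_log (by exact_mod_cast hp.pos) (by exact_mod_cast h)
  · exact Real.log_natCast_nonneg N

lemma vonMangoldt_sub_primeLog (n : ℕ) :
    vonMangoldt n - primeLog n = if n.Prime then 0 else vonMangoldt n := by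
  unfold primeLog
  split_ifs with h
  · rw [vonMangoldt_apply_prime h, sub_self]
  · rw [sub_zero]

lemma sum_vonMangoldt_not_prime_le {N : ℕ} (hN : 1 ≤ N) :
    ∑ n ∈ Finset.Ioc 0 N, (if n.Prime then 0 else vonMangoldt n) ≤ 2 * √N * Real.log N := by
  have h1 := Chebyshev.psi_sub_theta_eq_sum_not_prime (N : ℝ)
  have h2 := Chebyshev.psi_sub_theta_le (show (1 : ℝ) ≤ N by exact_mod_cast hN)
  rw [h1, Nat.floor_natCast, Finset.sum_filter] at h2
  refine le_of_eq_of_le (Finset.sum_congr rfl fun n _ => ?_) h2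
  split_ifs <;> rfl

lemma sum_card_divisors_pred_sq_le (N : ℕ) :
    ∑ n ∈ Finset.Ioc 0 N, ((n - 1).divisors.card : ℝ) ^ 2 ≤ N * (1 + Real.log N) ^ 3 := by
  refine le_trans ?_ (sum_card_divisors_sq_le N)
  rw [sum_Ioc_eq_sum_range]
  simp only [Nat.add_sub_cancel]
  have h : Finset.range N ⊆ insert 0 (Finset.Ioc 0 N) := by
    intro n hn
    have := Finset.mem_range.mp hn
    simp only [Finset.mem_insert, Finset.mem_Ioc]
    omega
  refine (Finset.sum_le_sum_of_subset_of_nonneg h fun _ _ _ => sq_nonneg _).trans_eq ?_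
  rw [Finset.sum_insert (by simp)]
  simp

lemma sum_range_primeLog_eq (N : ℕ) (w : ℕ → ℝ) (α : ℝ) :
    ∑ n ∈ Finset.range (N + 1), ((w n * primeLog n : ℝ) : ℂ) * ec (n * α) =
      ∑ n ∈ Finset.Ioc 0 N, ((w n * primeLog n : ℝ) : ℂ) * ec (n * α) := by
  rw [Finset.sum_range_succ', sum_Ioc_eq_sum_range]
  simp [primeLog]

lemma norm_sum_sub_sum_primeLog_le (N : ℕ) (w : ℕ → ℝ) (α : ℝ) :
    ‖∑ n ∈ Finset.Ioc 0 N, ((w n * primeLog n : ℝ) : ℂ) * ec (n * α) -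
      ∑ n ∈ Finset.Ioc 0 N, ((w n * vonMangoldt n : ℝ) : ℂ) * ec (n * α)‖ ≤
    ∑ n ∈ Finset.Ioc 0 N, |w n| * (if n.Prime then 0 else vonMangoldt n) := by
  rw [← Finset.sum_sub_distrib]
  refine (norm_sum_le _ _).trans (Finset.sum_le_sum fun n _ => ?_)
  rw [← sub_mul, ← Complex.ofReal_sub, norm_mul, norm_ec, mul_one, Complex.norm_real,
    ← mul_sub, norm_mul, Real.norm_eq_abs, norm_sub_rev, vonMangoldt_sub_primeLog]
  refine mul_le_mul_of_nonneg_left (le_of_eq ?_) (abs_nonneg _)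
  split_ifs
  · simp
  · exact Real.norm_of_nonneg vonMangoldt_nonneg

lemma sum_r3_mul_not_prime_sq_le {N : ℕ} (hN : 1 ≤ N) (D R : ℝ) :
    (∑ n ∈ Finset.Ioc 0 N, |r3 D R (n - 1)| * (if n.Prime then 0 else vonMangoldt n)) ^ 2 ≤
      N * (1 + Real.log N) ^ 3 * (Real.log N * (2 * √N * Real.log N)) := by
  have hl := Real.log_natCast_nonneg N
  refine (Finset.sum_mul_sq_le_sq_mul_sq _ _ _).trans ?_
  gcongr
  · refine le_trans (Finset.sum_le_sum fun n _ => ?_) (sum_card_divisors_pred_sq_le N)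
    exact pow_le_pow_left₀ (abs_nonneg _) (abs_r3_le _ _ _) 2
  · refine le_trans ?_ (mul_le_mul_of_nonneg_left (sum_vonMangoldt_not_prime_le hN) hl)
    rw [Finset.mul_sum]
    refine Finset.sum_le_sum fun n hn => ?_
    split_ifs
    · simp
    · rw [sq]
      refine mul_le_mul_of_nonneg_right (vonMangoldt_le_log.trans ?_) vonMangoldt_nonneg
      obtain ⟨h0, h1⟩ := Finset.mem_Ioc.mp hn
      exact Real.log_le_log (by exact_mod_cast h0) (by exact_mod_cast h1)

lemma sum_mul_primeLog_sq_le (N : ℕ) {w : ℕ → ℝ} (hw : ∀ n, |w n| ≤ (n - 1).divisors.card) :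
    ∑ n ∈ Finset.range (N + 1), (w n * primeLog n) ^ 2 ≤
      N * (1 + Real.log N) ^ 3 * Real.log N ^ 2 := by
  rw [Finset.sum_range_succ', ← sum_Ioc_eq_sum_range (fun n => (w n * primeLog n) ^ 2)]
  have h0 : (w 0 * primeLog 0) ^ 2 = 0 := by simp [primeLog]
  rw [h0, add_zero]
  refine le_trans ?_ (mul_le_mul_of_nonneg_right (sum_card_divisors_pred_sq_le N) (sq_nonneg _))
  rw [Finset.sum_mul]
  refine Finset.sum_le_sum fun n hn => ?_
  rw [mul_pow]
  refine mul_le_mul ?_ ?_ (sq_nonneg _) (sq_nonneg _)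
  · rw [← sq_abs]
    exact pow_le_pow_left₀ (abs_nonneg _) (hw n) 2
  · exact pow_le_pow_left₀ (primeLog_nonneg n) (primeLog_le (Finset.mem_Ioc.mp hn).2) 2

lemma sum_primeLog_sq_le (N : ℕ) :
    ∑ n ∈ Finset.range (N + 1), primeLog n ^ 2 ≤ N * Real.log N ^ 2 := by
  rw [Finset.sum_range_succ', ← sum_Ioc_eq_sum_range (fun n => primeLog n ^ 2)]
  have h0 : primeLog 0 ^ 2 = 0 := by simp [primeLog]
  rw [h0, add_zero]
  refine (Finset.sum_le_card_nsmul _ _ (Real.log N ^ 2) fun n hn => ?_).trans_eq (by simp)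
  exact pow_le_pow_left₀ (primeLog_nonneg n) (primeLog_le (Finset.mem_Ioc.mp hn).2) 2

lemma tripleSum_eq (N : ℕ) (w₁ w₂ : ℕ → ℝ) :
    tripleSum N w₁ w₂ = ∑ a ∈ Finset.range (N + 1), ∑ b ∈ Finset.range (N + 1),
      ∑ c ∈ Finset.range (N + 1), if a + b + c = N then
        (w₁ a * primeLog a) * (w₂ b * primeLog b) * primeLog c else 0 := by
  refine Finset.sum_congr rfl fun a _ => Finset.sum_congr rfl fun b _ =>
    Finset.sum_congr rfl fun c _ => ?_
  unfold primeLog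
  by_cases h1 : a.Prime <;> by_cases h2 : b.Prime <;> by_cases h3 : c.Prime <;>
    simp only [h1, h2, h3, if_true, if_false, true_and, false_and, mul_zero, zero_mul, ite_self]
  split_ifs <;> ring

/-- At every frequency, one of the two exponential sums over primes is small. -/
theorem exists_primeLog_dichotomy : ∃ c₀ : ℕ, ∃ C : ℝ, 0 < C ∧ ∃ N₀ : ℕ, ∀ N : ℕ, N₀ ≤ N →
    ∀ D : ℝ, 0 < D → D ≤ √N / Real.log N ^ c₀ → ∀ α : ℝ,
    ‖∑ n ∈ Finset.range (N + 1), (primeLog n : ℂ) * ec (n * α)‖ ≤ C * N / Real.log N ^ 6 ∨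
    ‖∑ n ∈ Finset.range (N + 1), ((r3 D N (n - 1) * primeLog n : ℝ) : ℂ) * ec (n * α)‖ ≤
      C * N / Real.log N ^ 6 := by
  obtain ⟨c₀, C, hC, N₀, h⟩ := exists_primeExpSum_dichotomy
  obtain ⟨M, hM0, hM⟩ : ∃ M : ℝ, 0 < M ∧ ∀ x : ℝ, 1 ≤ x → Real.log x ^ 17 ≤ M * √x :=
    ⟨2 ^ 17 * Nat.factorial 17, by positivity, fun x hx => log_pow_le_sqrt x hx _⟩
  refine ⟨c₀, C + (2 * M + √(16 * M)), by positivity, max 8 N₀, fun N hN D hD hDN α => ?_⟩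
  have hN8 : 8 ≤ N := (le_max_left _ _).trans hN
  have hN8' : (8 : ℝ) ≤ N := by exact_mod_cast hN8
  have hl : 2 ≤ Real.log N := two_le_log hN8'
  have hl0 : 0 < Real.log N := by linarith
  have hl1 : 1 ≤ Real.log N := by linarith
  have hsN : √N * √N = (N : ℝ) := Real.mul_self_sqrt (by linarith)
  have hM17 := hM N (by linarith)
  have hM7 : Real.log N ^ 7 ≤ M * √N := (pow_le_pow_right₀ hl1 (by norm_num)).trans hM17
  rcases h N ((le_max_right _ _).trans hN) D hD hDN α with h1 | h1
  · left
    have h2 := norm_sum_sub_sum_primeLog_le N (fun _ => 1) α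
    simp only [one_mul, abs_one] at h2
    have h3 := sum_range_primeLog_eq N (fun _ => 1) α
    simp only [one_mul] at h3
    rw [h3]
    have h4 : 2 * √N * Real.log N ≤ 2 * M * N / Real.log N ^ 6 := by
      rw [le_div_iff₀ (by positivity)]
      calc 2 * √N * Real.log N * Real.log N ^ 6 = 2 * Real.log N ^ 7 * √N := by ring
        _ ≤ 2 * (M * √N) * √N := by gcongr
        _ = 2 * M * (√N * √N) := by ring
        _ = _ := by rw [hsN]
    have h5 := (norm_le_norm_add_norm_sub' _ _).trans (add_le_add h1
      (h2.trans ((sum_vonMangoldt_not_prime_le (by omega)).trans h4)))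
    refine h5.trans ?_
    rw [← add_div, ← add_mul]
    gcongr
    linarith [Real.sqrt_nonneg (16 * M)]
  · right
    have h2 := norm_sum_sub_sum_primeLog_le N (fun n => r3 D N (n - 1)) α
    rw [sum_range_primeLog_eq N (fun n => r3 D N (n - 1)) α]
    have h4 := sum_r3_mul_not_prime_sq_le (show 1 ≤ N by omega) D N
    have h5 : N * (1 + Real.log N) ^ 3 * (Real.log N * (2 * √N * Real.log N)) ≤
        (√(16 * M) * N / Real.log N ^ 6) ^ 2 := by
      rw [div_pow, mul_pow, Real.sq_sqrt (by positivity), le_div_iff₀ (by positivity)]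
      calc _ ≤ N * (Real.log N + Real.log N) ^ 3 * (Real.log N * (2 * √N * Real.log N)) *
            (Real.log N ^ 6) ^ 2 := by gcongr
        _ = 16 * N * √N * Real.log N ^ 17 := by ring
        _ ≤ 16 * N * √N * (M * √N) := by gcongr
        _ = 16 * M * N * (√N * √N) := by ring
        _ = 16 * M * N ^ 2 := by rw [hsN]; ring
    have h6 := h2.trans ((le_abs_self _).trans (abs_le_of_sq_le_sq (h4.trans h5) (by positivity)))
    have h7 : primeExpSumR3 D N N α = ∑ n ∈ Finset.Ioc 0 N,
        ((r3 D N (n - 1) * vonMangoldt n : ℝ) : ℂ) * ec (n * α) := by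
      rw [primeExpSumR3]
      refine Finset.sum_congr rfl fun n _ => ?_
      push_cast
      ring
    rw [h7] at h1
    refine ((norm_le_norm_add_norm_sub' _ _).trans (add_le_add h1 h6)).trans ?_
    rw [← add_div, ← add_mul]
    gcongr
    linarith

end primesVersusPrimePowers

end TernaryPrimes

/-- with D = √N (log N)^{-c} for any large enough constant c,
R₂,₃(N) ≪ N² (log N)^{-1} for large odd N. -/
theorem R_two_three_bound :
    ∃ c0 : ℝ, 0 < c0 ∧ ∀ c : ℝ, c0 ≤ c → ∃ C : ℝ, 0 < C ∧ ∃ N0 : ℕ,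
      ∀ N : ℕ, N0 ≤ N → Odd N →
        |tripleSum N (fun p => r2 (Real.sqrt N * Real.log N ^ (-c)) (N : ℝ) (p - 1))
            (fun p => r3 (Real.sqrt N * Real.log N ^ (-c)) (N : ℝ) (p - 1))| ≤
          C * (N : ℝ) ^ 2 * (Real.log N)⁻¹ := by
  obtain ⟨c₀, C, hC, N₀, h⟩ := TernaryPrimes.exists_primeLog_dichotomy
  refine ⟨c₀ + 1, by positivity, fun c hc => ⟨9 * C, by positivity, max 8 N₀, fun N hN _ => ?_⟩⟩
  have hN8 : (8 : ℝ) ≤ N := by exact_mod_cast (le_max_left _ _).trans hN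
  have hl := TernaryPrimes.two_le_log hN8
  have hl0 : 0 < Real.log N := by linarith
  have hD : 0 < √N * Real.log N ^ (-c) := by positivity
  have hDN : √N * Real.log N ^ (-c) ≤ √N / Real.log N ^ c₀ := by
    rw [div_eq_mul_inv, ← Real.rpow_natCast, ← Real.rpow_neg hl0.le]
    gcongr
    · linarith
    · linarith
  have hdich := h N ((le_max_right _ _).trans hN) _ hD hDN
  generalize √N * Real.log N ^ (-c) = D at *
  rw [TernaryPrimes.tripleSum_eq]
  refine abs_le_of_sq_le_sq ((TernaryPrimes.ternary_sq_le N _ _ _ hdich).trans ?_)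
    (by positivity)
  have h1 := TernaryPrimes.sum_mul_primeLog_sq_le N (w := fun p => r2 D N (p - 1))
    fun n => TernaryPrimes.abs_r2_le _ _ _
  have h2 := TernaryPrimes.sum_mul_primeLog_sq_le N (w := fun p => r3 D N (p - 1))
    fun n => TernaryPrimes.abs_r3_le _ _ _
  have h3 := TernaryPrimes.sum_primeLog_sq_le N
  have h4 : (N : ℝ) * (1 + Real.log N) ^ 3 * Real.log N ^ 2 ≤ 8 * N * Real.log N ^ 5 := by
    calc _ ≤ (N : ℝ) * (Real.log N + Real.log N) ^ 3 * Real.log N ^ 2 := by gcongr; linarith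
      _ = _ := by ring
  have h5 : (N : ℝ) * Real.log N ^ 2 ≤ N * Real.log N ^ 5 := by
    gcongr
    · linarith
    · norm_num
  calc _ ≤ 8 * N * Real.log N ^ 5 * ((C * N / Real.log N ^ 6) ^ 2 *
        (8 * N * Real.log N ^ 5 + N * Real.log N ^ 5)) := by
        gcongr
        · exact h1.trans h4
        · exact h2.trans h4
        · exact h3.trans h5
    _ = 72 * (C ^ 2 * N ^ 4 / Real.log N ^ 2) := by field_simp; ring
    _ ≤ 81 * (C ^ 2 * N ^ 4 / Real.log N ^ 2) := by gcongr; norm_num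
    _ = _ := by field_simp; ring
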